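/- Let F⁺ be a totally real number field and let F be a totally imaginary quadratic extension of F⁺ (so F is a CM field). Fix an algebraic closure Ω of F and let G_F = Aut(Ω/F) with the Krull topology. Let σ ∈ Aut(Ω/F⁺) be an automorphism whose restriction to F is the nontrivial element of Gal(F/F⁺) (so conjugation by σ preserves G_F). Let χ : G_F → ℚ/ℤ be a continuous homomorphism (ℚ/ℤ discrete) such that χ(g) + χ(σ g σ⁻¹) = 0 for all g ∈ G_F. Then there exists a continuous homomorphism φ : G_F → ℚ/ℤ such that χ(g) = φ(g) − φ(σ g σ⁻¹) for all g ∈ G_F. -/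

import Mathlib

/-!
STATEMENT 14 (Lemma 5.8 of the paper).  Let `F/F⁺` be a CM quadratic extension of a
totally real number field, `Ω` an algebraic closure of `F`, `σ ∈ Aut(Ω/F⁺)` whose
restriction to `F` is the nontrivial element of `Gal(F/F⁺)`, and
`χ : G_F → ℚ/ℤ` a continuous homomorphism (for the Krull topology on
`G_F = Aut(Ω/F)` and the discrete topology on `ℚ/ℤ`) with `χ·χᶜ = 1`, i.e.
`χ(g) + χ(σgσ⁻¹) = 0` for all `g`.  Then `χ = φ/φᶜ` for some continuous
homomorphism `φ : G_F → ℚ/ℤ`.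

Here `c : G_F → G_F` is the conjugation map `g ↦ σgσ⁻¹` (well defined on `G_F`
since `σ` normalizes `G_F`), characterized by `(c g)(x) = σ(g(σ⁻¹(x)))`.
-/

/-- `ℚ/ℤ`. -/
abbrev QmodZ : Type := ℚ ⧸ AddSubgroup.zmultiples (1 : ℚ)

set_option linter.unusedSectionVars false

namespace QuadSymbol

section QuadraticForms

open WithZero NumberField IsDedekindDomain

section NormGroup

variable {M : Type*} [Field M]

/-- The group of nonzero elements of the form `x ^ 2 - a * y ^ 2`. -/
def normGroup (a : Mˣ) : Subgroup Mˣ where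
  carrier := {z | ∃ x y : M, (z : M) = x ^ 2 - a * y ^ 2}
  one_mem' := ⟨1, 0, by simp⟩
  mul_mem' := by
    rintro z w ⟨x, y, h⟩ ⟨x', y', h'⟩
    exact ⟨x * x' + a * y * y', x * y' + x' * y, by rw [Units.val_mul, h, h']; ring⟩
  inv_mem' := by
    rintro z ⟨x, y, h⟩
    refine ⟨x / z, y / z, ?_⟩
    have hz : (z : M) ≠ 0 := z.ne_zero
    rw [Units.val_inv_eq_inv_val]
    field_simp
    exact h

lemma mem_normGroup {a z : Mˣ} : z ∈ normGroup a ↔ ∃ x y : M, (z : M) = x ^ 2 - a * y ^ 2 :=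
  Iff.rfl

lemma sq_mem_normGroup (a z : Mˣ) : z ^ 2 ∈ normGroup a := ⟨z, 0, by simp⟩

lemma neg_self_mem_normGroup (a : Mˣ) : -a ∈ normGroup a := ⟨0, 1, by simp⟩

lemma normGroup_mul_sq (a b : Mˣ) : normGroup (a * b ^ 2) = normGroup a := by
  ext z
  have hb : (b : M) ≠ 0 := b.ne_zero
  constructor
  · rintro ⟨x, y, h⟩
    exact ⟨x, b * y, by rw [h]; push_cast; ring⟩
  · rintro ⟨x, y, h⟩
    exact ⟨x, y / b, by rw [h]; push_cast; field_simp⟩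

lemma normGroup_sq [CharZero M] (b : Mˣ) : normGroup (b ^ 2) = ⊤ := by
  rw [← one_mul (b ^ 2), normGroup_mul_sq, eq_top_iff]
  rintro z -
  exact ⟨(z + 1) / 2, (z - 1) / 2, by push_cast; ring⟩

lemma normGroup_symm [CharZero M] {a z : Mˣ} (h : z ∈ normGroup a) : a ∈ normGroup z := by
  obtain ⟨x, y, h⟩ := h
  by_cases hy : y = 0
  · have hx : x ≠ 0 := by
      rintro rfl
      exact z.ne_zero (by rw [h, hy]; simp)
    have : z = (Units.mk0 x hx) ^ 2 := by
      ext
      simp [h, hy]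
    rw [this, normGroup_sq]
    trivial
  · refine ⟨x / y, 1 / y, ?_⟩
    rw [h]
    field_simp
    ring

end NormGroup

section Local

variable {M : Type*} [Field M] [CharZero M] (v : Valuation M ℤᵐ⁰)

lemma val_natCast_le (n : ℕ) : v (n : M) ≤ 1 := by
  induction n with
  | zero => simp
  | succ n ih => rw [Nat.cast_succ]; exact v.map_add_le ih (by simp)

lemma val_four_le : v (4 : M) ≤ 1 := by exact_mod_cast val_natCast_le v 4

lemma val_two_le : v (2 : M) ≤ 1 := by exact_mod_cast val_natCast_le v 2

lemma val_four : v (4 : M) = v 2 ^ 2 := by rw [← map_pow]; norm_num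

lemma val_two_pos : 0 < v (2 : M) := by
  rw [Valuation.pos_iff]; norm_num

lemma val_one_add {x : M} (hx : v x < 1) : v (1 + x) = 1 := Valuation.map_one_add_of_lt v hx

lemma val_four_mul_lt {x : M} (hx : v x < 1) : v (4 * x) < 1 := by
  rw [map_mul]
  exact mul_lt_one_of_nonneg_of_lt_one_right (val_four_le v) zero_le hx

lemma val_two_mul_lt {x : M} (hx : v x < 1) : v (2 * x) < 1 := by
  rw [map_mul]
  exact mul_lt_one_of_nonneg_of_lt_one_right (val_two_le v) zero_le hx

/-- The closure of the group of squares for the topology of `v`. -/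
def sqGroup : Subgroup Mˣ where
  carrier := {z | ∃ (w : Mˣ) (x : M), v x < 1 ∧ (z : M) = w ^ 2 * (1 + 4 * x)}
  one_mem' := ⟨1, 0, by simp⟩
  mul_mem' := by
    rintro z w ⟨b, x, hx, h⟩ ⟨c, y, hy, h'⟩
    refine ⟨b * c, x + y + (4 * x) * y, ?_, by rw [Units.val_mul, h, h']; push_cast; ring⟩
    refine Valuation.map_add_lt v (Valuation.map_add_lt v hx hy) ?_
    rw [map_mul]
    exact mul_lt_one_of_nonneg_of_lt_one_right (val_four_mul_lt v hx).le zero_le hy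
  inv_mem' := by
    rintro z ⟨b, x, hx, h⟩
    have hv : v (1 + 4 * x) = 1 := val_one_add v (val_four_mul_lt v hx)
    have h0 : 1 + 4 * x ≠ 0 := by
      intro h0
      rw [h0] at hv
      simp at hv
    have hb : (b : M) ≠ 0 := b.ne_zero
    refine ⟨b⁻¹, -x / (1 + 4 * x), by simpa [hv] using hx, ?_⟩
    rw [Units.val_inv_eq_inv_val, h, Units.val_inv_eq_inv_val]
    field_simp
    ring

variable {v}

lemma mem_sqGroup {z : Mˣ} :
    z ∈ sqGroup v ↔ ∃ (w : Mˣ) (x : M), v x < 1 ∧ (z : M) = w ^ 2 * (1 + 4 * x) := Iff.rfl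

variable (v) in
lemma sq_mem_sqGroup (z : Mˣ) : z ^ 2 ∈ sqGroup v := ⟨z, 0, by simp⟩

lemma exp_lt_of_lt_one {x : ℤᵐ⁰} (hx : x < 1) : x ≤ exp (-1) := by
  rcases eq_or_ne x 0 with rfl | h
  · simp
  · rw [← exp_log h, ← exp_zero, exp_lt_exp] at hx
    rw [← exp_log h, exp_le_exp]
    omega

/-- Squares of `M` approximate elements of `sqGroup v` to any precision. -/
lemma exists_approx_of_mem_sqGroup {z : Mˣ} (hz : z ∈ sqGroup v) (n : ℕ) :
    ∃ (w : Mˣ) (x : M), v x ≤ exp (-((n : ℤ) + 1)) ∧ (z : M) = w ^ 2 * (1 + 4 * x) := by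
  induction n with
  | zero =>
    obtain ⟨w, x, hx, h⟩ := hz
    exact ⟨w, x, by simpa using exp_lt_of_lt_one hx, h⟩
  | succ n ih =>
    obtain ⟨w, x, hx, h⟩ := ih
    have hx1 : v x < 1 := hx.trans_lt (by rw [← exp_zero, exp_lt_exp]; omega)
    have hv : v (1 + 2 * x) = 1 := val_one_add v (val_two_mul_lt v hx1)
    have h0 : 1 + 2 * x ≠ 0 := by
      intro h0
      rw [h0] at hv
      simp at hv
    refine ⟨w * Units.mk0 _ h0, -(x / (1 + 2 * x)) ^ 2, ?_, ?_⟩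
    · rw [Valuation.map_neg, map_pow, map_div₀, hv, div_one, pow_two]
      calc v x * v x ≤ exp (-((n : ℤ) + 1)) * exp (-1) := mul_le_mul' hx (exp_lt_of_lt_one hx1)
        _ ≤ _ := by rw [← exp_add, exp_le_exp]; push_cast; omega
    · rw [h, Units.val_mul, Units.val_mk0]
      generalize hy : 1 + 2 * x = y at h0
      obtain rfl : x = (y - 1) / 2 := by rw [← hy]; ring
      field_simp
      ring

lemma div_mem_sqGroup {z w : Mˣ} (h : v (z - w : M) < v 4 * v w) : z / w ∈ sqGroup v := by
  have hw : (w : M) ≠ 0 := w.ne_zero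
  refine ⟨1, (z - w) / (4 * w), ?_, ?_⟩
  · rw [map_div₀, map_mul]
    refine (div_lt_one₀ ?_).2 h
    rw [← map_mul, Valuation.pos_iff]
    simp
  · rw [Units.val_div_eq_div_val]
    push_cast
    field_simp
    ring

variable (v) in
/-- The closure of `normGroup a` for the topology of `v`. -/
def locNorm (a : Mˣ) : Subgroup Mˣ := normGroup a ⊔ sqGroup v

lemma normGroup_le_locNorm (a : Mˣ) : normGroup a ≤ locNorm v a := le_sup_left

lemma sqGroup_le_locNorm (a : Mˣ) : sqGroup v ≤ locNorm v a := le_sup_right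

lemma exists_exp_mul_lt (b c : ℤᵐ⁰) (hc : c ≠ 0) : ∃ n : ℕ, exp (-((n : ℤ) + 1)) * b < c := by
  rcases eq_or_ne b 0 with rfl | hb
  · exact ⟨0, by simpa using zero_lt_iff.2 hc⟩
  · refine ⟨(log b - log c).toNat, ?_⟩
    have h1 : b = exp (log b) := (exp_log hb).symm
    have h2 : c = exp (log c) := (exp_log hc).symm
    rw [h1, h2, ← exp_add, exp_lt_exp]
    simp only [log_exp]
    omega

lemma normGroup_le_locNorm_of_div {a a' : Mˣ} (h : a' / a ∈ sqGroup v) :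
    normGroup a ≤ locNorm v a' := by
  rintro z ⟨X, Y, hz⟩
  obtain ⟨n, hn⟩ := exists_exp_mul_lt (v (a * Y ^ 2)) (v z) (by simp)
  obtain ⟨w, x, hx, hw⟩ := exists_approx_of_mem_sqGroup h n
  have hw0 : (w : M) ≠ 0 := w.ne_zero
  have ha0 : (a : M) ≠ 0 := a.ne_zero
  have ha' : (a' : M) = a * w ^ 2 * (1 + 4 * x) := by
    rw [Units.val_div_eq_div_val, div_eq_iff a.ne_zero] at hw
    rw [hw]; ring
  have hd : v ((z : M) - (X ^ 2 - a' * (Y / w) ^ 2)) < v 4 * v z := by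
    have : (z : M) - (X ^ 2 - a' * (Y / w) ^ 2) = 4 * (x * (a * Y ^ 2)) := by
      rw [hz, ha']; field_simp; ring
    rw [this, map_mul]
    refine mul_lt_mul_of_pos_left ?_ (by rw [Valuation.pos_iff]; norm_num)
    rw [map_mul]
    exact (mul_le_mul_left hx _).trans_lt hn
  have hd' : v ((X ^ 2 - a' * (Y / w) ^ 2 : M) - z) < v 4 * v z := by
    rwa [Valuation.map_sub_swap]
  have hne : (X ^ 2 - a' * (Y / w) ^ 2 : M) ≠ 0 := by
    intro h0
    rw [h0, sub_zero] at hd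
    exact absurd hd (not_lt.2 (mul_le_of_le_one_left zero_le (val_four_le v)))
  have hmem : Units.mk0 _ hne / z ∈ sqGroup v := div_mem_sqGroup (by simpa using hd')
  have hn' : Units.mk0 _ hne ∈ locNorm v a' := normGroup_le_locNorm _ ⟨X, Y / w, rfl⟩
  have := (locNorm v a').div_mem hn' (sqGroup_le_locNorm a' hmem)
  simpa using this

lemma locNorm_congr {a a' : Mˣ} (h : a' / a ∈ sqGroup v) : locNorm v a = locNorm v a' := by
  refine le_antisymm (sup_le (normGroup_le_locNorm_of_div h) (sqGroup_le_locNorm _))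
    (sup_le (normGroup_le_locNorm_of_div ?_) (sqGroup_le_locNorm _))
  simpa using (sqGroup v).inv_mem h

lemma locNorm_eq_top {a : Mˣ} (h : a ∈ sqGroup v) : locNorm v a = ⊤ := by
  rw [← locNorm_congr (a := 1 ^ 2) (by simpa using h), locNorm, normGroup_sq]
  simp

lemma locNorm_symm {a z : Mˣ} (h : z ∈ locNorm v a) : a ∈ locNorm v z := by
  obtain ⟨n, hn, s, hs, rfl⟩ := Subgroup.mem_sup.1 h
  rw [← locNorm_congr (a := n) (by simpa using hs)]
  exact normGroup_le_locNorm _ (normGroup_symm hn)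

lemma locNorm_mul_sq (a b : Mˣ) : locNorm v (a * b ^ 2) = locNorm v a :=
  (locNorm_congr (by simpa using sq_mem_sqGroup v b)).symm

end Local

section LocalNontrivial

variable {M : Type*} [Field M] [CharZero M] {v : Valuation M ℤᵐ⁰}

/-- An integral element `ρ` such that `t ^ 2 + t = ρ` has no solution in the residue field. -/
def IsASObstruction (v : Valuation M ℤᵐ⁰) (ρ : M) : Prop :=
  v ρ ≤ 1 ∧ ∀ t, v t ≤ 1 → v (t ^ 2 + t - ρ) = 1

lemma val_isSquare_of_mem_sqGroup {z : Mˣ} (hz : z ∈ sqGroup v) : IsSquare (v (z : M)) := by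
  obtain ⟨w, x, hx, h⟩ := hz
  refine ⟨v w, ?_⟩
  rw [h, map_mul, val_one_add v (val_four_mul_lt v hx), mul_one, map_pow, pow_two]

lemma val_isSquare_of_mem_locNorm {a : Mˣ} {ρ : M} (hρ : IsASObstruction v ρ)
    (ha : (a : M) = 1 + 4 * ρ) {z : Mˣ} (hz : z ∈ locNorm v a) : IsSquare (v (z : M)) := by
  obtain ⟨n, ⟨X, Y, hn⟩, s, hs, rfl⟩ := Subgroup.mem_sup.1 hz
  rw [Units.val_mul, map_mul]
  refine IsSquare.mul ?_ (val_isSquare_of_mem_sqGroup hs)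
  set Z := (X - Y) / 2 with hZ
  have key : (n : M) = 2 ^ 2 * (Z ^ 2 + Z * Y - ρ * Y ^ 2) := by
    rw [hn, ha, hZ]; ring
  rw [key, map_mul]
  refine IsSquare.mul (by rw [map_pow]; exact IsSquare.sq _) ?_
  rcases le_or_gt (v Z) (v Y) with h | h
  · by_cases hY : Y = 0
    · have : Z = 0 := by simpa [hY] using h
      simp [hY, this]
    · have h1 := hρ.2 (Z / Y) (by
        rw [map_div₀]; exact div_le_one_of_le₀ h zero_le)
      have h2 : Z ^ 2 + Z * Y - ρ * Y ^ 2 = Y ^ 2 * ((Z / Y) ^ 2 + Z / Y - ρ) := by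
        field_simp
      rw [h2, map_mul, h1, mul_one, map_pow]
      exact IsSquare.sq _
  · have h1 : v (Z * Y - ρ * Y ^ 2) < v (Z ^ 2) := by
      have hZ0 : 0 < v Z := lt_of_le_of_lt zero_le h
      refine Valuation.map_sub_lt v ?_ ?_
      · rw [map_mul, map_pow, pow_two]
        exact mul_lt_mul_of_pos_left h hZ0
      · rw [map_mul, map_pow, map_pow]
        exact (mul_le_of_le_one_left zero_le hρ.1).trans_lt
          (pow_lt_pow_left₀ h zero_le two_ne_zero)
    rw [add_sub_assoc, Valuation.map_add_eq_of_lt_left v h1, map_pow]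
    exact IsSquare.sq _

end LocalNontrivial

section LocalNontrivial

variable {M : Type*} [Field M] [CharZero M] {v : Valuation M ℤᵐ⁰}

lemma not_isSquare_exp_neg_one : ¬ IsSquare (exp (-1) : ℤᵐ⁰) := by
  rintro ⟨r, hr⟩
  have h0 : r ≠ 0 := by
    rintro rfl
    simp at hr
  have := congrArg log hr
  rw [log_exp, log_mul h0 h0] at this
  omega

lemma IsASObstruction.ne_zero {ρ : M} (hρ : IsASObstruction v ρ) : 1 + 4 * ρ ≠ 0 := by
  intro h
  have h1 : ρ = -(2⁻¹) ^ 2 := by linear_combination h / 4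
  have h2 : v (2⁻¹ : M) ≤ 1 := by
    have := hρ.1
    rw [h1, Valuation.map_neg, map_pow] at this
    exact (pow_le_one_iff_of_nonneg zero_le two_ne_zero).1 this
  have h3 := hρ.2 (-2⁻¹) (by simpa using h2)
  have h4 : (-2⁻¹ : M) ^ 2 + -2⁻¹ - ρ = 0 := by rw [h1]; ring
  rw [h4] at h3
  simp at h3

lemma locNorm_ne_top_of_not_isSquare {ρ : M} (hρ : IsASObstruction v ρ) {a : Mˣ}
    (ha : ¬ IsSquare (v (a : M))) : locNorm v a ≠ ⊤ := by
  intro h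
  have h1 : Units.mk0 _ hρ.ne_zero ∈ locNorm v a := h ▸ trivial
  exact ha (val_isSquare_of_mem_locNorm hρ rfl (locNorm_symm h1))

lemma locNorm_ne_top_of_approx {π : M} (hπ : v π = exp (-1)) {a w : Mˣ}
    (ha : a ∉ sqGroup v) (hw : v (a - w ^ 2 : M) ≤ v 4 * v w ^ 2) (haw : v (a : M) = v w ^ 2) :
    locNorm v a ≠ ⊤ := by
  have hw0 : (w : M) ≠ 0 := w.ne_zero
  have h40 : 0 < v (4 : M) := by rw [Valuation.pos_iff]; norm_num
  have hwv : 0 < v (w : M) ^ 2 := by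
    rw [← map_pow, Valuation.pos_iff]; simp
  set ρ : M := (a / w ^ 2 - 1) / 4 with hρdef
  have hb : ((a / w ^ 2 : Mˣ) : M) = 1 + 4 * ρ := by
    rw [hρdef]; push_cast; ring
  have hv1 : v (1 + 4 * ρ) = 1 := by
    rw [← hb]; push_cast; rw [map_div₀, map_pow, haw, div_self hwv.ne']
  have hρ : IsASObstruction v ρ := by
    have hρ1 : v ρ ≤ 1 := by
      have : ρ = (a - w ^ 2) / (4 * w ^ 2) := by rw [hρdef]; field_simp
      rw [this, map_div₀, map_mul, map_pow]
      exact div_le_one_of_le₀ hw zero_le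
    refine ⟨hρ1, fun t ht ↦ ?_⟩
    have hle : v (t ^ 2 + t - ρ) ≤ 1 := by
      refine v.map_sub_le (v.map_add_le ?_ ht) hρ1
      rw [map_pow]; exact pow_le_one₀ zero_le ht
    refine hle.eq_of_not_lt fun hlt ↦ ha ?_
    have h2t : v ((1 + 2 * t) ^ 2) = 1 := by
      have : (1 + 2 * t) ^ 2 = 1 + 4 * ρ + 4 * (t ^ 2 + t - ρ) := by ring
      rw [this, Valuation.map_add_eq_of_lt_left v, hv1]
      rw [hv1]; exact val_four_mul_lt v hlt
    have h2t0 : (1 + 2 * t) ≠ 0 := by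
      intro h0
      rw [h0] at h2t
      simp at h2t
    have hmem : a / w ^ 2 ∈ sqGroup v := by
      refine ⟨Units.mk0 _ h2t0, -(t ^ 2 + t - ρ) / (1 + 2 * t) ^ 2, ?_, ?_⟩
      · rw [map_div₀, h2t, div_one, Valuation.map_neg]; exact hlt
      · rw [hb, Units.val_mk0, mul_add, ← mul_assoc, mul_comm _ (4 : M), mul_assoc,
          mul_div_cancel₀ _ (pow_ne_zero 2 h2t0)]
        ring
    simpa using (sqGroup v).mul_mem hmem (sq_mem_sqGroup v w)
  intro htop
  have hπ0 : π ≠ 0 := by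
    rintro rfl
    rw [map_zero] at hπ
    exact exp_ne_zero hπ.symm
  have h1 : locNorm v (a / w ^ 2) = ⊤ := by
    rw [← htop, ← locNorm_mul_sq (a / w ^ 2) w]; simp
  have h2 : Units.mk0 π hπ0 ∈ locNorm v (a / w ^ 2) := h1 ▸ trivial
  have := val_isSquare_of_mem_locNorm hρ hb h2
  rw [Units.val_mk0, hπ] at this
  exact not_isSquare_exp_neg_one this

lemma locNorm_neg {i : M} (hi : i ^ 2 = -1) (a : Mˣ) : locNorm v (-a) = locNorm v a := by
  have hi0 : i ≠ 0 := by
    rintro rfl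
    norm_num at hi
  have : -a = a * (Units.mk0 i hi0) ^ 2 := by
    ext; simp [hi]
  rw [this, locNorm_mul_sq]

lemma neg_mem_locNorm_iff {i : M} (hi : i ^ 2 = -1) {a z : Mˣ} :
    -z ∈ locNorm v a ↔ z ∈ locNorm v a := by
  constructor <;> intro h
  · have := locNorm_symm h
    rw [locNorm_neg hi] at this
    exact locNorm_symm this
  · refine locNorm_symm ?_
    rw [locNorm_neg hi]
    exact locNorm_symm h

lemma self_mem_locNorm {i : M} (hi : i ^ 2 = -1) (a : Mˣ) : a ∈ locNorm v a :=
  (neg_mem_locNorm_iff hi).1 (normGroup_le_locNorm _ (neg_self_mem_normGroup a))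

/-- If `A = 1 + x` with `x` of odd valuation between `0` and that of `4`, then some `1 + y`
is not a local norm for `A`. -/
lemma locNorm_ne_top_of_odd {i : M} (hi : i ^ 2 = -1) {ρ : M} (hρ : IsASObstruction v ρ)
    {A : Mˣ} {x : M} (hA : (A : M) = 1 + x) (hx4 : v 4 < v x) (hx1 : v x < 1)
    (hx : ¬ IsSquare (v x)) : locNorm v A ≠ ⊤ := by
  intro htop
  have hx0 : x ≠ 0 := by
    rintro rfl
    simp at hx
  have hvx : 0 < v x := (Valuation.pos_iff v).2 hx0
  set y : M := -(4 * ρ) / x with hy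
  have hvy : v y < 1 := by
    rw [hy, map_div₀, Valuation.map_neg, map_mul]
    exact (div_lt_one₀ hvx).2 ((mul_le_of_le_one_right zero_le hρ.1).trans_lt hx4)
  have hB0 : 1 + y ≠ 0 := by
    intro h0
    have := val_one_add v hvy
    rw [h0] at this
    simp at this
  set B : Mˣ := Units.mk0 _ hB0 with hB
  set X : Mˣ := Units.mk0 x hx0 with hX
  set C : Mˣ := -X * B with hC
  set D : Mˣ := Units.mk0 _ hρ.ne_zero with hD
  have hBmem : B ∈ locNorm v A := htop ▸ trivial
  have hXmem : -X ∈ locNorm v A :=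
    normGroup_le_locNorm _ ⟨1, 1, by simp [hA, hX]⟩
  have hCmem : C ∈ locNorm v A := mul_mem hXmem hBmem
  have hDC : D * C ∈ locNorm v (A * C) := by
    rw [← locNorm_neg hi]
    refine normGroup_le_locNorm _ ⟨C, 1, ?_⟩
    simp only [hD, hC, hX, hB, Units.val_mul, Units.val_neg, Units.val_mk0, hA, hy]
    field_simp
    ring
  have hC' : C ∈ locNorm v (A * C) :=
    locNorm_symm (mul_mem (locNorm_symm hCmem) (self_mem_locNorm hi C))
  have hDmem : D ∈ locNorm v (A * C) := by
    simpa using (locNorm v (A * C)).div_mem hDC hC'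
  have hsq := val_isSquare_of_mem_locNorm hρ (a := D) rfl (locNorm_symm hDmem)
  have : v ((A * C : Mˣ) : M) = v x := by
    simp only [hC, hX, hB, Units.val_mul, Units.val_neg, Units.val_mk0, hA, map_mul,
      Valuation.map_neg, val_one_add v hvy, val_one_add v hx1, one_mul, mul_one]
  exact hx (this ▸ hsq)

lemma exists_val_eq {π : M} (hπ : v π = exp (-1)) {r : ℤᵐ⁰} (hr : r ≠ 0) :
    ∃ s : Mˣ, v (s : M) = r := by
  have hπ0 : π ≠ 0 := by
    rintro rfl
    rw [map_zero] at hπ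
    exact exp_ne_zero hπ.symm
  refine ⟨(Units.mk0 π hπ0) ^ (-log r), ?_⟩
  rw [Units.val_zpow_eq_zpow_val, map_zpow₀, Units.val_mk0, hπ, ← exp_zsmul]
  simp [exp_log hr]

lemma exists_best_sq_approx {a : Mˣ} (hbad : ∀ w : Mˣ, v (w : M) = 1 → v 4 < v (a - w ^ 2 : M)) :
    ∃ w : Mˣ, v (w : M) = 1 ∧ ∀ w' : Mˣ, v (w' : M) = 1 →
      v (a - w ^ 2 : M) ≤ v (a - w' ^ 2 : M) := by
  have h40 : v (4 : M) ≠ 0 := by simp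
  have hne : ∀ w : Mˣ, v (w : M) = 1 → v (a - w ^ 2 : M) ≠ 0 := fun w hw ↦
    (lt_of_le_of_lt zero_le (hbad w hw)).ne'
  let f : {w : Mˣ // v (w : M) = 1} → ℕ := fun w ↦
    (log (v (a - (w : Mˣ) ^ 2 : M)) - log (v (4 : M))).toNat
  have : Nonempty {w : Mˣ // v (w : M) = 1} := ⟨⟨1, by simp⟩⟩
  obtain ⟨w, hw⟩ : ∃ w, ∀ w', f w ≤ f w' :=
    ⟨_, fun w' ↦ Function.argmin_le f w'⟩
  refine ⟨w.1, w.2, fun w' hw' ↦ ?_⟩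
  have h1 := hw ⟨w', hw'⟩
  have h2 := (log_lt_log h40 (hne _ w.2)).2 (hbad _ w.2)
  have h3 := (log_lt_log h40 (hne _ hw')).2 (hbad _ hw')
  rw [← log_le_log (hne _ w.2) (hne _ hw')]
  simp only [f] at h1
  omega

/-- Nondegeneracy of the local quadratic symbol. -/
theorem locNorm_ne_top {i : M} (hi : i ^ 2 = -1) {π : M} (hπ : v π = exp (-1))
    {ρ : M} (hρ : IsASObstruction v ρ)
    (hperf : v 2 < 1 → ∀ u, v u = 1 → ∃ t, v (u - t ^ 2) < 1) {a : Mˣ} (ha : a ∉ sqGroup v) :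
    locNorm v a ≠ ⊤ := by
  by_cases hsq : IsSquare (v (a : M))
  swap
  · exact locNorm_ne_top_of_not_isSquare hρ hsq
  -- reduction to units
  wlog hunit : v (a : M) = 1 generalizing a with H
  · obtain ⟨r, hr⟩ := hsq
    have hr0 : r ≠ 0 := by
      rintro rfl
      simp at hr
    obtain ⟨s, hs⟩ := exists_val_eq hπ hr0
    have h1 : v ((a / s ^ 2 : Mˣ) : M) = 1 := by
      push_cast
      rw [map_div₀, map_pow, hs, hr, pow_two, div_self (by simp [hr0])]
    have := @H (a / s ^ 2) (fun h ↦ ha (by simpa using mul_mem h (sq_mem_sqGroup v s)))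
      (by rw [h1]; exact ⟨1, by simp⟩) h1
    rwa [← locNorm_mul_sq _ s, div_mul_cancel] at this
  by_cases hbad : ∀ w : Mˣ, v (w : M) = 1 → v 4 < v (a - w ^ 2 : M)
  swap
  · push Not at hbad
    obtain ⟨w, hw, hle⟩ := hbad
    exact locNorm_ne_top_of_approx hπ ha (w := w) (by simpa [hw] using hle) (by simp [hw, hunit])
  obtain ⟨w, hw, hmin⟩ := exists_best_sq_approx hbad
  have hw0 : (w : M) ≠ 0 := w.ne_zero
  have h21 : v (2 : M) < 1 := by
    refine (val_two_le v).lt_of_ne fun h ↦ ?_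
    have := hbad 1 (by simp)
    rw [val_four, h, one_pow] at this
    exact absurd this (not_lt.2 (v.map_sub_le hunit.le (by simp)))
  set x : M := a / w ^ 2 - 1 with hx
  have hA : ((a / w ^ 2 : Mˣ) : M) = 1 + x := by rw [hx]; push_cast; ring
  have hvx : v x = v (a - w ^ 2 : M) := by
    have : x = (a - w ^ 2) / w ^ 2 := by rw [hx]; field_simp
    rw [this, map_div₀, map_pow, hw]; simp
  have himp : ∀ t : M, v (1 + t) = 1 → v x ≤ v (x - 2 * t - t ^ 2) := by
    intro t ht
    have ht0 : 1 + t ≠ 0 := by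
      intro h0
      rw [h0] at ht
      simp at ht
    have h1 := hmin (w * Units.mk0 _ ht0) (by simp [hw, ht])
    rw [← hvx] at h1
    refine h1.trans_eq ?_
    have : (a - ((w * Units.mk0 _ ht0 : Mˣ) : M) ^ 2) = w ^ 2 * (x - 2 * t - t ^ 2) := by
      rw [hx, Units.val_mul, Units.val_mk0]; field_simp; ring
    rw [this, map_mul, map_pow, hw]; simp
  have hx4 : v 4 < v x := by rw [hvx]; exact hbad w hw
  have hx1 : v x < 1 := by
    rw [hvx]
    obtain ⟨t, ht⟩ := hperf h21 a hunit
    have htv : v t = 1 := by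
      have h1 : v (t ^ 2) = 1 := by
        have : t ^ 2 = a - (a - t ^ 2) := by ring
        rw [this, Valuation.map_sub_eq_of_lt_left v (by rwa [hunit]), hunit]
      rw [map_pow] at h1
      exact (pow_eq_one_iff_of_nonneg zero_le two_ne_zero).1 h1
    have ht0 : t ≠ 0 := by
      rintro rfl
      simp at htv
    exact (hmin (Units.mk0 t ht0) (by simpa using htv)).trans_lt (by simpa using ht)
  have hodd : ¬ IsSquare (v x) := by
    rintro ⟨r, hr⟩
    have hr0 : r ≠ 0 := by
      rintro rfl
      rw [hr] at hx4
      simp at hx4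
    obtain ⟨s, hs⟩ := exists_val_eq hπ hr0
    have hs0 : (s : M) ≠ 0 := s.ne_zero
    have hr1 : r < 1 := by
      rw [hr, ← pow_two] at hx1
      exact (pow_lt_one_iff_of_nonneg zero_le two_ne_zero).1 hx1
    have hr2 : v 2 < r := by
      rw [hr, val_four, ← pow_two] at hx4
      exact lt_of_pow_lt_pow_left₀ 2 zero_le hx4
    obtain ⟨t, ht⟩ := hperf h21 (x / s ^ 2) (by
      rw [map_div₀, map_pow, hs, hr, pow_two, div_self (by simp [hr0])])
    have ht1 : v t ≤ 1 := by
      have h1 : v (t ^ 2) ≤ 1 := by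
        have : t ^ 2 = x / s ^ 2 - (x / s ^ 2 - t ^ 2) := by ring
        rw [this]
        refine v.map_sub_le ?_ ht.le
        rw [map_div₀, map_pow, hs, hr, pow_two, div_self (by simp [hr0])]
      rw [map_pow] at h1
      exact (pow_le_one_iff_of_nonneg zero_le two_ne_zero).1 h1
    have hst : v (s * t) ≤ r := by
      rw [map_mul, hs]; exact mul_le_of_le_one_right zero_le ht1
    have h1 := himp (s * t) (val_one_add v (hst.trans_lt hr1))
    refine absurd h1 (not_le.2 ?_)
    have h2 : x - 2 * (s * t) - (s * t) ^ 2 = s ^ 2 * (x / s ^ 2 - t ^ 2) - 2 * (s * t) := by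
      field_simp
      ring
    have hrpos : 0 < r := zero_lt_iff.2 hr0
    rw [h2]
    refine v.map_sub_lt ?_ ?_
    · rw [map_mul, map_pow, hs, hr, ← pow_two]
      exact mul_lt_of_lt_one_right (pow_pos hrpos 2) ht
    · rw [map_mul, hr]
      calc v 2 * v (s * t) ≤ v 2 * r := mul_le_mul_right hst _
        _ < r * r := mul_lt_mul_of_pos_right hr2 hrpos
  have := locNorm_ne_top_of_odd hi hρ hA hx4 hx1 hodd
  rwa [← locNorm_mul_sq _ w, div_mul_cancel] at this

end LocalNontrivial

section NumberField

variable {M : Type*} [Field M] [NumberField M] (v : HeightOneSpectrum (𝓞 M))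

lemma exists_integer_val_sub_lt {x : M} (hx : v.valuation M x ≤ 1) :
    ∃ r : 𝓞 M, v.valuation M (x - r) < 1 := by
  obtain ⟨r, hr⟩ := v.exists_valuation_sub_lt_of_integer hx 1
  exact ⟨r, by rw [Valuation.map_sub_swap]; simpa using hr⟩

lemma finite_residue : Finite (𝓞 M ⧸ v.asIdeal) :=
  Ideal.finiteQuotientOfFreeOfNeBot _ v.ne_bot

lemma exists_isASObstruction : ∃ ρ : M, IsASObstruction (v.valuation M) ρ := by
  have := finite_residue v
  have : v.asIdeal.IsMaximal := v.isMaximal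
  let f : 𝓞 M ⧸ v.asIdeal → 𝓞 M ⧸ v.asIdeal := fun t ↦ t ^ 2 + t
  have hf : ¬ Function.Surjective f := by
    rw [← Finite.injective_iff_surjective]
    intro hinj
    have h1 : f 0 = f (-1) := by simp [f]
    have h2 := hinj h1
    have : Nontrivial (𝓞 M ⧸ v.asIdeal) := Ideal.Quotient.nontrivial_iff.2 v.isPrime.ne_top
    simp at h2
  unfold Function.Surjective at hf
  push Not at hf
  obtain ⟨b, hb⟩ := hf
  obtain ⟨ρ, rfl⟩ := Ideal.Quotient.mk_surjective b
  refine ⟨ρ, v.valuation_le_one ρ, fun t ht ↦ ?_⟩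
  obtain ⟨r, hr⟩ := exists_integer_val_sub_lt v ht
  have h1 : t ^ 2 + t - ρ = ((r ^ 2 + r - ρ : 𝓞 M) : M) + (t - r) * (t + r + 1) := by
    push_cast; ring
  have h2 : v.valuation M ((t - r) * (t + r + 1)) < 1 := by
    rw [map_mul]
    refine mul_lt_one_of_lt_of_le hr ?_
    exact Valuation.map_add_le _ (Valuation.map_add_le _ ht (v.valuation_le_one r)) (by simp)
  have h3 : v.valuation M ((r ^ 2 + r - ρ : 𝓞 M) : M) = 1 := by
    rw [v.valuation_eq_one_iff_notMem, ← Ideal.Quotient.eq_zero_iff_mem]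
    simp only [map_sub, map_add, map_pow, sub_eq_zero]
    exact hb _
  rw [h1, Valuation.map_add_eq_of_lt_left _ (by rw [h3]; exact h2), h3]

lemma exists_val_sub_sq_lt (h2 : v.valuation M 2 < 1) (u : M) (hu : v.valuation M u = 1) :
    ∃ t, v.valuation M (u - t ^ 2) < 1 := by
  have := finite_residue v
  have : v.asIdeal.IsMaximal := v.isMaximal
  let _ : Field (𝓞 M ⧸ v.asIdeal) := Ideal.Quotient.field _
  have h20 : (2 : 𝓞 M ⧸ v.asIdeal) = 0 := by
    have : Ideal.Quotient.mk v.asIdeal 2 = 0 := by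
      rw [Ideal.Quotient.eq_zero_iff_mem, ← v.valuation_lt_one_iff_mem (K := M)]
      change v.valuation M (algebraMap (𝓞 M) M 2) < 1
      rwa [map_ofNat]
    rwa [map_ofNat] at this
  have hchar : CharP (𝓞 M ⧸ v.asIdeal) 2 := CharTwo.of_one_ne_zero_of_two_eq_zero one_ne_zero h20
  obtain ⟨r, hr⟩ := exists_integer_val_sub_lt v hu.le
  have hbij := (PerfectRing.bijective_frobenius (R := 𝓞 M ⧸ v.asIdeal) (p := 2))
  obtain ⟨s, hs⟩ := hbij.2 (Ideal.Quotient.mk _ r)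
  obtain ⟨t, rfl⟩ := Ideal.Quotient.mk_surjective s
  refine ⟨t, ?_⟩
  have h3 : u - (t : M) ^ 2 = (u - r) + ((r - t ^ 2 : 𝓞 M) : M) := by push_cast; ring
  rw [h3]
  refine Valuation.map_add_lt _ hr ?_
  rw [v.valuation_lt_one_iff_mem, ← Ideal.Quotient.eq_zero_iff_mem, map_sub, map_pow, ← hs]
  exact sub_self _

/-- Nondegeneracy of the local quadratic symbol at a finite prime. -/
theorem locNorm_valuation_ne_top {i : M} (hi : i ^ 2 = -1) {a : Mˣ}
    (ha : a ∉ sqGroup (v.valuation M)) : locNorm (v.valuation M) a ≠ ⊤ := by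
  obtain ⟨π, hπ⟩ := v.valuation_exists_uniformizer M
  obtain ⟨ρ, hρ⟩ := exists_isASObstruction v
  exact locNorm_ne_top hi hπ hρ (exists_val_sub_sq_lt v) ha

/-- The order of `2` at `v`. -/
noncomputable def ordTwo : ℕ := (-(log (v.valuation M 2))).toNat

lemma valuation_two : v.valuation M 2 = exp (-(ordTwo v : ℤ)) := by
  have h0 : v.valuation M 2 ≠ 0 := by simp
  have h1 : log (v.valuation M 2) ≤ 0 := by
    rw [log_le_iff_le_exp h0, exp_zero]; exact val_two_le _
  rw [ordTwo, Int.toNat_of_nonneg (by omega), neg_neg, exp_log h0]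

lemma valuation_four : v.valuation M 4 = exp (-(2 * ordTwo v : ℤ)) := by
  rw [val_four, valuation_two, pow_two, ← exp_add]; congr 1; ring

lemma card_quotient_pow (k : ℕ) :
    Nat.card (𝓞 M ⧸ v.asIdeal ^ k) = Ideal.absNorm v.asIdeal ^ k := by
  rw [← map_pow, Ideal.absNorm_apply, Submodule.cardQuot_apply]

instance finite_quotient_pow (k : ℕ) : Finite (𝓞 M ⧸ v.asIdeal ^ k) :=
  Ideal.finiteQuotientOfFreeOfNeBot _ (pow_ne_zero _ v.ne_bot)

lemma card_ker_factorPow (e : ℕ) :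
    Nat.card (RingHom.ker (Ideal.Quotient.factor (S := v.asIdeal ^ (2 * e + 1))
      (T := v.asIdeal ^ (e + 1)) (Ideal.pow_le_pow_right (by omega)))) =
      Ideal.absNorm v.asIdeal ^ e := by
  set f := Ideal.Quotient.factor (S := v.asIdeal ^ (2 * e + 1))
      (T := v.asIdeal ^ (e + 1)) (Ideal.pow_le_pow_right (by omega))
  have hsurj : Function.Surjective f := Ideal.Quotient.factor_surjective _
  have h1 := AddSubgroup.card_mul_index f.toAddMonoidHom.ker
  have h2 := AddSubgroup.index_ker f.toAddMonoidHom
  have h3 : Nat.card f.toAddMonoidHom.range = Nat.card (𝓞 M ⧸ v.asIdeal ^ (e + 1)) := by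
    have : f.toAddMonoidHom.range = ⊤ := AddMonoidHom.range_eq_top.2 hsurj
    rw [this]; exact AddSubgroup.card_top
  rw [h2, h3, card_quotient_pow, card_quotient_pow] at h1
  have hpos : 0 < Ideal.absNorm v.asIdeal ^ (e + 1) :=
    pow_pos (Nat.pos_of_ne_zero fun h ↦ v.ne_bot (Ideal.absNorm_eq_zero_iff.1 h)) _
  have : Nat.card (RingHom.ker f) = Nat.card f.toAddMonoidHom.ker := rfl
  rw [this]
  refine Nat.eq_of_mul_eq_mul_right hpos ?_
  rw [h1, ← pow_add]
  congr 1
  ring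

/-- The number of square roots of `1` modulo a high power of a prime. -/
lemma card_sq_eq_one_le :
    Nat.card {x : 𝓞 M ⧸ v.asIdeal ^ (2 * ordTwo v + 1) // x ^ 2 = 1} ≤
      2 * Ideal.absNorm v.asIdeal ^ ordTwo v := by
  set e := ordTwo v with he
  set f := Ideal.Quotient.factor (S := v.asIdeal ^ (2 * e + 1))
      (T := v.asIdeal ^ (e + 1)) (Ideal.pow_le_pow_right (by omega))
  have hsub : {x : 𝓞 M ⧸ v.asIdeal ^ (2 * e + 1) | x ^ 2 = 1} ⊆
      (fun k ↦ k + 1) '' (RingHom.ker f : Set (𝓞 M ⧸ v.asIdeal ^ (2 * e + 1))) ∪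
      (fun k ↦ k - 1) '' (RingHom.ker f : Set (𝓞 M ⧸ v.asIdeal ^ (2 * e + 1))) := by
    intro x hx
    obtain ⟨x, rfl⟩ := Ideal.Quotient.mk_surjective x
    have hx' : (x - 1) * (x + 1) ∈ v.asIdeal ^ (2 * e + 1) := by
      rw [← Ideal.Quotient.eq_zero_iff_mem]
      have : (Ideal.Quotient.mk (v.asIdeal ^ (2 * e + 1)) x) ^ 2 = 1 := hx
      simp only [map_mul, map_sub, map_add, map_one]
      linear_combination this
    have hmem : x - 1 ∈ v.asIdeal ^ (e + 1) ∨ x + 1 ∈ v.asIdeal ^ (e + 1) := by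
      by_contra! hcon
      simp only [← v.intValuation_le_pow_iff_mem, not_le, ← v.valuation_of_algebraMap (K := M)]
        at hcon hx'
      change v.valuation M (algebraMap (𝓞 M) M ((x - 1) * (x + 1))) ≤ _ at hx'
      rw [map_mul (algebraMap (𝓞 M) M), map_mul] at hx'
      set p := v.valuation M (algebraMap (𝓞 M) M (x - 1)) with hp
      set q := v.valuation M (algebraMap (𝓞 M) M (x + 1)) with hq
      have hp0 : p ≠ 0 := (lt_of_le_of_lt zero_le hcon.1).ne'
      have hq0 : q ≠ 0 := (lt_of_le_of_lt zero_le hcon.2).ne'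
      have h2 : exp (-(e : ℤ)) ≤ max q p := by
        rw [← valuation_two]
        have : (2 : M) = algebraMap (𝓞 M) M (x + 1) - algebraMap (𝓞 M) M (x - 1) := by
          push_cast; ring
        rw [this]
        exact Valuation.map_sub _ _ _
      have h1 := (lt_log_iff_exp_lt hp0).2 hcon.1
      have h3 := (lt_log_iff_exp_lt hq0).2 hcon.2
      rw [← log_le_iff_le_exp (mul_ne_zero hp0 hq0), log_mul hp0 hq0] at hx'
      rcases le_max_iff.1 h2 with h | h
      · have := (le_log_iff_exp_le hq0).2 h
        push_cast at *
        omega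
      · have := (le_log_iff_exp_le hp0).2 h
        push_cast at *
        omega
    rcases hmem with h | h
    · refine Or.inl ⟨Ideal.Quotient.mk _ (x - 1), ?_, by simp⟩
      simpa [f, RingHom.mem_ker, Ideal.Quotient.eq_zero_iff_mem] using
        (Ideal.Quotient.eq_zero_iff_mem.2 h)
    · refine Or.inr ⟨Ideal.Quotient.mk _ (x + 1), ?_, by simp⟩
      simpa [f, RingHom.mem_ker, Ideal.Quotient.eq_zero_iff_mem] using
        (Ideal.Quotient.eq_zero_iff_mem.2 h)
  have hker : (RingHom.ker f : Set (𝓞 M ⧸ v.asIdeal ^ (2 * e + 1))).ncard =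
      Ideal.absNorm v.asIdeal ^ e := card_ker_factorPow v e
  calc Nat.card {x : 𝓞 M ⧸ v.asIdeal ^ (2 * e + 1) // x ^ 2 = 1}
      = {x : 𝓞 M ⧸ v.asIdeal ^ (2 * e + 1) | x ^ 2 = 1}.ncard := rfl
    _ ≤ _ := Set.ncard_le_ncard hsub (Set.toFinite _)
    _ ≤ _ := Set.ncard_union_le _ _
    _ ≤ _ := add_le_add (Set.ncard_image_le (Set.toFinite _)) (Set.ncard_image_le (Set.toFinite _))
    _ = _ := by rw [hker]; ring

lemma card_range_le_card_sq_eq_one {G Q : Type*} [CommGroup G] [Finite G] [Group Q] (φ : G →* Q)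
    (hφ : ∀ g, φ (g ^ 2) = 1) : Nat.card φ.range ≤ Nat.card {g : G // g ^ 2 = 1} := by
  have h1 := Subgroup.card_mul_index φ.ker
  rw [Subgroup.index_ker] at h1
  have h2 := Subgroup.card_mul_index (powMonoidHom 2 : G →* G).ker
  rw [Subgroup.index_ker] at h2
  have h3 : Nat.card (powMonoidHom 2 : G →* G).range ≤ Nat.card φ.ker := by
    refine Subgroup.card_le_of_le ?_
    rintro _ ⟨g, rfl⟩
    exact hφ g
  have h4 : Nat.card (powMonoidHom 2 : G →* G).ker = Nat.card {g : G // g ^ 2 = 1} := rfl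
  rw [← h4]
  have hpos : 0 < Nat.card φ.ker := Nat.card_pos
  refine Nat.le_of_mul_le_mul_left (h1.trans h2.symm |>.le.trans ?_) hpos
  rw [mul_comm]
  exact Nat.mul_le_mul_right _ h3

/-- The units at `v`. -/
def unitsAt : Subgroup Mˣ where
  carrier := {z | v.valuation M (z : M) = 1}
  one_mem' := by simp
  mul_mem' := by
    intro a b (ha : _ = 1) (hb : _ = 1)
    simp [ha, hb]
  inv_mem' := by
    intro a (ha : _ = 1)
    simp [ha]

lemma mem_unitsAt {z : Mˣ} : z ∈ unitsAt v ↔ v.valuation M (z : M) = 1 := Iff.rfl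

lemma div_mem_sqGroup_of_congr {z w : Mˣ} (hw : v.valuation M (w : M) = 1)
    (h : v.valuation M (z - w : M) ≤ exp (-((2 * ordTwo v + 1 : ℕ) : ℤ))) :
    z / w ∈ sqGroup (v.valuation M) := by
  refine div_mem_sqGroup (h.trans_lt ?_)
  rw [hw, mul_one, valuation_four, exp_lt_exp]
  push_cast
  omega

lemma card_map_unitsAt_le :
    Nat.card ((unitsAt v).map (QuotientGroup.mk' (sqGroup (v.valuation M)))) ≤
      2 * Ideal.absNorm v.asIdeal ^ ordTwo v ∧
    Finite ((unitsAt v).map (QuotientGroup.mk' (sqGroup (v.valuation M)))) := by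
  set k := 2 * ordTwo v + 1 with hk
  set R := 𝓞 M ⧸ v.asIdeal ^ k
  have hlift : ∀ u : Rˣ, ∃ r : 𝓞 M, Ideal.Quotient.mk (v.asIdeal ^ k) r = u ∧
      v.valuation M (r : M) = 1 := by
    intro u
    obtain ⟨r, hr⟩ := Ideal.Quotient.mk_surjective (u : R)
    refine ⟨r, hr, ?_⟩
    rw [v.valuation_eq_one_iff_notMem]
    intro hmem
    obtain ⟨s, hs⟩ := Ideal.Quotient.mk_surjective ((u⁻¹ : Rˣ) : R)
    have h1 : Ideal.Quotient.mk (v.asIdeal ^ k) (r * s - 1) = 0 := by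
      simp [hr, hs]
    rw [Ideal.Quotient.eq_zero_iff_mem] at h1
    have h2 : r * s - 1 ∈ v.asIdeal := Ideal.pow_le_self (by omega) h1
    have h3 : (1 : 𝓞 M) ∈ v.asIdeal := by
      have := v.asIdeal.sub_mem (v.asIdeal.mul_mem_right s hmem) h2
      simpa using this
    exact v.isPrime.ne_top ((Ideal.eq_top_iff_one _).2 h3)
  choose r hr hv using hlift
  have hr0 : ∀ u, (r u : M) ≠ 0 := fun u h0 ↦ by
    have := hv u
    rw [h0] at this
    simp at this
  have hcongr : ∀ (x y : 𝓞 M) (hx : (x : M) ≠ 0) (hy : (y : M) ≠ 0), v.valuation M (y : M) = 1 →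
      Ideal.Quotient.mk (v.asIdeal ^ k) x = Ideal.Quotient.mk (v.asIdeal ^ k) y →
      (QuotientGroup.mk' (sqGroup (v.valuation M))) (Units.mk0 _ hx) =
      (QuotientGroup.mk' (sqGroup (v.valuation M))) (Units.mk0 _ hy) := by
    intro x y hx hy hvy hxy
    rw [← div_eq_one]
    refine (QuotientGroup.eq_one_iff (Units.mk0 _ hx / Units.mk0 _ hy)).2 ?_
    refine div_mem_sqGroup_of_congr v (by simpa using hvy) ?_
    rw [Ideal.Quotient.eq, ← v.intValuation_le_pow_iff_mem, ← v.valuation_of_algebraMap (K := M)]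
      at hxy
    change v.valuation M (algebraMap (𝓞 M) M (x - y)) ≤ _ at hxy
    rwa [map_sub (algebraMap (𝓞 M) M)] at hxy
  let φ : Rˣ →* Mˣ ⧸ sqGroup (v.valuation M) := MonoidHom.mk'
    (fun u ↦ QuotientGroup.mk' (sqGroup (v.valuation M)) (Units.mk0 _ (hr0 u))) (by
      intro a b
      rw [← map_mul]
      have h0 : ((r a * r b : 𝓞 M) : M) ≠ 0 := by
        push_cast; exact mul_ne_zero (hr0 a) (hr0 b)
      have := hcongr (r (a * b)) (r a * r b) (hr0 _) h0
        (by push_cast; rw [map_mul, hv, hv, mul_one]) (by simp [hr])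
      rw [this]
      congr 1
      ext
      simp)
  have hφ : ∀ u, φ (u ^ 2) = 1 := by
    intro u
    rw [map_pow]
    change (QuotientGroup.mk' _ _) ^ 2 = 1
    rw [← map_pow, QuotientGroup.mk'_apply, QuotientGroup.eq_one_iff]
    exact sq_mem_sqGroup _ _
  have hle : (unitsAt v).map (QuotientGroup.mk' (sqGroup (v.valuation M))) ≤ φ.range := by
    have h_integral : ∀ (x : 𝓞 M) (hx : (x : M) ≠ 0), v.valuation M (x : M) = 1 →
        QuotientGroup.mk' (sqGroup (v.valuation M)) (Units.mk0 _ hx) ∈ φ.range := by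
      intro x hx hvx
      have hnot : x ∉ v.asIdeal := (v.valuation_eq_one_iff_notMem).1 hvx
      have hunit : IsUnit (Ideal.Quotient.mk (v.asIdeal ^ k) x) := by
        have : IsCoprime (Ideal.span {x}) (v.asIdeal ^ k) := by
          refine IsCoprime.pow_right ?_
          rw [Ideal.isCoprime_iff_sup_eq, sup_comm]
          exact v.isMaximal.1.2 _ (lt_of_le_of_ne le_sup_left fun h ↦ hnot (by
            rw [h]; exact Ideal.mem_sup_right (Ideal.mem_span_singleton_self x)))
        rw [Ideal.isCoprime_iff_exists] at this
        obtain ⟨y, hy, z, hz, hyz⟩ := this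
        obtain ⟨c, rfl⟩ := Ideal.mem_span_singleton'.1 hy
        refine IsUnit.of_mul_eq_one (Ideal.Quotient.mk _ c) ?_
        rw [← map_mul, ← map_one (Ideal.Quotient.mk (v.asIdeal ^ k)), Ideal.Quotient.eq]
        have : x * c - 1 = -z := by rw [← hyz]; ring
        rw [this]
        exact neg_mem hz
      refine ⟨hunit.unit, ?_⟩
      exact hcongr _ _ _ _ hvx (by rw [hr]; rfl)
    rintro _ ⟨z, hz, rfl⟩
    obtain ⟨n, ⟨d, hd⟩, hnd⟩ := v.exists_primeCompl_mul_eq_of_integer (z : M) (le_of_eq hz)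
    have hdv : v.valuation M (d : M) = 1 := by
      rw [v.valuation_eq_one_iff_notMem]; exact hd
    have hnv : v.valuation M (n : M) = 1 := by
      have : v.valuation M (z : M) = 1 := hz
      rw [show ((n : M)) = z * (d : M) from hnd.symm, map_mul, this, hdv, mul_one]
    have hd0 : (d : M) ≠ 0 := by
      intro h
      rw [h] at hdv
      simp at hdv
    have hn0 : (n : M) ≠ 0 := by
      intro h
      rw [h] at hnv
      simp at hnv
    have hz' : z = Units.mk0 _ hn0 / Units.mk0 _ hd0 := by
      ext
      rw [Units.val_div_eq_div_val, Units.val_mk0, Units.val_mk0, eq_div_iff hd0]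
      exact hnd
    rw [hz', map_div]
    exact div_mem (h_integral _ _ hnv) (h_integral _ _ hdv)
  have : Finite R := finite_quotient_pow v k
  have : Finite Rˣ := inferInstance
  have : Finite φ.range := Finite.of_surjective _ φ.rangeRestrict_surjective
  refine ⟨(Subgroup.card_le_of_le hle).trans ?_, Set.Finite.subset (Set.toFinite _) hle⟩
  refine (card_range_le_card_sq_eq_one φ hφ).trans (le_trans ?_ (card_sq_eq_one_le v))
  refine Nat.card_le_card_of_injective
    (fun g ↦ ⟨(g.1 : R), by rw [← Units.val_pow_eq_pow_val, g.2]; rfl⟩) ?_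
  intro g h hgh
  exact Subtype.ext (Units.ext (congrArg Subtype.val hgh))

lemma relIndex_sqGroup_unitsAt_le :
    (sqGroup (v.valuation M)).relIndex (unitsAt v) ≤ 2 * Ideal.absNorm v.asIdeal ^ ordTwo v ∧
    (sqGroup (v.valuation M)).relIndex (unitsAt v) ≠ 0 := by
  obtain ⟨h1, h2⟩ := card_map_unitsAt_le v
  rw [← Subgroup.relIndex_ker, QuotientGroup.ker_mk'] at h1
  refine ⟨h1, ?_⟩
  have : (sqGroup (v.valuation M)).relIndex (unitsAt v) =
      (QuotientGroup.mk' (sqGroup (v.valuation M))).ker.relIndex (unitsAt v) := by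
    rw [QuotientGroup.ker_mk']
  rw [this, Subgroup.relIndex_ker]
  exact Nat.card_pos.ne'

lemma index_le_two_of_mul_mem {G : Type*} [Group G] (H : Subgroup G)
    (h : ∀ x y, x ∉ H → y ∉ H → x * y ∈ H) : H.index ≤ 2 ∧ H.index ≠ 0 := by
  by_cases htop : H = ⊤
  · simp [htop]
  · obtain ⟨a, ha⟩ : ∃ a, a ∉ H := by
      by_contra! hcon
      exact htop ((Subgroup.eq_top_iff' H).2 hcon)
    have : H.index = 2 := by
      refine Subgroup.index_eq_two_iff.2 ⟨a, fun b ↦ ?_⟩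
      by_cases hb : b ∈ H
      · exact Or.inr ⟨hb, fun hba ↦ ha ((H.mul_mem_cancel_left hb).1 hba)⟩
      · exact Or.inl ⟨h b a hb ha, hb⟩
    simp [this]

lemma isSquare_or_isSquare_mul (x y : ℤᵐ⁰) (hx : ¬ IsSquare x) (hy : ¬ IsSquare y) :
    IsSquare (x * y) := by
  have key : ∀ z : ℤᵐ⁰, ¬ IsSquare z → z ≠ 0 ∧ ¬ Even (log z) := by
    intro z hz
    have hz0 : z ≠ 0 := by
      rintro rfl
      exact hz ⟨0, by simp⟩
    refine ⟨hz0, fun ⟨k, hk⟩ ↦ hz ⟨exp k, ?_⟩⟩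
    rw [← exp_add, ← hk, exp_log hz0]
  obtain ⟨hx0, hx'⟩ := key x hx
  obtain ⟨hy0, hy'⟩ := key y hy
  rw [Int.not_even_iff_odd] at hx' hy'
  obtain ⟨k, hk⟩ := hx'.add_odd hy'
  refine ⟨exp k, ?_⟩
  rw [← exp_add, ← hk, exp_add, exp_log hx0, exp_log hy0]

theorem index_sqGroup_le :
    (sqGroup (v.valuation M)).index ≤ 4 * Ideal.absNorm v.asIdeal ^ ordTwo v ∧
    (sqGroup (v.valuation M)).index ≠ 0 := by
  set H := sqGroup (v.valuation M)
  have hmem : ∀ z : Mˣ, IsSquare (v.valuation M (z : M)) → z ∈ unitsAt v ⊔ H := by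
    rintro z ⟨r, hr⟩
    have hr0 : r ≠ 0 := by
      rintro rfl
      simp at hr
    obtain ⟨π, hπ⟩ := v.valuation_exists_uniformizer M
    obtain ⟨s, hs⟩ := exists_val_eq hπ hr0
    rw [← div_mul_cancel z (s ^ 2)]
    refine mul_mem (Subgroup.mem_sup_left ?_) (Subgroup.mem_sup_right (sq_mem_sqGroup _ s))
    rw [mem_unitsAt]
    push_cast
    rw [map_div₀, map_pow, hs, hr, pow_two, div_self (by simp [hr0])]
  have h1 := index_le_two_of_mul_mem (unitsAt v ⊔ H) (by
    intro x y hx hy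
    refine hmem _ ?_
    rw [Units.val_mul, map_mul]
    exact isSquare_or_isSquare_mul _ _ (fun h ↦ hx (hmem _ h)) (fun h ↦ hy (hmem _ h)))
  obtain ⟨h2, h3⟩ := relIndex_sqGroup_unitsAt_le v
  rw [← Subgroup.relIndex_mul_index (le_sup_right : H ≤ unitsAt v ⊔ H),
    Subgroup.relIndex_sup_right]
  refine ⟨(Nat.mul_le_mul h2 h1.1).trans (by ring_nf; rfl), mul_ne_zero h3 h1.2⟩

lemma prod_absNorm_pow_ordTwo_le (S : Finset (HeightOneSpectrum (𝓞 M))) :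
    ∏ v ∈ S, Ideal.absNorm v.asIdeal ^ ordTwo v ≤ 2 ^ Module.finrank ℚ M := by
  have hdvd : ∏ v ∈ S, v.asIdeal ^ ordTwo v ∣ Ideal.span {(2 : 𝓞 M)} := by
    refine Finset.prod_dvd_of_coprime ?_ ?_
    · intro v _ w _ hvw
      refine IsCoprime.pow ?_
      have := v.isMaximal
      have := w.isMaximal
      exact Ideal.isCoprime_of_isMaximal fun h ↦ hvw (HeightOneSpectrum.ext h)
    · intro v _
      rw [← v.intValuation_le_pow_iff_dvd, ← v.valuation_of_algebraMap (K := M)]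
      change v.valuation M (algebraMap (𝓞 M) M 2) ≤ _
      rw [map_ofNat, valuation_two]
  have h2 : Ideal.absNorm (Ideal.span {(2 : 𝓞 M)}) = 2 ^ Module.finrank ℚ M := by
    rw [Ideal.absNorm_span_singleton]
    have : (2 : 𝓞 M) = algebraMap ℤ (𝓞 M) 2 := by simp
    rw [this, Algebra.norm_algebraMap, Int.natAbs_pow, RingOfIntegers.rank]
    rfl
  have h3 := map_dvd Ideal.absNorm hdvd
  rw [map_prod, h2] at h3
  simp only [map_pow] at h3
  exact Nat.le_of_dvd (by positivity) h3

/-- Weak approximation modulo local squares. -/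
theorem exists_forall_div_mem_sqGroup (S : Finset (HeightOneSpectrum (𝓞 M)))
    (z : HeightOneSpectrum (𝓞 M) → Mˣ) :
    ∃ x : Mˣ, ∀ v ∈ S, x / z v ∈ sqGroup (v.valuation M) := by
  rcases S.eq_empty_or_nonempty with rfl | ⟨v₀, hv₀⟩
  · exact ⟨1, by simp⟩
  have hrep : ∀ v, ∃ (n : 𝓞 M) (d : Mˣ), (n : M) = z v * d ^ 2 := by
    intro v
    obtain ⟨n, d, hd, hnd⟩ := IsFractionRing.div_surjective (A := 𝓞 M) (z v : M)
    have hd0 : algebraMap (𝓞 M) M d ≠ 0 := by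
      simpa using nonZeroDivisors.ne_zero hd
    refine ⟨n * d, Units.mk0 _ hd0, ?_⟩
    change algebraMap (𝓞 M) M (n * d) = _
    rw [← hnd, map_mul (algebraMap (𝓞 M) M), Units.val_mk0]
    field_simp
  choose n d hn using hrep
  have hn0 : ∀ v, (n v : M) ≠ 0 := fun v ↦ by rw [hn]; simp
  have hexp : ∀ v : HeightOneSpectrum (𝓞 M), ∃ k : ℕ,
      exp (-(k : ℤ)) < v.valuation M 4 * v.valuation M (n v : M) := by
    intro v
    obtain ⟨k, hk⟩ := exists_exp_mul_lt 1 (v.valuation M 4 * v.valuation M (n v : M))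
      (by simp [RingOfIntegers.coe_ne_zero_iff.1 (hn0 v)])
    exact ⟨k + 1, by simpa using hk⟩
  choose k hk using hexp
  obtain ⟨y, hy⟩ := IsDedekindDomain.exists_forall_sub_mem_ideal (s := S)
    (fun v : HeightOneSpectrum (𝓞 M) ↦ v.asIdeal) k (fun v _ ↦ v.prime)
    (fun v _ w _ hvw h ↦ hvw (HeightOneSpectrum.ext h)) (fun v ↦ n v.1)
  have hlt : ∀ v ∈ S, v.valuation M ((y : M) - n v) < v.valuation M 4 * v.valuation M (n v : M) := by
    intro v hv
    have h1 := hy v hv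
    rw [← v.intValuation_le_pow_iff_mem, ← v.valuation_of_algebraMap (K := M)] at h1
    exact (by simpa using h1 : v.valuation M ((y : M) - n v) ≤ exp (-(k v : ℤ))).trans_lt (hk v)
  have hy0 : (y : M) ≠ 0 := by
    intro h0
    have := hlt v₀ hv₀
    rw [h0, zero_sub, Valuation.map_neg] at this
    exact absurd this (not_lt.2 (mul_le_of_le_one_left zero_le (val_four_le _)))
  refine ⟨Units.mk0 _ hy0, fun v hv ↦ ?_⟩
  have h1 : Units.mk0 _ hy0 / Units.mk0 _ (hn0 v) ∈ sqGroup (v.valuation M) :=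
    div_mem_sqGroup (by simpa using hlt v hv)
  have h2 : Units.mk0 _ (hn0 v) = z v * d v ^ 2 := by
    ext; simp [hn]
  rw [h2] at h1
  have := mul_mem h1 (sq_mem_sqGroup (v.valuation M) (d v))
  rwa [← div_div, div_mul_cancel] at this

end NumberField

section SqIndex

/-- The index of the subgroup of squares. -/
noncomputable def sqIndex (A : Type*) [CommGroup A] : ℕ := (powMonoidHom 2 : A →* A).range.index

variable {A B C : Type*} [CommGroup A] [CommGroup B] [CommGroup C]

lemma mem_range_pow_two {a : A} : a ∈ (powMonoidHom 2 : A →* A).range ↔ ∃ b, b ^ 2 = a := Iff.rfl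

lemma sqIndex_congr (e : A ≃* B) : sqIndex A = sqIndex B := by
  rw [sqIndex, sqIndex, ← Subgroup.index_map_equiv _ e]
  congr 1
  ext b
  constructor
  · rintro ⟨_, ⟨a, rfl⟩, rfl⟩
    exact ⟨e a, by simp⟩
  · rintro ⟨b, rfl⟩
    exact ⟨_, ⟨e.symm b, rfl⟩, by simp⟩

/-- Multiplicativity of the index of squares. -/
lemma sqIndex_eq_mul (f : A →* C) (hf : Function.Surjective f) (hC : ∀ c : C, c ^ 2 = 1 → c = 1) :
    sqIndex A = sqIndex C * sqIndex f.ker := by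
  set P := (powMonoidHom 2 : A →* A).range with hP
  have h1 : (P ⊔ f.ker).index = sqIndex C := by
    rw [sqIndex, ← Subgroup.index_comap_of_surjective _ hf]
    congr 1
    ext a
    rw [Subgroup.mem_comap, mem_range_pow_two, Subgroup.mem_sup]
    constructor
    · rintro ⟨_, ⟨y, rfl⟩, z, hz, rfl⟩
      refine ⟨f y, ?_⟩
      rw [map_mul, (hz : f z = 1), mul_one]
      simp
    · rintro ⟨c, hc⟩
      obtain ⟨y, rfl⟩ := hf c
      refine ⟨y ^ 2, ⟨y, rfl⟩, a / y ^ 2, ?_, by simp⟩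
      rw [MonoidHom.mem_ker, map_div, map_pow, hc, div_self']
  have h2 : P.relIndex (P ⊔ f.ker) = sqIndex f.ker := by
    rw [sup_comm, Subgroup.relIndex_sup_right, Subgroup.relIndex, sqIndex]
    congr 1
    ext ⟨a, ha⟩
    rw [Subgroup.mem_subgroupOf, mem_range_pow_two, mem_range_pow_two]
    constructor
    · rintro ⟨b, hb⟩
      refine ⟨⟨b, hC _ ?_⟩, Subtype.ext hb⟩
      rw [← map_pow, hb]
      exact ha
    · rintro ⟨b, hb⟩
      exact ⟨b, congrArg Subtype.val hb⟩
  rw [sqIndex, ← Subgroup.relIndex_mul_index (le_sup_left : P ≤ P ⊔ f.ker), h1, h2, mul_comm]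

lemma sqIndex_of_finite [Finite A] : sqIndex A = Nat.card {a : A // a ^ 2 = 1} := by
  have h1 := Subgroup.card_mul_index (powMonoidHom 2 : A →* A).range
  have h2 := Subgroup.card_mul_index (powMonoidHom 2 : A →* A).ker
  rw [Subgroup.index_ker] at h2
  have hpos : 0 < Nat.card (powMonoidHom 2 : A →* A).range := Nat.card_pos
  have h3 : Nat.card (powMonoidHom 2 : A →* A).ker = Nat.card {g : A // g ^ 2 = 1} := rfl
  rw [sqIndex, ← h3]
  refine Nat.eq_of_mul_eq_mul_left hpos ?_
  rw [h1, ← h2, mul_comm]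

lemma sqIndex_pi_int (r : ℕ) : sqIndex (Multiplicative (Fin r → ℤ)) = 2 ^ r := by
  let f : (Fin r → ℤ) →+ (Fin r → ZMod 2) :=
    AddMonoidHom.mk' (fun x i ↦ (x i : ZMod 2)) (by intro a b; ext i; simp)
  have hker : (powMonoidHom 2 : Multiplicative (Fin r → ℤ) →* _).range =
      (AddMonoidHom.toMultiplicative f).ker := by
    ext x
    rw [mem_range_pow_two, MonoidHom.mem_ker]
    constructor
    · rintro ⟨b, rfl⟩
      rw [map_pow]
      refine Multiplicative.toAdd.injective ?_
      ext i
      have : (2 : ZMod 2) = 0 := rfl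
      simp [this]
    · intro hx
      have h1 : ∀ i, ((x.toAdd i : ℤ) : ZMod 2) = 0 := fun i ↦
        congrFun (congrArg Multiplicative.toAdd hx) i
      have h2 : ∀ i, ∃ c, x.toAdd i = 2 * c := fun i ↦ by
        have := (ZMod.intCast_zmod_eq_zero_iff_dvd _ 2).1 (h1 i)
        exact_mod_cast this
      choose c hc using h2
      refine ⟨Multiplicative.ofAdd c, Multiplicative.toAdd.injective ?_⟩
      ext i
      simp [hc]
  rw [sqIndex, hker, Subgroup.index_ker]
  have hsurj : Function.Surjective (AddMonoidHom.toMultiplicative f) := by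
    intro y
    refine ⟨Multiplicative.ofAdd fun i ↦ ((y.toAdd i).val : ℤ), Multiplicative.toAdd.injective ?_⟩
    ext i
    simp [f]
  rw [MonoidHom.range_eq_top.2 hsurj, Subgroup.card_top]
  change Nat.card (Fin r → ZMod 2) = _
  simp

lemma sqIndex_range_int (f : A →* Multiplicative ℤ) (hf : f ≠ 1) : sqIndex f.range = 2 := by
  obtain ⟨⟨g, hg⟩, hgen⟩ := (inferInstance : IsCyclic f.range)
  have hg1 : g ≠ 1 := by
    rintro rfl
    refine hf (MonoidHom.ext fun x ↦ ?_)
    obtain ⟨k, hk⟩ := hgen ⟨f x, x, rfl⟩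
    have := congrArg Subtype.val hk
    simpa using this.symm
  have hinj : ∀ k l : ℤ, g ^ k = g ^ l → k = l := by
    intro k l h
    have h2 : k * g.toAdd = l * g.toAdd := by
      simpa using congrArg Multiplicative.toAdd h
    exact mul_right_cancel₀ (fun h ↦ hg1 (Multiplicative.toAdd.injective h)) h2
  have hmem : ∀ k : ℤ, (⟨g, hg⟩ : f.range) ^ k ∈ (powMonoidHom 2 : f.range →* _).range ↔ Even k := by
    intro k
    rw [mem_range_pow_two]
    constructor
    · rintro ⟨b, hb⟩
      obtain ⟨l, rfl⟩ := hgen b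
      have := congrArg Subtype.val hb
      simp only [SubgroupClass.coe_zpow, ← zpow_natCast, ← zpow_mul] at this
      refine ⟨l, ?_⟩
      have := hinj _ _ this
      push_cast at this
      omega
    · rintro ⟨l, rfl⟩
      exact ⟨⟨g, hg⟩ ^ l, by rw [zpow_add, pow_two]⟩
  rw [sqIndex, Subgroup.index_eq_two_iff]
  refine ⟨⟨g, hg⟩, fun b ↦ ?_⟩
  obtain ⟨k, rfl⟩ := hgen b
  simp only
  rw [← zpow_add_one, hmem, hmem, Int.even_add_one]
  by_cases h : Even k
  · exact Or.inr ⟨h, not_not.2 h⟩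
  · exact Or.inl ⟨h, h⟩

end SqIndex

section SUnits

variable {M : Type*} [Field M] [NumberField M]

/-- The group of `S`-units. -/
def sUnits (S : Finset (HeightOneSpectrum (𝓞 M))) : Subgroup Mˣ where
  carrier := {z | ∀ v ∉ S, v.valuation M (z : M) = 1}
  one_mem' := by simp
  mul_mem' := by
    intro a b ha hb v hv
    simp [ha v hv, hb v hv]
  inv_mem' := by
    intro a ha v hv
    simp [ha v hv]

lemma mem_sUnits {S : Finset (HeightOneSpectrum (𝓞 M))} {z : Mˣ} :
    z ∈ sUnits S ↔ ∀ v ∉ S, v.valuation M (z : M) = 1 := Iff.rfl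

lemma sUnits_mono {S T : Finset (HeightOneSpectrum (𝓞 M))} (h : S ⊆ T) : sUnits S ≤ sUnits T :=
  fun _ hz v hv ↦ hz v fun hvS ↦ hv (h hvS)

lemma exists_mem_sUnits (z : Mˣ) : ∃ S : Finset (HeightOneSpectrum (𝓞 M)), z ∈ sUnits S := by
  have key : ∀ x : 𝓞 M, x ≠ 0 → {v : HeightOneSpectrum (𝓞 M) | v.valuation M (x : M) ≠ 1}.Finite := by
    intro x hx
    refine (Ideal.finite_factors (I := Ideal.span {x}) (by simpa using hx)).subset fun v hv ↦ ?_
    have h1 := lt_of_le_of_ne (v.valuation_le_one (K := M) x) hv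
    exact (v.valuation_lt_one_iff_dvd x).1 h1
  obtain ⟨n, d, hd, hnd⟩ := IsFractionRing.div_surjective (A := 𝓞 M) (z : M)
  have hd0 : d ≠ 0 := nonZeroDivisors.ne_zero hd
  have hn0 : n ≠ 0 := by
    rintro rfl
    simp at hnd
    exact z.ne_zero hnd.symm
  refine ⟨((key n hn0).union (key d hd0)).toFinset, fun v hv ↦ ?_⟩
  simp only [Set.Finite.mem_toFinset, Set.mem_union, Set.mem_ofPred_eq, not_or, not_not] at hv
  rw [← hnd, map_div₀]
  exact (congrArg₂ _ hv.1 hv.2).trans (div_one 1)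

lemma sqIndex_units {i : M} (hi : i ^ 2 = -1) {k : ℕ} (hk : Module.finrank ℚ M = 2 * k) :
    sqIndex (𝓞 M)ˣ = 2 ^ k := by
  have hC : ∀ c : Multiplicative (Fin (Units.rank M) → ℤ), c ^ 2 = 1 → c = 1 := by
    intro c hc
    refine Multiplicative.toAdd.injective (funext fun i ↦ ?_)
    have h1 := congrFun (congrArg Multiplicative.toAdd hc) i
    simpa using h1
  choose p hp huniq using Units.exist_unique_eq_mul_prod M
  let f : (𝓞 M)ˣ →* Multiplicative (Fin (Units.rank M) → ℤ) := MonoidHom.mk'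
    (fun x ↦ Multiplicative.ofAdd (p x).2) (by
      intro x y
      have := huniq (x * y) ((p x).1 * (p y).1, (p x).2 + (p y).2) (by
        refine (congrArg₂ (· * ·) (hp x) (hp y)).trans ?_
        simp only [Subgroup.coe_mul, Pi.add_apply, zpow_add, Finset.prod_mul_distrib]
        exact mul_mul_mul_comm _ _ _ _)
      rw [← this]
      rfl)
  have hsurj : Function.Surjective f := by
    intro c
    refine ⟨∏ i, Units.fundSystem M i ^ (c.toAdd i), ?_⟩
    have := huniq (∏ i, Units.fundSystem M i ^ (c.toAdd i)) (1, c.toAdd) (by simp)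
    change Multiplicative.ofAdd (p _).2 = c
    rw [← this]
    rfl
  have hker : f.ker = Units.torsion M := by
    ext x
    rw [MonoidHom.mem_ker]
    constructor
    · intro h
      have h1 : (p x).2 = 0 := h
      have h2 := hp x
      simp only [h1, Pi.zero_apply, zpow_zero, Finset.prod_const_one, mul_one] at h2
      rw [h2]
      exact (p x).1.2
    · intro h
      have := huniq x (⟨x, h⟩, 0) (by simp)
      change Multiplicative.ofAdd (p x).2 = 1
      rw [← this]
      rfl
  have htors : sqIndex (Units.torsion M) = 2 := by
    rw [sqIndex_of_finite, Nat.card_eq_two_iff]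
    have hneg : (-1 : (𝓞 M)ˣ) ∈ Units.torsion M := by
      rw [Units.torsion, CommGroup.mem_torsion, isOfFinOrder_iff_pow_eq_one]
      exact ⟨2, by norm_num, by simp⟩
    refine ⟨⟨1, one_pow 2⟩, ⟨⟨-1, hneg⟩, Subtype.ext (by simp)⟩, ?_, ?_⟩
    · intro h
      have h1 : (1 : (𝓞 M)ˣ) = -1 := congrArg (fun x ↦ x.1.1) h
      have h2 : (1 : M) = -1 := by
        simpa using congrArg (fun x : (𝓞 M)ˣ ↦ algebraMap (𝓞 M) M (x : 𝓞 M)) h1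
      norm_num at h2
    · ext ⟨⟨x, hx⟩, hx2⟩
      have h1 : x ^ 2 = 1 := congrArg Subtype.val hx2
      have h2 : ((x : 𝓞 M)) ^ 2 = 1 := by rw [← Units.val_pow_eq_pow_val, h1]; rfl
      simp only [Set.mem_insert_iff, Set.mem_singleton_iff, Set.mem_univ, iff_true]
      rw [pow_two, mul_self_eq_one_iff] at h2
      rcases h2 with h | h
      · exact Or.inl (Subtype.ext (Subtype.ext (Units.ext h)))
      · exact Or.inr (Subtype.ext (Subtype.ext (Units.ext h)))
  rw [sqIndex_eq_mul f hsurj hC, hker, sqIndex_pi_int, htors, ← pow_succ]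
  congr 1
  have hcx : IsTotallyComplex M := ⟨fun w ↦ by
    rw [← InfinitePlace.not_isReal_iff_isComplex]
    rintro ⟨φ, hφ, -⟩
    have h1 : (hφ.embedding i) ^ 2 = -1 := by rw [← map_pow, hi, map_neg, map_one]
    nlinarith [sq_nonneg (hφ.embedding i)]⟩
  have h1 := IsTotallyComplex.finrank (K := M)
  have h2 : 0 < Module.finrank ℚ M := Module.finrank_pos
  have h3 := InfinitePlace.card_eq_nrRealPlaces_add_nrComplexPlaces (K := M)
  have h4 := IsTotallyComplex.nrRealPlaces_eq_zero M
  rw [Units.rank]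
  omega


lemma valuation_eq_one_of_not_dvd (v : HeightOneSpectrum (𝓞 M)) {x : 𝓞 M}
    (h : ¬ v.asIdeal ∣ Ideal.span {x}) : v.valuation M (x : M) = 1 :=
  le_antisymm (v.valuation_le_one x) (not_lt.1 fun hlt ↦ h ((v.valuation_lt_one_iff_dvd x).1 hlt))

lemma not_dvd_of_ne {v w : HeightOneSpectrum (𝓞 M)} (h : w ≠ v) : ¬ w.asIdeal ∣ v.asIdeal := by
  intro hd
  have := v.isMaximal
  exact h (HeightOneSpectrum.ext (this.eq_of_le w.isPrime.ne_top (Ideal.le_of_dvd hd)).symm)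

/-- Some power of every prime is principal. -/
lemma exists_val_lt_one (v : HeightOneSpectrum (𝓞 M)) :
    ∃ x : Mˣ, v.valuation M (x : M) < 1 ∧ ∀ w ≠ v, w.valuation M (x : M) = 1 := by
  have hv : v.asIdeal ∈ nonZeroDivisors (Ideal (𝓞 M)) := mem_nonZeroDivisors_of_ne_zero v.ne_bot
  set h := Nat.card (ClassGroup (𝓞 M)) with hh
  have hpos : h ≠ 0 := Nat.card_pos.ne'
  have h1 : ClassGroup.mk0 (⟨v.asIdeal, hv⟩ ^ h) = 1 := by
    rw [map_pow, hh, pow_card_eq_one']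
  have h2 := (ClassGroup.mk0_eq_one_iff (pow_mem hv h)).1 h1
  obtain ⟨x, hx⟩ := (Submodule.isPrincipal_iff _).1 h2
  change v.asIdeal ^ h = Ideal.span {x} at hx
  have hx0 : (x : M) ≠ 0 := by
    intro h0
    rw [RingOfIntegers.coe_eq_zero_iff] at h0
    rw [h0, Ideal.span_singleton_eq_bot.2 rfl] at hx
    exact pow_ne_zero h v.ne_bot hx
  refine ⟨Units.mk0 _ hx0, ?_, fun w hw ↦ ?_⟩
  · refine (v.valuation_lt_one_iff_dvd x).2 ?_
    rw [← hx]
    exact dvd_pow_self _ hpos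
  · refine valuation_eq_one_of_not_dvd w fun hd ↦ ?_
    rw [← hx] at hd
    exact not_dvd_of_ne hw (w.prime.dvd_of_dvd_pow hd)

lemma sqIndex_sUnits_insert {S : Finset (HeightOneSpectrum (𝓞 M))} [DecidableEq (HeightOneSpectrum (𝓞 M))]
    {v : HeightOneSpectrum (𝓞 M)} (hv : v ∉ S) :
    sqIndex (sUnits (insert v S)) = 2 * sqIndex (sUnits S) := by
  have hne : ∀ z : Mˣ, v.valuation M (z : M) ≠ 0 := fun z ↦ by simp
  let f : sUnits (insert v S) →* Multiplicative ℤ := MonoidHom.mk'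
    (fun z ↦ Multiplicative.ofAdd (log (v.valuation M (z.1 : M)))) (by
      intro a b
      rw [← ofAdd_add, ← log_mul (hne _) (hne _), ← map_mul]
      rfl)
  have hf : f ≠ 1 := by
    obtain ⟨x, hx1, hx2⟩ := exists_val_lt_one v
    intro h
    have hx : x ∈ sUnits (insert v S) := fun w hw ↦
      hx2 w fun h ↦ hw (by rw [h]; exact Finset.mem_insert_self v S)
    have h1 : log (v.valuation M (x : M)) = 0 := DFunLike.congr_fun h ⟨x, hx⟩
    rw [← exp_log (hne x), h1, exp_zero] at hx1
    exact lt_irrefl _ hx1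
  have h1 := sqIndex_eq_mul f.rangeRestrict f.rangeRestrict_surjective (by
    rintro ⟨c, hc⟩ h
    refine Subtype.ext (Multiplicative.toAdd.injective ?_)
    have h2 := congrArg (fun x ↦ Multiplicative.toAdd x.1) h
    simpa using h2)
  rw [h1, sqIndex_range_int f hf]
  congr 1
  have hker : f.rangeRestrict.ker = (sUnits S).subgroupOf (sUnits (insert v S)) := by
    ext ⟨z, hz⟩
    rw [MonoidHom.ker_rangeRestrict, MonoidHom.mem_ker, Subgroup.mem_subgroupOf]
    change log (v.valuation M (z : M)) = 0 ↔ _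
    constructor
    · intro h w hw
      by_cases hwv : w = v
      · rw [hwv]
        exact (exp_log (hne z)).symm.trans (by rw [h, exp_zero])
      · exact hz w (by simp [hwv, hw])
    · intro h
      rw [h v hv, log_one]
  rw [hker]
  exact sqIndex_congr (Subgroup.subgroupOfEquivOfLe (sUnits_mono (Finset.subset_insert v S)))

theorem sqIndex_sUnits {i : M} (hi : i ^ 2 = -1) {k : ℕ} (hk : Module.finrank ℚ M = 2 * k)
    (S : Finset (HeightOneSpectrum (𝓞 M))) : sqIndex (sUnits S) = 2 ^ (S.card + k) := by
  classical
  induction S using Finset.induction_on with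
  | empty =>
    rw [Finset.card_empty, zero_add, ← sqIndex_units hi hk]
    let g : (𝓞 M)ˣ →* Mˣ := Units.map (algebraMap (𝓞 M) M)
    have hg : Function.Injective g := Units.map_injective (RingOfIntegers.coe_injective)
    have hrange : g.range = sUnits ∅ := by
      ext z
      constructor
      · rintro ⟨u, rfl⟩ v -
        have h1 := v.valuation_le_one (K := M) (u : 𝓞 M)
        have h2 := v.valuation_le_one (K := M) ((u⁻¹ : (𝓞 M)ˣ) : 𝓞 M)
        refine le_antisymm h1 ?_
        have h3 : v.valuation M (algebraMap (𝓞 M) M (u : 𝓞 M)) *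
            v.valuation M (algebraMap (𝓞 M) M ((u⁻¹ : (𝓞 M)ˣ) : 𝓞 M)) = 1 := by
          rw [← map_mul, ← map_mul, Units.mul_inv, map_one, map_one]
        rw [← h3]
        exact mul_le_of_le_one_right zero_le h2
      · intro hz
        obtain ⟨x, hx⟩ := HeightOneSpectrum.mem_integers_of_valuation_le_one M (z : M)
          fun v ↦ (hz v (by simp)).le
        obtain ⟨y, hy⟩ := HeightOneSpectrum.mem_integers_of_valuation_le_one M ((z⁻¹ : Mˣ) : M)
          fun v ↦ ((sUnits ∅).inv_mem hz v (by simp)).le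
        have hxy : x * y = 1 := RingOfIntegers.coe_injective (by
          rw [map_mul, hx, hy, Units.mul_inv, map_one])
        exact ⟨⟨x, y, hxy, by rw [mul_comm, hxy]⟩, Units.ext hx⟩
    rw [← hrange]
    exact sqIndex_congr (MonoidHom.ofInjective hg).symm
  | insert v S hv ih =>
    rw [sqIndex_sUnits_insert hv, ih, Finset.card_insert_of_notMem hv]
    ring

/-- The `S`-class group is trivial: every prime outside `S` has a generator outside `S`. -/
def ClTrivial (S : Finset (HeightOneSpectrum (𝓞 M))) : Prop :=
  ∀ v ∉ S, ∃ x : Mˣ, v.valuation M (x : M) = exp (-1 : ℤ) ∧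
    ∀ w ∉ S, w ≠ v → w.valuation M (x : M) = 1

lemma ClTrivial.mono {S T : Finset (HeightOneSpectrum (𝓞 M))} (h : ClTrivial S) (hST : S ⊆ T) :
    ClTrivial T := fun v hv ↦ by
  obtain ⟨x, hx1, hx2⟩ := h v fun h ↦ hv (hST h)
  exact ⟨x, hx1, fun w hw ↦ hx2 w fun h ↦ hw (hST h)⟩

lemma exists_clTrivial : ∃ S : Finset (HeightOneSpectrum (𝓞 M)), ClTrivial S := by
  have := Fintype.ofFinite (ClassGroup (𝓞 M))
  choose I hI using ClassGroup.mk0_surjective (R := 𝓞 M)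
  have hfin : {v : HeightOneSpectrum (𝓞 M) | ∃ c, v.asIdeal ∣ (I c : Ideal (𝓞 M))}.Finite := by
    have : {v : HeightOneSpectrum (𝓞 M) | ∃ c, v.asIdeal ∣ (I c : Ideal (𝓞 M))} =
        ⋃ c, {v : HeightOneSpectrum (𝓞 M) | v.asIdeal ∣ (I c : Ideal (𝓞 M))} := by
      ext v; simp
    rw [this]
    exact Set.finite_iUnion fun c ↦ Ideal.finite_factors (nonZeroDivisors.ne_zero (I c).2)
  refine ⟨hfin.toFinset, fun v hv ↦ ?_⟩
  simp only [Set.Finite.mem_toFinset, Set.mem_ofPred_eq, not_exists] at hv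
  have hv0 : v.asIdeal ∈ nonZeroDivisors (Ideal (𝓞 M)) := mem_nonZeroDivisors_of_ne_zero v.ne_bot
  set c := (ClassGroup.mk0 (⟨v.asIdeal, hv0⟩))⁻¹ with hc
  have h1 : ClassGroup.mk0 (⟨v.asIdeal, hv0⟩ * I c) = 1 := by
    rw [map_mul, hI, hc, mul_inv_cancel]
  obtain ⟨x, hx⟩ := (Submodule.isPrincipal_iff _).1
    ((ClassGroup.mk0_eq_one_iff (mul_mem hv0 (I c).2)).1 h1)
  change v.asIdeal * I c = Ideal.span {x} at hx
  have hx0 : (x : M) ≠ 0 := by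
    intro h0
    rw [RingOfIntegers.coe_eq_zero_iff] at h0
    rw [h0, Ideal.span_singleton_eq_bot.2 rfl] at hx
    exact mul_ne_zero v.ne_bot (nonZeroDivisors.ne_zero (I c).2) hx
  refine ⟨Units.mk0 _ hx0, ?_, fun w hw hwv ↦ ?_⟩
  · have h2 : v.valuation M (x : M) ≤ exp (-((1 : ℕ) : ℤ)) := by
      refine (v.valuation_of_algebraMap x).trans_le ((v.intValuation_le_pow_iff_dvd x 1).2 ?_)
      rw [pow_one, ← hx]
      exact dvd_mul_right _ _
    have h3 : ¬ v.valuation M (x : M) ≤ exp (-((2 : ℕ) : ℤ)) := by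
      intro h
      have := (v.intValuation_le_pow_iff_dvd x 2).1 ((v.valuation_of_algebraMap x).symm.trans_le h)
      rw [← hx, pow_two] at this
      exact hv c ((mul_dvd_mul_iff_left v.ne_bot).1 this)
    have hne : v.valuation M (x : M) ≠ 0 := by simpa using hx0
    rw [Units.val_mk0, ← exp_log hne]
    rw [← log_le_iff_le_exp hne] at h2 h3
    congr 1
    push_cast at h2 h3
    omega
  · refine valuation_eq_one_of_not_dvd w fun hd ↦ ?_
    rw [← hx] at hd
    simp only [Set.Finite.mem_toFinset, Set.mem_ofPred_eq, not_exists] at hw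
    rcases w.prime.dvd_or_dvd hd with h | h
    · exact not_dvd_of_ne hwv h
    · exact hw c h

end SUnits

section Below

variable {M L : Type*} [Field M] [NumberField M] [Field L] [NumberField L] [Algebra M L]

/-- The prime below a prime of an extension. -/
noncomputable def below (M : Type*) [Field M] [NumberField M] [Algebra M L]
    (w : HeightOneSpectrum (𝓞 L)) : HeightOneSpectrum (𝓞 M) where
  asIdeal := w.asIdeal.under (𝓞 M)
  isPrime := inferInstance
  ne_bot := Ideal.under_ne_bot _ w.ne_bot

instance liesOver_below (w : HeightOneSpectrum (𝓞 L)) :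
    w.asIdeal.LiesOver (below M w).asIdeal := ⟨rfl⟩

lemma exists_valuation_algebraMap (w : HeightOneSpectrum (𝓞 L)) : ∃ e : ℕ, e ≠ 0 ∧
    ∀ x : M, w.valuation L (algebraMap M L x) = (below M w).valuation M x ^ e :=
  ⟨_, Ideal.IsDedekindDomain.ramificationIdx'_ne_zero_of_liesOver w.asIdeal (below M w).ne_bot,
    fun x ↦ (HeightOneSpectrum.valuation_liesOver L (below M w) w x).symm⟩

lemma valuation_algebraMap_lt_one_iff (w : HeightOneSpectrum (𝓞 L)) (x : M) :
    w.valuation L (algebraMap M L x) < 1 ↔ (below M w).valuation M x < 1 := by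
  obtain ⟨e, he, h⟩ := exists_valuation_algebraMap (M := M) w
  rw [h, pow_lt_one_iff he]

lemma valuation_algebraMap_le_one_iff (w : HeightOneSpectrum (𝓞 L)) (x : M) :
    w.valuation L (algebraMap M L x) ≤ 1 ↔ (below M w).valuation M x ≤ 1 := by
  obtain ⟨e, he, h⟩ := exists_valuation_algebraMap (M := M) w
  rw [h, pow_le_one_iff he]

lemma valuation_algebraMap_eq_one_iff (w : HeightOneSpectrum (𝓞 L)) (x : M) :
    w.valuation L (algebraMap M L x) = 1 ↔ (below M w).valuation M x = 1 := by
  obtain ⟨e, he, h⟩ := exists_valuation_algebraMap (M := M) w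
  rw [h, pow_eq_one_iff, or_iff_left he]

lemma eq_of_valuation_lt_one {v v' : HeightOneSpectrum (𝓞 M)}
    (h : ∀ x : M, v.valuation M x < 1 → v'.valuation M x < 1) : v = v' := by
  have hle : v.asIdeal ≤ v'.asIdeal := fun x hx ↦
    (v'.valuation_lt_one_iff_mem (K := M) x).1 (h _ ((v.valuation_lt_one_iff_mem x).2 hx))
  exact HeightOneSpectrum.ext (v.isMaximal.eq_of_le v'.isPrime.ne_top hle)

lemma exists_below_eq (v : HeightOneSpectrum (𝓞 M)) :
    ∃ w : HeightOneSpectrum (𝓞 L), below M w = v := by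
  have := v.isMaximal
  obtain ⟨Q, hQ, hl⟩ := Ideal.exists_maximal_ideal_liesOver_of_isIntegral (S := 𝓞 L) v.asIdeal
  refine ⟨⟨Q, hQ.isPrime, ?_⟩, ?_⟩
  · exact Ideal.ne_bot_of_liesOver_of_ne_bot v.ne_bot Q
  · exact HeightOneSpectrum.ext hl.over.symm

lemma finite_below_eq (v : HeightOneSpectrum (𝓞 M)) :
    {w : HeightOneSpectrum (𝓞 L) | below M w = v}.Finite := by
  have h1 : (v.asIdeal.primesOver (𝓞 L)).Finite := IsDedekindDomain.primesOver_finite _ _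
  refine Set.Finite.of_finite_image (f := HeightOneSpectrum.asIdeal) (h1.subset ?_)
    (fun a _ b _ h ↦ HeightOneSpectrum.ext h)
  rintro _ ⟨w, rfl, rfl⟩
  exact ⟨w.isPrime, ⟨rfl⟩⟩

/-- The finite set of primes above a finite set of primes. -/
noncomputable def primesAbove (L : Type*) [Field L] [NumberField L] [Algebra M L]
    (S : Finset (HeightOneSpectrum (𝓞 M))) : Finset (HeightOneSpectrum (𝓞 L)) :=
  (show {w : HeightOneSpectrum (𝓞 L) | below M w ∈ S}.Finite by
    have : {w : HeightOneSpectrum (𝓞 L) | below M w ∈ S} =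
      ⋃ v ∈ S, {w : HeightOneSpectrum (𝓞 L) | below M w = v} := by ext; simp
    rw [this]
    exact S.finite_toSet.biUnion fun v _ ↦ finite_below_eq v).toFinset

lemma mem_primesAbove {S : Finset (HeightOneSpectrum (𝓞 M))} {w : HeightOneSpectrum (𝓞 L)} :
    w ∈ primesAbove L S ↔ below M w ∈ S := by
  simp [primesAbove]

lemma valuation_algebraMap_of_surjective (h : Function.Surjective (algebraMap M L))
    (w : HeightOneSpectrum (𝓞 L)) (x : M) :
    w.valuation L (algebraMap M L x) = (below M w).valuation M x := by
  obtain ⟨e, he, hw⟩ := exists_valuation_algebraMap (M := M) w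
  obtain ⟨π, hπ⟩ := w.valuation_exists_uniformizer L
  obtain ⟨y, rfl⟩ := h π
  rw [hw] at hπ
  have h0 : (below M w).valuation M y ≠ 0 := by
    intro h0
    rw [h0, zero_pow he] at hπ
    exact exp_ne_zero hπ.symm
  have h1 : (e : ℤ) * log ((below M w).valuation M y) = -1 := by
    have := congrArg log hπ
    rwa [log_pow, log_exp, nsmul_eq_mul] at this
  have h2 : e = 1 := by
    have : (e : ℤ) ∣ 1 := ⟨-log ((below M w).valuation M y), by linarith⟩
    exact_mod_cast Int.eq_one_of_dvd_one (by positivity) this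
  rw [hw, h2, pow_one]

/-- The conjugate of a prime by an automorphism. -/
noncomputable def conjPrime (τ : L ≃+* L) (w : HeightOneSpectrum (𝓞 L)) : HeightOneSpectrum (𝓞 L) :=
  letI := τ.toRingHom.toAlgebra
  below L w

lemma valuation_conjPrime (τ : L ≃+* L) (w : HeightOneSpectrum (𝓞 L)) (x : L) :
    (conjPrime τ w).valuation L x = w.valuation L (τ x) :=
  (@valuation_algebraMap_of_surjective L L _ _ _ _ τ.toRingHom.toAlgebra τ.surjective w x).symm

lemma below_conjPrime (τ : L ≃ₐ[M] L) (w : HeightOneSpectrum (𝓞 L)) :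
    below M (conjPrime (τ : L ≃+* L) w) = below M w := by
  refine eq_of_valuation_lt_one fun x hx ↦ ?_
  rw [← valuation_algebraMap_lt_one_iff, valuation_conjPrime] at hx
  rw [← valuation_algebraMap_lt_one_iff]
  simpa using hx

end Below

section Quad

variable {M E : Type*} [Field M] [NumberField M] [Field E] [NumberField E] [Algebra M E]

/-- `E = M(δ)` is the quadratic extension generated by a square root `δ` of the nonsquare `a`,
with nontrivial automorphism `τ`. -/
structure IsQuad (a : Mˣ) (δ : E) (τ : E ≃ₐ[M] E) : Prop where
  sq : δ ^ 2 = algebraMap M E a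
  gen : ∀ z : E, ∃ x y : M, z = algebraMap M E x + algebraMap M E y * δ
  conj : τ δ = -δ
  notSq : ¬ IsSquare a

namespace IsQuad

variable {a : Mˣ} {δ : E} {τ : E ≃ₐ[M] E}

lemma conj_conj (h : IsQuad a δ τ) (z : E) : τ (τ z) = z := by
  obtain ⟨x, y, rfl⟩ := h.gen z
  simp [h.conj]

lemma delta_ne_zero (h : IsQuad a δ τ) : δ ≠ 0 := by
  rintro rfl
  have := h.sq
  rw [zero_pow two_ne_zero] at this
  exact a.ne_zero ((map_eq_zero _).1 this.symm)

lemma exists_eq_of_conj_eq (h : IsQuad a δ τ) {z : E} (hz : τ z = z) : ∃ x : M, z = algebraMap M E x := by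
  obtain ⟨x, y, rfl⟩ := h.gen z
  simp only [map_add, AlgEquiv.commutes, map_mul, h.conj] at hz
  have h1 : algebraMap M E y * δ = 0 := by linear_combination (-1 / 2 : E) * hz
  exact ⟨x, by rw [h1, add_zero]⟩

lemma mul_conj (h : IsQuad a δ τ) (x y : M) : (algebraMap M E x + algebraMap M E y * δ) *
    τ (algebraMap M E x + algebraMap M E y * δ) = algebraMap M E (x ^ 2 - a * y ^ 2) := by
  simp only [map_add, AlgEquiv.commutes, map_mul, h.conj, map_sub, map_pow, ← h.sq]
  ring

lemma mem_normGroup_of_eq_mul_conj (h : IsQuad a δ τ) {u : Mˣ} {z : E} (hu : algebraMap M E u = z * τ z) :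
    u ∈ normGroup a := by
  obtain ⟨x, y, rfl⟩ := h.gen z
  rw [h.mul_conj] at hu
  rw [mem_normGroup]
  exact ⟨x, y, (algebraMap M E).injective hu⟩

/-- Hilbert 90 for a quadratic extension. -/
lemma exists_eq_div_conj (h : IsQuad a δ τ) {y : E} (hy : y * τ y = 1) : ∃ z : E, z ≠ 0 ∧ y = z / τ z := by
  have hy0 : y ≠ 0 := left_ne_zero_of_mul_eq_one hy
  by_cases h1 : 1 + y = 0
  · refine ⟨δ, h.delta_ne_zero, ?_⟩
    rw [h.conj, div_neg, div_self h.delta_ne_zero]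
    linear_combination h1
  · refine ⟨1 + y, h1, ?_⟩
    have h2 : τ (1 + y) ≠ 0 := (map_ne_zero τ).2 h1
    rw [eq_div_iff h2, map_add, map_one]
    linear_combination hy

lemma below_eq_iff (h : IsQuad a δ τ) {w w' : HeightOneSpectrum (𝓞 E)} (hw : below M w' = below M w) :
    w' = w ∨ w' = conjPrime (τ : E ≃+* E) w := by
  by_contra! hcon
  have hnot : ¬ (w'.asIdeal : Set (𝓞 E)) ⊆ w.asIdeal ∪ (conjPrime (τ : E ≃+* E) w).asIdeal := by
    rw [Ideal.subset_union]
    rintro (hle | hle)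
    · exact hcon.1 (HeightOneSpectrum.ext (w'.isMaximal.eq_of_le w.isPrime.ne_top hle))
    · exact hcon.2 (HeightOneSpectrum.ext (w'.isMaximal.eq_of_le (HeightOneSpectrum.isPrime _).ne_top hle))
  obtain ⟨z, hz', hz⟩ := Set.not_subset.1 hnot
  rw [Set.mem_union, not_or] at hz
  have h1 : w.valuation E (algebraMap (𝓞 E) E z) = 1 := w.valuation_eq_one_iff_notMem.2 hz.1
  have h2 : w.valuation E (τ (algebraMap (𝓞 E) E z)) = 1 := by
    have := (HeightOneSpectrum.valuation_eq_one_iff_notMem (K := E) _).2 hz.2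
    exact (valuation_conjPrime _ _ _).symm.trans this
  have h3 : w'.valuation E (algebraMap (𝓞 E) E z) < 1 := (w'.valuation_lt_one_iff_mem z).2 hz'
  have h4 : w'.valuation E (τ (algebraMap (𝓞 E) E z)) ≤ 1 :=
    (valuation_conjPrime (τ : E ≃+* E) w' _).symm.trans_le (HeightOneSpectrum.valuation_le_one _ z)
  obtain ⟨x, hx⟩ := h.exists_eq_of_conj_eq
    (z := algebraMap (𝓞 E) E z * τ (algebraMap (𝓞 E) E z)) (by rw [map_mul, h.conj_conj, mul_comm])
  have h5 : w'.valuation E (algebraMap M E x) < 1 := by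
    rw [← hx, map_mul]
    exact mul_lt_one_of_lt_of_le h3 h4
  rw [valuation_algebraMap_lt_one_iff, hw, ← valuation_algebraMap_lt_one_iff, ← hx, map_mul, h1, h2,
    mul_one] at h5
  exact lt_irrefl _ h5

lemma conjPrime_ne (h : IsQuad a δ τ) (w : HeightOneSpectrum (𝓞 E)) (ha : a ∈ sqGroup ((below M w).valuation M)) :
    conjPrime (τ : E ≃+* E) w ≠ w := by
  intro hw
  have hval : ∀ z, w.valuation E (τ z) = w.valuation E z := fun z ↦ by
    conv_rhs => rw [← hw, valuation_conjPrime]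
    rfl
  obtain ⟨u, x, hx, hax⟩ := mem_sqGroup.1 ha
  have hu : algebraMap M E u ≠ 0 := (map_ne_zero _).2 u.ne_zero
  set θ : E := (1 + δ / algebraMap M E u) / 2 with hθ
  have h1 : τ θ = (1 - δ / algebraMap M E u) / 2 := by
    rw [hθ]
    simp only [map_div₀, map_add, map_one, h.conj, AlgEquiv.commutes, map_ofNat]
    ring
  have h2 : θ + τ θ = 1 := by rw [h1, hθ]; ring
  have h3 : θ * τ θ = - algebraMap M E x := by
    have h4 : (δ / algebraMap M E u) ^ 2 = 1 + 4 * algebraMap M E x := by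
      rw [div_pow, h.sq, hax, map_mul, map_pow, mul_div_cancel_left₀ _ (pow_ne_zero 2 hu), map_add, map_one,
        map_mul, map_ofNat]
    rw [h1, hθ]
    linear_combination (-1 / 4 : E) * h4
  have h4 : w.valuation E θ < 1 := by
    have h5 : w.valuation E (θ * τ θ) < 1 := by
      rw [h3, Valuation.map_neg, valuation_algebraMap_lt_one_iff]
      exact hx
    rw [map_mul, hval, ← pow_two] at h5
    exact (pow_lt_one_iff two_ne_zero).1 h5
  have h5 := Valuation.map_add_lt _ h4 ((hval θ).trans_lt h4)
  rw [h2, map_one] at h5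
  exact lt_irrefl _ h5

/-- A form of the fact that `E / M` is unramified at odd primes where `a` is a unit. -/
lemma exists_val_eq_zpow (h : IsQuad a δ τ) (w : HeightOneSpectrum (𝓞 E)) (h2 : (below M w).valuation M 2 = 1)
    (ha : (below M w).valuation M (a : M) = 1) {π : Mˣ}
    (hπ : (below M w).valuation M (π : M) = exp (-1 : ℤ)) {z : E} (hz0 : z ≠ 0)
    (hz : w.valuation E (τ z) = w.valuation E z) :
    ∃ k : ℤ, w.valuation E z = w.valuation E (algebraMap M E π) ^ k := by
  set v := below M w with hv
  set g := w.valuation E (algebraMap M E π) with hg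
  have hg1 : g < 1 := by
    rw [hg, valuation_algebraMap_lt_one_iff, ← hv, hπ, ← exp_zero, exp_lt_exp]; norm_num
  have hg0 : g ≠ 0 := by simp [hg]
  have hlog : log g < 0 := by rw [log_lt_iff_lt_exp hg0, exp_zero]; exact hg1
  have hwz : w.valuation E z ≠ 0 := by simpa using hz0
  refine ⟨-log (w.valuation E z) / -log g, ?_⟩
  set k := -log (w.valuation E z) / -log g with hk
  have hπ0 : algebraMap M E π ≠ 0 := by simp
  obtain ⟨x, y, hxy⟩ := h.gen (z / algebraMap M E π ^ k)
  set z' := z / algebraMap M E π ^ k with hz'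
  have hval : w.valuation E z' = w.valuation E z / g ^ k := by rw [hz', map_div₀, map_zpow₀]
  have hτval : w.valuation E (τ z') = w.valuation E z' := by
    rw [hval, hz', map_div₀, map_div₀, map_zpow₀, map_zpow₀, AlgEquiv.commutes, hz]
  have hz'0 : w.valuation E z' ≠ 0 := by rw [hval]; exact div_ne_zero hwz (zpow_ne_zero _ hg0)
  have hlogz : log (w.valuation E z') = -(-log (w.valuation E z) % -log g) := by
    rw [hval, log_div hwz (zpow_ne_zero _ hg0), log_zpow, Int.emod_def, ← hk, smul_eq_mul]
    ring
  have hle : w.valuation E z' ≤ 1 := by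
    rw [← exp_zero, ← log_le_iff_le_exp hz'0, hlogz]
    have := Int.emod_nonneg (-log (w.valuation E z)) (b := -log g) (by omega)
    omega
  have hlt : g < w.valuation E z' := by
    rw [← exp_log hg0, ← lt_log_iff_exp_lt hz'0, hlogz]
    have := Int.emod_lt_of_pos (-log (w.valuation E z)) (b := -log g) (by omega)
    omega
  have hw2 : w.valuation E 2 = 1 := by
    have := (valuation_algebraMap_eq_one_iff w (2 : M)).2 h2
    rwa [map_ofNat] at this
  have hwδ : w.valuation E δ = 1 := by
    have := (valuation_algebraMap_eq_one_iff w (a : M)).2 ha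
    rw [← h.sq, map_pow] at this
    exact (pow_eq_one_iff_of_nonneg zero_le two_ne_zero).1 this
  have hτz : τ z' = algebraMap M E x - algebraMap M E y * δ := by
    rw [hxy, map_add, map_mul, AlgEquiv.commutes, AlgEquiv.commutes, h.conj]; ring
  have hx : w.valuation E (algebraMap M E x) ≤ w.valuation E z' := by
    have h3 : z' + τ z' = 2 * algebraMap M E x := by rw [hτz, hxy]; ring
    have h4 := Valuation.map_add (w.valuation E) z' (τ z')
    rwa [h3, map_mul, hw2, one_mul, hτval, max_self] at h4
  have hy : w.valuation E (algebraMap M E y) ≤ w.valuation E z' := by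
    have h3 : z' - τ z' = 2 * (algebraMap M E y * δ) := by rw [hτz, hxy]; ring
    have h4 := Valuation.map_sub (w.valuation E) z' (τ z')
    rwa [h3, map_mul, hw2, one_mul, hτval, max_self, map_mul, hwδ, mul_one] at h4
  have hkey : ∀ s : M, w.valuation E (algebraMap M E s) < 1 → w.valuation E (algebraMap M E s) ≤ g := by
    intro s hs
    have h3 : w.valuation E (algebraMap M E (s / π)) ≤ 1 := by
      rw [valuation_algebraMap_le_one_iff, ← hv, map_div₀, hπ]
      rw [valuation_algebraMap_lt_one_iff, ← hv] at hs
      rw [div_le_one₀ (by simp)]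
      rcases eq_or_ne (v.valuation M s) 0 with h0 | h0
      · simp [h0]
      · rw [← exp_zero, ← log_lt_iff_lt_exp h0] at hs
        rw [← log_le_iff_le_exp h0]
        omega
    rwa [map_div₀, map_div₀, ← hg, div_le_one₀ (zero_lt_iff.2 hg0)] at h3
  have hone : w.valuation E z' = 1 := by
    refine le_antisymm hle ?_
    by_contra! hcon
    have h3 : w.valuation E z' ≤ g := by
      rw [hxy]
      refine (Valuation.map_add _ _ _).trans (max_le (hkey x (hx.trans_lt hcon)) ?_)
      rw [map_mul, hwδ, mul_one]
      exact hkey y (hy.trans_lt hcon)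
    exact absurd hlt h3.not_gt
  rw [hval] at hone
  exact (div_eq_one_iff_eq (zpow_ne_zero _ hg0)).1 hone

end IsQuad

end Quad

section Quad

variable {M E : Type*} [Field M] [NumberField M] [Field E] [NumberField E] [Algebra M E]

namespace IsQuad

variable {a : Mˣ} {δ : E} {τ : E ≃ₐ[M] E}

lemma exists_local_valuation_eq (h : IsQuad a δ τ) {S : Finset (HeightOneSpectrum (𝓞 M))}
    (hS : ClTrivial S) (h2 : ∀ v ∉ S, v.valuation M 2 = 1) (ha : a ∈ sUnits S) {z : E} (hz0 : z ≠ 0)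
    (hz : ∀ w : HeightOneSpectrum (𝓞 E), w ∉ primesAbove E S →
      w.valuation E (τ z) = w.valuation E z) {v : HeightOneSpectrum (𝓞 M)} (hv : v ∉ S) :
    ∃ m : Mˣ, (∀ v' ∉ S, v' ≠ v → v'.valuation M (m : M) = 1) ∧
      ∀ w : HeightOneSpectrum (𝓞 E), below M w = v →
        w.valuation E z = w.valuation E (algebraMap M E m) := by
  obtain ⟨x, hx, hx'⟩ := hS v hv
  obtain ⟨w, rfl⟩ := exists_below_eq (L := E) v
  have hw : w ∉ primesAbove E S := by rwa [mem_primesAbove]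
  obtain ⟨k, hk⟩ := h.exists_val_eq_zpow w (h2 _ hv) (ha _ hv) hx hz0 (hz w hw)
  refine ⟨x ^ k, fun v' hv' hne ↦ ?_, fun w' hw' ↦ ?_⟩
  · rw [Units.val_zpow_eq_zpow_val, map_zpow₀, hx' v' hv' hne, one_zpow]
  · rw [Units.val_zpow_eq_zpow_val, map_zpow₀, map_zpow₀]
    rcases h.below_eq_iff hw' with rfl | rfl
    · exact hk
    · rw [valuation_conjPrime, valuation_conjPrime]
      change w.valuation E (τ z) = w.valuation E (τ (algebraMap M E x)) ^ k
      rw [hz w hw, AlgEquiv.commutes, hk]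

/-- Hilbert 90 for `S`-units. -/
lemma exists_sUnits_eq_div_conj (h : IsQuad a δ τ) {S : Finset (HeightOneSpectrum (𝓞 M))}
    (hS : ClTrivial S) (h2 : ∀ v ∉ S, v.valuation M 2 = 1) (ha : a ∈ sUnits S) {y : Eˣ}
    (hy : y ∈ sUnits (primesAbove E S)) (hyτ : (y : E) * τ y = 1) :
    ∃ z ∈ sUnits (primesAbove E S), (y : E) = z / τ z := by
  classical
  obtain ⟨z, hz0, hz⟩ := h.exists_eq_div_conj hyτ
  have hτz0 : τ z ≠ 0 := (map_ne_zero τ).2 hz0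
  have hzval : ∀ w : HeightOneSpectrum (𝓞 E), w ∉ primesAbove E S →
      w.valuation E (τ z) = w.valuation E z := fun w hw ↦ by
    have := hy w hw
    rw [hz, map_div₀, div_eq_one_iff_eq (by simpa using hz0)] at this
    exact this.symm
  have hloc := fun v (hv : v ∉ S) ↦ h.exists_local_valuation_eq hS h2 ha hz0 hzval hv
  choose m hm hm' using hloc
  obtain ⟨T, hT⟩ := exists_mem_sUnits (Units.mk0 z hz0)
  set V := (T.image (below M)) \ S with hV
  have hVS : ∀ v ∈ V, v ∉ S := fun v hv ↦ (Finset.mem_sdiff.1 hv).2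
  set p : Mˣ := ∏ v ∈ V.attach, m v.1 (hVS _ v.2) with hp
  have hpval : ∀ w : HeightOneSpectrum (𝓞 E), w ∉ primesAbove E S →
      w.valuation E (algebraMap M E p) = w.valuation E z := by
    intro w hw
    have hwS : below M w ∉ S := by rwa [mem_primesAbove] at hw
    have hpp : w.valuation E (algebraMap M E p) =
        ∏ v ∈ V.attach, w.valuation E (algebraMap M E (m v.1 (hVS _ v.2))) := by
      rw [hp, Units.coe_prod, map_prod, map_prod]
    rw [hpp]
    by_cases hwV : below M w ∈ V
    · rw [Finset.prod_eq_single ⟨below M w, hwV⟩]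
      · exact (hm' _ _ w rfl).symm
      · rintro ⟨v, hv⟩ - hne
        rw [valuation_algebraMap_eq_one_iff]
        exact hm v _ _ hwS fun heq ↦ hne (Subtype.ext heq.symm)
      · intro hcon
        exact absurd (Finset.mem_attach _ _) hcon
    · rw [Finset.prod_eq_one]
      · refine (hT w fun hwT ↦ hwV ?_).symm
        exact Finset.mem_sdiff.2 ⟨Finset.mem_image_of_mem _ hwT, hwS⟩
      · rintro ⟨v, hv⟩ -
        rw [valuation_algebraMap_eq_one_iff]
        exact hm v _ _ hwS fun heq ↦ hwV (heq ▸ hv)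
  have hp0 : algebraMap M E p ≠ 0 := by simp
  refine ⟨Units.mk0 (z / algebraMap M E p) (div_ne_zero hz0 hp0), fun w hw ↦ ?_, ?_⟩
  · rw [Units.val_mk0, map_div₀, hpval w hw, div_self (by simpa using hz0)]
  · rw [Units.val_mk0, map_div₀, AlgEquiv.commutes, hz]
    field_simp

lemma two_mul_card_le (h : IsQuad a δ τ) (S : Finset (HeightOneSpectrum (𝓞 M)))
    [DecidablePred fun v : HeightOneSpectrum (𝓞 M) ↦ a ∉ sqGroup (v.valuation M)] :
    2 * S.card ≤ (primesAbove E S).card +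
      (S.filter fun v ↦ a ∉ sqGroup (v.valuation M)).card := by
  classical
  have hmap : ∀ w ∈ primesAbove E S, below M w ∈ S := fun w hw ↦ by rwa [mem_primesAbove] at hw
  rw [Finset.card_eq_sum_card_fiberwise hmap, Finset.card_filter, ← Finset.sum_add_distrib,
    mul_comm, ← smul_eq_mul]
  refine Finset.card_nsmul_le_sum _ _ _ fun v hv ↦ ?_
  obtain ⟨w, rfl⟩ := exists_below_eq (L := E) v
  by_cases hav : a ∈ sqGroup ((below M w).valuation M)
  · rw [if_neg (not_not.2 hav), add_zero]
    have hsub : ({conjPrime (τ : E ≃+* E) w, w} : Finset _) ⊆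
        (primesAbove E S).filter fun w' ↦ below M w' = below M w := by
      intro w' hw'
      have hb : below M w' = below M w := by
        rcases Finset.mem_insert.1 hw' with rfl | hw'
        · exact below_conjPrime τ w
        · rw [Finset.mem_singleton.1 hw']
      rw [Finset.mem_filter, mem_primesAbove, hb]
      exact ⟨hv, rfl⟩
    exact (Finset.card_pair (h.conjPrime_ne w hav)).symm.trans_le (Finset.card_le_card hsub)
  · rw [if_pos hav]
    have : 0 < ((primesAbove E S).filter fun w' ↦ below M w' = below M w).card :=
      Finset.card_pos.2 ⟨w, Finset.mem_filter.2 ⟨by rwa [mem_primesAbove], rfl⟩⟩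
    omega

end IsQuad

end Quad

section Herbrand

variable {Y : Type*} [CommGroup Y]

/-- The subgroup of squares of elements of `X`. -/
def sqs (X : Subgroup Y) : Subgroup Y := X.map (powMonoidHom 2)

lemma mem_sqs {X : Subgroup Y} {y : Y} : y ∈ sqs X ↔ ∃ x ∈ X, x ^ 2 = y := Iff.rfl

lemma sqIndex_eq_relIndex (X : Subgroup Y) : sqIndex X = (sqs X).relIndex X := by
  rw [sqIndex, Subgroup.relIndex]
  congr 1
  ext ⟨x, hx⟩
  rw [mem_range_pow_two, Subgroup.mem_subgroupOf, mem_sqs]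
  constructor
  · rintro ⟨⟨b, hb⟩, h⟩
    exact ⟨b, hb, congrArg Subtype.val h⟩
  · rintro ⟨b, hb, h⟩
    exact ⟨⟨b, hb⟩, Subtype.ext h⟩

/-- An index computation for the norm of a quadratic extension: if `Y` carries an involution `τ` with
fixed subgroup `U`, if the kernel of the norm `y ↦ y * τ y` consists of the quotients `y / τ y`, and if
the two-torsion of `Y` is generated by the square of some `ι ∈ U`, then the index of the norms in `U`
is determined by the indices of squares in `Y` and `U`. -/
lemma relIndex_norm (τ : Y →* Y) (hτ : ∀ y, τ (τ y) = y) {U R : Subgroup Y}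
    (hU : ∀ y, y ∈ U ↔ τ y = y) (hR : ∀ y, y ∈ R ↔ ∃ x, y = x * τ x)
    (hP : ∀ y, y * τ y = 1 → ∃ z, y = z / τ z)
    {ι : Y} (hι : ι ∈ U) (hι1 : ι ^ 2 ≠ 1) (h2 : ∀ y : Y, y ^ 2 = 1 ↔ y = 1 ∨ y = ι ^ 2)
    (hB : sqIndex U ≠ 0) :
    R.relIndex U * (2 * sqIndex Y) = sqIndex U * sqIndex U := by
  let N : Y →* Y := MonoidHom.mk' (fun y ↦ y * τ y) fun x y ↦ by rw [map_mul, mul_mul_mul_comm]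
  let D : Y →* Y := MonoidHom.mk' (fun y ↦ y / τ y) fun x y ↦ by rw [map_mul, mul_div_mul_comm]
  have hN : ∀ y, N y = y * τ y := fun _ ↦ rfl
  have hD : ∀ y, D y = y / τ y := fun _ ↦ rfl
  set P := N.ker with hPdef
  have hPmem : ∀ y, y ∈ P ↔ y * τ y = 1 := fun y ↦ Iff.rfl
  have hRN : R = N.range := by
    ext y
    rw [hR, MonoidHom.mem_range]
    exact exists_congr fun x ↦ eq_comm
  have hPD : P = D.range := by
    ext y
    rw [hPmem, MonoidHom.mem_range]
    constructor
    · intro hy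
      obtain ⟨z, rfl⟩ := hP y hy
      exact ⟨z, rfl⟩
    · rintro ⟨z, rfl⟩
      rw [hD, map_div, hτ]
      simp
  have hNU : ∀ u ∈ U, N u = u ^ 2 := fun u hu ↦ by rw [hN, (hU u).1 hu, pow_two]
  have hDP : ∀ p ∈ P, D p = p ^ 2 := fun p hp ↦ by
    rw [hD, pow_two, div_eq_mul_inv, inv_eq_of_mul_eq_one_left ((hPmem p).1 hp)]
  have hsqUR : sqs U ≤ R := by
    rintro _ ⟨u, hu, rfl⟩
    rw [hRN]
    exact ⟨u, hNU u hu⟩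
  have hRU : R ≤ U := by
    intro y hy
    obtain ⟨x, rfl⟩ := (hR y).1 hy
    rw [hU, map_mul, hτ, mul_comm]
  have ha : (sqs U).relIndex R * R.relIndex U = sqIndex U := by
    rw [sqIndex_eq_relIndex, Subgroup.relIndex_mul_relIndex _ _ _ hsqUR hRU]
  have hb : (sqs U).relIndex R = (U ⊔ P).index := by
    rw [hRN, ← Subgroup.index_comap]
    congr 1
    ext y
    rw [Subgroup.mem_comap, mem_sqs, Subgroup.mem_sup]
    constructor
    · rintro ⟨u, hu, h⟩
      refine ⟨u, hu, y / u, ?_, by simp⟩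
      rw [MonoidHom.mem_ker, map_div, hNU u hu, h, div_self']
    · rintro ⟨u, hu, p, hp, rfl⟩
      exact ⟨u, hu, by rw [map_mul, hNU u hu, (hp : N p = 1), mul_one]⟩
  have hc : (U ⊔ P).index = (sqs P).relIndex P := by
    conv_rhs => rw [hPD, ← Subgroup.index_comap, ← hPD]
    congr 1
    ext y
    rw [Subgroup.mem_comap, mem_sqs, Subgroup.mem_sup]
    constructor
    · rintro ⟨u, hu, p, hp, rfl⟩
      exact ⟨p, hp, by rw [map_mul, hDP p hp, hD u, (hU u).1 hu, div_self', one_mul]⟩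
    · rintro ⟨p, hp, h⟩
      refine ⟨y / p, ?_, p, hp, by simp⟩
      have h3 : D (y / p) = 1 := by rw [map_div, hDP p hp, h, div_self']
      rw [hU]
      exact (div_eq_one.1 h3).symm
  have hd : sqIndex Y = (sqs ⊤).relIndex P * (sqs R).relIndex R := by
    have h1 : (P ⊔ sqs ⊤).index = (sqs R).relIndex R := by
      conv_rhs => rw [hRN, ← Subgroup.index_comap, ← hRN]
      congr 1
      ext y
      rw [Subgroup.mem_comap, mem_sqs, Subgroup.mem_sup]
      constructor
      · rintro ⟨p, hp, _, ⟨x, -, rfl⟩, rfl⟩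
        refine ⟨N x, hRN ▸ ⟨x, rfl⟩, ?_⟩
        rw [map_mul, (hp : N p = 1), one_mul]
        simp
      · rintro ⟨_, hr, h⟩
        rw [hRN] at hr
        obtain ⟨x, rfl⟩ := hr
        refine ⟨y / x ^ 2, ?_, x ^ 2, ⟨x, trivial, rfl⟩, by simp⟩
        rw [MonoidHom.mem_ker, map_div, map_pow, h, div_self']
    have h3 : (powMonoidHom 2 : Y →* Y).range = sqs ⊤ := MonoidHom.range_eq_map _
    rw [sqIndex, h3, ← Subgroup.relIndex_mul_index (le_sup_right : sqs ⊤ ≤ P ⊔ sqs ⊤), h1,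
      Subgroup.relIndex_sup_right]
  have he : (sqs P).relIndex P = 2 * (sqs ⊤).relIndex P := by
    have hle : sqs P ≤ sqs ⊤ ⊓ P := by
      rintro _ ⟨p, hp, rfl⟩
      exact ⟨⟨p, trivial, rfl⟩, P.pow_mem hp 2⟩
    have h1 : (sqs P).relIndex (sqs ⊤ ⊓ P) = 2 := by
      have hι4 : (ι ^ 2) ^ 2 = 1 := (h2 _).2 (Or.inr rfl)
      have hιP : ι ^ 2 ∈ sqs ⊤ ⊓ P := by
        refine ⟨⟨ι, trivial, rfl⟩, ?_⟩
        change ι ^ 2 * τ (ι ^ 2) = 1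
        rw [map_pow, (hU ι).1 hι, ← pow_two, hι4]
      have hιsq : ι ^ 2 ∉ sqs P := by
        intro hcon
        obtain ⟨p, hp, h⟩ := mem_sqs.1 hcon
        have h3 : (p / ι) ^ 2 = 1 := by rw [div_pow, h, div_self']
        have hpU : p ∈ U := by
          have : p / ι ∈ U := by
            rcases (h2 _).1 h3 with h4 | h4
            · rw [h4]; exact U.one_mem
            · rw [h4]; exact U.pow_mem hι 2
          simpa using U.mul_mem this hι
        have h4 := hNU p hpU
        rw [(hp : N p = 1), h] at h4
        exact hι1 h4.symm
      rw [Subgroup.relIndex, Subgroup.index_eq_two_iff]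
      refine ⟨⟨ι ^ 2, hιP⟩, ?_⟩
      rintro ⟨b, ⟨hb', hb⟩⟩
      obtain ⟨y, -, hyb⟩ := mem_sqs.1 hb'
      simp only [Subgroup.mem_subgroupOf, Subgroup.coe_mul]
      have h3 : (y * τ y) ^ 2 = 1 := by
        rw [mul_pow, ← map_pow, hyb]; exact hb
      rcases (h2 _).1 h3 with h4 | h4
      · have hbP : b ∈ sqs P := ⟨y, h4, hyb⟩
        refine Or.inr ⟨hbP, fun hcon ↦ hιsq ?_⟩
        exact ((sqs P).mul_mem_cancel_left hbP).1 hcon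
      · have hbP : b * ι ^ 2 ∈ sqs P := by
          refine ⟨y * ι, ?_, by rw [← hyb]; exact mul_pow y ι 2⟩
          change (y * ι) * τ (y * ι) = 1
          rw [map_mul, (hU ι).1 hι, mul_mul_mul_comm, h4, ← pow_two, ← pow_two, hι4]
        refine Or.inl ⟨hbP, fun hcon ↦ hιsq ?_⟩
        exact ((sqs P).mul_mem_cancel_left hcon).1 hbP
    rw [← Subgroup.relIndex_mul_relIndex _ _ _ hle inf_le_right, h1, Subgroup.inf_relIndex_right]
  have hRne : R.relIndex U ≠ 0 := right_ne_zero_of_mul (ha ▸ hB)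
  have hf : (sqs R).relIndex R = sqIndex U := by
    have hkerR : (powMonoidHom 2 : Y →* Y).ker ≤ R := by
      intro y hy
      rcases (h2 y).1 hy with rfl | rfl
      · exact R.one_mem
      · exact hsqUR ⟨ι, hι, rfl⟩
    have h1 : (sqs R).relIndex (sqs U) = R.relIndex U := by
      rw [sqs, sqs, Subgroup.relIndex_map_map, sup_eq_left.2 hkerR, sup_eq_left.2 (hkerR.trans hRU)]
    have hsqR : sqs R ≤ R := by
      rintro _ ⟨p, hp, rfl⟩
      exact R.pow_mem hp 2
    have h3 := Subgroup.relIndex_mul_relIndex _ _ _ hsqR hRU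
    have h4 := Subgroup.relIndex_mul_relIndex (sqs R) (sqs U) U (Subgroup.map_mono hRU) (hsqUR.trans hRU)
    rw [h1, ← h3, ← sqIndex_eq_relIndex, mul_comm] at h4
    exact (Nat.eq_of_mul_eq_mul_right (Nat.pos_of_ne_zero hRne) h4).symm
  rw [hd, hf]
  nth_rw 3 [← ha]
  rw [hb, hc, he]
  ring

end Herbrand

universe u

section NormIndex

variable {M E : Type*} [Field M] [NumberField M] [Field E] [NumberField E] [Algebra M E]

lemma even_finrank {i : M} (hi : i ^ 2 = -1) : ∃ k, Module.finrank ℚ M = 2 * k := by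
  have h := InfinitePlace.card_add_two_mul_card_eq_rank M
  have h0 : InfinitePlace.nrRealPlaces M = 0 := by
    classical
    rw [InfinitePlace.nrRealPlaces, Fintype.card_eq_zero_iff]
    refine ⟨fun ⟨w, hw⟩ ↦ ?_⟩
    have h1 := congrArg (InfinitePlace.embedding_of_isReal hw) hi
    rw [map_pow, map_neg, map_one] at h1
    nlinarith [sq_nonneg (InfinitePlace.embedding_of_isReal hw i)]
  exact ⟨_, by rw [← h, h0, zero_add]⟩

namespace IsQuad

variable {a : Mˣ} {δ : E} {τ : E ≃ₐ[M] E}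

lemma finrank_eq_two (h : IsQuad a δ τ) : Module.finrank M E = 2 := by
  have hli : LinearIndependent M ![(1 : E), δ] := by
    rw [LinearIndependent.pair_iff]
    intro s t hst
    rw [Algebra.smul_def, Algebra.smul_def, mul_one] at hst
    have h1 := congrArg τ hst
    simp only [map_add, AlgEquiv.commutes, map_mul, h.conj, map_zero] at h1
    have hs : algebraMap M E s = 0 := by linear_combination (1 / 2 : E) * (hst + h1)
    have ht : algebraMap M E t * δ = 0 := by linear_combination (1 / 2 : E) * (hst - h1)
    exact ⟨(map_eq_zero _).1 hs, (map_eq_zero _).1 ((mul_eq_zero.1 ht).resolve_right h.delta_ne_zero)⟩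
  have hsp : ⊤ ≤ Submodule.span M (Set.range ![(1 : E), δ]) := by
    intro z _
    obtain ⟨x, y, rfl⟩ := h.gen z
    rw [Matrix.range_cons, Matrix.range_cons, Matrix.range_empty, Set.union_empty,
      Set.singleton_union, Submodule.mem_span_pair]
    exact ⟨x, y, by rw [Algebra.smul_def, Algebra.smul_def, mul_one]⟩
  simpa using Module.finrank_eq_card_basis (Module.Basis.mk hli hsp)

lemma two_mul_relIndex_normGroup_le (h : IsQuad a δ τ) {i : M} (hi : i ^ 2 = -1)
    {S : Finset (HeightOneSpectrum (𝓞 M))}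
    [DecidablePred fun v : HeightOneSpectrum (𝓞 M) ↦ a ∉ sqGroup (v.valuation M)]
    (hS : ClTrivial S) (h2 : ∀ v ∉ S, v.valuation M 2 = 1) (ha : a ∈ sUnits S) :
    2 * (normGroup a).relIndex (sUnits S) ≤ 2 ^ (S.filter fun v ↦ a ∉ sqGroup (v.valuation M)).card ∧
      (normGroup a).relIndex (sUnits S) ≠ 0 := by
  obtain ⟨k, hk⟩ := even_finrank hi
  have hkE : Module.finrank ℚ E = 2 * (2 * k) := by
    rw [← Module.finrank_mul_finrank ℚ M E, hk, h.finrank_eq_two, mul_comm]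
  have hiE : (algebraMap M E i) ^ 2 = -1 := by rw [← map_pow, hi, map_neg, map_one]
  set T := primesAbove E S with hT
  have hA := sqIndex_sUnits hiE hkE T
  have hB := sqIndex_sUnits hi hk S
  let τu : Eˣ →* Eˣ := Units.map (τ : E →* E)
  have hτu : ∀ z, ((τu z : Eˣ) : E) = τ z := fun _ ↦ rfl
  have hτT : ∀ z ∈ sUnits T, τu z ∈ sUnits T := by
    intro z hz w hw
    have h1 : conjPrime (τ : E ≃+* E) w ∉ T := by
      rw [hT, mem_primesAbove, below_conjPrime]
      rwa [hT, mem_primesAbove] at hw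
    have h3 := hz _ h1
    rwa [valuation_conjPrime] at h3
  let τY : sUnits T →* sUnits T :=
    MonoidHom.mk' (fun z ↦ ⟨τu z, hτT z z.2⟩) fun x y ↦ Subtype.ext (map_mul τu (x : Eˣ) (y : Eˣ))
  have hτY : ∀ z, (((τY z : sUnits T) : Eˣ) : E) = τ ((z : Eˣ) : E) := fun _ ↦ rfl
  have hext : ∀ y z : sUnits T, ((y : Eˣ) : E) = ((z : Eˣ) : E) → y = z := fun y z hyz ↦
    Subtype.ext (Units.ext hyz)
  let f : sUnits S →* sUnits T :=
    MonoidHom.mk' (fun z ↦ ⟨Units.map (algebraMap M E : M →* E) z, fun w hw ↦ by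
      rw [hT, mem_primesAbove] at hw
      exact (valuation_algebraMap_eq_one_iff w _).2 (z.2 _ hw)⟩)
      fun x y ↦ hext _ _ (map_mul (algebraMap M E) _ _)
  have hf : ∀ z, (((f z : sUnits T) : Eˣ) : E) = algebraMap M E ((z : Mˣ) : M) := fun _ ↦ rfl
  have hfinj : Function.Injective f := fun x y hxy ↦ by
    refine Subtype.ext (Units.ext ((algebraMap M E).injective ?_))
    rw [← hf, ← hf, hxy]
  let N : sUnits T →* sUnits T := MonoidHom.mk' (fun y ↦ y * τY y) fun x y ↦ by
    rw [map_mul, mul_mul_mul_comm]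
  have hfU : ∀ y, y ∈ f.range ↔ τY y = y := by
    intro y
    constructor
    · rintro ⟨z, rfl⟩
      exact hext _ _ (by rw [hτY, hf, AlgEquiv.commutes])
    · intro hy
      obtain ⟨x, hx⟩ := h.exists_eq_of_conj_eq (z := ((y : Eˣ) : E)) (by rw [← hτY, hy])
      have hx0 : x ≠ 0 := by
        rintro rfl
        rw [map_zero] at hx
        exact (y : Eˣ).ne_zero hx
      refine ⟨⟨Units.mk0 x hx0, fun v hv ↦ ?_⟩, hext _ _ (by rw [hf, hx]; rfl)⟩
      obtain ⟨w, rfl⟩ := exists_below_eq (L := E) v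
      rw [Units.val_mk0, ← valuation_algebraMap_eq_one_iff, ← hx]
      exact y.2 w (by rwa [hT, mem_primesAbove])
  have hiU : IsUnit i := by
    refine IsUnit.of_mul_eq_one (-i) ?_
    rw [mul_neg, ← pow_two, hi, neg_neg]
  have hival : ∀ v : HeightOneSpectrum (𝓞 M), v.valuation M i = 1 := fun v ↦ by
    have h3 : v.valuation M i ^ 2 = 1 := by rw [← map_pow, hi, Valuation.map_neg, map_one]
    exact (pow_eq_one_iff_of_nonneg zero_le two_ne_zero).1 h3
  set iS : sUnits S := ⟨hiU.unit, fun v _ ↦ hival v⟩ with hiS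
  have hfi : (((f iS : sUnits T) : Eˣ) : E) = algebraMap M E i := rfl
  have hBU : sqIndex f.range = 2 ^ (S.card + k) := by
    rw [← hB]; exact (sqIndex_congr (MonoidHom.ofInjective hfinj)).symm
  have key := relIndex_norm (U := f.range) (R := N.range) (ι := f iS) τY
    (fun y ↦ hext _ _ (h.conj_conj _)) hfU (fun y ↦ exists_congr fun x ↦ eq_comm)
    (fun y hy ↦ by
      obtain ⟨z, hz, hyz⟩ := h.exists_sUnits_eq_div_conj hS h2 ha y.2
        (congrArg (fun t : sUnits T ↦ ((t : Eˣ) : E)) hy)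
      refine ⟨⟨z, hz⟩, hext _ _ ?_⟩
      rw [hyz]
      simp [hτY])
    ⟨iS, rfl⟩
    (fun hcon ↦ by
      have h3 := congrArg (fun t : sUnits T ↦ ((t : Eˣ) : E)) hcon
      simp only [Subgroup.coe_pow, Units.val_pow_eq_pow_val, hfi, hiE, OneMemClass.coe_one, Units.val_one] at h3
      exact absurd h3 (by norm_num))
    (fun y ↦ by
      have h4 : ((y : Eˣ) : E) ^ 2 = 1 ↔ ((y : Eˣ) : E) = 1 ∨ ((y : Eˣ) : E) = -1 := sq_eq_one_iff
      constructor
      · intro hy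
        have h3 := congrArg (fun t : sUnits T ↦ ((t : Eˣ) : E)) hy
        rcases h4.1 h3 with h5 | h5
        · exact Or.inl (hext _ _ h5)
        · exact Or.inr (hext _ _ (h5.trans hiE.symm))
      · rintro (rfl | rfl)
        · exact one_pow 2
        · refine hext _ _ ?_
          simp only [Subgroup.coe_pow, Units.val_pow_eq_pow_val, hfi, hiE, OneMemClass.coe_one, Units.val_one]
          norm_num)
    (by rw [hBU]; positivity)
  rw [hBU, hA] at key
  have hdvd : (normGroup a).relIndex (sUnits S) ∣ N.range.relIndex f.range := by
    rw [← Subgroup.index_comap, Subgroup.relIndex]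
    refine Subgroup.index_dvd_of_le ?_
    rintro z ⟨y, hy⟩
    rw [Subgroup.mem_subgroupOf]
    refine h.mem_normGroup_of_eq_mul_conj (z := ((y : Eˣ) : E)) ?_
    rw [← hf, ← hy]
    rfl
  have hne : N.range.relIndex f.range ≠ 0 := by
    intro h0
    rw [h0, zero_mul] at key
    exact absurd key.symm (by positivity)
  refine ⟨?_, fun h0 ↦ hne (Nat.eq_zero_of_zero_dvd (h0 ▸ hdvd))⟩
  have hle := Nat.le_of_dvd (Nat.pos_of_ne_zero hne) hdvd
  have hcard := h.two_mul_card_le S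
  rw [← hT] at hcard
  have h5 : 2 * N.range.relIndex f.range * 2 ^ (T.card + 2 * k) ≤
      2 ^ (S.filter fun v ↦ a ∉ sqGroup (v.valuation M)).card * 2 ^ (T.card + 2 * k) := by
    have h6 : 2 * N.range.relIndex f.range * 2 ^ (T.card + 2 * k) = 2 ^ (2 * S.card + 2 * k) := by
      calc _ = N.range.relIndex f.range * (2 * 2 ^ (T.card + 2 * k)) := by ring
        _ = _ := by rw [key, ← pow_add]; congr 1; ring
    rw [h6, ← pow_add]
    exact Nat.pow_le_pow_right (by norm_num) (by omega)
  exact (Nat.mul_le_mul_left 2 hle).trans (Nat.le_of_mul_le_mul_right h5 (by positivity))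

end IsQuad

/-- Every nonsquare of a number field generates a quadratic extension. -/
lemma exists_isQuad {M : Type u} [Field M] [NumberField M] {a : Mˣ} (ha : ¬ IsSquare a) :
    ∃ (E : Type u) (_ : Field E) (_ : NumberField E) (_ : Algebra M E) (δ : E) (τ : E ≃ₐ[M] E),
      IsQuad a δ τ := by
  classical
  set g : Polynomial M := Polynomial.X ^ 2 - Polynomial.C (a : M) with hg
  have hmonic : g.Monic := Polynomial.monic_X_pow_sub_C _ two_ne_zero
  have hdeg : g.natDegree = 2 := Polynomial.natDegree_X_pow_sub_C
  have hirr : Irreducible g := by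
    rw [hmonic.irreducible_iff_roots_eq_zero_of_degree_le_three hdeg.ge (by omega)]
    refine Multiset.eq_zero_of_forall_notMem fun x hx ↦ ha ?_
    have hx' := (Polynomial.mem_roots'.1 hx).2
    simp only [hg, Polynomial.IsRoot, Polynomial.eval_sub, Polynomial.eval_pow, Polynomial.eval_X,
      Polynomial.eval_C] at hx'
    have hx0 : x ≠ 0 := by
      rintro rfl
      exact a.ne_zero (by linear_combination -hx')
    exact ⟨Units.mk0 x hx0, Units.ext (by rw [Units.val_mul, Units.val_mk0]; linear_combination -hx')⟩
  have : Fact (Irreducible g) := ⟨hirr⟩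
  let E := AdjoinRoot g
  have : CharZero E := charZero_of_injective_algebraMap (algebraMap M E).injective
  have : Module.Finite M E := hmonic.finite_adjoinRoot
  have : Module.Finite ℚ E := Module.Finite.trans M E
  have : NumberField E := { }
  have hsq : (AdjoinRoot.root g) ^ 2 = algebraMap M E a := by
    have h1 : AdjoinRoot.mk g g = 0 := AdjoinRoot.mk_self
    have h3 : AdjoinRoot.mk g (Polynomial.X ^ 2 - Polynomial.C (a : M)) = 0 := h1
    rw [map_sub, map_pow, AdjoinRoot.mk_X, AdjoinRoot.mk_C] at h3
    exact sub_eq_zero.1 h3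
  let t : E →ₐ[M] E := AdjoinRoot.liftAlgHom g (Algebra.ofId M E) (-AdjoinRoot.root g) (by
    change Polynomial.eval₂ _ _ (Polynomial.X ^ 2 - Polynomial.C (a : M)) = 0
    simp only [Polynomial.eval₂_sub, Polynomial.eval₂_pow, Polynomial.eval₂_X, Polynomial.eval₂_C]
    rw [neg_sq, hsq]
    exact sub_self _)
  have ht : t (AdjoinRoot.root g) = -AdjoinRoot.root g := AdjoinRoot.liftAlgHom_root ..
  have htt : t.comp t = AlgHom.id M E := by
    refine AdjoinRoot.algHom_ext ?_
    rw [AlgHom.comp_apply, ht, map_neg, ht, neg_neg]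
    rfl
  refine ⟨E, inferInstance, inferInstance, inferInstance, AdjoinRoot.root g,
    AlgEquiv.ofAlgHom t t htt htt, hsq, fun z ↦ ?_, ht, ha⟩
  obtain ⟨p, rfl⟩ := AdjoinRoot.mk_surjective z
  have hp : AdjoinRoot.mk g p = AdjoinRoot.mk g (p %ₘ g) := by
    conv_lhs => rw [← Polynomial.modByMonic_add_div p g, map_add, map_mul, AdjoinRoot.mk_self, zero_mul, add_zero]
  have hlt : (p %ₘ g).natDegree ≤ 1 := by
    have := Polynomial.natDegree_modByMonic_lt p hmonic (fun h ↦ by rw [h] at hdeg; simp at hdeg)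
    omega
  obtain ⟨y, x, hxy⟩ := Polynomial.exists_eq_X_add_C_of_natDegree_le_one hlt
  refine ⟨x, y, ?_⟩
  rw [hp, hxy, map_add, map_mul, AdjoinRoot.mk_X, AdjoinRoot.mk_C, AdjoinRoot.mk_C, add_comm]
  rfl

/-- An upper bound for the index of norms from a quadratic extension among the `S`-units. -/
lemma two_mul_relIndex_normGroup_le {M : Type*} [Field M] [NumberField M] {a : Mˣ} (ha' : ¬ IsSquare a)
    {i : M} (hi : i ^ 2 = -1) {S : Finset (HeightOneSpectrum (𝓞 M))}
    [DecidablePred fun v : HeightOneSpectrum (𝓞 M) ↦ a ∉ sqGroup (v.valuation M)]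
    (hS : ClTrivial S) (h2 : ∀ v ∉ S, v.valuation M 2 = 1) (ha : a ∈ sUnits S) :
    2 * (normGroup a).relIndex (sUnits S) ≤ 2 ^ (S.filter fun v ↦ a ∉ sqGroup (v.valuation M)).card ∧
      (normGroup a).relIndex (sUnits S) ≠ 0 := by
  obtain ⟨E, _, _, _, δ, τ, h⟩ := exists_isQuad ha'
  exact h.two_mul_relIndex_normGroup_le hi hS h2 ha

end NormIndex

section Approximation

variable {M : Type*} [Field M] [NumberField M]

lemma mem_biInf {S : Finset (HeightOneSpectrum (𝓞 M))} {H : HeightOneSpectrum (𝓞 M) → Subgroup Mˣ}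
    {z : Mˣ} : z ∈ ⨅ v ∈ S, H v ↔ ∀ v ∈ S, z ∈ H v := by
  simp only [Subgroup.mem_iInf]

lemma index_iInf_eq_prod {G ι : Type*} [CommGroup G] [Fintype ι] (H : ι → Subgroup G)
    (h : ∀ z : ι → G, ∃ x, ∀ i, x / z i ∈ H i) : (⨅ i, H i).index = ∏ i, (H i).index := by
  have hbij : Function.Bijective (Subgroup.quotientiInfEmbedding H) := by
    refine ⟨(Subgroup.quotientiInfEmbedding H).injective, fun y ↦ ?_⟩
    choose z hz using fun i ↦ QuotientGroup.mk_surjective (y i)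
    obtain ⟨x, hx⟩ := h z
    refine ⟨QuotientGroup.mk x, funext fun i ↦ ?_⟩
    rw [← hz i]
    refine (QuotientGroup.eq.2 ?_).symm
    rw [← div_eq_inv_mul]
    exact hx i
  rw [Subgroup.index, Nat.card_congr (Equiv.ofBijective _ hbij), Nat.card_pi]
  rfl

/-- Weak approximation as an index computation. -/
lemma index_biInf (S : Finset (HeightOneSpectrum (𝓞 M))) (H : HeightOneSpectrum (𝓞 M) → Subgroup Mˣ)
    (hH : ∀ v ∈ S, sqGroup (v.valuation M) ≤ H v) :
    (⨅ v ∈ S, H v).index = ∏ v ∈ S, (H v).index := by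
  classical
  have hinf : ⨅ v ∈ S, H v = ⨅ v : S, H v := iInf_subtype'
  rw [hinf, index_iInf_eq_prod, Finset.prod_coe_sort S fun v ↦ (H v).index]
  intro z
  obtain ⟨x, hx⟩ := exists_forall_div_mem_sqGroup S fun v ↦ if hv : v ∈ S then z ⟨v, hv⟩ else 1
  refine ⟨x, fun ⟨v, hv⟩ ↦ hH v hv ?_⟩
  have h1 := hx v hv
  rwa [dif_pos hv] at h1

lemma relIndex_eq_index_of_sup_eq_top {G : Type*} [CommGroup G] {H K : Subgroup G} (h : H ⊔ K = ⊤) :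
    H.relIndex K = H.index := by
  rw [← Subgroup.relIndex_sup_left K H, h, Subgroup.relIndex_top_right]

lemma exists_sup_sUnits_eq_top (H : Subgroup Mˣ) (hH : H.index ≠ 0) :
    ∃ S : Finset (HeightOneSpectrum (𝓞 M)), ∀ T, S ⊆ T → H ⊔ sUnits T = ⊤ := by
  classical
  have : Finite (Mˣ ⧸ H) := Nat.finite_of_card_ne_zero hH
  have : Fintype (Mˣ ⧸ H) := Fintype.ofFinite _
  choose S hS using fun q : Mˣ ⧸ H ↦ exists_mem_sUnits q.out
  refine ⟨Finset.univ.biUnion S, fun T hT ↦ ?_⟩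
  rw [eq_top_iff]
  rintro z -
  have h1 : (QuotientGroup.mk z : Mˣ ⧸ H).out ∈ sUnits T :=
    sUnits_mono (((Finset.subset_biUnion_of_mem S (Finset.mem_univ _))).trans hT) (hS _)
  have h2 : z / (QuotientGroup.mk z : Mˣ ⧸ H).out ∈ H := by
    rw [div_eq_inv_mul]
    exact QuotientGroup.eq.1 (QuotientGroup.out_eq' _)
  have h3 := Subgroup.mul_mem_sup h2 h1
  rwa [div_mul_cancel] at h3

/-- Every finite set of primes is contained in one which contains the dyadic primes and generates the
class group. -/
lemma exists_good_superset (T : Finset (HeightOneSpectrum (𝓞 M))) :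
    ∃ S, T ⊆ S ∧ ClTrivial S ∧ ∀ v ∉ S, v.valuation M 2 = 1 := by
  classical
  obtain ⟨S₁, h₁⟩ := exists_clTrivial (M := M)
  obtain ⟨S₂, h₂⟩ := exists_mem_sUnits (Units.mk0 (2 : M) two_ne_zero)
  refine ⟨T ∪ (S₁ ∪ S₂), Finset.subset_union_left,
    h₁.mono (Finset.subset_union_left.trans Finset.subset_union_right), fun v hv ↦ h₂ v fun h ↦ hv ?_⟩
  simp [h]

lemma two_le_index_locNorm {i : M} (hi : i ^ 2 = -1) {a : Mˣ} {v : HeightOneSpectrum (𝓞 M)}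
    (ha : a ∉ sqGroup (v.valuation M)) :
    2 ≤ (locNorm (v.valuation M) a).index ∧ (locNorm (v.valuation M) a).index ≠ 0 := by
  have h0 : (locNorm (v.valuation M) a).index ≠ 0 := fun h ↦
    (index_sqGroup_le v).2 (Nat.eq_zero_of_zero_dvd (h ▸ Subgroup.index_dvd_of_le (sqGroup_le_locNorm a)))
  have h1 : (locNorm (v.valuation M) a).index ≠ 1 := fun h ↦
    locNorm_valuation_ne_top v hi ha (Subgroup.index_eq_one.1 h)
  exact ⟨by omega, h0⟩

/-- A nonsquare fails to be a square at infinitely many primes. -/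
theorem exists_notMem_sqGroup {i : M} (hi : i ^ 2 = -1) {b : Mˣ} (hb : ¬ IsSquare b)
    (B : Finset (HeightOneSpectrum (𝓞 M))) :
    ∃ v ∉ B, b ∉ sqGroup (v.valuation M) := by
  classical
  by_contra! hcon
  obtain ⟨S₁, h₁⟩ := exists_mem_sUnits b
  obtain ⟨S₀, hS₀, hcl, htwo⟩ := exists_good_superset (B ∪ S₁)
  set V := S₀.filter fun v ↦ b ∉ sqGroup (v.valuation M) with hV
  set H := ⨅ v ∈ V, locNorm (v.valuation M) b with hH
  have hind : H.index = ∏ v ∈ V, (locNorm (v.valuation M) b).index :=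
    index_biInf V _ fun v _ ↦ sqGroup_le_locNorm b
  have hV' : ∀ v ∈ V, b ∉ sqGroup (v.valuation M) := fun v hv ↦ (Finset.mem_filter.1 hv).2
  have hH0 : H.index ≠ 0 := by
    rw [hind, Finset.prod_ne_zero_iff]
    exact fun v hv ↦ (two_le_index_locNorm hi (hV' v hv)).2
  have hHge : 2 ^ V.card ≤ H.index := by
    rw [hind, ← Finset.prod_const]
    exact Finset.prod_le_prod' fun v hv ↦ (two_le_index_locNorm hi (hV' v hv)).1
  obtain ⟨S₂, hS₂⟩ := exists_sup_sUnits_eq_top H hH0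
  set S := S₀ ∪ S₂ with hS
  have hsub : S₀ ⊆ S := Finset.subset_union_left
  have hrel : H.relIndex (sUnits S) = H.index :=
    relIndex_eq_index_of_sup_eq_top (hS₂ S Finset.subset_union_right)
  obtain ⟨h1, h2⟩ := two_mul_relIndex_normGroup_le hb hi (hcl.mono hsub)
    (fun v hv ↦ htwo v fun h ↦ hv (hsub h))
    (sUnits_mono ((Finset.subset_union_right.trans hS₀).trans hsub) h₁)
  have hfil : (S.filter fun v ↦ b ∉ sqGroup (v.valuation M)) = V := by
    ext v
    rw [hV, Finset.mem_filter, Finset.mem_filter]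
    refine and_congr_left fun hv ↦ ⟨fun _ ↦ ?_, fun h ↦ hsub h⟩
    by_contra hv0
    exact hv (hcon v fun hvB ↦ hv0 (hS₀ (Finset.mem_union_left _ hvB)))
  rw [hfil] at h1
  have hle : normGroup b ≤ H := fun z hz ↦ mem_biInf.2 fun v _ ↦ normGroup_le_locNorm b hz
  have h3 := Subgroup.relIndex_le_of_le_left hle h2
  have : 0 < 2 ^ V.card := by positivity
  omega

end Approximation

section Hasse

variable {M : Type*} [Field M] [NumberField M]

lemma ClTrivial.exists_val_eq {S : Finset (HeightOneSpectrum (𝓞 M))}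
    [DecidableEq (HeightOneSpectrum (𝓞 M))] (h : ClTrivial S)
    (V : Finset (HeightOneSpectrum (𝓞 M))) (k : HeightOneSpectrum (𝓞 M) → ℤ) :
    ∃ m : Mˣ, ∀ v ∉ S, v.valuation M (m : M) = if v ∈ V then exp (k v) else 1 := by
  induction V using Finset.induction_on with
  | empty => exact ⟨1, by simp⟩
  | insert q V hq ih =>
    obtain ⟨m, hm⟩ := ih
    by_cases hqS : q ∈ S
    · refine ⟨m, fun v hv ↦ ?_⟩
      have hvq : v ≠ q := fun h ↦ hv (h ▸ hqS)
      rw [hm v hv]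
      simp [hvq]
    · obtain ⟨x, hx1, hx2⟩ := h q hqS
      refine ⟨m * x ^ (-k q), fun v hv ↦ ?_⟩
      rw [Units.val_mul, map_mul, hm v hv, Units.val_zpow_eq_zpow_val, map_zpow₀]
      by_cases hvq : v = q
      · subst hvq
        rw [hx1, if_neg hq, if_pos (Finset.mem_insert_self _ _), one_mul, ← exp_zsmul]
        simp
      · rw [hx2 v hv hvq, one_zpow, mul_one]
        simp [hvq]

lemma map_mem_sqGroup {E : Type*} [Field E] [NumberField E] [Algebra M E]
    (w : HeightOneSpectrum (𝓞 E)) {z : Mˣ} (hz : z ∈ sqGroup ((below M w).valuation M)) :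
    Units.map (algebraMap M E : M →* E) z ∈ sqGroup (w.valuation E) := by
  obtain ⟨u, x, hx, h⟩ := mem_sqGroup.1 hz
  refine mem_sqGroup.2 ⟨Units.map (algebraMap M E : M →* E) u, algebraMap M E x,
    (valuation_algebraMap_lt_one_iff w x).2 hx, ?_⟩
  simp only [Units.coe_map, MonoidHom.coe_coe, h, map_mul, map_pow, map_add, map_one, map_ofNat]

lemma relIndex_sqGroup_le_two {v : HeightOneSpectrum (𝓞 M)} (h2 : v.valuation M 2 = 1) :
    (sqGroup (v.valuation M)).relIndex (unitsAt v) ≤ 2 ∧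
      (sqGroup (v.valuation M)).relIndex (unitsAt v) ≠ 0 := by
  have h := relIndex_sqGroup_unitsAt_le v
  have h0 : ordTwo v = 0 := by rw [ordTwo, h2]; simp
  rwa [h0, pow_zero, mul_one] at h

lemma mul_mem_sqGroup_of_notMem {v : HeightOneSpectrum (𝓞 M)} (h2 : v.valuation M 2 = 1) {a b : Mˣ}
    (ha : v.valuation M (a : M) = 1) (hb : v.valuation M (b : M) = 1)
    (ha' : a ∉ sqGroup (v.valuation M)) (hb' : b ∉ sqGroup (v.valuation M)) :
    a * b ∈ sqGroup (v.valuation M) := by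
  obtain ⟨h3, h4⟩ := relIndex_sqGroup_le_two h2
  have h1 : (sqGroup (v.valuation M)).relIndex (unitsAt v) ≠ 1 := fun h ↦
    ha' (Subgroup.relIndex_eq_one.1 h ha)
  have h5 : ((sqGroup (v.valuation M)).subgroupOf (unitsAt v)).index = 2 := by
    change (sqGroup (v.valuation M)).relIndex (unitsAt v) = 2
    omega
  have h6 := (Subgroup.mul_mem_iff_of_index_two h5 (a := ⟨a, ha⟩) (b := ⟨b, hb⟩)).2
    (by simp [Subgroup.mem_subgroupOf, ha', hb'])
  exact h6

lemma exists_mem_sUnits_sq {S : Finset (HeightOneSpectrum (𝓞 M))} {u : Mˣ} (hu : u ∈ sUnits S)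
    (h : IsSquare u) : u ∈ sqs (sUnits S) := by
  obtain ⟨r, rfl⟩ := h
  refine mem_sqs.2 ⟨r, fun v hv ↦ ?_, sq r⟩
  have h1 := hu v hv
  rw [Units.val_mul, map_mul, ← sq] at h1
  exact (pow_eq_one_iff_of_nonneg zero_le two_ne_zero).1 h1

lemma relIndex_biInf_sqGroup_le {S₀ Q : Finset (HeightOneSpectrum (𝓞 M))}
    (h2 : ∀ v ∉ S₀, v.valuation M 2 = 1) (hQ : ∀ q ∈ Q, q ∉ S₀) :
    (⨅ q ∈ Q, sqGroup (q.valuation M)).relIndex (sUnits S₀) ≤ 2 ^ Q.card ∧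
      (⨅ q ∈ Q, sqGroup (q.valuation M)).relIndex (sUnits S₀) ≠ 0 := by
  classical
  have key : ∀ q ∈ Q, (sqGroup (q.valuation M)).relIndex (sUnits S₀) ≤ 2 ∧
      (sqGroup (q.valuation M)).relIndex (sUnits S₀) ≠ 0 := fun q hq ↦ by
    obtain ⟨h3, h4⟩ := relIndex_sqGroup_le_two (h2 q (hQ q hq))
    have hle : sUnits S₀ ≤ unitsAt q := fun z hz ↦ hz q (hQ q hq)
    exact ⟨(Subgroup.relIndex_le_of_le_right hle h4).trans h3, fun h ↦ h4
      (Subgroup.relIndex_eq_zero_of_le_right hle h)⟩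
  have hinf : ⨅ v ∈ Q, sqGroup (v.valuation M) = ⨅ v : Q, sqGroup (v.1.valuation M) := iInf_subtype'
  rw [hinf]
  constructor
  · refine (Subgroup.relIndex_iInf_le _).trans ?_
    rw [Finset.prod_coe_sort Q fun v ↦ (sqGroup (v.valuation M)).relIndex (sUnits S₀),
      ← Finset.prod_const]
    exact Finset.prod_le_prod' fun q hq ↦ (key q hq).1
  · exact Subgroup.relIndex_iInf_ne_zero fun q ↦ (key q.1 q.2).2

lemma exists_mem_biInf_not_isSquare {i : M} (hi : i ^ 2 = -1) {k : ℕ}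
    (hk : Module.finrank ℚ M = 2 * k) (a : Mˣ) {S₀ Q : Finset (HeightOneSpectrum (𝓞 M))}
    (h2 : ∀ v ∉ S₀, v.valuation M 2 = 1) (hQ : ∀ q ∈ Q, q ∉ S₀) (hcard : Q.card + 2 ≤ S₀.card + k) :
    ∃ b ∈ sUnits S₀, (∀ q ∈ Q, b ∈ sqGroup (q.valuation M)) ∧ ¬ IsSquare b ∧ ¬ IsSquare (a * b) := by
  by_contra! hcon
  set H := ⨅ q ∈ Q, sqGroup (q.valuation M) with hH
  set U := sUnits S₀ with hU
  have h1 : ((sqs U).subgroupOf (H ⊓ U)).index ≤ 2 ∧ ((sqs U).subgroupOf (H ⊓ U)).index ≠ 0 := by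
    refine index_le_two_of_mul_mem _ ?_
    rintro ⟨x, hx⟩ ⟨y, hy⟩ hxn hyn
    rw [Subgroup.mem_subgroupOf] at hxn hyn ⊢
    have key : ∀ z ∈ H ⊓ U, z ∉ sqs U → IsSquare (a * z) := fun z hz hzn ↦
      hcon z hz.2 (mem_biInf.1 hz.1) fun hsq ↦ hzn (exists_mem_sUnits_sq hz.2 hsq)
    obtain ⟨r, hr⟩ := key x hx hxn
    obtain ⟨s, hs⟩ := key y hy hyn
    refine exists_mem_sUnits_sq (mul_mem hx.2 hy.2) ⟨r * s / a, ?_⟩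
    change x * y = _
    rw [div_mul_div_comm, mul_mul_mul_comm, ← hr, ← hs, mul_mul_mul_comm, mul_div_cancel_left]
  have h3 := sqIndex_sUnits hi hk S₀
  rw [sqIndex_eq_relIndex] at h3
  obtain ⟨h4, h5⟩ := relIndex_biInf_sqGroup_le h2 hQ
  have h6 : sqs U ≤ H := by
    rintro _ ⟨u, hu, rfl⟩
    exact mem_biInf.2 fun q _ ↦ sq_mem_sqGroup _ u
  have h7 := Subgroup.relIndex_inf_mul_relIndex (sqs U) H U
  rw [inf_of_le_left h6, h3] at h7
  have h8 : (sqs U).relIndex (H ⊓ U) ≤ 2 := h1.1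
  have h9 : 2 ^ (S₀.card + k) ≤ 2 ^ (Q.card + 1) := by
    rw [← h7, pow_succ, mul_comm]
    exact Nat.mul_le_mul h4 h8
  have := (Nat.pow_le_pow_iff_right (by norm_num : 1 < 2)).1 h9
  omega

lemma not_isSquare_map {E : Type*} [Field E] [NumberField E] [Algebra M E] {a : Mˣ} {δ : E}
    {τ : E ≃ₐ[M] E} (h : IsQuad a δ τ) {b : Mˣ} (hb : ¬ IsSquare b) (hab : ¬ IsSquare (a * b)) :
    ¬ IsSquare (Units.map (algebraMap M E : M →* E) b) := by
  rintro ⟨z, hz⟩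
  have hz' : algebraMap M E b = z * z := congrArg Units.val hz
  have h1 : τ z * τ z = z * z := by rw [← map_mul, ← hz', AlgEquiv.commutes]
  rcases mul_self_eq_mul_self_iff.1 h1 with h1 | h1
  · obtain ⟨x, hx⟩ := h.exists_eq_of_conj_eq h1
    rw [hx, ← map_mul] at hz'
    have h2 := (algebraMap M E).injective hz'
    have hx0 : x ≠ 0 := by
      rintro rfl
      simp at h2
    exact hb ⟨Units.mk0 x hx0, Units.ext h2⟩
  · obtain ⟨x, hx⟩ := h.exists_eq_of_conj_eq (z := δ * z) (by rw [map_mul, h.conj, h1]; ring)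
    have h2 : algebraMap M E (a * b) = algebraMap M E (x * x) := by
      rw [map_mul, map_mul, ← hx, ← h.sq, hz']; ring
    have h2 := (algebraMap M E).injective h2
    have hx0 : x ≠ 0 := by
      rintro rfl
      simp at h2
    exact hab ⟨Units.mk0 x hx0, Units.ext h2⟩

/-- Auxiliary primes at which `a` is a square and which are independent on the `S₀`-units. -/
lemma exists_auxiliary {i : M} (hi : i ^ 2 = -1) {k : ℕ} (hk : Module.finrank ℚ M = 2 * k) {a : Mˣ}
    (hsq : ¬ IsSquare a) {S₀ : Finset (HeightOneSpectrum (𝓞 M))}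
    (ha : a ∈ sUnits S₀) (h2 : ∀ v ∉ S₀, v.valuation M 2 = 1) (j : ℕ) (hj : j + 1 ≤ S₀.card + k) :
    ∃ Q : Finset (HeightOneSpectrum (𝓞 M)), (∀ q ∈ Q, q ∉ S₀) ∧ Q.card = j ∧
      (∀ q ∈ Q, a ∈ sqGroup (q.valuation M)) ∧
      ∀ Q' ⊆ Q, 2 ^ Q'.card ≤ (⨅ q ∈ Q', sqGroup (q.valuation M)).relIndex (sUnits S₀) := by
  classical
  induction j with
  | zero =>
    refine ⟨∅, by simp, rfl, by simp, fun Q' hQ' ↦ ?_⟩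
    rw [Finset.subset_empty.1 hQ']
    simp
  | succ j ih =>
    obtain ⟨Q, hQ, hcard, haQ, hind⟩ := ih (by omega)
    obtain ⟨b, hb, hbQ, hb1, hb2⟩ := exists_mem_biInf_not_isSquare hi hk a h2 hQ (by omega)
    obtain ⟨E, _, _, _, δ, τ, h⟩ := exists_isQuad hsq
    obtain ⟨w, hw, hwb⟩ := exists_notMem_sqGroup (i := algebraMap M E i)
      (by rw [← map_pow, hi, map_neg, map_one]) (not_isSquare_map h hb1 hb2) (primesAbove E (S₀ ∪ Q))
    rw [mem_primesAbove, Finset.mem_union, not_or] at hw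
    set q := below M w with hq
    have hbq : b ∉ sqGroup (q.valuation M) := fun h' ↦ hwb (map_mem_sqGroup w h')
    have haq : a ∈ sqGroup (q.valuation M) := by
      by_contra haq
      have h3 := map_mem_sqGroup w
        (mul_mem_sqGroup_of_notMem (h2 q hw.1) (ha q hw.1) (hb q hw.1) haq hbq)
      have h4 : Units.map (algebraMap M E : M →* E) a = Units.mk0 δ h.delta_ne_zero ^ 2 :=
        Units.ext h.sq.symm
      rw [map_mul, h4, Subgroup.mul_mem_cancel_left _ (sq_mem_sqGroup _ _)] at h3
      exact hwb h3
    refine ⟨insert q Q, ?_, by rw [Finset.card_insert_of_notMem hw.2, hcard], ?_, fun Q' hQ' ↦ ?_⟩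
    · simpa [hw.1] using hQ
    · simpa [haq] using haQ
    · by_cases hqQ' : q ∈ Q'
      · obtain ⟨Q'', hQ'', rfl⟩ : ∃ Q'', q ∉ Q'' ∧ insert q Q'' = Q' :=
          ⟨Q'.erase q, Finset.notMem_erase _ _, Finset.insert_erase hqQ'⟩
        have hsub : Q'' ⊆ Q := (Finset.insert_subset_insert_iff hQ'').1 hQ'
        rw [Finset.card_insert_of_notMem hQ'', Finset.iInf_insert, ← Subgroup.relIndex_inf_mul_relIndex,
          pow_succ, mul_comm]
        refine Nat.mul_le_mul ?_ (hind _ hsub)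
        have h5 : (sqGroup (q.valuation M)).relIndex ((⨅ x ∈ Q'', sqGroup (x.valuation M)) ⊓ sUnits S₀) ≠ 0 :=
          fun h0 ↦ (index_sqGroup_le q).2 (by
            rw [← Subgroup.relIndex_top_right]
            exact Subgroup.relIndex_eq_zero_of_le_right le_top h0)
        have h6 : (sqGroup (q.valuation M)).relIndex ((⨅ x ∈ Q'', sqGroup (x.valuation M)) ⊓ sUnits S₀) ≠ 1 :=
          fun h1 ↦ hbq (Subgroup.relIndex_eq_one.1 h1
            ⟨mem_biInf.2 fun x hx ↦ hbQ x (hsub hx), hb⟩)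
        omega
      · exact hind Q' ((Finset.subset_insert_iff_of_notMem hqQ').1 hQ')

lemma mem_sqGroup_of_mem_normGroup {v : HeightOneSpectrum (𝓞 M)} (h2 : v.valuation M 2 = 1)
    {u z : Mˣ} (hu : ¬ IsSquare (v.valuation M (u : M))) (hz : v.valuation M (z : M) = 1)
    (h : z ∈ normGroup u) : z ∈ sqGroup (v.valuation M) := by
  obtain ⟨x, y, hxy⟩ := mem_normGroup.1 h
  set p := v.valuation M x with hp
  set r := v.valuation M y with hr
  have hpr : v.valuation M (x ^ 2) = p ^ 2 := map_pow _ _ _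
  have hur : v.valuation M (u * y ^ 2) = v.valuation M (u : M) * r ^ 2 := by rw [map_mul, map_pow]
  have hy1 : v.valuation M (u * y ^ 2) ≠ 1 := by
    intro h1
    have hr0 : r ≠ 0 := by rintro h0; simp [hur, h0] at h1
    refine hu ⟨r⁻¹, ?_⟩
    rw [hur] at h1
    rw [eq_inv_of_mul_eq_one_left h1, sq, mul_inv]
  have hne : v.valuation M (u * y ^ 2) = v.valuation M (x ^ 2) → v.valuation M (x ^ 2) = 0 := by
    intro h1
    by_contra h0
    have hr0 : r ≠ 0 := by rintro h0'; exact h0 (by rw [← h1, hur, h0']; simp)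
    refine hu ⟨p / r, ?_⟩
    rw [hur, hpr] at h1
    rw [div_mul_div_comm, ← sq, ← sq, eq_div_iff (pow_ne_zero 2 hr0), h1]
  have hlt : v.valuation M (u * y ^ 2) < 1 ∧ v.valuation M (x ^ 2) = 1 := by
    rw [hxy] at hz
    rcases lt_trichotomy (v.valuation M (u * y ^ 2)) (v.valuation M (x ^ 2)) with hl | hl | hl
    · rw [Valuation.map_sub_eq_of_lt_left _ hl] at hz
      exact ⟨hz ▸ hl, hz⟩
    · exfalso
      have h0 := hne hl
      rw [h0] at hl
      rw [map_eq_zero] at h0 hl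
      rw [h0, hl] at hz
      simp at hz
    · rw [Valuation.map_sub_eq_of_lt_right _ hl] at hz
      exact (hy1 hz).elim
  have hx0 : x ≠ 0 := by
    rintro rfl
    simp at hlt
  have h4 : v.valuation M 4 = 1 := by rw [val_four, h2, one_pow]
  have h5 : z / (Units.mk0 x hx0) ^ 2 ∈ sqGroup (v.valuation M) := by
    refine div_mem_sqGroup ?_
    push_cast
    rw [Units.val_mk0, hlt.2, h4, hxy, sub_sub_cancel_left, Valuation.map_neg, mul_one]
    exact hlt.1
  have h6 := mul_mem h5 (sq_mem_sqGroup (v.valuation M) (Units.mk0 x hx0))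
  rwa [div_mul_cancel] at h6

lemma isSquare_of_forall_mem_sqGroup {i : M} (hi : i ^ 2 = -1)
    {S₀ Q : Finset (HeightOneSpectrum (𝓞 M))} [DecidableEq (HeightOneSpectrum (𝓞 M))]
    (hcl : ClTrivial S₀) (h2 : ∀ v ∉ S₀, v.valuation M 2 = 1) (hQ : ∀ q ∈ Q, q ∉ S₀)
    (hind : ∀ Q' ⊆ Q, 2 ^ Q'.card ≤ (⨅ q ∈ Q', sqGroup (q.valuation M)).relIndex (sUnits S₀))
    {u : Mˣ} (hu : u ∈ sUnits (S₀ ∪ Q)) (hloc : ∀ v ∈ S₀, u ∈ sqGroup (v.valuation M)) :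
    IsSquare u := by
  classical
  by_contra hsq
  set Q' := Q.filter fun v ↦ ¬ IsSquare (v.valuation M (u : M)) with hQ'
  have hex : ∀ v : HeightOneSpectrum (𝓞 M), ∃ n : ℤ, IsSquare (v.valuation M (u : M)) →
      v.valuation M (u : M) = exp n ^ 2 := by
    intro v
    by_cases hv : IsSquare (v.valuation M (u : M))
    · obtain ⟨r, hr⟩ := hv
      have hr0 : r ≠ 0 := by rintro rfl; simp at hr
      exact ⟨log r, fun _ ↦ by rw [exp_log hr0, hr, sq]⟩
    · exact ⟨0, fun h ↦ (hv h).elim⟩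
  choose n hn using hex
  obtain ⟨m, hm⟩ := hcl.exists_val_eq (Q \ Q') n
  set u' := u / m ^ 2 with hu'
  have hval : ∀ v ∉ S₀, v.valuation M (u' : M) = if v ∈ Q' then v.valuation M (u : M) else 1 := by
    intro v hv
    have h1 : v.valuation M (u' : M) = v.valuation M (u : M) / v.valuation M (m : M) ^ 2 := by
      rw [hu']; push_cast; rw [map_div₀, map_pow]
    rw [h1, hm v hv]
    by_cases hvQ' : v ∈ Q'
    · simp [hvQ']
    · by_cases hvQ : v ∈ Q
      · have h3 : IsSquare (v.valuation M (u : M)) := by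
          by_contra h3
          exact hvQ' (Finset.mem_filter.2 ⟨hvQ, h3⟩)
        rw [if_pos (Finset.mem_sdiff.2 ⟨hvQ, hvQ'⟩), if_neg hvQ', hn v h3,
          div_self (pow_ne_zero _ exp_ne_zero)]
      · have h3 := hu v (by simp [hv, hvQ])
        simp [hvQ', hvQ, h3]
  have hsq' : ¬ IsSquare u' := by
    rintro ⟨r, hr⟩
    refine hsq ⟨r * m, ?_⟩
    rw [mul_mul_mul_comm, ← hr, hu', ← sq, div_mul_cancel]
  have hmem : u' ∈ sUnits (S₀ ∪ Q') := by
    intro v hv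
    rw [Finset.mem_union, not_or] at hv
    rw [hval v hv.1, if_neg hv.2]
  obtain ⟨h3, h4⟩ := two_mul_relIndex_normGroup_le hsq' hi (hcl.mono Finset.subset_union_left)
    (fun v hv ↦ h2 v fun h ↦ hv (Finset.mem_union_left _ h)) hmem
  have h5 : ((S₀ ∪ Q').filter fun v ↦ u' ∉ sqGroup (v.valuation M)).card ≤ Q'.card := by
    refine Finset.card_le_card fun v hv ↦ ?_
    rw [Finset.mem_filter, Finset.mem_union] at hv
    rcases hv.1 with hv0 | hv0
    · exact (hv.2 (div_mem (hloc v hv0) (sq_mem_sqGroup _ _))).elim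
    · exact hv0
  have h6 : (normGroup u' ⊓ sUnits S₀) ≤ ⨅ q ∈ Q', sqGroup (q.valuation M) := by
    rintro z ⟨hz1, hz2⟩
    refine mem_biInf.2 fun q hq ↦ ?_
    have hqS := hQ q (Finset.mem_filter.1 hq).1
    refine mem_sqGroup_of_mem_normGroup (h2 q hqS) ?_ (hz2 q hqS) hz1
    rw [hval q hqS, if_pos hq]
    exact (Finset.mem_filter.1 hq).2
  have h7 := hind Q' (Finset.filter_subset _ _)
  have hle : sUnits S₀ ≤ sUnits (S₀ ∪ Q') := sUnits_mono Finset.subset_union_left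
  have h8 : (normGroup u').relIndex (sUnits S₀) ≠ 0 := fun h ↦
    h4 (Subgroup.relIndex_eq_zero_of_le_right hle h)
  have h9 := Subgroup.relIndex_le_of_le_left (L := sUnits S₀) h6
    (by rwa [Subgroup.inf_relIndex_right])
  rw [Subgroup.inf_relIndex_right] at h9
  have h10 := Subgroup.relIndex_le_of_le_right hle h4
  have h11 : 2 ^ ((S₀ ∪ Q').filter fun v ↦ u' ∉ sqGroup (v.valuation M)).card ≤ 2 ^ Q'.card :=
    Nat.pow_le_pow_right (by norm_num) h5
  have : 0 < 2 ^ Q'.card := by positivity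
  omega

lemma exists_index_eq_and_inf_le {i : M} (hi : i ^ 2 = -1) {a : Mˣ} (hsq : ¬ IsSquare a)
    {S₀ : Finset (HeightOneSpectrum (𝓞 M))} (hcl : ClTrivial S₀) (h2 : ∀ v ∉ S₀, v.valuation M 2 = 1)
    (ha : a ∈ sUnits S₀) {V : Finset (HeightOneSpectrum (𝓞 M))}
    (hV : ∀ v, v ∈ V ↔ v ∈ S₀ ∧ a ∉ sqGroup (v.valuation M)) :
    ∏ v ∈ V, (locNorm (v.valuation M) a).index = 2 ^ V.card ∧
      (⨅ v ∈ V, locNorm (v.valuation M) a) ⊓ sUnits S₀ ≤ normGroup a := by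
  classical
  obtain ⟨k, hk⟩ := even_finrank hi
  have hk0 : 0 < Module.finrank ℚ M := Module.finrank_pos
  obtain ⟨Q, hQ, hcard, haQ, hind⟩ := exists_auxiliary hi hk hsq ha h2 (S₀.card + k - 1) (by omega)
  set S := S₀ ∪ Q with hS
  have hScard : S.card = S₀.card + Q.card :=
    Finset.card_union_of_disjoint (Finset.disjoint_left.2 fun v hv hvQ ↦ hQ v hvQ hv)
  set H₀ := ⨅ v ∈ S₀, sqGroup (v.valuation M) with hH₀
  have hH₀ind : H₀.index = ∏ v ∈ S₀, (sqGroup (v.valuation M)).index := index_biInf S₀ _ fun _ _ ↦ le_rfl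
  have hH₀le : H₀.index ≤ 2 ^ (2 * (S₀.card + k)) := by
    rw [hH₀ind]
    refine (Finset.prod_le_prod' fun v _ ↦ (index_sqGroup_le v).1).trans ?_
    rw [Finset.prod_mul_distrib, Finset.prod_const, mul_add, pow_add, pow_mul, ← hk]
    exact Nat.mul_le_mul le_rfl (prod_absNorm_pow_ordTwo_le S₀)
  have hrel : H₀.relIndex (sUnits S) = 2 ^ (S.card + k) := by
    rw [← sqIndex_sUnits hi hk, sqIndex_eq_relIndex, ← Subgroup.inf_relIndex_right]
    congr 1
    refine le_antisymm ?_ ?_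
    · rintro u ⟨hu1, hu2⟩
      exact exists_mem_sUnits_sq hu2
        (isSquare_of_forall_mem_sqGroup hi hcl h2 hQ hind hu2 (mem_biInf.1 hu1))
    · rintro _ ⟨u, hu, rfl⟩
      exact ⟨mem_biInf.2 fun v _ ↦ sq_mem_sqGroup _ _, pow_mem hu 2⟩
  have hmul : H₀.relIndex (sUnits S) * (sUnits S ⊔ H₀).index = H₀.index := by
    rw [← Subgroup.relIndex_sup_right, Subgroup.relIndex_mul_index le_sup_right]
  have hsup : (sUnits S ⊔ H₀).index ≤ 2 := by
    rw [hrel] at hmul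
    refine Nat.le_of_mul_le_mul_left (c := 2 ^ (S.card + k)) ?_ (by positivity)
    rw [hmul, ← pow_succ]
    refine hH₀le.trans (Nat.pow_le_pow_right (by norm_num) ?_)
    omega
  have hsup0 : (sUnits S ⊔ H₀).index ≠ 0 := by
    refine right_ne_zero_of_mul (a := H₀.relIndex (sUnits S)) ?_
    rw [hmul, hH₀ind, Finset.prod_ne_zero_iff]
    exact fun v _ ↦ (index_sqGroup_le v).2
  set W := ⨅ v ∈ V, locNorm (v.valuation M) a with hW
  have hWind : W.index = ∏ v ∈ V, (locNorm (v.valuation M) a).index :=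
    index_biInf V _ fun v _ ↦ sqGroup_le_locNorm a
  have hHW : H₀ ≤ W := fun z hz ↦ mem_biInf.2 fun v hv ↦
    sqGroup_le_locNorm a (mem_biInf.1 hz v ((hV v).1 hv).1)
  have hNW : normGroup a ≤ W := fun z hz ↦ mem_biInf.2 fun v _ ↦ normGroup_le_locNorm a hz
  have hmulW : W.relIndex (sUnits S) * (sUnits S ⊔ W).index = W.index := by
    rw [← Subgroup.relIndex_sup_right, Subgroup.relIndex_mul_index le_sup_right]
  have hsupW : (sUnits S ⊔ W).index ≤ 2 := by
    have hdvd := Subgroup.index_dvd_of_le (sup_le_sup_left hHW (sUnits S))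
    exact (Nat.le_of_dvd (Nat.pos_of_ne_zero hsup0) hdvd).trans hsup
  obtain ⟨h3, h4⟩ := two_mul_relIndex_normGroup_le (S := S) hsq hi
    (hcl.mono Finset.subset_union_left)
    (fun v hv ↦ h2 v fun h ↦ hv (Finset.mem_union_left _ h))
    (sUnits_mono (Finset.subset_union_left : S₀ ⊆ S) ha)
  have hfil : (S.filter fun v ↦ a ∉ sqGroup (v.valuation M)) = V := by
    ext v
    rw [Finset.mem_filter, hS, Finset.mem_union, hV]
    refine and_congr_left fun hv ↦ or_iff_left fun hvQ ↦ hv (haQ v hvQ)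
  rw [hfil] at h3
  have h5 := Subgroup.relIndex_le_of_le_left hNW h4
  have h6 : 2 ^ V.card ≤ W.index := by
    rw [hWind, ← Finset.prod_const]
    exact Finset.prod_le_prod' fun v hv ↦ (two_le_index_locNorm hi ((hV v).1 hv).2).1
  have h7 : W.index ≤ 2 * W.relIndex (sUnits S) := by
    rw [← hmulW, mul_comm]
    exact Nat.mul_le_mul hsupW le_rfl
  refine ⟨by rw [← hWind]; omega, ?_⟩
  have h8 := Subgroup.relIndex_inf_mul_relIndex (normGroup a) W (sUnits S)
  rw [inf_of_le_left hNW, show W.relIndex (sUnits S) = (normGroup a).relIndex (sUnits S) by omega] at h8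
  have h9 : (normGroup a).relIndex (W ⊓ sUnits S) = 1 :=
    Nat.eq_of_mul_eq_mul_right (Nat.pos_of_ne_zero h4) (by rw [h8, one_mul])
  exact (inf_le_inf_left W (sUnits_mono Finset.subset_union_left)).trans (Subgroup.relIndex_eq_one.1 h9)

/-- The local norm groups of local nonsquares have index two. -/
theorem index_locNorm_eq_two {i : M} (hi : i ^ 2 = -1) {a : Mˣ} {v : HeightOneSpectrum (𝓞 M)}
    (hav : a ∉ sqGroup (v.valuation M)) : (locNorm (v.valuation M) a).index = 2 := by
  classical
  have hsq : ¬ IsSquare a := by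
    rintro ⟨r, rfl⟩
    exact hav (by rw [← sq]; exact sq_mem_sqGroup _ r)
  obtain ⟨S₁, h₁⟩ := exists_mem_sUnits a
  obtain ⟨S₀, hS₀, hcl, h2⟩ := exists_good_superset (insert v S₁)
  obtain ⟨h3, -⟩ := exists_index_eq_and_inf_le hi hsq hcl h2
    (sUnits_mono ((Finset.subset_insert v S₁).trans hS₀) h₁)
    (V := S₀.filter fun v ↦ a ∉ sqGroup (v.valuation M)) (fun v ↦ Finset.mem_filter)
  by_contra hne
  refine absurd h3 (ne_of_gt ?_)
  rw [← Finset.prod_const]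
  refine Finset.prod_lt_prod (fun _ _ ↦ by norm_num) (fun u hu ↦
    (two_le_index_locNorm hi (Finset.mem_filter.1 hu).2).1)
    ⟨v, Finset.mem_filter.2 ⟨hS₀ (Finset.mem_insert_self _ _), hav⟩,
      lt_of_le_of_ne (two_le_index_locNorm hi hav).1 (Ne.symm hne)⟩

/-- The Hasse norm theorem for quadratic extensions. -/
theorem mem_normGroup_of_forall_mem_locNorm {i : M} (hi : i ^ 2 = -1) {a z : Mˣ}
    (hz : ∀ v : HeightOneSpectrum (𝓞 M), z ∈ locNorm (v.valuation M) a) : z ∈ normGroup a := by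
  classical
  by_cases hsq : IsSquare a
  · obtain ⟨r, rfl⟩ := hsq
    rw [← sq, normGroup_sq]
    trivial
  obtain ⟨S₁, h₁⟩ := exists_mem_sUnits a
  obtain ⟨S₂, h₂⟩ := exists_mem_sUnits z
  obtain ⟨S₀, hS₀, hcl, h2⟩ := exists_good_superset (S₁ ∪ S₂)
  obtain ⟨-, h3⟩ := exists_index_eq_and_inf_le hi hsq hcl h2
    (sUnits_mono (Finset.subset_union_left.trans hS₀) h₁)
    (V := S₀.filter fun v ↦ a ∉ sqGroup (v.valuation M)) (fun v ↦ Finset.mem_filter)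
  exact h3 ⟨mem_biInf.2 fun v _ ↦ hz v, sUnits_mono (Finset.subset_union_right.trans hS₀) h₂⟩

end Hasse

section Tower

variable {M E : Type*} [Field M] [NumberField M] [Field E] [NumberField E] [Algebra M E]

lemma map_mem_normGroup {R T : Type*} [Field R] [Field T] (f : R →+* T) {a z : Rˣ}
    (hz : z ∈ normGroup a) : Units.map (f : R →* T) z ∈ normGroup (Units.map (f : R →* T) a) := by
  obtain ⟨x, y, h⟩ := mem_normGroup.1 hz
  exact mem_normGroup.2 ⟨f x, f y, by simp [h]⟩

lemma map_mem_locNorm (w : HeightOneSpectrum (𝓞 E)) {a z : Mˣ}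
    (hz : z ∈ locNorm ((below M w).valuation M) a) :
    Units.map (algebraMap M E : M →* E) z ∈
      locNorm (w.valuation E) (Units.map (algebraMap M E : M →* E) a) := by
  obtain ⟨n, hn, s, hs, rfl⟩ := Subgroup.mem_sup.1 hz
  rw [map_mul]
  exact mul_mem (normGroup_le_locNorm _ (map_mem_normGroup _ hn))
    (sqGroup_le_locNorm _ (map_mem_sqGroup w hs))

lemma exists_approx_pair {w w' : HeightOneSpectrum (𝓞 E)} (hw : w' ≠ w) {x : 𝓞 E} (hx : x ≠ 0) :
    ∃ z : 𝓞 E, w.valuation E ((z : E) - x) < w.valuation E (x : E) ∧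
      w'.valuation E (z : E) < w.valuation E (x : E) := by
  classical
  obtain ⟨k, hk⟩ := exists_exp_mul_lt 1 (w.valuation E (x : E)) (by simp [hx])
  rw [mul_one] at hk
  obtain ⟨z, hz⟩ := IsDedekindDomain.exists_forall_sub_mem_ideal (s := ({w, w'} : Finset _))
    (fun v : HeightOneSpectrum (𝓞 E) ↦ v.asIdeal) (fun _ ↦ k + 1) (fun v _ ↦ v.prime)
    (fun v _ w _ hvw h ↦ hvw (HeightOneSpectrum.ext h)) (fun v ↦ if v.1 = w then x else 0)
  have h1 := hz w (by simp)
  have h2 := hz w' (by simp)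
  rw [if_pos rfl, ← w.intValuation_le_pow_iff_mem, ← w.valuation_of_algebraMap (K := E)] at h1
  rw [if_neg hw, sub_zero, ← w'.intValuation_le_pow_iff_mem, ← w'.valuation_of_algebraMap (K := E)] at h2
  refine ⟨z, lt_of_le_of_lt ?_ hk, lt_of_le_of_lt ?_ hk⟩
  · simpa using h1
  · simpa using h2

namespace IsQuad

variable {a : Mˣ} {δ : E} {τ : E ≃ₐ[M] E}

/-- At a split prime the extension is immediate. -/
lemma exists_valuation_sub_lt (h : IsQuad a δ τ) {w : HeightOneSpectrum (𝓞 E)}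
    (hw : conjPrime (τ : E ≃+* E) w ≠ w) {x : 𝓞 E} (hx : x ≠ 0) :
    ∃ y : M, w.valuation E (algebraMap M E y - x) < w.valuation E (x : E) := by
  obtain ⟨z, hz1, hz2⟩ := exists_approx_pair hw hx
  rw [valuation_conjPrime] at hz2
  obtain ⟨y, hy⟩ := h.exists_eq_of_conj_eq (z := (z : E) + τ z)
    (by rw [map_add, h.conj_conj, add_comm])
  refine ⟨y, ?_⟩
  rw [← hy, add_sub_right_comm]
  exact Valuation.map_add_lt _ hz1 hz2

lemma valuation_algebraMap_of_split (h : IsQuad a δ τ) {w : HeightOneSpectrum (𝓞 E)}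
    (hw : conjPrime (τ : E ≃+* E) w ≠ w) (x : M) :
    w.valuation E (algebraMap M E x) = (below M w).valuation M x := by
  obtain ⟨e, he, hval⟩ := exists_valuation_algebraMap (M := M) w
  obtain ⟨π, hπ⟩ := w.intValuation_exists_uniformizer
  have hπ0 : π ≠ 0 := by
    rintro rfl
    rw [map_zero] at hπ
    exact exp_ne_zero hπ.symm
  have hπ' : w.valuation E (π : E) = exp (-1 : ℤ) := by
    rw [← hπ]; exact w.valuation_of_algebraMap π
  obtain ⟨y, hy⟩ := h.exists_valuation_sub_lt hw hπ0
  have hy' := Valuation.map_eq_of_sub_lt _ hy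
  rw [hval, hπ'] at hy'
  have hy0 : (below M w).valuation M y ≠ 0 := by
    intro h0
    rw [h0, zero_pow he] at hy'
    exact exp_ne_zero hy'.symm
  have h1 := congrArg log hy'
  rw [log_pow, log_exp, nsmul_eq_mul] at h1
  have h2 : e = 1 := by
    have h3 : (e : ℤ) ∣ 1 := ⟨-log ((below M w).valuation M y), by linarith⟩
    exact_mod_cast Int.eq_one_of_dvd_one (by positivity) h3
  rw [hval, h2, pow_one]

lemma pow_sub_one_of_split (h : IsQuad a δ τ) {w : HeightOneSpectrum (𝓞 E)}
    (hw : conjPrime (τ : E ≃+* E) w ≠ w) {C : ℕ}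
    (hC : ∀ x : M, (below M w).valuation M x = 1 → (below M w).valuation M (x ^ C - 1) < 1)
    (x : E) (hx : w.valuation E x = 1) : w.valuation E (x ^ C - 1) < 1 := by
  obtain ⟨r, hr⟩ := exists_integer_val_sub_lt w hx.le
  have hr1 : w.valuation E (r : E) = 1 := by
    rw [← hx]
    exact Valuation.map_eq_of_sub_lt _ (by rwa [Valuation.map_sub_swap, hx])
  have hr0 : r ≠ 0 := by
    rintro rfl
    simp at hr1
  obtain ⟨y, hy⟩ := h.exists_valuation_sub_lt hw hr0
  have hyr := Valuation.map_eq_of_sub_lt _ hy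
  rw [hr1, valuation_algebraMap_eq_one_iff] at hyr
  have h1 := hC y hyr
  rw [← valuation_algebraMap_lt_one_iff, map_sub, map_pow, map_one] at h1
  have h2 : w.valuation E (x - algebraMap M E y) < 1 := by
    have h3 : x - algebraMap M E y = (x - r) - (algebraMap M E y - r) := by ring
    rw [h3]
    exact (Valuation.map_sub _ _ _).trans_lt (max_lt hr (hr1 ▸ hy))
  obtain ⟨q, hq⟩ := sub_dvd_pow_sub_pow (⟨x, hx.le⟩ : (w.valuation E).integer)
    ⟨algebraMap M E y, ((valuation_algebraMap_eq_one_iff w y).2 hyr).le⟩ C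
  have hq' : x ^ C - algebraMap M E y ^ C = (x - algebraMap M E y) * q := congrArg Subtype.val hq
  have h4 : w.valuation E (x ^ C - algebraMap M E y ^ C) < 1 := by
    rw [hq', map_mul]
    exact (mul_le_of_le_one_right zero_le q.2).trans_lt h2
  have h5 : x ^ C - 1 = (x ^ C - algebraMap M E y ^ C) + (algebraMap M E y ^ C - 1) := by ring
  rw [h5]
  exact Valuation.map_add_lt _ h4 h1

lemma mem_locNorm_of_mul_conj_eq (h : IsQuad a δ τ) {w : HeightOneSpectrum (𝓞 E)}
    (hw : conjPrime (τ : E ≃+* E) w = w) {b z : Mˣ} {u : Eˣ}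
    (hu : u ∈ locNorm (w.valuation E) (Units.map (algebraMap M E : M →* E) b))
    (hz : algebraMap M E z = u * τ u) : z ∈ locNorm ((below M w).valuation M) b := by
  have hval : ∀ z, w.valuation E (τ z) = w.valuation E z := fun z ↦ by
    conv_rhs => rw [← hw, valuation_conjPrime]
    rfl
  obtain ⟨n, hn, s, hs, rfl⟩ := Subgroup.mem_sup.1 hu
  obtain ⟨X, Y, hXY⟩ := mem_normGroup.1 hn
  obtain ⟨r, x, hx, hsx⟩ := mem_sqGroup.1 hs
  have hfix : ∀ t : E, ∃ m : M, t * τ t = algebraMap M E m := fun t ↦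
    h.exists_eq_of_conj_eq (by rw [map_mul, h.conj_conj, mul_comm])
  obtain ⟨p, hp⟩ := hfix n
  obtain ⟨q, hq⟩ := hfix s
  have hp0 : p ≠ 0 := by
    rintro rfl
    simp at hp
  have hq0 : q ≠ 0 := by
    rintro rfl
    simp at hq
  have hzpq : z = Units.mk0 p hp0 * Units.mk0 q hq0 := by
    ext
    refine (algebraMap M E).injective ?_
    rw [hz, Units.val_mul, Units.val_mul, Units.val_mk0, Units.val_mk0, map_mul, map_mul, ← hp, ← hq]
    ring
  have hfixadd : ∀ t : E, τ t = t → ∃ m : M, t = algebraMap M E m := fun t ht ↦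
    h.exists_eq_of_conj_eq ht
  have hp' : Units.mk0 p hp0 ∈ normGroup b := by
    obtain ⟨A, hA⟩ := hfixadd (X * τ X + algebraMap M E b * (Y * τ Y)) (by
      simp only [map_add, map_mul, h.conj_conj, AlgEquiv.commutes]; ring)
    obtain ⟨B, hB⟩ := hfixadd (X * τ Y + Y * τ X) (by
      simp only [map_add, map_mul, h.conj_conj]; ring)
    refine mem_normGroup.2 ⟨A, B, (algebraMap M E).injective ?_⟩
    rw [Units.val_mk0, ← hp, map_sub, map_mul, map_pow, map_pow, ← hA, ← hB, hXY]
    simp only [map_sub, map_pow, map_mul, Units.coe_map, MonoidHom.coe_coe, AlgEquiv.commutes]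
    ring
  have hq' : Units.mk0 q hq0 ∈ sqGroup ((below M w).valuation M) := by
    obtain ⟨ρ, hρ⟩ := hfix r
    obtain ⟨ξ, hξ⟩ := hfixadd (x + τ x + 4 * (x * τ x)) (by
      simp only [map_add, map_mul, h.conj_conj, map_ofNat]; ring)
    have hρ0 : ρ ≠ 0 := by
      rintro rfl
      simp at hρ
    refine mem_sqGroup.2 ⟨Units.mk0 ρ hρ0, ξ, ?_, (algebraMap M E).injective ?_⟩
    · rw [← valuation_algebraMap_lt_one_iff, ← hξ]
      refine Valuation.map_add_lt _ (Valuation.map_add_lt _ hx ((hval x).trans_lt hx)) ?_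
      rw [map_mul, map_mul, hval]
      refine (mul_le_of_le_one_left zero_le (val_four_le _)).trans_lt ?_
      exact (mul_le_of_le_one_left zero_le hx.le).trans_lt hx
    · rw [Units.val_mk0, Units.val_mk0, ← hq, map_mul, map_pow, map_add, map_mul, map_one, map_ofNat,
        ← hρ, ← hξ, hsx]
      simp only [map_mul, map_pow, map_add, map_one, map_ofNat]
      ring
  rw [hzpq]
  exact mul_mem (normGroup_le_locNorm _ hp') (sqGroup_le_locNorm _ hq')

/-- A quadratic extension splits every local symbol at a nonsplit prime. -/
theorem mem_locNorm_of_nonsplit {b : Mˣ} (h : IsQuad b δ τ) {i : M} (hi : i ^ 2 = -1)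
    {w : HeightOneSpectrum (𝓞 E)} (hw : conjPrime (τ : E ≃+* E) w = w) (a y : Mˣ) :
    Units.map (algebraMap M E : M →* E) y ∈
      locNorm (w.valuation E) (Units.map (algebraMap M E : M →* E) a) := by
  by_contra hy
  set f : Mˣ →* Eˣ := Units.map (algebraMap M E : M →* E) with hf
  set v := below M w with hv
  have hiE : (algebraMap M E i) ^ 2 = -1 := by rw [← map_pow, hi, map_neg, map_one]
  have hbv : b ∉ sqGroup (v.valuation M) := fun hb ↦ h.conjPrime_ne w hb hw
  have hfb : f b = Units.mk0 δ h.delta_ne_zero ^ 2 := Units.ext h.sq.symm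
  have key : ∀ c : Mˣ, f y ∉ locNorm (w.valuation E) (f c) →
      y ∉ locNorm (v.valuation M) b ∧ y ∉ locNorm (v.valuation M) c := by
    intro c hc
    have hyc : y ∉ locNorm (v.valuation M) c := fun h' ↦ hc (map_mem_locNorm w h')
    refine ⟨?_, hyc⟩
    have hind : (locNorm (w.valuation E) (f c)).index = 2 := index_locNorm_eq_two hiE fun h' ↦ by
      rw [locNorm_eq_top h'] at hc
      exact hc trivial
    have hind' : (locNorm (v.valuation M) c).index = 2 := index_locNorm_eq_two hi fun h' ↦ by
      rw [locNorm_eq_top h'] at hyc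
      exact hyc trivial
    have hle : locNorm (v.valuation M) b ≤ locNorm (v.valuation M) c := by
      refine sup_le (fun z hz ↦ ?_) (sqGroup_le_locNorm _)
      obtain ⟨X, Y, hXY⟩ := mem_normGroup.1 hz
      have hn : algebraMap M E z = (algebraMap M E X + algebraMap M E Y * δ) *
          τ (algebraMap M E X + algebraMap M E Y * δ) := by rw [h.mul_conj, hXY]
      have hn0 : algebraMap M E X + algebraMap M E Y * δ ≠ 0 := by
        intro h0
        rw [h0, zero_mul] at hn
        simp at hn
      set u := Units.mk0 _ hn0 with hu
      by_cases huc : u ∈ locNorm (w.valuation E) (f c)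
      · exact h.mem_locNorm_of_mul_conj_eq hw huc hn
      · have h1 : u * f y ∈ locNorm (w.valuation E) (f c) :=
          (Subgroup.mul_mem_iff_of_index_two hind).2 (by simp [huc, hc])
        have h2 := h.mem_locNorm_of_mul_conj_eq (z := z * y ^ 2) hw h1 (by
          rw [Units.val_mul, map_mul, hn, Units.val_mul, map_mul τ, hf]
          simp only [Units.coe_map, MonoidHom.coe_coe, AlgEquiv.commutes, Units.val_pow_eq_pow_val, map_pow]
          rw [hu, Units.val_mk0]
          ring)
        rwa [Subgroup.mul_mem_cancel_right _ (sqGroup_le_locNorm _ (sq_mem_sqGroup _ y))] at h2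
    exact fun h' ↦ hyc (hle h')
  obtain ⟨h1, h2⟩ := key a hy
  obtain ⟨-, h3⟩ := key (a * b) (by
    rw [map_mul, hfb, locNorm_mul_sq]
    exact hy)
  have h4 : a ∉ locNorm (v.valuation M) y := fun h' ↦ h2 (locNorm_symm h')
  have h5 : b ∉ locNorm (v.valuation M) y := fun h' ↦ h1 (locNorm_symm h')
  have h6 : (locNorm (v.valuation M) y).index = 2 := index_locNorm_eq_two hi fun h' ↦ by
    rw [locNorm_eq_top h'] at h4
    exact h4 trivial
  exact h3 (locNorm_symm ((Subgroup.mul_mem_iff_of_index_two h6).2 (by simp [h4, h5])))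

end IsQuad

lemma mem_locNorm_of_units {i : M} (hi : i ^ 2 = -1) {v : HeightOneSpectrum (𝓞 M)}
    (h2 : v.valuation M 2 = 1) {a y : Mˣ} (ha : v.valuation M (a : M) = 1)
    (hy : v.valuation M (y : M) = 1) : y ∈ locNorm (v.valuation M) a := by
  by_cases ha' : a ∈ sqGroup (v.valuation M)
  · rw [locNorm_eq_top ha']; trivial
  by_cases hy' : y ∈ sqGroup (v.valuation M)
  · exact sqGroup_le_locNorm _ hy'
  have h1 := mul_mem_sqGroup_of_notMem h2 hy ha hy' ha'
  have h3 : y / a ∈ sqGroup (v.valuation M) := by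
    have h4 := div_mem h1 (sq_mem_sqGroup (v.valuation M) a)
    rwa [sq, mul_div_mul_right_eq_div] at h4
  rw [locNorm_congr h3]
  exact self_mem_locNorm hi y

lemma valuation_two_le_of_isPrimitiveRoot (v : HeightOneSpectrum (𝓞 M)) (h2 : v.valuation M 2 < 1)
    (n : ℕ) {ζ : M} (hζ : ζ ^ 2 ^ n = -1) :
    v.valuation M (1 - ζ) < 1 ∧ v.valuation M 2 ≤ v.valuation M (1 - ζ) ^ 2 ^ n := by
  induction n generalizing ζ with
  | zero =>
    rw [pow_zero, pow_one] at hζ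
    subst hζ
    have : (1 - -1 : M) = 2 := by norm_num
    rw [this]
    exact ⟨h2, by simp⟩
  | succ n ih =>
    obtain ⟨h3, h4⟩ := ih (ζ := ζ ^ 2) (by rw [← pow_mul, ← pow_succ', hζ])
    have hζ1 : v.valuation M ζ = 1 := by
      have h5 := congrArg (v.valuation M) hζ
      rw [map_pow, Valuation.map_neg, map_one] at h5
      exact (pow_eq_one_iff_of_nonneg zero_le (by positivity)).1 h5
    have hmul : v.valuation M (1 - ζ ^ 2) = v.valuation M (1 - ζ) * v.valuation M (1 + ζ) := by
      rw [← map_mul]; congr 1; ring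
    have hadd : 1 + ζ = (1 - ζ) + 2 * ζ := by ring
    have h2ζ : v.valuation M (2 * ζ) = v.valuation M 2 := by rw [map_mul, hζ1, mul_one]
    have hle1 : v.valuation M (1 - ζ) ≤ 1 :=
      (Valuation.map_sub _ _ _).trans (by rw [map_one, hζ1, max_self])
    have hle1' : v.valuation M (1 + ζ) ≤ 1 :=
      (Valuation.map_add _ _ _).trans (by rw [map_one, hζ1, max_self])
    have h5 : v.valuation M (1 - ζ) < 1 := by
      by_contra h5
      have h6 : v.valuation M (1 - ζ) = 1 := le_antisymm hle1 (not_lt.1 h5)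
      have h7 : v.valuation M (1 + ζ) = 1 := by
        rw [hadd, Valuation.map_add_eq_of_lt_left _ (by rw [h2ζ, h6]; exact h2), h6]
      rw [hmul, h6, h7, one_mul] at h3
      exact lt_irrefl _ h3
    have h6 : v.valuation M 2 ≤ v.valuation M (1 - ζ) := by
      refine h4.trans ((pow_le_of_le_one zero_le h3.le (by positivity)).trans ?_)
      rw [hmul]
      exact mul_le_of_le_one_right zero_le hle1'
    have h7 : v.valuation M (1 - ζ ^ 2) ≤ v.valuation M (1 - ζ) ^ 2 := by
      rw [hmul, sq]
      gcongr
      rw [hadd]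
      exact (Valuation.map_add _ _ _).trans (max_le le_rfl (by rw [h2ζ]; exact h6))
    refine ⟨h5, h4.trans ?_⟩
    calc _ ≤ (v.valuation M (1 - ζ) ^ 2) ^ 2 ^ n := by gcongr
      _ = _ := by rw [← pow_mul, pow_succ']

/-- The local obstruction at `v` to `y` being a norm for `a` vanishes, or the ramification and the
residue field at `v` are bounded by `D` and `C`. -/
def NormOrBounded (D C : ℕ) (a y : Mˣ) : Prop :=
  ∀ v : HeightOneSpectrum (𝓞 M), y ∈ locNorm (v.valuation M) a ∨
    (exp (-(D : ℤ)) ≤ v.valuation M 2 ∧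
      ∀ x : M, v.valuation M x = 1 → v.valuation M (x ^ C - 1) < 1)

lemma exists_pow_sub_one (v : HeightOneSpectrum (𝓞 M)) : ∃ C : ℕ, C ≠ 0 ∧
    ∀ x : M, v.valuation M x = 1 → v.valuation M (x ^ C - 1) < 1 := by
  classical
  have := v.isMaximal
  let := Ideal.Quotient.field v.asIdeal
  have := finite_residue v
  have := Fintype.ofFinite (𝓞 M ⧸ v.asIdeal)
  refine ⟨Fintype.card (𝓞 M ⧸ v.asIdeal) - 1, ?_, fun x hx ↦ ?_⟩
  · have := Fintype.one_lt_card (α := 𝓞 M ⧸ v.asIdeal)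
    omega
  set C := Fintype.card (𝓞 M ⧸ v.asIdeal) - 1
  obtain ⟨r, hr⟩ := exists_integer_val_sub_lt v hx.le
  have hr1 : v.valuation M (r : M) = 1 := by
    rw [← hx]
    exact Valuation.map_eq_of_sub_lt _ (by rwa [Valuation.map_sub_swap, hx])
  have hrne : Ideal.Quotient.mk v.asIdeal r ≠ 0 := by
    rw [Ne, Ideal.Quotient.eq_zero_iff_mem]
    exact (v.valuation_eq_one_iff_notMem).1 hr1
  have h1 := FiniteField.pow_card_sub_one_eq_one _ hrne
  rw [← map_pow, ← map_one (Ideal.Quotient.mk v.asIdeal), Ideal.Quotient.eq,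
    ← v.valuation_lt_one_iff_mem (K := M)] at h1
  have h1' : v.valuation M ((r : M) ^ C - 1) < 1 := by
    convert h1 using 2
    push_cast
    rfl
  obtain ⟨q, hq⟩ := sub_dvd_pow_sub_pow (⟨x, hx.le⟩ : (v.valuation M).integer) ⟨(r : M), hr1.le⟩ C
  have hq' : x ^ C - (r : M) ^ C = (x - r) * q := congrArg Subtype.val hq
  have h4 : v.valuation M (x ^ C - (r : M) ^ C) < 1 := by
    rw [hq', map_mul]
    exact (mul_le_of_le_one_right zero_le q.2).trans_lt hr
  have h5 : x ^ C - 1 = (x ^ C - (r : M) ^ C) + ((r : M) ^ C - 1) := by ring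
  rw [h5]
  exact Valuation.map_add_lt _ h4 h1'

lemma exists_normOrBounded {i : M} (hi : i ^ 2 = -1) (a y : Mˣ) :
    ∃ D C, C ≠ 0 ∧ NormOrBounded D C a y := by
  classical
  obtain ⟨S₁, h₁⟩ := exists_mem_sUnits a
  obtain ⟨S₂, h₂⟩ := exists_mem_sUnits y
  obtain ⟨S₃, h₃⟩ := exists_mem_sUnits (Units.mk0 (2 : M) two_ne_zero)
  choose c hc0 hc using fun v : HeightOneSpectrum (𝓞 M) ↦ exists_pow_sub_one v
  set S := S₁ ∪ (S₂ ∪ S₃) with hS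
  refine ⟨S.sup ordTwo, ∏ v ∈ S, c v, Finset.prod_ne_zero_iff.2 fun v _ ↦ hc0 v, fun v ↦ ?_⟩
  by_cases hv : v ∈ S
  · right
    refine ⟨?_, fun x hx ↦ ?_⟩
    · rw [valuation_two, exp_le_exp]
      have := Finset.le_sup (f := ordTwo) hv
      omega
    · obtain ⟨d, hd⟩ := Finset.dvd_prod_of_mem c hv
      rw [hd, pow_mul]
      obtain ⟨q, hq⟩ := sub_dvd_pow_sub_pow (⟨x ^ c v, by
        rw [Valuation.mem_integer_iff, map_pow, hx, one_pow]⟩ : (v.valuation M).integer) 1 d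
      have hq' : (x ^ c v) ^ d - 1 ^ d = (x ^ c v - 1) * q := congrArg Subtype.val hq
      rw [one_pow] at hq'
      rw [hq', map_mul]
      exact (mul_le_of_le_one_right zero_le q.2).trans_lt (hc v x hx)
  · left
    simp only [hS, Finset.mem_union, not_or] at hv
    exact mem_locNorm_of_units hi (h₃ v hv.2.2) (h₁ v hv.1) (h₂ v hv.2.1)

lemma NormOrBounded.map_isQuad {D C : ℕ} {a y : Mˣ} (hb : NormOrBounded D C a y) {i : M}
    (hi : i ^ 2 = -1) {b : Mˣ} {δ : E} {τ : E ≃ₐ[M] E} (h : IsQuad b δ τ) :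
    NormOrBounded D C (Units.map (algebraMap M E : M →* E) a)
      (Units.map (algebraMap M E : M →* E) y) := by
  intro w
  by_cases hw : conjPrime (τ : E ≃+* E) w = w
  · exact Or.inl (h.mem_locNorm_of_nonsplit hi hw a y)
  · refine (hb (below M w)).imp (map_mem_locNorm w) fun ⟨h1, h2⟩ ↦ ⟨?_, h.pow_sub_one_of_split hw h2⟩
    rw [← map_ofNat (algebraMap M E) 2, h.valuation_algebraMap_of_split hw]
    exact h1

lemma NormOrBounded.map_surjective {D C : ℕ} {a y : Mˣ} (hb : NormOrBounded D C a y)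
    (h : Function.Surjective (algebraMap M E)) :
    NormOrBounded D C (Units.map (algebraMap M E : M →* E) a)
      (Units.map (algebraMap M E : M →* E) y) := by
  intro w
  refine (hb (below M w)).imp (map_mem_locNorm w) fun ⟨h1, h2⟩ ↦ ⟨?_, fun x hx ↦ ?_⟩
  · rw [← map_ofNat (algebraMap M E) 2, valuation_algebraMap_of_surjective h]
    exact h1
  · obtain ⟨x, rfl⟩ := h x
    rw [valuation_algebraMap_of_surjective h] at hx
    rw [← map_pow, ← map_one (algebraMap M E), ← map_sub, valuation_algebraMap_of_surjective h]
    exact h2 x hx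

lemma NormOrBounded.mem_normGroup {D C : ℕ} {a y : Mˣ} (hb : NormOrBounded D C a y) {i : M}
    (hi : i ^ 2 = -1) (hC : C ≠ 0) {n : ℕ} (hD : D < 2 ^ n) (hCn : C < 2 ^ (n + 1)) {ζ : M}
    (hζ : ζ ^ 2 ^ n = -1) : y ∈ normGroup a := by
  refine mem_normGroup_of_forall_mem_locNorm hi fun v ↦ (hb v).resolve_right ?_
  rintro ⟨h1, h2⟩
  by_cases hv : v.valuation M 2 < 1
  · obtain ⟨h3, h4⟩ := valuation_two_le_of_isPrimitiveRoot v hv n hζ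
    have h5 : v.valuation M (1 - ζ) ≤ exp (-1 : ℤ) := exp_lt_of_lt_one h3
    have h6 := h1.trans (h4.trans (pow_le_pow_left₀ zero_le h5 _))
    rw [← exp_nsmul, exp_le_exp] at h6
    rw [nsmul_eq_mul, mul_neg, mul_one, neg_le_neg_iff] at h6
    exact absurd (by exact_mod_cast h6 : 2 ^ n ≤ D) (not_le.2 hD)
  · have hv1 : v.valuation M 2 = 1 := le_antisymm (val_two_le _) (not_lt.1 hv)
    have hζ1 : v.valuation M ζ = 1 := by
      have h5 := congrArg (v.valuation M) hζ
      rw [map_pow, Valuation.map_neg, map_one] at h5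
      exact (pow_eq_one_iff_of_nonneg zero_le (by positivity)).1 h5
    have h3 := h2 ζ hζ1
    obtain ⟨j, o, ho, hjo⟩ : ∃ j o, Odd o ∧ C = 2 ^ j * o := by
      obtain ⟨j, o, ho, h⟩ := Nat.exists_eq_two_pow_mul_odd hC
      exact ⟨j, o, ho, h⟩
    have hj : j ≤ n := by
      have h5 : 2 ^ j ≤ C := Nat.le_of_dvd (Nat.pos_of_ne_zero hC) ⟨o, hjo⟩
      have h6 : 2 ^ j < 2 ^ (n + 1) := h5.trans_lt hCn
      have := (Nat.pow_lt_pow_iff_right (by norm_num : 1 < 2)).1 h6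
      omega
    have h4 : (ζ ^ C) ^ 2 ^ (n - j) = -1 := by
      rw [← pow_mul, hjo, show 2 ^ j * o * 2 ^ (n - j) = 2 ^ n * o by
        rw [mul_right_comm, ← pow_add, Nat.add_sub_cancel' hj], pow_mul, hζ, ho.neg_one_pow]
    obtain ⟨q, hq⟩ := sub_dvd_pow_sub_pow (⟨ζ ^ C, by
      rw [Valuation.mem_integer_iff, map_pow, hζ1, one_pow]⟩ : (v.valuation M).integer) 1 (2 ^ (n - j))
    have hq' : (ζ ^ C) ^ 2 ^ (n - j) - 1 ^ 2 ^ (n - j) = (ζ ^ C - 1) * q := congrArg Subtype.val hq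
    rw [h4, one_pow] at hq'
    have h5 : v.valuation M (-1 - 1) < 1 := by
      rw [hq', map_mul]
      exact (mul_le_of_le_one_right zero_le q.2).trans_lt h3
    rw [show (-1 - 1 : M) = -2 by norm_num, Valuation.map_neg, hv1] at h5
    exact lt_irrefl _ h5

end Tower

section SqrtStep

variable {M E : Type*} [Field M] [NumberField M] [Field E] [NumberField E] [Algebra M E]

lemma exists_isQuad_of_gen {b : Mˣ} {δ : E} (hδ : δ ^ 2 = algebraMap M E b)
    (hgen : ∀ z : E, ∃ x y : M, z = algebraMap M E x + algebraMap M E y * δ)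
    (hb : ¬ IsSquare b) : ∃ τ : E ≃ₐ[M] E, IsQuad b δ τ := by
  classical
  have : Module.Finite M E := Module.Finite.of_restrictScalars_finite ℚ M E
  have hδM : ∀ x, algebraMap M E x ≠ δ := by
    rintro x rfl
    rw [← map_pow] at hδ
    have hx := (algebraMap M E).injective hδ
    have hx0 : x ≠ 0 := by
      rintro rfl
      exact b.ne_zero (by rw [← hx]; simp)
    exact hb ⟨Units.mk0 x hx0, Units.ext (by simp [← hx, sq])⟩
  have hle : Module.finrank M E ≤ 2 := by
    have htop : Submodule.span M {(1 : E), δ} = ⊤ := by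
      refine eq_top_iff.2 fun z _ ↦ ?_
      obtain ⟨x, y, rfl⟩ := hgen z
      exact Submodule.mem_span_pair.2 ⟨x, y, by simp [Algebra.smul_def]⟩
    rw [← finrank_top, ← htop]
    refine (finrank_span_le_card _).trans ?_
    rw [Set.toFinset_card]
    simpa [Set.toFinset_insert] using Finset.card_insert_le (1 : E) {δ}
  have hne : Module.finrank M E ≠ 1 := by
    intro h1
    obtain ⟨x, hx⟩ := (Algebra.mem_bot.1 (Subalgebra.bot_eq_top_of_finrank_eq_one h1 ▸
      (Algebra.mem_top : δ ∈ (⊤ : Subalgebra M E))) : _)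
    exact hδM x hx
  have hpos : 0 < Module.finrank M E := Module.finrank_pos
  have : Algebra.IsQuadraticExtension M E := ⟨by omega⟩
  have hcard := IsGalois.card_aut_eq_finrank M E
  rw [Algebra.IsQuadraticExtension.finrank_eq_two] at hcard
  have : Nontrivial (E ≃ₐ[M] E) := Finite.one_lt_card_iff_nontrivial.1 (by omega)
  obtain ⟨τ, hτ⟩ := exists_ne (1 : E ≃ₐ[M] E)
  refine ⟨τ, hδ, hgen, ?_, hb⟩
  have h1 : τ δ ^ 2 = δ ^ 2 := by rw [← map_pow, hδ, AlgEquiv.commutes]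
  refine (sq_eq_sq_iff_eq_or_eq_neg.1 h1).resolve_left fun h ↦ hτ (AlgEquiv.ext fun z ↦ ?_)
  obtain ⟨x, y, rfl⟩ := hgen z
  simp [h]

lemma NormOrBounded.map_sqrt {D C : ℕ} {a y : Mˣ} (hb : NormOrBounded D C a y) {i : M}
    (hi : i ^ 2 = -1) {b : Mˣ} {δ : E} (hδ : δ ^ 2 = algebraMap M E b)
    (hgen : ∀ z : E, ∃ x y : M, z = algebraMap M E x + algebraMap M E y * δ) :
    NormOrBounded D C (Units.map (algebraMap M E : M →* E) a)
      (Units.map (algebraMap M E : M →* E) y) := by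
  by_cases hsq : IsSquare b
  · refine hb.map_surjective fun z ↦ ?_
    obtain ⟨c, rfl⟩ := hsq
    obtain ⟨x, y, rfl⟩ := hgen z
    have : δ ^ 2 = (algebraMap M E c) ^ 2 := by rw [hδ]; simp [sq]
    rcases sq_eq_sq_iff_eq_or_eq_neg.1 this with h | h
    · exact ⟨x + y * c, by simp [h]⟩
    · exact ⟨x - y * c, by simp [h, sub_eq_add_neg]⟩
  · obtain ⟨τ, h⟩ := exists_isQuad_of_gen hδ hgen hsq
    exact hb.map_isQuad hi h

end SqrtStep

section Cyclotomic

open IntermediateField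

variable {K Ω : Type*} [Field K] [NumberField K] [Field Ω] [Algebra K Ω]

/-- A compatible system of `2`-power roots of unity. -/
structure IsRootSystem (ζ : ℕ → Ω) : Prop where
  zero : ζ 0 = 1
  one : ζ 1 = -1
  succ_sq : ∀ n, ζ (n + 1) ^ 2 = ζ n

namespace IsRootSystem

variable {ζ : ℕ → Ω}

lemma pow_two_pow (h : IsRootSystem ζ) (n k : ℕ) : ζ (n + k) ^ 2 ^ k = ζ n := by
  induction k with
  | zero => simp
  | succ k ih => rw [pow_succ', pow_mul, ← add_assoc, h.succ_sq, ih]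

lemma pow_eq_neg_one (h : IsRootSystem ζ) (n : ℕ) : ζ (n + 1) ^ 2 ^ n = -1 := by
  rw [add_comm, h.pow_two_pow, h.one]

lemma pow_eq_one (h : IsRootSystem ζ) (n : ℕ) : ζ n ^ 2 ^ n = 1 := by
  simpa [h.zero] using h.pow_two_pow 0 n

lemma ne_zero (h : IsRootSystem ζ) (n : ℕ) : ζ n ≠ 0 := fun h0 ↦ by
  have := h.pow_eq_one n
  rw [h0, zero_pow (by positivity)] at this
  exact zero_ne_one this

lemma isIntegral (h : IsRootSystem ζ) (K : Type*) [Field K] [Algebra K Ω] (n : ℕ) :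
    IsIntegral K (ζ n) :=
  .of_pow (n := 2 ^ n) (by positivity) (by rw [h.pow_eq_one]; exact isIntegral_one)

lemma mem_adjoin (h : IsRootSystem ζ) (K : Type*) [Field K] [Algebra K Ω] {n m : ℕ} (hnm : n ≤ m) :
    ζ n ∈ K⟮ζ m⟯ := by
  obtain ⟨k, rfl⟩ := Nat.exists_eq_add_of_le hnm
  rw [← h.pow_two_pow n k]
  exact pow_mem (mem_adjoin_simple_self K _) _

lemma adjoin_mono (h : IsRootSystem ζ) (K : Type*) [Field K] [Algebra K Ω] {n m : ℕ}
    (hnm : n ≤ m) : K⟮ζ n⟯ ≤ K⟮ζ m⟯ :=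
  adjoin_simple_le_iff.2 (h.mem_adjoin K hnm)

lemma exists_of_mem_adjoin_succ (h : IsRootSystem ζ) (n : ℕ) {z : Ω} (hz : z ∈ K⟮ζ (n + 1)⟯) :
    ∃ x ∈ K⟮ζ n⟯, ∃ y ∈ K⟮ζ n⟯, z = x + y * ζ (n + 1) := by
  rw [← mem_toSubalgebra, adjoin_simple_toSubalgebra_of_isAlgebraic (h.isIntegral K _).isAlgebraic]
    at hz
  induction hz using Algebra.adjoin_induction with
  | mem x hx => exact ⟨0, zero_mem _, 1, one_mem _, by rw [Set.mem_singleton_iff.1 hx]; ring⟩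
  | algebraMap r => exact ⟨algebraMap K Ω r, IntermediateField.algebraMap_mem _ _, 0, zero_mem _, by ring⟩
  | add x y _ _ hx hy =>
    obtain ⟨x₁, hx₁, x₂, hx₂, rfl⟩ := hx
    obtain ⟨y₁, hy₁, y₂, hy₂, rfl⟩ := hy
    exact ⟨_, add_mem hx₁ hy₁, _, add_mem hx₂ hy₂, by ring⟩
  | mul x y _ _ hx hy =>
    obtain ⟨x₁, hx₁, x₂, hx₂, rfl⟩ := hx
    obtain ⟨y₁, hy₁, y₂, hy₂, rfl⟩ := hy
    refine ⟨x₁ * y₁ + x₂ * y₂ * ζ n, ?_, x₁ * y₂ + x₂ * y₁, ?_, ?_⟩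
    · exact add_mem (mul_mem hx₁ hy₁) (mul_mem (mul_mem hx₂ hy₂) (mem_adjoin_simple_self K _))
    · exact add_mem (mul_mem hx₁ hy₂) (mul_mem hx₂ hy₁)
    · linear_combination (x₂ * y₂) * h.succ_sq n

lemma numberField (h : IsRootSystem ζ) (n : ℕ) : NumberField K⟮ζ n⟯ :=
  have := adjoin.finiteDimensional (h.isIntegral K n)
  NumberField.of_module_finite K _

lemma exists_sq_sub_mul_sq_of_two_le (h : IsRootSystem ζ) {n : ℕ} (hn : 2 ≤ n) {a y : Ω}
    (ha : a ∈ K⟮ζ n⟯) (hy : y ∈ K⟮ζ n⟯) (ha0 : a ≠ 0) (hy0 : y ≠ 0) :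
    ∃ m ≥ n, ∃ X ∈ K⟮ζ m⟯, ∃ Y ∈ K⟮ζ m⟯, y = X ^ 2 - a * Y ^ 2 := by
  have := h.numberField (K := K)
  have hi (m : ℕ) (hm : 2 ≤ m) : (⟨ζ 2, h.mem_adjoin K hm⟩ : K⟮ζ m⟯) ^ 2 = -1 :=
    Subtype.ext (by simpa [h.one] using h.succ_sq 1)
  let u (b : Ω) (hb : b ∈ K⟮ζ n⟯) (hb0 : b ≠ 0) (m : ℕ) (hm : n ≤ m) : (K⟮ζ m⟯)ˣ :=
    Units.mk0 ⟨b, h.adjoin_mono K hm hb⟩ fun h0 ↦ hb0 (congrArg Subtype.val h0)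
  obtain ⟨D, C, hC, hb⟩ := exists_normOrBounded (hi n hn) (u a ha ha0 n le_rfl) (u y hy hy0 n le_rfl)
  have key (m : ℕ) (hm : n ≤ m) : NormOrBounded D C (u a ha ha0 m hm) (u y hy hy0 m hm) := by
    induction m, hm using Nat.le_induction with
    | base => exact hb
    | succ m hm ih =>
      let _ : Algebra K⟮ζ m⟯ K⟮ζ (m + 1)⟯ := (inclusion (h.adjoin_mono K m.le_succ)).toAlgebra
      have hb := ih.map_sqrt (E := K⟮ζ (m + 1)⟯) (hi m (hn.trans hm))
        (b := Units.mk0 ⟨ζ m, mem_adjoin_simple_self K _⟩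
          fun h0 ↦ h.ne_zero m (congrArg Subtype.val h0))
        (δ := ⟨ζ (m + 1), mem_adjoin_simple_self K _⟩) (Subtype.ext (h.succ_sq m)) fun ⟨z, hz⟩ ↦ by
          obtain ⟨x, hx, y, hy, rfl⟩ := h.exists_of_mem_adjoin_succ m hz
          exact ⟨⟨x, hx⟩, ⟨y, hy⟩, rfl⟩
      exact hb
  obtain ⟨m, hm⟩ : ∃ m, D + C < 2 ^ m := ⟨_, Nat.lt_two_pow_self⟩
  have hlt : D + C < 2 ^ (n + m) := hm.trans_le (Nat.pow_le_pow_right two_pos (by omega))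
  have hle : n ≤ n + m + 1 := by omega
  have hfin := (key _ hle).mem_normGroup (hi _ (by omega)) hC (n := n + m)
    (ζ := ⟨ζ (n + m + 1), mem_adjoin_simple_self K _⟩) (by omega)
    ((by omega : C < 2 ^ (n + m)).trans (Nat.pow_lt_pow_right (by omega) (by omega)))
    (Subtype.ext (h.pow_eq_neg_one _))
  obtain ⟨X, Y, hXY⟩ := mem_normGroup.1 hfin
  exact ⟨_, hle, X, X.2, Y, Y.2, congrArg Subtype.val hXY⟩

/-- Over the `2`-power cyclotomic tower of a number field every binary quadratic form
`X ^ 2 - a * Y ^ 2` is universal. -/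
lemma exists_sq_sub_mul_sq (h : IsRootSystem ζ) {n : ℕ} {a y : Ω}
    (ha : a ∈ K⟮ζ n⟯) (hy : y ∈ K⟮ζ n⟯) (ha0 : a ≠ 0) :
    ∃ m ≥ n, ∃ X ∈ K⟮ζ m⟯, ∃ Y ∈ K⟮ζ m⟯, y = X ^ 2 - a * Y ^ 2 := by
  rcases eq_or_ne y 0 with rfl | hy0
  · exact ⟨n, le_rfl, 0, zero_mem _, 0, zero_mem _, by ring⟩
  have hle : n ≤ n + 2 := by omega
  obtain ⟨m, hm, H⟩ := h.exists_sq_sub_mul_sq_of_two_le (n := n + 2) (by omega)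
    (h.adjoin_mono K hle ha) (h.adjoin_mono K hle hy) ha0 hy0
  exact ⟨m, hle.trans hm, H⟩

end IsRootSystem

end Cyclotomic

end QuadraticForms

section CentralExtension

variable (A G : Type*) [CommGroup A] [Group G]

/-- Normalized `2`-cocycles of `G` with values in the trivial module `A`. -/
structure TwoCocycle where
  /-- The underlying function. -/
  toFun : G → G → A
  one_left : ∀ g, toFun 1 g = 1
  one_right : ∀ g, toFun g 1 = 1
  assoc : ∀ g h k, toFun g h * toFun (g * h) k = toFun g (h * k) * toFun h k

variable {A G}

instance : CoeFun (TwoCocycle A G) fun _ ↦ G → G → A := ⟨TwoCocycle.toFun⟩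

/-- The central extension of `G` by `A` attached to a cocycle. -/
@[ext]
structure TwoCocycle.Ext (f : TwoCocycle A G) where
  /-- The component in `A`. -/
  fst : A
  /-- The component in `G`. -/
  snd : G

namespace TwoCocycle

variable (f : TwoCocycle A G)

instance : Mul f.Ext := ⟨fun x y ↦ ⟨x.fst * y.fst * f x.snd y.snd, x.snd * y.snd⟩⟩
instance : One f.Ext := ⟨⟨1, 1⟩⟩
instance : Inv f.Ext := ⟨fun x ↦ ⟨x.fst⁻¹ * (f x.snd⁻¹ x.snd)⁻¹, x.snd⁻¹⟩⟩

@[simp] lemma mul_fst (x y : f.Ext) : (x * y).fst = x.fst * y.fst * f x.snd y.snd := rfl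
@[simp] lemma mul_snd (x y : f.Ext) : (x * y).snd = x.snd * y.snd := rfl
@[simp] lemma one_fst : (1 : f.Ext).fst = 1 := rfl
@[simp] lemma one_snd : (1 : f.Ext).snd = 1 := rfl
@[simp] lemma inv_fst (x : f.Ext) : (x⁻¹).fst = x.fst⁻¹ * (f x.snd⁻¹ x.snd)⁻¹ := rfl
@[simp] lemma inv_snd (x : f.Ext) : (x⁻¹).snd = x.snd⁻¹ := rfl

instance : Group f.Ext := Group.ofLeftAxioms
  (fun x y z ↦ Ext.ext (by
    have := f.assoc x.snd y.snd z.snd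
    simp only [mul_fst, mul_snd]
    calc _ = x.fst * y.fst * z.fst * (f x.snd y.snd * f (x.snd * y.snd) z.snd) := by
          rw [← mul_assoc, mul_right_comm (x.fst * y.fst)]
      _ = _ := by rw [this, mul_comm (f _ _)]; simp only [mul_assoc]) (mul_assoc _ _ _))
  (fun x ↦ Ext.ext (by simp [f.one_left]) (one_mul _))
  (fun x ↦ Ext.ext (by simp [mul_comm]) (inv_mul_cancel _))

/-- The projection of the central extension. -/
def proj : f.Ext →* G where
  toFun := Ext.snd
  map_one' := rfl
  map_mul' _ _ := rfl

@[simp] lemma proj_apply (x : f.Ext) : f.proj x = x.snd := rfl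

/-- The inclusion of the kernel of the central extension. -/
def incl : A →* f.Ext where
  toFun a := ⟨a, 1⟩
  map_one' := rfl
  map_mul' _ _ := Ext.ext (by simp [f.one_left]) (by simp)

@[simp] lemma incl_fst (a : A) : (f.incl a).fst = a := rfl
@[simp] lemma incl_snd (a : A) : (f.incl a).snd = 1 := rfl

lemma incl_comm (a : A) (x : f.Ext) : Commute (f.incl a) x :=
  Ext.ext (by simp [f.one_left, f.one_right, mul_comm]) (by simp)

/-- `p` trivializes the cocycle `f` on the subgroup `J`. -/
def IsSol (J : Subgroup G) (p : G → A) : Prop :=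
  ∀ g ∈ J, ∀ h ∈ J, p (g * h) = p g * p h * f g h

variable {f} {J J' : Subgroup G} {p : G → A}

lemma IsSol.mono (h : f.IsSol J' p) (hJ : J ≤ J') : f.IsSol J p :=
  fun g hg k hk ↦ h g (hJ hg) k (hJ hk)

lemma IsSol.one (h : f.IsSol J p) : p 1 = 1 := by
  simpa [f.one_left] using h 1 J.one_mem 1 J.one_mem

lemma IsSol.mul (h : f.IsSol J p) {ω : G → A} (hω : ∀ g ∈ J, ∀ k ∈ J, ω (g * k) = ω g * ω k) :
    f.IsSol J fun g ↦ p g * ω g := fun g hg k hk ↦ by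
  simp only [h g hg k hk, hω g hg k hk, mul_assoc, mul_left_comm, mul_comm]

/-- The subgroup of the extension defined by a trivialization. -/
def IsSol.section (h : f.IsSol J p) : Subgroup f.Ext where
  carrier := {s | s.snd ∈ J ∧ s.fst = p s.snd}
  mul_mem' := fun {s t} hs ht ↦ ⟨J.mul_mem hs.1 ht.1, by
    rw [mul_fst, mul_snd, h _ hs.1 _ ht.1, hs.2, ht.2]⟩
  one_mem' := ⟨J.one_mem, h.one.symm⟩
  inv_mem' := fun {s} hs ↦ ⟨J.inv_mem hs.1, by
    have := h _ (J.inv_mem hs.1) _ hs.1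
    rw [inv_mul_cancel, h.one] at this
    rw [inv_fst, inv_snd, hs.2, ← mul_inv, inv_eq_iff_mul_eq_one, this, mul_comm, mul_assoc]⟩

lemma IsSol.mem_section (h : f.IsSol J p) {s : f.Ext} :
    s ∈ h.section ↔ s.snd ∈ J ∧ s.fst = p s.snd := Iff.rfl

/-- A trivialization of the cocycle extends along a cyclic extension of groups if it is compatible
with conjugation by a generator. -/
theorem IsSol.exists_extension (h : f.IsSol J p) (hdiv : ∀ n : ℤ, n ≠ 0 → ∀ a : A, ∃ b, b ^ n = a)
    {x : G} (hx : ∀ g, g ∈ J ↔ x * g * x⁻¹ ∈ J)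
    (hcomp : ∀ g ∈ J, p g * f x g = p (x * g * x⁻¹) * f (x * g * x⁻¹) x)
    (hJJ' : J ≤ J') (hJ' : ∀ g ∈ J', ∃ i : ℤ, g * x ^ i ∈ J) :
    ∃ p', f.IsSol J' p' ∧ ∀ g ∈ J, p' g = p g := by
  classical
  let X₀ : f.Ext := ⟨1, x⟩
  obtain ⟨n, hn⟩ := Int.subgroup_cyclic (AddSubgroup.comap (zmultiplesHom (Additive G) (.ofMul x))
    (Subgroup.toAddSubgroup J))
  have hn' (i : ℤ) : x ^ i ∈ J ↔ n ∣ i := by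
    rw [← Int.mem_zmultiples_iff, ← AddSubgroup.zmultiples_eq_closure] at *
    rw [← hn]
    rfl
  obtain ⟨β, hβ⟩ : ∃ β : A, β ^ n * (X₀ ^ n).fst = p (x ^ n) := by
    rcases eq_or_ne n 0 with rfl | h0
    · exact ⟨1, by simp [h.one]⟩
    · obtain ⟨β, hβ⟩ := hdiv n h0 (p (x ^ n) * ((X₀ ^ n).fst)⁻¹)
      exact ⟨β, by rw [hβ, inv_mul_cancel_right]⟩
  let X : f.Ext := f.incl β * X₀
  have hXsnd (i : ℤ) : (X ^ i).snd = x ^ i := by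
    rw [← proj_apply, map_zpow]
    congr 1
    simp [X, X₀]
  have hXn : X ^ n ∈ h.section := by
    refine h.mem_section.2 ⟨by rw [hXsnd]; exact (hn' n).2 dvd_rfl, ?_⟩
    rw [hXsnd, ← hβ, (f.incl_comm β X₀).mul_zpow, mul_fst, ← map_zpow, incl_fst, incl_snd,
      f.one_left, mul_one]
  have hconj : X ∈ Subgroup.normalizer (h.section : Set f.Ext) := by
    have h1 (s : f.Ext) (hs : s ∈ h.section) : X * s * X⁻¹ ∈ h.section := by
      have hs' := h.mem_section.1 hs
      have h2 : X * s = (⟨p (x * s.snd * x⁻¹), x * s.snd * x⁻¹⟩ : f.Ext) * X := by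
        refine Ext.ext ?_ ?_
        · simp only [X, X₀, mul_fst, mul_snd, incl_fst, incl_snd, one_mul, f.one_left, mul_one,
            hs'.2]
          rw [mul_assoc, hcomp _ hs'.1, mul_left_comm, ← mul_assoc]
        · simp [X, X₀]
      rw [h2, mul_inv_cancel_right]
      exact h.mem_section.2 ⟨(hx _).1 hs'.1, rfl⟩
    refine Subgroup.mem_normalizer_iff.2 fun s ↦ ⟨h1 s, fun hs ↦ ?_⟩
    have hs1 : s.snd ∈ J := by
      have := (h.mem_section.1 hs).1
      refine (hx _).2 ?_
      simpa [X, X₀] using this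
    have h3 := h1 ⟨p s.snd, s.snd⟩ (h.mem_section.2 ⟨hs1, rfl⟩)
    have h4 := mul_mem (inv_mem h3) hs
    have h5 : s = ⟨p s.snd, s.snd⟩ * f.incl ((p s.snd)⁻¹ * s.fst) :=
      Ext.ext (by simp [f.one_right]) (by simp)
    refine h.mem_section.2 ⟨hs1, ?_⟩
    have h6 : (X * ⟨p s.snd, s.snd⟩ * X⁻¹)⁻¹ * (X * s * X⁻¹) = f.incl ((p s.snd)⁻¹ * s.fst) := by
      conv_lhs => enter [2, 1, 2]; rw [h5]
      rw [← mul_assoc X, mul_assoc _ (f.incl _), (f.incl_comm _ _).eq, ← mul_assoc (X * _),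
        inv_mul_cancel_left]
    rw [h6] at h4
    have h7 := (h.mem_section.1 h4).2
    rw [incl_fst, incl_snd, h.one] at h7
    exact (inv_mul_eq_one.1 h7).symm
  have hzpow (i : ℤ) {s : f.Ext} (hs : s ∈ h.section) : X ^ i * s * (X ^ i)⁻¹ ∈ h.section :=
    (Subgroup.mem_normalizer_iff.1 (zpow_mem hconj i) s).1 hs
  let Q : f.Ext → Prop := fun e ↦ ∃ s ∈ h.section, ∃ i : ℤ, e = s * X ^ i
  have hQmul {d e : f.Ext} (hd : Q d) (he : Q e) : Q (d * e) := by
    obtain ⟨s, hs, i, rfl⟩ := hd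
    obtain ⟨t, ht, j, rfl⟩ := he
    refine ⟨s * (X ^ i * t * (X ^ i)⁻¹), mul_mem hs (hzpow i ht), i + j, ?_⟩
    rw [zpow_add]
    group
  have hQuniq {a b : A} {g : G} (ha : Q ⟨a, g⟩) (hb : Q ⟨b, g⟩) : a = b := by
    obtain ⟨s, hs, i, hsi⟩ := ha
    obtain ⟨t, ht, j, htj⟩ := hb
    have e1 : f.incl (b⁻¹ * a) = (⟨b, g⟩ : f.Ext)⁻¹ * ⟨a, g⟩ := by
      rw [eq_inv_mul_iff_mul_eq]
      exact Ext.ext (by simp [f.one_right]) (by simp)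
    have e3 : s.snd * x ^ i = t.snd * x ^ j := by
      rw [← hXsnd, ← hXsnd, ← mul_snd, ← mul_snd, ← hsi, ← htj]
    have e4 : x ^ (i - j) ∈ J := by
      have : x ^ (i - j) = s.snd⁻¹ * t.snd := by
        rw [zpow_sub, mul_inv_eq_iff_eq_mul, mul_assoc, ← e3]
        group
      rw [this]
      exact mul_mem (inv_mem hs.1) ht.1
    obtain ⟨d, hd⟩ := (hn' _).1 e4
    have e5 : X ^ (i - j) ∈ h.section := by
      rw [hd, zpow_mul]
      exact zpow_mem hXn d
    have e6 : f.incl (b⁻¹ * a) ∈ h.section := by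
      have : f.incl (b⁻¹ * a) = X ^ (-j) * ((t⁻¹ * s) * X ^ (i - j)) * (X ^ (-j))⁻¹ := by
        rw [e1, hsi, htj, zpow_sub]
        group
      rw [this]
      exact hzpow _ (mul_mem (mul_mem (inv_mem ht) hs) e5)
    have e7 := (h.mem_section.1 e6).2
    rw [incl_fst, incl_snd, h.one] at e7
    exact (inv_mul_eq_one.1 e7).symm
  have hQex {g : G} (hg : g ∈ J') : ∃ a, Q ⟨a, g⟩ := by
    obtain ⟨i, hi⟩ := hJ' g hg
    have hq : Q ((⟨p (g * x ^ i), g * x ^ i⟩ : f.Ext) * X ^ (-i)) :=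
      ⟨_, h.mem_section.2 ⟨hi, rfl⟩, -i, rfl⟩
    have : ((⟨p (g * x ^ i), g * x ^ i⟩ : f.Ext) * X ^ (-i)).snd = g := by
      rw [mul_snd, hXsnd]
      exact (zpow_neg x i).symm ▸ mul_inv_cancel_right g _
    exact ⟨_, by rw [← this]; exact hq⟩
  choose! p' hp' using fun g (hg : g ∈ J') ↦ hQex hg
  refine ⟨p', fun g hg k hk ↦ ?_, fun g hg ↦ ?_⟩
  · exact hQuniq (hp' _ (mul_mem hg hk)) (hQmul (hp' g hg) (hp' k hk))
  · exact hQuniq (hp' g (hJJ' hg)) ⟨⟨p g, g⟩, h.mem_section.2 ⟨hg, rfl⟩, 0, by simp⟩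

end TwoCocycle

end CentralExtension

section LocallyConstant

variable {A G : Type*} [CommGroup A] [Group G]

namespace TwoCocycle

variable {f : TwoCocycle A G} {J J' : Subgroup G} {p : G → A}

variable (f) in
/-- The defect of compatibility of `p` with conjugation by `x`. -/
def defect (p : G → A) (x g : G) : A :=
  p g * f x g * (p (x * g * x⁻¹) * f (x * g * x⁻¹) x)⁻¹

lemma lift_mul (p : G → A) (x g : G) :
    (⟨1, x⟩ : f.Ext) * ⟨p g, g⟩ =
      f.incl (f.defect p x g) * ⟨p (x * g * x⁻¹), x * g * x⁻¹⟩ * ⟨1, x⟩ := by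
  refine Ext.ext ?_ (by simp)
  simp only [mul_fst, mul_snd, incl_fst, incl_snd, one_mul, mul_one, f.one_left, defect]
  rw [mul_assoc (_ * _), inv_mul_cancel_right]

lemma IsSol.defect_mul (h : f.IsSol J p) {x : G} (hx : ∀ g ∈ J, x * g * x⁻¹ ∈ J) {g k : G}
    (hg : g ∈ J) (hk : k ∈ J) : f.defect p x (g * k) = f.defect p x g * f.defect p x k := by
  have h1 (g k : G) (hg : g ∈ J) (hk : k ∈ J) :
      (⟨p (g * k), g * k⟩ : f.Ext) = ⟨p g, g⟩ * ⟨p k, k⟩ := Ext.ext (h g hg k hk) rfl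
  have h2 : x * (g * k) * x⁻¹ = (x * g * x⁻¹) * (x * k * x⁻¹) := by group
  have h3 := lift_mul (f := f) p x (g * k)
  rw [h1 g k hg hk, ← mul_assoc, lift_mul, mul_assoc, lift_mul, h2,
    h1 _ _ (hx g hg) (hx k hk), ← mul_assoc, mul_assoc (f.incl _),
    (f.incl_comm (f.defect p x k) _).symm.left_comm, ← mul_assoc (f.incl _), ← map_mul] at h3
  have h4 := mul_right_cancel (mul_right_cancel h3)
  exact (congrArg Ext.fst h4).symm

lemma defect_conj {x : G} (hx : x * x = 1) (p : G → A) (g : G) :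
    f.defect p x (x * g * x⁻¹) = (f.defect p x g)⁻¹ := by
  have h1 : (⟨1, x⟩ : f.Ext) * ⟨1, x⟩ = f.incl (f x x) := Ext.ext (by simp) (by simpa)
  have h2 : x * (x * g * x⁻¹) * x⁻¹ = g := by
    rw [show x * (x * g * x⁻¹) * x⁻¹ = (x * x) * g * (x * x)⁻¹ by group, hx]
    simp
  have h3 : (⟨1, x⟩ : f.Ext) * (⟨1, x⟩ * ⟨p g, g⟩) = f.incl (f.defect p x g) *
      (f.incl (f.defect p x (x * g * x⁻¹)) * (⟨p g, g⟩ * (⟨1, x⟩ * ⟨1, x⟩))) := by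
    rw [lift_mul, mul_assoc, (f.incl_comm (f.defect p x g) _).symm.left_comm,
      ← mul_assoc (⟨1, x⟩ : f.Ext), lift_mul, h2]
    simp only [mul_assoc]
  rw [← mul_assoc, h1, (f.incl_comm _ _).eq, ← mul_assoc, ← mul_assoc, ← map_mul] at h3
  have h4 := congrArg Ext.fst (mul_right_cancel h3)
  simp only [mul_fst, incl_fst, incl_snd, f.one_left, mul_one] at h4
  rw [eq_inv_iff_mul_eq_one, mul_comm]
  simpa using h4.symm

lemma defect_mul_apply (p ω : G → A) (x g : G) :
    f.defect (fun g ↦ p g * ω g) x g = f.defect p x g * (ω g * (ω (x * g * x⁻¹))⁻¹) := by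
  simp only [defect, mul_inv]
  simp only [mul_assoc, mul_left_comm, mul_comm]

end TwoCocycle

variable [TopologicalSpace G]

/-- A locally constant homomorphism on an open subgroup `J`. -/
structure IsLocHom (J : Subgroup G) (ω : G → A) : Prop where
  map_mul : ∀ g ∈ J, ∀ h ∈ J, ω (g * h) = ω g * ω h
  loc : ∃ L : Subgroup G, IsOpen (L : Set G) ∧ L ≤ J ∧ ∀ l ∈ L, ω l = 1

/-- A locally constant trivialization of a cocycle on an open subgroup `J`. -/
structure TwoCocycle.IsLocSol (f : TwoCocycle A G) (J : Subgroup G) (p : G → A) : Prop where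
  isSol : f.IsSol J p
  loc : ∃ L : Subgroup G, IsOpen (L : Set G) ∧ L ≤ J ∧ ∀ l ∈ L, p l = 1

/-- A cocycle which vanishes near the identity in either variable. -/
def TwoCocycle.IsLocTrivial (f : TwoCocycle A G) : Prop :=
  ∃ L : Subgroup G, IsOpen (L : Set G) ∧ ∀ l ∈ L, ∀ g, f g l = 1 ∧ f l g = 1

section

variable {J J' : Subgroup G} {ω ω' : G → A}

namespace IsLocHom

lemma map_one (h : IsLocHom J ω) : ω 1 = 1 := by
  simpa using h.map_mul 1 J.one_mem 1 J.one_mem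

lemma map_inv (h : IsLocHom J ω) {g : G} (hg : g ∈ J) : ω g⁻¹ = (ω g)⁻¹ := by
  rw [eq_inv_iff_mul_eq_one, ← h.map_mul _ (J.inv_mem hg) _ hg, inv_mul_cancel, h.map_one]

lemma mono (h : IsLocHom J' ω) (hJ : J ≤ J') (ho : IsOpen (J : Set G)) : IsLocHom J ω := by
  obtain ⟨L, hL, -, hω⟩ := h.loc
  exact ⟨fun g hg k hk ↦ h.map_mul g (hJ hg) k (hJ hk), L ⊓ J, hL.inter ho, inf_le_right,
    fun l hl ↦ hω l hl.1⟩

lemma mul (h : IsLocHom J ω) (h' : IsLocHom J ω') : IsLocHom J fun g ↦ ω g * ω' g := by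
  obtain ⟨L, hL, hLJ, hω⟩ := h.loc
  obtain ⟨L', hL', -, hω'⟩ := h'.loc
  exact ⟨fun g hg k hk ↦ by rw [h.map_mul g hg k hk, h'.map_mul g hg k hk, mul_mul_mul_comm],
    L ⊓ L', hL.inter hL', inf_le_left.trans hLJ, fun l hl ↦ by rw [hω l hl.1, hω' l hl.2, one_mul]⟩

lemma inv (h : IsLocHom J ω) : IsLocHom J fun g ↦ (ω g)⁻¹ := by
  obtain ⟨L, hL, hLJ, hω⟩ := h.loc
  exact ⟨fun g hg k hk ↦ by rw [h.map_mul g hg k hk, mul_inv],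
    L, hL, hLJ, fun l hl ↦ by rw [hω l hl, inv_one]⟩

lemma exists_pow_eq_one [IsTopologicalGroup G] [CompactSpace G] (h : IsLocHom J ω)
    (hA : ∀ a : A, ∃ k : ℕ, a ^ 2 ^ k = 1) : ∃ k : ℕ, ∀ g ∈ J, ω g ^ 2 ^ k = 1 := by
  classical
  obtain ⟨L, hL, hLJ, hω⟩ := h.loc
  have : Finite (G ⧸ L) := L.quotient_finite_of_isOpen hL
  have := Fintype.ofFinite (G ⧸ L)
  have key (q : G ⧸ L) : ∃ k : ℕ, ∀ g ∈ J, (g : G ⧸ L) = q → ω g ^ 2 ^ k = 1 := by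
    by_cases hq : ∃ g ∈ J, (g : G ⧸ L) = q
    · obtain ⟨g, hg, rfl⟩ := hq
      obtain ⟨k, hk⟩ := hA (ω g)
      refine ⟨k, fun g' hg' e ↦ ?_⟩
      have hl := QuotientGroup.eq.1 e.symm
      have : ω g' = ω g := by
        rw [← mul_inv_cancel_left g g', h.map_mul g hg _ (hLJ hl), hω _ hl, mul_one]
      rw [this, hk]
    · exact ⟨0, fun g hg e ↦ absurd ⟨g, hg, e⟩ hq⟩
  choose k hk using key
  refine ⟨∑ q, k q, fun g hg ↦ ?_⟩
  obtain ⟨d, hd⟩ := Nat.exists_eq_add_of_le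
    (Finset.single_le_sum (fun _ _ ↦ Nat.zero_le _) (Finset.mem_univ (g : G ⧸ L)) : k g ≤ ∑ q, k q)
  rw [hd, pow_add, pow_mul, hk _ g hg rfl, one_pow]

end IsLocHom

namespace TwoCocycle

variable {f : TwoCocycle A G} {p : G → A}

lemma IsLocSol.mono (h : f.IsLocSol J' p) (hJ : J ≤ J') (ho : IsOpen (J : Set G)) :
    f.IsLocSol J p := by
  obtain ⟨L, hL, -, hω⟩ := h.loc
  exact ⟨h.isSol.mono hJ, L ⊓ J, hL.inter ho, inf_le_right, fun l hl ↦ hω l hl.1⟩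

lemma IsLocSol.mul (h : f.IsLocSol J p) (hω : IsLocHom J ω) :
    f.IsLocSol J fun g ↦ p g * ω g := by
  obtain ⟨L, hL, hLJ, hl⟩ := h.loc
  obtain ⟨L', hL', -, hl'⟩ := hω.loc
  exact ⟨h.isSol.mul hω.map_mul, L ⊓ L', hL.inter hL', inf_le_left.trans hLJ, fun l hl₀ ↦ by
    simp only [hl l hl₀.1, hl' l hl₀.2, one_mul]⟩

lemma IsLocSol.isLocHom_defect [IsTopologicalGroup G] (h : f.IsLocSol J p) (hf : f.IsLocTrivial)
    {x : G} (hx : ∀ g ∈ J, x * g * x⁻¹ ∈ J) : IsLocHom J (f.defect p x) := by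
  obtain ⟨L, hL, hLJ, hl⟩ := h.loc
  obtain ⟨L', hL', hl'⟩ := hf
  refine ⟨fun g hg k hk ↦ h.isSol.defect_mul hx hg hk,
    (L ⊓ L') ⊓ (L ⊓ L').comap (MulAut.conj x).toMonoidHom, ?_, fun l hl ↦ hLJ hl.1.1,
    fun l hl₀ ↦ ?_⟩
  · refine (hL.inter hL').inter ((hL.inter hL').preimage (f := fun g ↦ x * g * x⁻¹) ?_)
    fun_prop
  · have h1 : x * l * x⁻¹ ∈ L ⊓ L' := hl₀.2
    simp [defect, hl l hl₀.1.1, hl _ h1.1, (hl' l hl₀.1.2 x).1, (hl' _ h1.2 x).2]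

theorem IsLocSol.exists_extension (h : f.IsLocSol J p)
    (hdiv : ∀ n : ℤ, n ≠ 0 → ∀ a : A, ∃ b, b ^ n = a)
    {x : G} (hx : ∀ g, g ∈ J ↔ x * g * x⁻¹ ∈ J) (hω : IsLocHom J ω)
    (hωx : ∀ g ∈ J, ω (x * g * x⁻¹) = ω g * f.defect p x g)
    (hJJ' : J ≤ J') (hJ' : ∀ g ∈ J', ∃ i : ℤ, g * x ^ i ∈ J) :
    ∃ p', f.IsLocSol J' p' := by
  have h' := h.mul hω
  obtain ⟨p', hp', hpp'⟩ := h'.isSol.exists_extension hdiv hx (fun g hg ↦ by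
    simp only [hωx g hg, defect]
    have (a b c d e : A) : a * b * c = d * (b * (a * c * (d * e)⁻¹)) * e := by
      calc _ = a * b * c * ((d * e)⁻¹ * (d * e)) := by rw [inv_mul_cancel, mul_one]
        _ = _ := by ac_rfl
    exact this ..) hJJ' hJ'
  obtain ⟨L, hL, hLJ, hl⟩ := h'.loc
  exact ⟨p', hp', L, hL, hLJ.trans hJJ', fun l hl₀ ↦ by rw [hpp' l (hLJ hl₀), hl l hl₀]⟩

end TwoCocycle

end

end LocallyConstant

section Kummer

open IntermediateField

/-- The group of roots of unity of `2`-power order. -/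
def twoTors (Ω : Type*) [Field Ω] : Subgroup Ωˣ where
  carrier := {z | ∃ k : ℕ, z ^ 2 ^ k = 1}
  one_mem' := ⟨0, by simp⟩
  mul_mem' := fun {a b} ⟨k, hk⟩ ⟨l, hl⟩ ↦ ⟨k + l, by
    rw [mul_pow, pow_add, pow_mul, hk, one_pow, one_mul, mul_comm, pow_mul, hl, one_pow]⟩
  inv_mem' := fun {a} ⟨k, hk⟩ ↦ ⟨k, by rw [inv_pow, hk, inv_one]⟩

variable {K Ω : Type*} [Field K] [Field Ω] [Algebra K Ω]

lemma exists_pow_two_pow_eq_one (a : twoTors Ω) : ∃ k : ℕ, a ^ 2 ^ k = 1 := by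
  obtain ⟨k, hk⟩ := a.2
  exact ⟨k, Subtype.ext hk⟩

lemma exists_pow_nat_eq [IsAlgClosed Ω] {n : ℕ} (hn : n ≠ 0) (a : twoTors Ω) : ∃ b, b ^ n = a := by
  obtain ⟨k, hk⟩ := a.2
  obtain ⟨e, m, hm, rfl⟩ := Nat.exists_eq_two_pow_mul_odd hn
  obtain ⟨w, hw⟩ := IsAlgClosed.exists_pow_nat_eq ((a : Ωˣ) : Ω) (n := 2 ^ e) (by positivity)
  have hw0 : w ≠ 0 := by
    rintro rfl
    rw [zero_pow (by positivity)] at hw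
    exact (a : Ωˣ).ne_zero hw.symm
  have hw' : Units.mk0 w hw0 ^ 2 ^ e = (a : Ωˣ) := Units.ext (by simpa using hw)
  let b : twoTors Ω := ⟨Units.mk0 w hw0, e + k, by rw [pow_add, pow_mul, hw', hk]⟩
  have hb : b ^ 2 ^ e = a := Subtype.ext hw'
  have hbk : b ^ 2 ^ (e + k) = 1 := by
    rw [pow_add, pow_mul, hb]
    exact Subtype.ext hk
  have hcop : Nat.Coprime m (orderOf b) :=
    (hm.coprime_two_right.pow_right _).coprime_dvd_right (orderOf_dvd_of_pow_eq_one hbk)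
  obtain ⟨c, hc⟩ := exists_pow_eq_self_of_coprime hcop
  refine ⟨b ^ c, ?_⟩
  rw [← pow_mul, mul_comm, mul_assoc, mul_comm, pow_mul, pow_mul, hc, hb]

lemma exists_zpow_eq [IsAlgClosed Ω] {n : ℤ} (hn : n ≠ 0) (a : twoTors Ω) : ∃ b, b ^ n = a := by
  obtain ⟨b, hb⟩ := exists_pow_nat_eq (Int.natAbs_ne_zero.2 hn) a
  rcases Int.natAbs_eq n with h | h
  · exact ⟨b, by rw [h, zpow_natCast, hb]⟩
  · exact ⟨b⁻¹, by rw [h, zpow_neg, inv_zpow, inv_inv, zpow_natCast, hb]⟩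

/-- The underlying element of a root of unity. -/
def tval : twoTors Ω →* Ω := (Units.coeHom Ω).comp (twoTors Ω).subtype

lemma tval_injective : Function.Injective (tval (Ω := Ω)) := fun _ _ h ↦
  Subtype.ext (Units.ext h)

lemma tval_ne_zero (a : twoTors Ω) : tval a ≠ 0 := (a : Ωˣ).ne_zero

lemma tval_inv (a : twoTors Ω) : tval a⁻¹ = (tval a)⁻¹ := by
  exact eq_inv_of_mul_eq_one_left (by rw [← map_mul, inv_mul_cancel, map_one])

lemma exists_tval_eq {z : Ω} {k : ℕ} (hz : z ^ 2 ^ k = 1) : ∃ a, tval a = z :=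
  ⟨⟨Units.mk0 z (by rintro rfl; simp at hz), k, Units.ext (by simpa)⟩, rfl⟩

open Classical in
/-- A root of unity of `2`-power order as an element of `twoTors`. -/
noncomputable def toTors (z : Ω) : twoTors Ω := if h : ∃ a, tval a = z then h.choose else 1

lemma tval_toTors {z : Ω} {k : ℕ} (hz : z ^ 2 ^ k = 1) : tval (toTors z) = z := by
  have h := exists_tval_eq hz
  rw [toTors, dif_pos h, h.choose_spec]

lemma toTors_tval (a : twoTors Ω) : toTors (tval a) = a := by
  have h : ∃ b, tval b = tval a := ⟨a, rfl⟩
  rw [toTors, dif_pos h]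
  exact tval_injective h.choose_spec

/-- The Kummer character attached to `z`. -/
noncomputable def kum (z : Ω) (g : Ω ≃ₐ[K] Ω) : twoTors Ω := toTors (g z / z)

lemma tval_kum {z : Ω} (hz : z ≠ 0) {k : ℕ} {g : Ω ≃ₐ[K] Ω} (hg : g (z ^ 2 ^ k) = z ^ 2 ^ k) :
    tval (kum z g) = g z / z :=
  tval_toTors (k := k) (by rw [div_pow, ← map_pow, hg, div_self (pow_ne_zero _ hz)])

lemma apply_eq_kum_mul {z : Ω} (hz : z ≠ 0) {k : ℕ} {g : Ω ≃ₐ[K] Ω}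
    (hg : g (z ^ 2 ^ k) = z ^ 2 ^ k) : g z = tval (kum z g) * z := by
  rw [tval_kum hz hg, div_mul_cancel₀ _ hz]

lemma kum_eq_of_apply {z : Ω} (hz : z ≠ 0) {a : twoTors Ω} {g : Ω ≃ₐ[K] Ω}
    (h : g z = tval a * z) : kum z g = a := by
  rw [kum, h, mul_div_cancel_right₀ _ hz, toTors_tval]

lemma kum_pow_eq_one {z : Ω} (hz : z ≠ 0) {k : ℕ} {g : Ω ≃ₐ[K] Ω}
    (hg : g (z ^ 2 ^ k) = z ^ 2 ^ k) : kum z g ^ 2 ^ k = 1 :=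
  tval_injective (by
    rw [map_pow, tval_kum hz hg, div_pow, ← map_pow, hg, div_self (pow_ne_zero _ hz), map_one])

lemma kum_mul {z w : Ω} (hz : z ≠ 0) (hw : w ≠ 0) {k : ℕ} {g : Ω ≃ₐ[K] Ω}
    (hgz : g (z ^ 2 ^ k) = z ^ 2 ^ k) (hgw : g (w ^ 2 ^ k) = w ^ 2 ^ k) :
    kum (z * w) g = kum z g * kum w g :=
  kum_eq_of_apply (mul_ne_zero hz hw) (by
    rw [map_mul, map_mul, apply_eq_kum_mul hz hgz, apply_eq_kum_mul hw hgw]; ring)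

lemma kum_conj {z : Ω} (hz : z ≠ 0) {k : ℕ} {g x : Ω ≃ₐ[K] Ω}
    (hg : g (x⁻¹ z ^ 2 ^ k) = x⁻¹ z ^ 2 ^ k) :
    tval (kum z (x * g * x⁻¹)) = x (tval (kum (x⁻¹ z) g)) := by
  have hx : x (x⁻¹ z) = z := by rw [← AlgEquiv.mul_apply, mul_inv_cancel]; rfl
  have hz' : x⁻¹ z ≠ 0 := by simpa using hz
  rw [tval_kum hz' hg, tval_kum (k := k) hz, map_div₀, hx]
  · rfl
  · rw [AlgEquiv.mul_apply, AlgEquiv.mul_apply, map_pow, hg, map_pow, hx]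

section Level

variable [CharZero Ω] {ζ : ℕ → Ω}

lemma exists_isRootSystem [IsAlgClosed Ω] : ∃ ζ : ℕ → Ω, IsRootSystem ζ := by
  choose r hr using fun z : Ω ↦ IsAlgClosed.exists_pow_nat_eq z two_pos
  let ζ : ℕ → Ω := fun n ↦ Nat.casesOn n 1 fun n ↦ Nat.rec (-1) (fun _ z ↦ r z) n
  refine ⟨ζ, rfl, rfl, fun n ↦ ?_⟩
  cases n with
  | zero => simp [ζ]
  | succ n => exact hr _

lemma IsRootSystem.isPrimitiveRoot (h : IsRootSystem ζ) (n : ℕ) :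
    IsPrimitiveRoot (ζ n) (2 ^ n) := by
  cases n with
  | zero => simpa using h.zero
  | succ n =>
    have : orderOf (ζ (n + 1)) = 2 ^ (n + 1) := orderOf_eq_prime_pow
      (by rw [h.pow_eq_neg_one]; norm_num) (h.pow_eq_one _)
    exact this ▸ IsPrimitiveRoot.orderOf _

lemma IsRootSystem.exists_eq_pow (h : IsRootSystem ζ) {n : ℕ} {z : Ω} (hz : z ^ 2 ^ n = 1) :
    ∃ i, z = ζ n ^ i := by
  have : NeZero (2 ^ n) := ⟨by positivity⟩
  obtain ⟨i, -, hi⟩ := (h.isPrimitiveRoot n).eq_pow_of_pow_eq_one hz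
  exact ⟨i, hi.symm⟩

variable (K) in
/-- The automorphisms fixing `z`. -/
def fixer (z : Ω) : Subgroup (Ω ≃ₐ[K] Ω) := MulAction.stabilizer _ z

lemma mem_fixer {z : Ω} {g : Ω ≃ₐ[K] Ω} : g ∈ fixer K z ↔ g z = z := Iff.rfl

lemma isOpen_fixer [Algebra.IsIntegral K Ω] (z : Ω) : IsOpen (fixer K z : Set (Ω ≃ₐ[K] Ω)) :=
  by
  have := adjoin.finiteDimensional (K := K) (Algebra.IsIntegral.isIntegral z)
  refine Subgroup.isOpen_mono (fun g hg ↦ ?_) (fixingSubgroup_isOpen K⟮z⟯)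
  exact hg ⟨z, mem_adjoin_simple_self K z⟩

lemma mem_adjoin_of_fixer [IsGalois K Ω] {z w : Ω} (h : ∀ g ∈ fixer K z, g w = w) : w ∈ K⟮z⟯ := by
  rw [← InfiniteGalois.fixedField_fixingSubgroup K⟮z⟯]
  rintro ⟨g, hg⟩
  exact h g (hg ⟨z, mem_adjoin_simple_self K z⟩)

lemma apply_eq_of_mem_adjoin {z w : Ω} (hw : w ∈ K⟮z⟯) {g : Ω ≃ₐ[K] Ω} (hg : g ∈ fixer K z) :
    g w = w := by
  have : K⟮z⟯ ≤ fixedField (Subgroup.zpowers g) := by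
    rw [adjoin_simple_le_iff]
    rintro ⟨k, i, rfl⟩
    exact (fixer K z).zpow_mem hg i
  exact this hw ⟨g, Subgroup.mem_zpowers g⟩

lemma IsRootSystem.apply_eq (h : IsRootSystem ζ) {n : ℕ} {g : Ω ≃ₐ[K] Ω}
    (hg : g ∈ fixer K (ζ n)) {z : Ω} (hz : z ^ 2 ^ n = 1) : g z = z := by
  obtain ⟨i, rfl⟩ := h.exists_eq_pow hz
  rw [map_pow, mem_fixer.1 hg]

lemma IsRootSystem.fixer_anti (h : IsRootSystem ζ) {n m : ℕ} (hnm : n ≤ m) :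
    fixer K (ζ m) ≤ fixer K (ζ n) := fun _ hg ↦ apply_eq_of_mem_adjoin (h.mem_adjoin K hnm) hg

lemma IsRootSystem.conj_mem_fixer (h : IsRootSystem ζ) {n : ℕ} (x g : Ω ≃ₐ[K] Ω)
    (hg : g ∈ fixer K (ζ n)) : x * g * x⁻¹ ∈ fixer K (ζ n) := by
  have h1 : (x⁻¹ (ζ n)) ^ 2 ^ n = 1 := by rw [← map_pow, h.pow_eq_one, map_one]
  rw [mem_fixer, AlgEquiv.mul_apply, AlgEquiv.mul_apply, h.apply_eq hg h1, ← AlgEquiv.mul_apply,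
    mul_inv_cancel]
  rfl

lemma IsRootSystem.conj_mem_fixer_iff (h : IsRootSystem ζ) {n : ℕ} (x g : Ω ≃ₐ[K] Ω) :
    g ∈ fixer K (ζ n) ↔ x * g * x⁻¹ ∈ fixer K (ζ n) :=
  ⟨h.conj_mem_fixer x g, fun hg ↦ by
    simpa [mul_assoc] using h.conj_mem_fixer x⁻¹ _ hg⟩

variable {J : Subgroup (Ω ≃ₐ[K] Ω)} {k : ℕ}

lemma IsRootSystem.kum_congr (h : IsRootSystem ζ) {z w : Ω} (hz : z ≠ 0)
    (hzw : z ^ 2 ^ k = w ^ 2 ^ k) {g : Ω ≃ₐ[K] Ω} (hg : g ∈ fixer K (ζ k)) : kum z g = kum w g := by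
  have hw : w ≠ 0 := by
    rintro rfl
    rw [zero_pow (by positivity)] at hzw
    exact hz (pow_eq_zero_iff (by positivity) |>.1 hzw)
  have h1 : g (z / w) = z / w :=
    h.apply_eq hg (by rw [div_pow, hzw, div_self (pow_ne_zero _ hw)])
  rw [map_div₀, div_eq_div_iff (by simpa) hw] at h1
  rw [kum, kum, (div_eq_div_iff hz hw).2 (by rw [h1, mul_comm])]

lemma IsRootSystem.isLocHom_kum [Algebra.IsIntegral K Ω] (h : IsRootSystem ζ)
    (hJ : IsOpen (J : Set (Ω ≃ₐ[K] Ω))) (hJk : J ≤ fixer K (ζ k)) {z : Ω} (hz : z ≠ 0)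
    (hfix : ∀ g ∈ J, g (z ^ 2 ^ k) = z ^ 2 ^ k) : IsLocHom J (kum (K := K) z) := by
  refine ⟨fun g hg g' hg' ↦ ?_, fixer K z ⊓ J, (isOpen_fixer z).inter hJ, inf_le_right,
    fun l hl ↦ kum_eq_of_apply hz (by rw [mem_fixer.1 hl.1, map_one, one_mul])⟩
  refine kum_eq_of_apply hz ?_
  rw [AlgEquiv.mul_apply, apply_eq_kum_mul hz (hfix g' hg'), map_mul,
    apply_eq_kum_mul hz (hfix g hg), h.apply_eq (hJk hg), map_mul]
  · ring
  · rw [← map_pow, kum_pow_eq_one hz (hfix g' hg'), map_one]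

/-- Hilbert 90 for homomorphisms to roots of unity. -/
lemma IsRootSystem.exists_apply_eq_mul [Algebra.IsIntegral K Ω] (h : IsRootSystem ζ)
    (hJk : J ≤ fixer K (ζ k)) {η : (Ω ≃ₐ[K] Ω) → twoTors Ω} (hη : IsLocHom J η)
    (hk : ∀ g ∈ J, η g ^ 2 ^ k = 1) : ∃ t ≠ 0, ∀ g ∈ J, g t = tval (η g) * t := by
  classical
  obtain ⟨L, hL, hLJ, hηL⟩ := hη.loc
  obtain ⟨E, hE, hEL⟩ := (krullTopology_mem_nhds_one_iff K Ω _).1 (hL.mem_nhds L.one_mem)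
  let r : J → (E →ₐ[K] Ω) := fun g ↦ (g : Ω ≃ₐ[K] Ω).toAlgHom.comp E.val
  have hr (g g' : J) (e : r g = r g') : η g = η g' := by
    have : ((g : Ω ≃ₐ[K] Ω)⁻¹ * g' : Ω ≃ₐ[K] Ω) ∈ L := hEL fun x ↦ by
      have h1 : (g : Ω ≃ₐ[K] Ω) x = (g' : Ω ≃ₐ[K] Ω) x := DFunLike.congr_fun e x
      change ((g : Ω ≃ₐ[K] Ω)⁻¹ * (g' : Ω ≃ₐ[K] Ω)) (x : Ω) = x
      rw [AlgEquiv.mul_apply, ← h1, ← AlgEquiv.mul_apply, inv_mul_cancel]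
      rfl
    rw [← mul_inv_cancel_left (g : Ω ≃ₐ[K] Ω) g', hη.map_mul _ g.2 _ (hLJ this), hηL _ this,
      mul_one]
  let T := Set.range r
  have : Fintype T := Fintype.ofFinite _
  choose γ hγ using fun q : T ↦ q.2
  let s : E → Ω := fun z ↦ ∑ q : T, (tval (η (γ q)))⁻¹ * q.1 z
  obtain ⟨z, hz⟩ : ∃ z, s z ≠ 0 := by
    by_contra! h0
    have hli := (linearIndependent_monoidHom E Ω).comp (fun q : T ↦ (q.1 : E →* Ω)) fun q q' e ↦
      Subtype.ext (AlgHom.ext fun x ↦ DFunLike.congr_fun e x)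
    rw [Fintype.linearIndependent_iff] at hli
    have := hli (fun q ↦ (tval (η (γ q)))⁻¹) (funext fun z ↦ by
      simpa [s, Finset.sum_apply] using h0 z) ⟨r 1, 1, rfl⟩
    exact inv_ne_zero (tval_ne_zero _) this
  refine ⟨s z, hz, fun g hg ↦ ?_⟩
  let m : T → T := fun q ↦ ⟨r (⟨g, hg⟩ * γ q), Set.mem_range_self _⟩
  have hm (q : T) (x : E) : (m q).1 x = g (q.1 x) := by
    rw [← hγ q]; rfl
  have hmb : Function.Bijective m := Finite.injective_iff_bijective.1 fun q q' e ↦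
    Subtype.ext (AlgHom.ext fun x ↦ g.injective (by rw [← hm, ← hm, e]))
  have hηm (q : T) : η (γ (m q)) = η g * η (γ q) := by
    rw [← hη.map_mul g hg _ (γ q).2]
    exact hr _ (⟨g, hg⟩ * γ q) (hγ (m q))
  have hηg (q : T) : g (tval (η (γ q)))⁻¹ = (tval (η (γ q)))⁻¹ := h.apply_eq (hJk hg) (by
    rw [inv_pow, ← map_pow, hk _ (γ q).2, map_one, inv_one])
  simp only [s]
  rw [map_sum, Finset.mul_sum, ← hmb.sum_comp fun q : T ↦ tval (η g) * ((tval (η (γ q)))⁻¹ * q.1 z)]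
  refine Finset.sum_congr rfl fun q _ ↦ ?_
  rw [hηm, hm, map_mul g, hηg, map_mul tval, mul_inv, ← mul_assoc, ← mul_assoc,
    mul_inv_cancel₀ (tval_ne_zero _), one_mul]

end Level

end Kummer

section Descent

open IntermediateField

variable {K Ω : Type*} [Field K] [NumberField K] [Field Ω] [Algebra K Ω] [CharZero Ω]
  [IsAlgClosed Ω] [IsGalois K Ω] {ζ : ℕ → Ω}

lemma conj_apply_apply (x g : Ω ≃ₐ[K] Ω) (z : Ω) : (x * g * x⁻¹) (x z) = x (g z) := by
  change x (g (x⁻¹ (x z))) = _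
  rw [← AlgEquiv.mul_apply x⁻¹, inv_mul_cancel]
  rfl

lemma apply_eq_or_eq_neg_of_sq {δ : Ω} {a : K} (hδ : δ ^ 2 = algebraMap K Ω a) (g : Ω ≃ₐ[K] Ω) :
    g δ = δ ∨ g δ = -δ :=
  sq_eq_sq_iff_eq_or_eq_neg.1 (by rw [← map_pow, hδ, AlgEquiv.commutes])

lemma conj_mem_fixer_of_sq {δ : Ω} {a : K} (hδ : δ ^ 2 = algebraMap K Ω a) (x g : Ω ≃ₐ[K] Ω)
    (hg : g ∈ fixer K δ) : x * g * x⁻¹ ∈ fixer K δ := by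
  rcases apply_eq_or_eq_neg_of_sq hδ x with h | h
  · rw [mem_fixer]; conv_lhs => rw [← h]
    rw [conj_apply_apply, mem_fixer.1 hg, h]
  · have h' : δ = x (-δ) := by rw [map_neg, h, neg_neg]
    rw [mem_fixer]; conv_lhs => rw [h']
    rw [conj_apply_apply, map_neg, mem_fixer.1 hg, map_neg, h, neg_neg]

lemma IsRootSystem.exists_isLocHom_of_anti (hζ : IsRootSystem ζ) {δ : Ω} {a : K}
    (hδ : δ ^ 2 = algebraMap K Ω a) (ha : a ≠ 0) {τ : Ω ≃ₐ[K] Ω} (hτ : ∀ n, τ ∈ fixer K (ζ n))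
    (hτδ : τ δ = -δ) {χ : (Ω ≃ₐ[K] Ω) → twoTors Ω} (hχ : IsLocHom (fixer K δ) χ)
    (hχτ : ∀ g ∈ fixer K δ, χ (τ * g * τ⁻¹) = (χ g)⁻¹) (hχ2 : χ (τ * τ) = 1) :
    ∃ m ω, IsLocHom (fixer K (ζ m) ⊓ fixer K δ) ω ∧
      ∀ g ∈ fixer K (ζ m) ⊓ fixer K δ, ω (τ * g * τ⁻¹) = ω g * (χ g)⁻¹ := by
  have hδ0 : δ ≠ 0 := by
    rintro rfl
    exact ha ((algebraMap K Ω).injective (by rw [← hδ, map_zero]; simp))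
  have hop (m : ℕ) : IsOpen ((fixer K (ζ m) ⊓ fixer K δ : Subgroup _) : Set (Ω ≃ₐ[K] Ω)) :=
    (isOpen_fixer _).inter (isOpen_fixer _)
  obtain ⟨k, hk⟩ := hχ.exists_pow_eq_one exists_pow_two_pow_eq_one
  have hτt (u : twoTors Ω) : τ (tval u) = tval u := by
    obtain ⟨l, hl⟩ := exists_pow_two_pow_eq_one u
    exact hζ.apply_eq (hτ l) (by rw [← map_pow, hl, map_one])
  obtain ⟨t, ht0, ht⟩ := hζ.exists_apply_eq_mul (k := k) (inf_le_left : _ ⊓ fixer K δ ≤ _)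
    (hχ.mono inf_le_right (hop k)) (fun g hg ↦ hk g hg.2)
  have htτ (g : Ω ≃ₐ[K] Ω) (hg : g ∈ fixer K (ζ k) ⊓ fixer K δ) :
      g (τ t) = (tval (χ g))⁻¹ * τ t := by
    have hg' : τ⁻¹ * g * τ ∈ fixer K (ζ k) ⊓ fixer K δ := by
      constructor
      · simpa using hζ.conj_mem_fixer τ⁻¹ g hg.1
      · simpa using conj_mem_fixer_of_sq hδ τ⁻¹ g hg.2
    have h1 := conj_apply_apply τ (τ⁻¹ * g * τ) t
    have h2 : τ * (τ⁻¹ * g * τ) * τ⁻¹ = g := by group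
    rw [ht _ hg', map_mul, hτt, h2] at h1
    rw [h1, ← tval_inv, ← hχτ _ hg.2]
    have h3 := hχτ _ hg'.2
    rw [h2] at h3
    rw [hχτ _ hg.2, h3, inv_inv]
  have hyJ (g : Ω ≃ₐ[K] Ω) (hg : g ∈ fixer K (ζ k) ⊓ fixer K δ) : g (t * τ t) = t * τ t := by
    rw [map_mul, ht g hg, htτ g hg]
    field_simp [tval_ne_zero]
  have hττ : τ * τ ∈ fixer K δ := by
    rw [mem_fixer, AlgEquiv.mul_apply, hτδ, map_neg, hτδ, neg_neg]
  have hyτ : τ (t * τ t) = t * τ t := by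
    have h1 := ht (τ * τ) ⟨(fixer K _).mul_mem (hτ k) (hτ k), hττ⟩
    rw [hχ2, map_one, one_mul] at h1
    rw [map_mul, mul_comm, ← AlgEquiv.mul_apply τ τ, h1]
  have hy : t * τ t ∈ K⟮ζ k⟯ := mem_adjoin_of_fixer fun g hg ↦ by
    rcases apply_eq_or_eq_neg_of_sq hδ g with h | h
    · exact hyJ g ⟨hg, h⟩
    · have := hyJ (g * τ) ⟨(fixer K _).mul_mem hg (hτ k), by
        change g (τ δ) = δ
        rw [hτδ, map_neg, h, neg_neg]⟩
      rwa [AlgEquiv.mul_apply, hyτ] at this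
  obtain ⟨m, hkm, X, hX, Y, hY, hXY⟩ := hζ.exists_sq_sub_mul_sq
    (IntermediateField.algebraMap_mem _ a) hy ((map_ne_zero _).2 ha)
  let v := X + Y * δ
  have hτv : v * τ v = t * τ t := by
    rw [hXY, ← hδ]
    simp only [v, map_add, map_mul, apply_eq_of_mem_adjoin hX (hτ m),
      apply_eq_of_mem_adjoin hY (hτ m), hτδ]
    ring
  have hv0 : v ≠ 0 := by
    intro h0
    rw [h0, zero_mul] at hτv
    exact mul_ne_zero ht0 (by simpa) hτv.symm
  have hτv0 : τ v ≠ 0 := by simpa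
  have hvJ (g : Ω ≃ₐ[K] Ω) (hg : g ∈ fixer K (ζ m) ⊓ fixer K δ) : g v = v := by
    simp only [v, map_add, map_mul, apply_eq_of_mem_adjoin hX hg.1,
      apply_eq_of_mem_adjoin hY hg.1, mem_fixer.1 hg.2]
  have hle : fixer K (ζ m) ⊓ fixer K δ ≤ fixer K (ζ k) ⊓ fixer K δ :=
    inf_le_inf_right _ (hζ.fixer_anti hkm)
  let s := t / v
  have hs0 : s ≠ 0 := div_ne_zero ht0 hv0
  have hs (g : Ω ≃ₐ[K] Ω) (hg : g ∈ fixer K (ζ m) ⊓ fixer K δ) : g s = tval (χ g) * s := by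
    simp only [s]
    rw [map_div₀, ht g (hle hg), hvJ g hg, mul_div_assoc]
  have hsτ : s * τ s = 1 := by
    simp only [s, map_div₀]
    rw [div_mul_div_comm, hτv, div_self (mul_ne_zero ht0 (by simpa))]
  let x := s ^ 2 ^ k
  have hxτ : x * τ x = 1 := by
    simp only [x]
    rw [map_pow, ← mul_pow, hsτ, one_pow]
  have hxJ (g : Ω ≃ₐ[K] Ω) (hg : g ∈ fixer K (ζ m) ⊓ fixer K δ) : g x = x := by
    simp only [x]
    rw [map_pow, hs g hg, mul_pow, ← map_pow, hk g hg.2, map_one, one_mul]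
  obtain ⟨w, hw0, hwJ, hwτ⟩ : ∃ w ≠ 0, (∀ g ∈ fixer K (ζ m) ⊓ fixer K δ, g w = w) ∧
      w = x * τ w := by
    by_cases hx1 : x = -1
    · exact ⟨δ, hδ0, fun g hg ↦ hg.2, by rw [hx1, hτδ]; ring⟩
    · refine ⟨1 + x, fun h ↦ hx1 (by linear_combination h), fun g hg ↦ ?_, ?_⟩
      · rw [map_add, map_one, hxJ g hg]
      · rw [map_add, map_one]; linear_combination -hxτ
  obtain ⟨z, hz⟩ := IsAlgClosed.exists_pow_nat_eq w (n := 2 ^ k) (by positivity)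
  have hz0 : z ≠ 0 := by
    rintro rfl
    exact hw0 (by rw [← hz, zero_pow (by positivity)])
  have hzJ (g : Ω ≃ₐ[K] Ω) (hg : g ∈ fixer K (ζ m) ⊓ fixer K δ) :
      g (z ^ 2 ^ k) = z ^ 2 ^ k := by rw [hz, hwJ g hg]
  refine ⟨m, kum z, hζ.isLocHom_kum (k := k) (hop m) (inf_le_left.trans (hζ.fixer_anti hkm))
    hz0 hzJ, fun g hg ↦ kum_eq_of_apply hz0 ?_⟩
  have hg' : τ * g * τ⁻¹ ∈ fixer K (ζ m) ⊓ fixer K δ :=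
    ⟨hζ.conj_mem_fixer τ g hg.1, conj_mem_fixer_of_sq hδ τ g hg.2⟩
  have hsz : s * τ z ≠ 0 := mul_ne_zero hs0 (by simpa)
  have h1 : (τ * g * τ⁻¹) (z / (s * τ z)) = z / (s * τ z) := by
    refine hζ.apply_eq (hζ.fixer_anti hkm hg'.1) ?_
    rw [div_pow, mul_pow, ← map_pow, hz]
    change w / (x * τ w) = 1
    rw [← hwτ, div_self hw0]
  have h2 : (τ * g * τ⁻¹) (s * τ z) = tval (kum z g * (χ g)⁻¹) * (s * τ z) := by
    rw [map_mul, conj_apply_apply, apply_eq_kum_mul hz0 (hzJ g hg), map_mul, hτt, hs _ hg',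
      hχτ g hg.2, map_mul]
    ring
  have h3 : z = z / (s * τ z) * (s * τ z) := (div_mul_cancel₀ _ hsz).symm
  conv_lhs => rw [h3]
  rw [map_mul, h1, h2, mul_left_comm, div_mul_cancel₀ _ hsz]

/-- The trace to the real subfield of a root of unity. -/
abbrev IsRootSystem.re (_ : IsRootSystem ζ) (n : ℕ) : Ω := ζ n + (ζ n)⁻¹

lemma IsRootSystem.mem_fixer_re (hζ : IsRootSystem ζ) {n : ℕ} {g : Ω ≃ₐ[K] Ω} :
    g ∈ fixer K (hζ.re n) ↔ g (ζ n) = ζ n ∨ g (ζ n) = (ζ n)⁻¹ := by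
  have h0 := hζ.ne_zero n
  have h1 : g (ζ n) ≠ 0 := by simpa
  rw [mem_fixer, IsRootSystem.re, map_add, map_inv₀]
  constructor
  · intro h
    have : (g (ζ n) - ζ n) * (g (ζ n) * ζ n - 1) = 0 := by
      field_simp at h
      linear_combination h
    rcases mul_eq_zero.1 this with h | h
    · exact .inl (sub_eq_zero.1 h)
    · exact .inr (eq_inv_of_mul_eq_one_left (sub_eq_zero.1 h))
  · rintro (h | h)
    · rw [h]
    · rw [h, inv_inv, add_comm]

lemma IsRootSystem.fixer_le_fixer_re (hζ : IsRootSystem ζ) (n : ℕ) :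
    fixer K (ζ n) ≤ fixer K (hζ.re n) := fun _ hg ↦ hζ.mem_fixer_re.2 (.inl hg)

lemma TwoCocycle.IsLocSol.exists_fixer_re {f : TwoCocycle (twoTors Ω) (Ω ≃ₐ[K] Ω)}
    (hf : f.IsLocTrivial) (hζ : IsRootSystem ζ) {c : Ω ≃ₐ[K] Ω} (hc : c * c = 1)
    (hct : ∀ u, c (tval u) = (tval u)⁻¹) {n : ℕ} {p : (Ω ≃ₐ[K] Ω) → twoTors Ω}
    (hp : f.IsLocSol (fixer K (ζ n)) p) : ∃ m p', f.IsLocSol (fixer K (hζ.re m)) p' := by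
  have hcc (z : Ω) : c (c z) = z := by rw [← AlgEquiv.mul_apply, hc]; rfl
  have hη := hp.isLocHom_defect hf (hζ.conj_mem_fixer c)
  obtain ⟨k, hk⟩ := hη.exists_pow_eq_one exists_pow_two_pow_eq_one
  have hop (m : ℕ) : IsOpen (fixer K (ζ m) : Set (Ω ≃ₐ[K] Ω)) := isOpen_fixer _
  obtain ⟨N, hnN, hkN⟩ : ∃ N, n ≤ N ∧ k ≤ N := ⟨_, le_max_left n k, le_max_right n k⟩
  obtain ⟨t, ht0, ht⟩ := hζ.exists_apply_eq_mul (hζ.fixer_anti hkN)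
    (hη.mono (hζ.fixer_anti hnN) (hop N)) (fun g hg ↦ hk g (hζ.fixer_anti hnN hg))
  have htc (g : Ω ≃ₐ[K] Ω) (hg : g ∈ fixer K (ζ N)) :
      g (c t) = tval (f.defect p c g) * c t := by
    have h1 := conj_apply_apply c (c * g * c⁻¹) t
    have h2 : c * (c * g * c⁻¹) * c⁻¹ = g := by
      rw [show c * (c * g * c⁻¹) * c⁻¹ = (c * c) * g * (c * c)⁻¹ by group, hc]
      simp
    rw [ht _ (hζ.conj_mem_fixer c g hg), map_mul, hct, h2, TwoCocycle.defect_conj hc, tval_inv,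
      inv_inv] at h1
    exact h1
  have hi : c (ζ 2) = -ζ 2 := by
    obtain ⟨u, hu⟩ := exists_tval_eq (hζ.pow_eq_one 2)
    have h1 := hct u
    rw [hu] at h1
    rw [h1]
    exact inv_eq_of_mul_eq_one_right (by linear_combination -hζ.succ_sq 1 - hζ.one)
  let N' := max N 2
  obtain ⟨t, ht0, ht, htc⟩ : ∃ t ≠ 0, (∀ g ∈ fixer K (ζ N'), g t = tval (f.defect p c g) * t) ∧
      c t = t := by
    have hle : fixer K (ζ N') ≤ fixer K (ζ N) := hζ.fixer_anti (le_max_left ..)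
    by_cases h0 : c t = -t
    · refine ⟨ζ 2 * t, mul_ne_zero (hζ.ne_zero 2) ht0, fun g hg ↦ ?_, ?_⟩
      · rw [map_mul, ht g (hle hg), mem_fixer.1 (hζ.fixer_anti (le_max_right N 2) hg), mul_left_comm]
      · rw [map_mul, h0, hi, neg_mul_neg]
    · refine ⟨t + c t, fun h ↦ h0 (by linear_combination h), fun g hg ↦ ?_, ?_⟩
      · rw [map_add, ht g (hle hg), htc g (hle hg), mul_add]
      · rw [map_add, hcc, add_comm]
  obtain ⟨s, hs⟩ := IsAlgClosed.exists_pow_nat_eq t two_pos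
  have hs0 : s ≠ 0 := by
    rintro rfl
    exact ht0 (by rw [← hs]; simp)
  obtain ⟨m, hNm, hkm⟩ : ∃ m, N' ≤ m ∧ k + 1 ≤ m := ⟨_, le_max_left N' (k + 1), le_max_right ..⟩
  have hnm : n ≤ m := (hnN.trans (le_max_left ..)).trans hNm
  have hsJ (g : Ω ≃ₐ[K] Ω) (hg : g ∈ fixer K (ζ m)) : g (s ^ 2 ^ (k + 1)) = s ^ 2 ^ (k + 1) := by
    rw [pow_succ', pow_mul, hs, map_pow, ht g (hζ.fixer_anti hNm hg), mul_pow, ← map_pow,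
      hk g (hζ.fixer_anti hnm hg), map_one, one_mul]
  have hω := (hζ.isLocHom_kum (hop m) (hζ.fixer_anti hkm) hs0 hsJ).inv
  have hκ (g : Ω ≃ₐ[K] Ω) (hg : g ∈ fixer K (ζ m)) : f.defect p c g = kum s g ^ 2 := by
    refine tval_injective (mul_right_cancel₀ ht0 ?_)
    rw [← ht g (hζ.fixer_anti hNm hg), map_pow, ← hs, map_pow, apply_eq_kum_mul hs0 (hsJ g hg)]
    ring
  obtain ⟨p', hp'⟩ := (hp.mono (hζ.fixer_anti hnm) (hop m)).exists_extension
    (J' := fixer K (hζ.re m)) (fun _ ↦ exists_zpow_eq)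
    (hζ.conj_mem_fixer_iff c) hω (fun g hg ↦ by
      rw [hκ g hg]
      have h1 : c s = s ∨ c s = -s := sq_eq_sq_iff_eq_or_eq_neg.1 (by rw [← map_pow, hs, htc])
      have h2 : (c * g * c⁻¹) (c s) = (tval (kum s g))⁻¹ * c s := by
        rw [conj_apply_apply, apply_eq_kum_mul hs0 (hsJ g hg), map_mul, hct]
      rw [kum_eq_of_apply (a := (kum s g)⁻¹) hs0]
      · group
      · rw [tval_inv]
        rcases h1 with h | h
        · rwa [h] at h2
        · rw [h, map_neg] at h2
          linear_combination -h2) (hζ.fixer_le_fixer_re m) (fun g hg ↦ by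
      rcases hζ.mem_fixer_re.1 hg with h | h
      · exact ⟨0, by simpa⟩
      · refine ⟨1, ?_⟩
        obtain ⟨u, hu⟩ := exists_tval_eq (hζ.pow_eq_one m)
        rw [zpow_one, mem_fixer, AlgEquiv.mul_apply, ← hu, hct, hu, map_inv₀, h, inv_inv])
  exact ⟨m, p', hp'⟩

end Descent

section Positivity

open IntermediateField ComplexConjugate

variable {K Ω : Type*} [Field K] [NumberField K] [Field Ω] [Algebra K Ω] [CharZero Ω]
  [IsAlgClosed Ω] [IsGalois K Ω] {ζ : ℕ → Ω}

/-- `c` is the complex conjugation attached to `ψ`. -/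
def IsComplexConj (ψ : Ω →+* ℂ) (c : Ω ≃ₐ[K] Ω) : Prop := ∀ z, ψ (c z) = conj (ψ z)

lemma exists_isComplexConj (hK : ∀ ψ : K →+* ℂ, NumberField.ComplexEmbedding.IsReal ψ)
    (ψ : Ω →+* ℂ) : ∃ c : Ω ≃ₐ[K] Ω, IsComplexConj ψ c := by
  let _ : Algebra Ω ℂ := ψ.toAlgebra
  let _ : Algebra K ℂ := (ψ.comp (algebraMap K Ω)).toAlgebra
  have : IsScalarTower K Ω ℂ := .of_algebraMap_eq fun _ ↦ rfl
  let e : ℂ ≃ₐ[K] ℂ := AlgEquiv.ofRingEquiv (f := starRingAut) fun x ↦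
    RingHom.congr_fun (hK (ψ.comp (algebraMap K Ω))) x
  exact ⟨e.restrictNormal Ω, fun z ↦ e.restrictNormal_commutes Ω z⟩

namespace IsComplexConj

variable {ψ : Ω →+* ℂ} {c : Ω ≃ₐ[K] Ω} (hc : IsComplexConj ψ c)

lemma apply_apply (hc : IsComplexConj ψ c) (z : Ω) : c (c z) = z :=
  ψ.injective (by rw [hc, hc, Complex.conj_conj])

lemma mul_self (hc : IsComplexConj ψ c) : c * c = 1 := AlgEquiv.ext hc.apply_apply

lemma apply_tval (hc : IsComplexConj ψ c) (u : twoTors Ω) : c (tval u) = (tval u)⁻¹ := by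
  refine ψ.injective ?_
  obtain ⟨k, hk⟩ := exists_pow_two_pow_eq_one u
  have h1 : ψ (tval u) ^ 2 ^ k = 1 := by rw [← map_pow, ← map_pow, hk, map_one, map_one]
  have h2 : ‖ψ (tval u)‖ = 1 := Complex.norm_eq_one_of_pow_eq_one h1 (by positivity)
  rw [hc, map_inv₀, Complex.inv_def, Complex.normSq_eq_norm_sq, h2]
  simp

lemma apply_eq_inv (hc : IsComplexConj ψ c) {z : Ω} {k : ℕ} (hz : z ^ 2 ^ k = 1) :
    c z = z⁻¹ := by
  obtain ⟨u, rfl⟩ := exists_tval_eq hz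
  exact hc.apply_tval u

lemma map_mul_apply (hc : IsComplexConj ψ c) (z : Ω) : ψ (z * c z) = (Complex.normSq (ψ z) : ℂ) := by
  rw [map_mul, hc, Complex.mul_conj]

lemma mem_fixer_re (hc : IsComplexConj ψ c) (hζ : IsRootSystem ζ) (n : ℕ) :
    c ∈ fixer K (hζ.re n) :=
  hζ.mem_fixer_re.2 (.inr (hc.apply_eq_inv (hζ.pow_eq_one n)))

lemma im_eq_zero (hc : IsComplexConj ψ c) {z : Ω} (hz : c z = z) : (ψ z).im = 0 :=
  Complex.conj_eq_iff_im.1 (by rw [← hc, hz])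

lemma apply_mem (hc : IsComplexConj ψ c) (hζ : IsRootSystem ζ) {n : ℕ} {z : Ω}
    (hz : z ∈ K⟮ζ n⟯) : c z ∈ K⟮ζ n⟯ := by
  refine mem_adjoin_of_fixer fun g hg ↦ ?_
  have h1 := conj_apply_apply c (c * g * c⁻¹) z
  rw [apply_eq_of_mem_adjoin hz (hζ.conj_mem_fixer c g hg)] at h1
  have h2 : c * (c * g * c⁻¹) * c⁻¹ = g := by
    rw [show c * (c * g * c⁻¹) * c⁻¹ = (c * c) * g * (c * c)⁻¹ by group, hc.mul_self]
    simp
  rwa [h2] at h1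

end IsComplexConj

/-- The norms from the cyclotomic tower to its real subfield. -/
def IsNorm (ζ : ℕ → Ω) (c : Ω ≃ₐ[K] Ω) (s : Ω) : Prop := ∃ m, ∃ v ∈ K⟮ζ m⟯, s = v * c v

namespace IsNorm

variable {ψ : Ω →+* ℂ} {c : Ω ≃ₐ[K] Ω} {s t : Ω}

lemma mul (hζ : IsRootSystem ζ) (hs : IsNorm ζ c s) (ht : IsNorm ζ c t) : IsNorm ζ c (s * t) := by
  obtain ⟨m, v, hv, rfl⟩ := hs
  obtain ⟨n, w, hw, rfl⟩ := ht
  exact ⟨max m n, v * w, mul_mem (hζ.adjoin_mono K (le_max_left _ _) hv)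
    (hζ.adjoin_mono K (le_max_right _ _) hw), by rw [map_mul]; ring⟩

lemma inv (hs : IsNorm ζ c s) : IsNorm ζ c s⁻¹ := by
  obtain ⟨m, v, hv, rfl⟩ := hs
  exact ⟨m, v⁻¹, inv_mem hv, by rw [map_inv₀, mul_inv]⟩

lemma sq_of_mem {m : ℕ} (hs : s ∈ K⟮ζ m⟯) (hcs : c s = s) : IsNorm ζ c (s ^ 2) := ⟨m, s, hs, by rw [hcs, sq]⟩

lemma zero : IsNorm ζ c 0 := ⟨0, 0, zero_mem _, by simp⟩

lemma one : IsNorm ζ c 1 := ⟨0, 1, one_mem _, by simp⟩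

lemma one_add_sq (hc : IsComplexConj ψ c) (hζ : IsRootSystem ζ) {m : ℕ} (hs : s ∈ K⟮ζ m⟯)
    (hcs : c s = s) : IsNorm ζ c (1 + s ^ 2) := by
  refine ⟨max m 2, s + ζ 2, add_mem (hζ.adjoin_mono K (le_max_left _ _) hs)
    (hζ.mem_adjoin K (le_max_right _ _)), ?_⟩
  have h2 : ζ 2 ^ 2 = -1 := by rw [hζ.succ_sq, hζ.one]
  have h1 : c (ζ 2) = -ζ 2 := by
    rw [hc.apply_eq_inv (hζ.pow_eq_one 2)]
    exact inv_eq_of_mul_eq_one_right (by linear_combination -h2)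
  rw [map_add, hcs, h1]
  linear_combination h2

lemma one_add (hc : IsComplexConj ψ c) (hζ : IsRootSystem ζ) (ht : IsNorm ζ c t) :
    IsNorm ζ c (1 + t) := by
  obtain ⟨m, v, hv, rfl⟩ := ht
  set W := 1 + v * c v with hW
  have hcW : c W = W := by
    rw [hW, map_add, map_one, map_mul, hc.apply_apply, mul_comm]
  have hW0 : W ≠ 0 := fun h0 ↦ by
    have h1 := congrArg (fun z ↦ (ψ z).re) h0
    simp only [hW, map_add, hc.map_mul_apply, map_one, map_zero, Complex.add_re, Complex.one_re,
      Complex.ofReal_re, Complex.zero_re] at h1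
    linarith [Complex.normSq_nonneg (ψ v)]
  obtain ⟨n, hmn, X, hX, Y, hY, hXY⟩ := hζ.exists_sq_sub_mul_sq
    (add_mem (one_mem _) (mul_mem hv (hc.apply_mem hζ hv)) : W ∈ K⟮ζ m⟯) hv hW0
  let α := X * c X + W * (Y * c Y)
  let β := X * c Y + c X * Y
  have hW' : W ∈ K⟮ζ n⟯ := hζ.adjoin_mono K hmn
    (add_mem (one_mem _) (mul_mem hv (hc.apply_mem hζ hv)))
  have hα : α ∈ K⟮ζ n⟯ := add_mem (mul_mem hX (hc.apply_mem hζ hX))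
    (mul_mem hW' (mul_mem hY (hc.apply_mem hζ hY)))
  have hβ : β ∈ K⟮ζ n⟯ := add_mem (mul_mem hX (hc.apply_mem hζ hY))
    (mul_mem (hc.apply_mem hζ hX) hY)
  have hcα : c α = α := by
    simp only [α, map_add, map_mul, hc.apply_apply, hcW]; ring
  have hcβ : c β = β := by
    simp only [β, map_add, map_mul, hc.apply_apply]; ring
  have hβ0 : 1 + β ^ 2 ≠ 0 := fun h0 ↦ by
    have h1 := congrArg (fun z ↦ (ψ z).re) h0
    have h2 := hc.im_eq_zero hcβ
    simp only [pow_two, map_add, map_mul, map_one, map_zero, Complex.add_re, Complex.one_re,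
      Complex.zero_re, Complex.mul_re, h2] at h1
    nlinarith [mul_self_nonneg (ψ β).re]
  have hcv : c v = c X ^ 2 - W * c Y ^ 2 := by
    rw [hXY, map_sub, map_mul, map_pow, map_pow, hcW]
  have hkey : W = (1 + α ^ 2) * (1 + β ^ 2)⁻¹ := by
    rw [eq_mul_inv_iff_mul_eq₀ hβ0]
    have : W = 1 + (X ^ 2 - W * Y ^ 2) * (c X ^ 2 - W * c Y ^ 2) := by rw [← hcv, ← hXY]
    simp only [α, β]
    linear_combination this
  rw [hkey]
  exact (one_add_sq hc hζ hα hcα).mul hζ (one_add_sq hc hζ hβ hcβ).inv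

lemma add (hc : IsComplexConj ψ c) (hζ : IsRootSystem ζ) (hs : IsNorm ζ c s) (ht : IsNorm ζ c t) :
    IsNorm ζ c (s + t) := by
  rcases eq_or_ne s 0 with rfl | h
  · rwa [zero_add]
  · rw [show s + t = s * (1 + t * s⁻¹) by field_simp]
    exact hs.mul hζ ((ht.mul hζ hs.inv).one_add hc hζ)

lemma sum (hc : IsComplexConj ψ c) (hζ : IsRootSystem ζ) {ι : Type*} {S : Finset ι} {f : ι → Ω}
    (h : ∀ i ∈ S, IsNorm ζ c (f i)) : IsNorm ζ c (∑ i ∈ S, f i) := by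
  classical
  induction S using Finset.induction_on with
  | empty => simpa using zero
  | insert a S ha ih =>
    rw [Finset.sum_insert ha]
    exact (h _ (Finset.mem_insert_self ..)).add hc hζ
      (ih fun i hi ↦ h i (Finset.mem_insert_of_mem hi))

lemma natCast (hc : IsComplexConj ψ c) (hζ : IsRootSystem ζ) (n : ℕ) : IsNorm ζ c (n : Ω) := by
  induction n with
  | zero => simpa using zero
  | succ n ih => push_cast; exact ih.add hc hζ one

lemma ratCast (hc : IsComplexConj ψ c) (hζ : IsRootSystem ζ) {q : ℚ} (hq : 0 ≤ q) :
    IsNorm ζ c (q : Ω) := by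
  rw [Rat.cast_def, ← Int.toNat_of_nonneg (Rat.num_nonneg.2 hq), Int.cast_natCast, div_eq_mul_inv]
  exact (natCast hc hζ _).mul hζ (natCast hc hζ _).inv

end IsNorm

/-- Positivity at all complex embeddings. -/
def IsTotPos (y : Ω) : Prop := ∀ ψ : Ω →+* ℂ, (ψ y).im = 0 ∧ 0 < (ψ y).re

lemma coeff_prod_X_add_C_nonneg (s : Multiset ℝ) (hs : ∀ r ∈ s, 0 < r) (j : ℕ) :
    0 ≤ ((s.map fun r ↦ Polynomial.X + Polynomial.C r).prod).coeff j := by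
  induction s using Multiset.induction_on generalizing j with
  | empty => simp [Polynomial.coeff_one]; split_ifs <;> norm_num
  | cons a s ih =>
    have ih' := ih fun r hr ↦ hs r (Multiset.mem_cons_of_mem hr)
    have ha := hs a (Multiset.mem_cons_self ..)
    rw [Multiset.map_cons, Multiset.prod_cons, add_mul, Polynomial.coeff_add,
      Polynomial.coeff_C_mul]
    refine add_nonneg ?_ (mul_nonneg ha.le (ih' j))
    cases j with
    | zero => simp
    | succ j => rw [Polynomial.coeff_X_mul]; exact ih' j

open Polynomial in
lemma coeff_nonneg_of_isTotPos [Algebra.IsAlgebraic ℚ Ω] {y : Ω} (hy : IsTotPos y) (j : ℕ) :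
    0 ≤ (-1 : ℚ) ^ ((minpoly ℚ y).natDegree + j) * (minpoly ℚ y).coeff j := by
  set f := minpoly ℚ y with hf
  have hmon : f.Monic := minpoly.monic (Algebra.IsIntegral.isIntegral y)
  have hroots : ∀ r ∈ (f.aroots ℂ), r.im = 0 ∧ 0 < r.re := fun r hr ↦ by
    have h1 : r ∈ f.rootSet ℂ := by
      rw [rootSet, Finset.mem_coe, Multiset.mem_toFinset]; exact hr
    rw [hf, ← Algebra.IsAlgebraic.range_eval_eq_rootSet_minpoly (K := Ω)] at h1
    obtain ⟨φ, rfl⟩ := h1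
    exact hy φ.toRingHom
  let s : Multiset ℝ := (f.aroots ℂ).map Complex.re
  have hs : (f.aroots ℂ) = s.map (fun r : ℝ ↦ (r : ℂ)) := by
    rw [Multiset.map_map]
    conv_lhs => rw [← Multiset.map_id (f.aroots ℂ)]
    exact Multiset.map_congr rfl fun r hr ↦ Complex.ext rfl (by simp [(hroots r hr).1])
  have hsplit := (IsAlgClosed.splits (f.map (algebraMap ℚ ℂ))).eq_prod_roots_of_monic
    (hmon.map _)
  have hsplit' : f.map (algebraMap ℚ ℝ) = (s.map fun r ↦ X - C r).prod := by
    apply Polynomial.map_injective (algebraMap ℝ ℂ) Complex.ofReal_injective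
    rw [Polynomial.map_map, ← IsScalarTower.algebraMap_eq, hsplit, Polynomial.map_multiset_prod,
      Multiset.map_map]
    change ((f.aroots ℂ).map _).prod = _
    rw [hs, Multiset.map_map]
    congr 1
    refine Multiset.map_congr rfl fun r _ ↦ ?_
    simp
  have hcard : f.natDegree = s.card := by
    rw [← natDegree_map_eq_of_injective (algebraMap ℚ ℝ).injective, hsplit',
      natDegree_multiset_prod_X_sub_C_eq_card]
  have hcomp : (f.map (algebraMap ℚ ℝ)).comp (-X) =
      C ((-1) ^ f.natDegree) * (s.map fun r ↦ X + C r).prod := by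
    rw [hsplit', hcard, multiset_prod_comp, Multiset.map_map]
    have (r : ℝ) : (X - C r : ℝ[X]).comp (-X) = C (-1) * (X + C r) := by
      simp; ring
    simp only [Function.comp_def, this, Multiset.prod_map_mul, Multiset.map_const',
      Multiset.prod_replicate, map_pow]
  have h3 := congrArg (fun p : ℝ[X] ↦ p.coeff j) hcomp
  simp only [show (-X : ℝ[X]) = C (-1) * X by simp, comp_C_mul_X_coeff, coeff_map,
    coeff_C_mul] at h3
  have h4 := coeff_prod_X_add_C_nonneg s (fun r hr ↦ by
    obtain ⟨z, hz, rfl⟩ := Multiset.mem_map.1 hr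
    exact (hroots z hz).2) j
  have h5 : ((-1 : ℝ) ^ f.natDegree) * (-1) ^ f.natDegree = 1 := by
    rw [← mul_pow]; simp
  have h6 : 0 ≤ ((-1 : ℝ) ^ (f.natDegree + j)) * (f.coeff j : ℝ) := by
    have : ((-1 : ℝ) ^ (f.natDegree + j)) * (f.coeff j : ℝ) =
        (s.map fun r ↦ X + C r).prod.coeff j := by
      have h3' : (f.coeff j : ℝ) * (-1 : ℝ) ^ j =
        (-1) ^ f.natDegree * (s.map fun r ↦ X + C r).prod.coeff j := h3
      rw [mul_comm] at h3'
      rw [pow_add, mul_assoc, h3', ← mul_assoc, h5, one_mul]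
    rw [this]; exact h4
  exact_mod_cast h6

lemma IsTotPos.isNorm [Algebra.IsAlgebraic ℚ Ω] {ψ : Ω →+* ℂ} {c : Ω ≃ₐ[K] Ω} {y : Ω} {m : ℕ}
    (hc : IsComplexConj ψ c) (hζ : IsRootSystem ζ) (hy : IsTotPos y) (hm : y ∈ K⟮ζ m⟯)
    (hcy : c y = y) : IsNorm ζ c y := by
  set f := minpoly ℚ y with hf
  have hmon : f.Monic := minpoly.monic (Algebra.IsIntegral.isIntegral y)
  let d := f.natDegree
  let e : ℕ → ℚ := fun j ↦ (-1) ^ (d + j) * f.coeff j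
  have he (j : ℕ) : 0 ≤ e j := coeff_nonneg_of_isTotPos hy j
  have hpow (j : ℕ) (hj : Even j) : IsNorm ζ c (y ^ j) := by
    obtain ⟨i, rfl⟩ := hj
    rw [← two_mul, mul_comm, pow_mul]
    exact IsNorm.sq_of_mem (pow_mem hm i) (by rw [map_pow, hcy])
  let R := Finset.range (d + 1)
  let E := ∑ j ∈ R with Even j, (e j : Ω) * y ^ j
  let O := ∑ j ∈ R with ¬ Even j, (e j : Ω) * y ^ (j - 1)
  have hE : IsNorm ζ c E := IsNorm.sum hc hζ fun j hj ↦
    (IsNorm.ratCast hc hζ (he j)).mul hζ (hpow j (Finset.mem_filter.1 hj).2)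
  have hO : IsNorm ζ c O := IsNorm.sum hc hζ fun j hj ↦
    (IsNorm.ratCast hc hζ (he j)).mul hζ (hpow _ (by
      have := (Finset.mem_filter.1 hj).2
      rw [Nat.not_even_iff_odd] at this
      exact this.tsub_odd odd_one))
  have hyO : y * O = ∑ j ∈ R with ¬ Even j, (e j : Ω) * y ^ j := by
    rw [Finset.mul_sum]
    refine Finset.sum_congr rfl fun j hj ↦ ?_
    have := (Finset.mem_filter.1 hj).2
    obtain ⟨i, rfl⟩ : ∃ i, j = i + 1 := Nat.exists_eq_add_one_of_ne_zero (by rintro rfl; simp at this)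
    rw [Nat.add_sub_cancel, pow_succ]; ring
  have hEO : E = y * O := by
    have h1 : ∑ j ∈ R, (f.coeff j : Ω) * y ^ j = 0 := by
      have := minpoly.aeval ℚ y
      rw [Polynomial.aeval_eq_sum_range] at this
      simpa [Algebra.smul_def] using this
    have h2 (j : ℕ) : (f.coeff j : Ω) = (-1) ^ d * ((-1) ^ j * (e j : Ω)) := by
      simp only [e]; push_cast
      have (a : ℕ) : ((-1 : Ω) ^ a) * (-1) ^ a = 1 := by rw [← mul_pow]; simp
      rw [pow_add]
      linear_combination -(f.coeff j : Ω) * (this d * (-1) ^ j * (-1) ^ j + this j)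
    simp only [h2, mul_assoc] at h1
    rw [← Finset.mul_sum, mul_eq_zero_iff_left (by simp),
      ← Finset.sum_filter_add_sum_filter_not R (fun j ↦ Even j)] at h1
    rw [hyO, ← sub_eq_zero, ← h1, sub_eq_add_neg, ← Finset.sum_neg_distrib]
    congr 1
    · refine Finset.sum_congr rfl fun j hj ↦ ?_
      rw [(Finset.mem_filter.1 hj).2.neg_one_pow, one_mul]
    · refine Finset.sum_congr rfl fun j hj ↦ ?_
      rw [(Nat.not_even_iff_odd.1 (Finset.mem_filter.1 hj).2).neg_one_pow]
      ring
  obtain ⟨him, hre⟩ := hy ψ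
  have hyr : ψ y = ((ψ y).re : ℂ) := Complex.ext rfl (by simpa using him)
  have hterm (j : ℕ) : ψ ((e j : Ω) * y ^ j) = ((e j * (ψ y).re ^ j : ℝ) : ℂ) := by
    rw [map_mul, map_pow, map_ratCast]
    conv_lhs => rw [hyr]
    push_cast; rfl
  have hO0 : O ≠ 0 := by
    intro h0
    have h1 : ∑ j ∈ R, (e j : Ω) * y ^ j = 0 := by
      rw [← Finset.sum_filter_add_sum_filter_not R (fun j ↦ Even j), ← hyO, h0, mul_zero, add_zero]
      exact hEO.trans (by rw [h0, mul_zero])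
    have h2 := congrArg ψ h1
    simp only [map_sum, hterm, map_zero] at h2
    have h3 : ∑ j ∈ R, ((e j : ℝ) * (ψ y).re ^ j) = 0 := by exact_mod_cast h2
    have h4 := (Finset.sum_eq_zero_iff_of_nonneg fun j _ ↦
      mul_nonneg (by exact_mod_cast he j) (pow_nonneg hre.le j)).1 h3 d (by simp [R])
    have h5 : e d = 1 := by
      simp only [e, d]
      rw [hmon.coeff_natDegree, ← two_mul, pow_mul]; simp
    rw [h5] at h4
    simp [hre.ne'] at h4
  rw [show y = E * O⁻¹ by rw [hEO, mul_inv_cancel_right₀ hO0]]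
  exact hE.mul hζ hO.inv

end Positivity

section LocHom

variable {A G : Type*} [CommGroup A] [Group G] [TopologicalSpace G] {J : Subgroup G} {ω : G → A}

namespace IsLocHom

lemma one (hJ : IsOpen (J : Set G)) : IsLocHom J fun _ ↦ (1 : A) :=
  ⟨fun _ _ _ _ ↦ (one_mul 1).symm, J, hJ, le_rfl, fun _ _ ↦ rfl⟩

lemma pow (h : IsLocHom J ω) (n : ℕ) : IsLocHom J fun g ↦ ω g ^ n := by
  obtain ⟨L, hL, hLJ, hl⟩ := h.loc
  exact ⟨fun g hg k hk ↦ by rw [h.map_mul g hg k hk, mul_pow], L, hL, hLJ,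
    fun l hl₀ ↦ by rw [hl l hl₀, one_pow]⟩

lemma conj [IsTopologicalGroup G] (h : IsLocHom J ω) (hJ : IsOpen (J : Set G)) {x : G}
    (hx : ∀ g ∈ J, x * g * x⁻¹ ∈ J) : IsLocHom J fun g ↦ ω (x * g * x⁻¹) := by
  obtain ⟨L, hL, hLJ, hl⟩ := h.loc
  refine ⟨fun g hg k hk ↦ ?_, J ⊓ L.comap (MulAut.conj x).toMonoidHom, ?_, inf_le_left,
    fun l hl₀ ↦ hl _ hl₀.2⟩
  · rw [← h.map_mul _ (hx g hg) _ (hx k hk)]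
    congr 1
    group
  · refine hJ.inter (hL.preimage (f := fun g ↦ x * g * x⁻¹) ?_)
    fun_prop

lemma prod {ι : Type*} (S : Finset ι) {F : ι → G → A} (hJ : IsOpen (J : Set G))
    (h : ∀ i ∈ S, IsLocHom J (F i)) : IsLocHom J fun g ↦ ∏ i ∈ S, F i g := by
  classical
  induction S using Finset.induction_on with
  | empty => simpa using one hJ
  | insert a S ha ih =>
    simp only [Finset.prod_insert ha]
    exact (h _ (Finset.mem_insert_self ..)).mul (ih fun i hi ↦ h i (Finset.mem_insert_of_mem hi))

lemma congr {ω' : G → A} (h : IsLocHom J ω) (hω : ∀ g ∈ J, ω' g = ω g) : IsLocHom J ω' := by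
  obtain ⟨L, hL, hLJ, hl⟩ := h.loc
  exact ⟨fun g hg k hk ↦ by
    rw [hω _ (J.mul_mem hg hk), hω g hg, hω k hk, h.map_mul g hg k hk], L, hL, hLJ,
    fun l hl₀ ↦ by rw [hω l (hLJ hl₀), hl l hl₀]⟩

end IsLocHom

end LocHom

section RealTower

open IntermediateField

variable {K Ω : Type*} [Field K] [NumberField K] [Field Ω] [Algebra K Ω] [CharZero Ω]
  [IsAlgClosed Ω] [IsGalois K Ω] {ζ : ℕ → Ω}

namespace IsRootSystem

lemma re_sq (hζ : IsRootSystem ζ) (n : ℕ) : hζ.re (n + 1) ^ 2 = hζ.re n + 2 := by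
  have h0 := hζ.ne_zero (n + 1)
  have h1 := hζ.succ_sq n
  have h2 : (ζ n)⁻¹ = (ζ (n + 1))⁻¹ ^ 2 := by rw [← h1, inv_pow]
  simp only [re]
  rw [add_sq, h1, h2, mul_assoc, mul_inv_cancel₀ h0]
  ring

lemma fixer_re_anti (hζ : IsRootSystem ζ) {n m : ℕ} (hnm : n ≤ m) :
    fixer K (hζ.re m) ≤ fixer K (hζ.re n) := by
  induction m, hnm using Nat.le_induction with
  | base => rfl
  | succ m hm ih =>
    refine le_trans (fun g hg ↦ ?_) ih
    have h1 := congrArg g (hζ.re_sq m)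
    rw [map_pow, mem_fixer.1 hg, map_add, map_ofNat, hζ.re_sq] at h1
    exact (add_right_cancel h1).symm

lemma re_mem (hζ : IsRootSystem ζ) (n : ℕ) : hζ.re n ∈ K⟮ζ n⟯ :=
  add_mem (mem_adjoin_simple_self K _) (inv_mem (mem_adjoin_simple_self K _))

lemma conj_mem_fixer_re (hζ : IsRootSystem ζ) {n : ℕ} (x g : Ω ≃ₐ[K] Ω)
    (hg : g ∈ fixer K (hζ.re n)) : x * g * x⁻¹ ∈ fixer K (hζ.re n) := by
  have h1 : (x⁻¹ (ζ n)) ^ 2 ^ n = 1 := by rw [← map_pow, hζ.pow_eq_one, map_one]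
  obtain ⟨i, hi⟩ := hζ.exists_eq_pow h1
  have h2 : x (ζ n ^ i) = ζ n := by
    rw [← hi, ← AlgEquiv.mul_apply, mul_inv_cancel]; rfl
  rw [hζ.mem_fixer_re] at hg ⊢
  have h3 := conj_apply_apply x g (ζ n ^ i)
  rw [h2, map_pow] at h3
  rcases hg with h | h
  · exact .inl (by rw [h3, h, h2])
  · exact .inr (by rw [h3, h, inv_pow, map_inv₀, h2])

lemma conj_mem_fixer_re_iff (hζ : IsRootSystem ζ) {n : ℕ} (x g : Ω ≃ₐ[K] Ω) :
    g ∈ fixer K (hζ.re n) ↔ x * g * x⁻¹ ∈ fixer K (hζ.re n) :=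
  ⟨hζ.conj_mem_fixer_re x g, fun hg ↦ by simpa [mul_assoc] using hζ.conj_mem_fixer_re x⁻¹ _ hg⟩

lemma apply_re_succ (hζ : IsRootSystem ζ) {n : ℕ} {g : Ω ≃ₐ[K] Ω} (hg : g (hζ.re n) = hζ.re n) :
    g (hζ.re (n + 1)) = hζ.re (n + 1) ∨ g (hζ.re (n + 1)) = -hζ.re (n + 1) :=
  sq_eq_sq_iff_eq_or_eq_neg.1 (by rw [← map_pow, hζ.re_sq, map_add, hg, map_ofNat])

lemma apply_of_re_neg (hζ : IsRootSystem ζ) {n : ℕ} {g : Ω ≃ₐ[K] Ω}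
    (hg : g (hζ.re n) = -hζ.re n) : g (ζ n) = -ζ n ∨ g (ζ n) = -(ζ n)⁻¹ := by
  have h0 := hζ.ne_zero n
  have h1 : g (ζ n) ≠ 0 := by simpa
  rw [re, map_add, map_inv₀] at hg
  have : (g (ζ n) + ζ n) * (g (ζ n) * ζ n + 1) = 0 := by
    field_simp at hg
    linear_combination hg
  rcases mul_eq_zero.1 this with h | h
  · exact .inl (eq_neg_of_add_eq_zero_left h)
  · refine .inr ?_
    field_simp
    linear_combination h

lemma sq_two (hζ : IsRootSystem ζ) : ζ 2 ^ 2 = -1 := by rw [hζ.succ_sq, hζ.one]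

lemma re_add_three_ne_zero (hζ : IsRootSystem ζ) (n : ℕ) : hζ.re (n + 3) ≠ 0 := by
  intro h
  have h0 := hζ.ne_zero (n + 3)
  have h1 : ζ (n + 3) ^ 2 = -1 := by
    rw [re] at h
    field_simp at h
    linear_combination h
  have h2 := hζ.pow_two_pow 1 (n + 2)
  rw [show 1 + (n + 2) = n + 3 by ring, pow_succ' 2, pow_mul, h1, hζ.one, pow_succ' 2, pow_mul] at h2
  norm_num at h2

lemma apply_apply_re_succ (hζ : IsRootSystem ζ) {n : ℕ} {g : Ω ≃ₐ[K] Ω}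
    (hg : g (hζ.re (n + 3)) = -hζ.re (n + 3)) :
    (g ^ 2) (hζ.re (n + 4)) = -hζ.re (n + 4) := by
  have hpow : ζ (n + 3) ^ 2 ^ (n + 1) = ζ 2 := by
    rw [show n + 3 = 2 + (n + 1) by ring, hζ.pow_two_pow]
  have h0 := hζ.ne_zero (n + 3)
  set d := ζ 2 * (ζ (n + 3) - (ζ (n + 3))⁻¹) with hd
  have h2 : (ζ 2)⁻¹ = -ζ 2 := inv_eq_of_mul_eq_one_right (by linear_combination -hζ.sq_two)
  have hgd : g d = -d := by
    have hev (z : Ω) : (-z) ^ 2 ^ (n + 1) = z ^ 2 ^ (n + 1) := by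
      rw [pow_succ' 2, pow_mul, pow_mul, neg_sq]
    have h3 : g (ζ 2) = g (ζ (n + 3)) ^ 2 ^ (n + 1) := by rw [← map_pow, hpow]
    rw [hd, map_mul, map_sub, map_inv₀, h3]
    rcases hζ.apply_of_re_neg hg with h | h
    · rw [h, hev, hpow, inv_neg]; ring
    · rw [h, hev, inv_pow, hpow, h2, inv_neg, inv_inv]; ring
  set u := hζ.re (n + 4) with hu
  have hu2 : u ^ 2 = hζ.re (n + 3) + 2 := hζ.re_sq _
  have hgu2 : g u ^ 2 = 2 - hζ.re (n + 3) := by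
    rw [← map_pow, hu2, map_add, hg, map_ofNat]; ring
  have hud : u * g u = d ∨ u * g u = -d := by
    apply sq_eq_sq_iff_eq_or_eq_neg.1
    rw [mul_pow, hu2, hgu2, hd, mul_pow, hζ.sq_two, re]
    field_simp
    ring
  have hgud : g (u * g u) = -(u * g u) := by
    rcases hud with h | h <;> rw [h]
    · exact hgd
    · rw [map_neg, hgd]
  have hgu0 : g u ≠ 0 := (map_ne_zero g).2 (hζ.re_add_three_ne_zero (n + 1))
  rw [map_mul] at hgud
  refine mul_left_cancel₀ hgu0 ?_
  rw [sq, AlgEquiv.mul_apply, hgud]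
  ring

variable {γ : Ω ≃ₐ[K] Ω} {M : ℕ}

lemma pow_two_pow_apply_re (hζ : IsRootSystem ζ) (hγ : γ (hζ.re (M + 3)) = -hζ.re (M + 3)) (r : ℕ) :
    (γ ^ 2 ^ r) (hζ.re (M + r + 3)) = -hζ.re (M + r + 3) := by
  induction r with
  | zero => simpa using hγ
  | succ r ih =>
    have := hζ.apply_apply_re_succ ih
    rwa [← pow_mul, ← pow_succ] at this

lemma exists_pow_apply_eq_neg (hζ : IsRootSystem ζ) (hγ : γ (hζ.re (M + 3)) = -hζ.re (M + 3))
    (m : ℕ) : ∃ N, ∃ j ≥ m, (γ ^ N) (ζ (j + 1)) = -ζ (j + 1) := by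
  have hr := hζ.pow_two_pow_apply_re hγ m
  rcases hζ.apply_of_re_neg hr with h | h
  · exact ⟨2 ^ m, M + m + 2, by omega, h⟩
  · refine ⟨2 ^ m * 2, M + m + 3, by omega, ?_⟩
    have h2 := hζ.apply_apply_re_succ hr
    rw [← pow_mul] at h2
    have h3 : (γ ^ (2 ^ m * 2)) (ζ (M + m + 3)) = ζ (M + m + 3) := by
      rw [pow_mul, sq, AlgEquiv.mul_apply, h, map_neg, map_inv₀, h, inv_neg, neg_neg, inv_inv]
    refine (hζ.apply_of_re_neg h2).resolve_right fun h4 ↦ ?_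
    have h5 := congrArg (· ^ 2) h4
    simp only [← map_pow, hζ.succ_sq, h3, neg_sq, inv_pow] at h5
    have h0 := hζ.ne_zero (M + m + 3)
    have h6 : ζ (M + m + 3) ^ 2 = 1 := by
      rw [sq]
      nth_rewrite 2 [h5]
      exact mul_inv_cancel₀ h0
    have h7 := hζ.pow_two_pow 2 (M + m + 1)
    rw [show 2 + (M + m + 1) = M + m + 3 by ring, pow_succ', pow_mul, h6, one_pow] at h7
    have h8 := hζ.sq_two
    rw [← h7] at h8
    norm_num at h8

lemma exists_mul_pow_mem (hζ : IsRootSystem ζ) (hM : ∀ g : Ω ≃ₐ[K] Ω, g ∈ fixer K (hζ.re (M + 2)))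
    (hγ : γ (hζ.re (M + 3)) = -hζ.re (M + 3)) (m : ℕ) (g : Ω ≃ₐ[K] Ω) :
    ∃ i : ℕ, g * γ ^ i ∈ fixer K (hζ.re m) := by
  suffices ∀ r, ∃ i : ℕ, g * γ ^ i ∈ fixer K (hζ.re (M + r + 2)) by
    obtain ⟨i, hi⟩ := this m
    exact ⟨i, hζ.fixer_re_anti (by omega) hi⟩
  intro r
  induction r with
  | zero => exact ⟨0, hM _⟩
  | succ r ih =>
    obtain ⟨i, hi⟩ := ih
    rcases hζ.apply_re_succ hi with h | h
    · exact ⟨i, h⟩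
    · refine ⟨i + 2 ^ r, ?_⟩
      have h1 := hζ.pow_two_pow_apply_re hγ r
      rw [mem_fixer, pow_add, ← mul_assoc, AlgEquiv.mul_apply,
        show M + (r + 1) + 2 = M + r + 3 by ring, h1, map_neg]
      rw [show M + r + 2 + 1 = M + r + 3 by ring] at h
      rw [h, neg_neg]

lemma exists_twisted_kum (hζ : IsRootSystem ζ) (hγ : γ (hζ.re (M + 3)) = -hζ.re (M + 3))
    {m k : ℕ} (hk : k ≠ 0) {z : Ω} (hz0 : z ≠ 0) (hz : ∀ g ∈ fixer K (ζ m), g (z ^ 2 ^ k) = z ^ 2 ^ k) :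
    ∃ m' ≥ m, k ≤ m' ∧ ∃ Θ : (Ω ≃ₐ[K] Ω) → twoTors Ω, IsLocHom (fixer K (ζ m')) Θ ∧
      ∀ g ∈ fixer K (ζ m'), Θ (γ * g * γ⁻¹) = Θ g * kum z g := by
  obtain ⟨N, j, hj, hN⟩ := hζ.exists_pow_apply_eq_neg hγ (m + 1)
  set x := γ ^ N with hx
  have hxj : x ∈ fixer K (ζ m) := hζ.fixer_anti (by omega : m ≤ j) (by
    rw [mem_fixer, ← hζ.succ_sq, map_pow, hN, neg_sq])
  obtain ⟨s, hs⟩ := IsAlgClosed.exists_pow_nat_eq z (n := 2 ^ j) (by positivity)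
  have hs0 : s ≠ 0 := by
    rintro rfl
    exact hz0 (by rw [← hs, zero_pow (by positivity)])
  have hle : fixer K (ζ (j + k)) ≤ fixer K (ζ m) := hζ.fixer_anti (by omega)
  have hop (m : ℕ) : IsOpen (fixer K (ζ m) : Set (Ω ≃ₐ[K] Ω)) := isOpen_fixer _
  have hsw : s ^ 2 ^ (j + k) = z ^ 2 ^ k := by rw [pow_add, pow_mul, hs]
  have hsJ (g : Ω ≃ₐ[K] Ω) (hg : g ∈ fixer K (ζ (j + k))) :
      g (s ^ 2 ^ (j + k)) = s ^ 2 ^ (j + k) := by rw [hsw, hz g (hle hg)]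
  have hκ := hζ.isLocHom_kum (hop (j + k)) le_rfl hs0 hsJ
  obtain ⟨U, hU⟩ := hζ.exists_eq_pow (z := x (ζ (j + k))) (n := j + k) (by
    rw [← map_pow, hζ.pow_eq_one, map_one])
  obtain ⟨o, ho, hUo⟩ : ∃ o, Odd o ∧ U = 1 + 2 ^ j * o := by
    have h1 : ζ (j + 1) ^ U = ζ (j + 1) ^ (1 + 2 ^ j) := by
      rw [pow_add, pow_one, hζ.pow_eq_neg_one, mul_neg_one, ← hN]
      obtain ⟨l, rfl⟩ := Nat.exists_eq_add_one_of_ne_zero hk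
      rw [← hζ.pow_two_pow (j + 1) l, ← pow_mul, mul_comm, pow_mul,
        show j + 1 + l = j + (l + 1) by ring, ← hU, map_pow]
    have h2 : Units.mk0 _ (hζ.ne_zero (j + 1)) ^ U =
        Units.mk0 _ (hζ.ne_zero (j + 1)) ^ (1 + 2 ^ j) := by
      ext; simpa using h1
    rw [pow_eq_pow_iff_modEq, ← orderOf_units, Units.val_mk0,
      ← (hζ.isPrimitiveRoot (j + 1)).eq_orderOf, Nat.ModEq] at h2
    have hlt : 1 + 2 ^ j < 2 ^ (j + 1) := by
      have : 1 < 2 ^ j := Nat.one_lt_two_pow (by omega)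
      rw [pow_succ]; omega
    rw [Nat.mod_eq_of_lt hlt] at h2
    refine ⟨2 * (U / 2 ^ (j + 1)) + 1, ⟨_, rfl⟩, ?_⟩
    conv_lhs => rw [← Nat.div_add_mod U (2 ^ (j + 1)), h2]
    ring
  obtain ⟨o', -, ho'⟩ := Nat.exists_mul_mod_eq_one_of_coprime (ho.coprime_two_right.pow_right k)
    (Nat.one_lt_two_pow hk)
  have hκz (g : Ω ≃ₐ[K] Ω) (hg : g ∈ fixer K (ζ (j + k))) : kum s g ^ 2 ^ j = kum z g := by
    refine (kum_eq_of_apply hz0 ?_).symm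
    rw [← hs, map_pow, apply_eq_kum_mul hs0 (hsJ g hg), mul_pow, map_pow]
  have hκo (g : Ω ≃ₐ[K] Ω) (hg : g ∈ fixer K (ζ (j + k))) :
      (kum s g ^ 2 ^ j) ^ (o * o') = kum s g ^ 2 ^ j := by
    have h1 : (kum s g ^ 2 ^ j) ^ 2 ^ k = 1 := by
      rw [← pow_mul, ← pow_add, kum_pow_eq_one hs0 (hsJ g hg)]
    conv_lhs => rw [← Nat.div_add_mod (o * o') (2 ^ k), ho', pow_add, pow_mul, h1, one_pow, one_mul,
      pow_one]
  have hκx (g : Ω ≃ₐ[K] Ω) (hg : g ∈ fixer K (ζ (j + k))) :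
      kum s (x * g * x⁻¹) = kum s g ^ U := by
    refine kum_eq_of_apply hs0 ?_
    have hxs : x s ≠ 0 := by simpa
    have h1 : (x * g * x⁻¹) (s / x s) = s / x s := hζ.apply_eq (hζ.conj_mem_fixer x g hg) (by
      rw [div_pow, ← map_pow, hsw, hz x hxj, div_self (pow_ne_zero _ hz0)])
    have h2 : x (tval (kum s g)) = tval (kum s g) ^ U := by
      obtain ⟨i, hi⟩ := hζ.exists_eq_pow (z := tval (kum s g)) (n := j + k) (by
        rw [← map_pow, kum_pow_eq_one hs0 (hsJ g hg), map_one])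
      rw [hi, map_pow, hU, ← pow_mul, ← pow_mul, mul_comm]
    have h3 : (x * g * x⁻¹) (x s) = tval (kum s g ^ U) * x s := by
      rw [conj_apply_apply, apply_eq_kum_mul hs0 (hsJ g hg), map_mul, h2, map_pow]
    conv_lhs => rw [← div_mul_cancel₀ s hxs]
    rw [map_mul, h1, h3, mul_left_comm, div_mul_cancel₀ _ hxs]
  let F (i : ℕ) (g : Ω ≃ₐ[K] Ω) : twoTors Ω := kum s (γ ^ i * g * (γ ^ i)⁻¹) ^ o'
  refine ⟨j + k, by omega, by omega, fun g ↦ ∏ i ∈ Finset.range N, F i g,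
    IsLocHom.prod _ (hop _) fun i _ ↦ (hκ.conj (hop _) (hζ.conj_mem_fixer (γ ^ i))).pow o',
    fun g hg ↦ ?_⟩
  have hF (i : ℕ) : F i (γ * g * γ⁻¹) = F (i + 1) g := by
    simp only [F]
    congr 2
  have h1 := (Finset.prod_range_succ (fun i ↦ F i g) N).symm.trans
    (Finset.prod_range_succ' (fun i ↦ F i g) N)
  have hF0 : F 0 g = kum s g ^ o' := by simp [F]
  have hFN : F N g = F 0 g * kum z g := by
    rw [hF0]
    simp only [F]
    rw [hκx g hg, hUo, ← pow_mul, add_mul, one_mul, pow_add, mul_assoc, pow_mul (kum s g) (2 ^ j),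
      hκo g hg, hκz g hg]
  simp only [hF]
  rw [hFN, ← mul_assoc, mul_right_comm] at h1
  exact (mul_right_cancel h1).symm

end IsRootSystem

end RealTower

section SignChange

open Filter

lemma eventually_pos_mul_of_pos {a b : ℝ} (ha : a ≠ 0) (hb : 0 < b) (hb2 : b < 2) :
    ∀ᶠ B : ℕ in atTop, 0 < a * (1 + a * (1 + b / 2) ^ B) * (1 + a * (1 - b / 2) ^ B) := by
  have h1 : Tendsto (fun B : ℕ ↦ 1 + a * (1 - b / 2) ^ B) atTop (nhds (1 + a * 0)) :=
    ((tendsto_pow_atTop_nhds_zero_of_lt_one (by linarith) (by linarith)).const_mul a).const_add 1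
  rw [mul_zero, add_zero] at h1
  have h2 : Tendsto (fun B : ℕ ↦ a ^ 2 * (1 + b / 2) ^ B) atTop atTop :=
    (tendsto_pow_atTop_atTop_of_one_lt (by linarith)).const_mul_atTop (by positivity)
  filter_upwards [h1.eventually_const_lt one_pos, h2.eventually_gt_atTop (-a)] with B hB hB'
  refine mul_pos ?_ hB
  linarith [show a * (1 + a * (1 + b / 2) ^ B) = a + a ^ 2 * (1 + b / 2) ^ B by ring]

lemma eventually_pos_mul {a b : ℝ} (ha : a ≠ 0) (hb0 : b ≠ 0) (hb : |b| < 2) :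
    ∀ᶠ B : ℕ in atTop, 0 < a * (1 + a * (1 + b / 2) ^ B) * (1 + a * (1 - b / 2) ^ B) := by
  rw [abs_lt] at hb
  rcases lt_or_gt_of_ne hb0 with h | h
  · filter_upwards [eventually_pos_mul_of_pos ha (neg_pos.2 h) (by linarith)] with B hB
    convert hB using 1
    rw [mul_right_comm]
    ring
  · exact eventually_pos_mul_of_pos ha h hb.2

variable {Ω : Type*} [Field Ω] [CharZero Ω]

lemma finite_range_apply [Algebra.IsAlgebraic ℚ Ω] (y : Ω) :
    (Set.range fun ψ : Ω →+* ℂ ↦ ψ y).Finite := by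
  refine (minpoly ℚ y).rootSet_finite ℂ |>.subset ?_
  rintro _ ⟨ψ, rfl⟩
  rw [← Algebra.IsAlgebraic.range_eval_eq_rootSet_minpoly (A := ℂ) y]
  exact ⟨ψ.toRatAlgHom, rfl⟩

lemma exists_isTotPos_mul [Algebra.IsAlgebraic ℚ Ω] {y w : Ω} (hy0 : y ≠ 0) (hw0 : w ≠ 0)
    (hy : ∀ ψ : Ω →+* ℂ, (ψ y).im = 0) (hw : ∀ ψ : Ω →+* ℂ, (ψ w).im = 0)
    (hw2 : ∀ ψ : Ω →+* ℂ, |(ψ w).re| < 2) :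
    ∃ B : ℕ, IsTotPos (y * (1 + y * (1 + w / 2) ^ B) * (1 + y * (1 - w / 2) ^ B)) := by
  have hfin : (Set.range fun ψ : Ω →+* ℂ ↦ (ψ y, ψ w)).Finite :=
    ((finite_range_apply y).prod (finite_range_apply w)).subset (by
      rintro _ ⟨ψ, rfl⟩
      exact ⟨⟨ψ, rfl⟩, ⟨ψ, rfl⟩⟩)
  have hre (ψ : Ω →+* ℂ) {z : Ω} (hz : (ψ z).im = 0) : ψ z = ((ψ z).re : ℂ) :=
    Complex.ext rfl (by simp [hz])
  have hev : ∀ᶠ B : ℕ in atTop, ∀ q ∈ Set.range fun ψ : Ω →+* ℂ ↦ (ψ y, ψ w),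
      0 < q.1.re * (1 + q.1.re * (1 + q.2.re / 2) ^ B) * (1 + q.1.re * (1 - q.2.re / 2) ^ B) := by
    rw [Filter.eventually_all_finite hfin]
    rintro _ ⟨ψ, rfl⟩
    refine eventually_pos_mul (fun h ↦ ?_) (fun h ↦ ?_) (hw2 ψ)
    · exact hy0 ((map_eq_zero ψ).1 (by rw [hre ψ (hy ψ), h, Complex.ofReal_zero]))
    · exact hw0 ((map_eq_zero ψ).1 (by rw [hre ψ (hw ψ), h, Complex.ofReal_zero]))
  obtain ⟨B, hB⟩ := hev.exists
  refine ⟨B, fun ψ ↦ ?_⟩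
  have h1 : ψ (y * (1 + y * (1 + w / 2) ^ B) * (1 + y * (1 - w / 2) ^ B)) =
      (((ψ y).re * (1 + (ψ y).re * (1 + (ψ w).re / 2) ^ B) *
        (1 + (ψ y).re * (1 - (ψ w).re / 2) ^ B) : ℝ) : ℂ) := by
    simp only [map_mul, map_add, map_one, map_pow, map_div₀, map_ofNat, map_sub]
    push_cast
    rw [← hre ψ (hy ψ), ← hre ψ (hw ψ)]
  rw [h1]
  exact ⟨Complex.ofReal_im _, by rw [Complex.ofReal_re]; exact hB _ ⟨ψ, rfl⟩⟩

end SignChange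

section RealTower

open IntermediateField

variable {K Ω : Type*} [Field K] [NumberField K] [Field Ω] [Algebra K Ω] [CharZero Ω]
  [IsAlgClosed Ω] [IsGalois K Ω] {ζ : ℕ → Ω}

lemma IsTotPos.mul {y z : Ω} (hy : IsTotPos y) (hz : IsTotPos z) : IsTotPos (y * z) := fun ψ ↦ by
  obtain ⟨h1, h2⟩ := hy ψ
  obtain ⟨h3, h4⟩ := hz ψ
  rw [map_mul, Complex.mul_im, Complex.mul_re, h1, h3]
  exact ⟨by ring, by simpa using mul_pos h2 h4⟩

lemma isTotPos_sq {y : Ω} (hy0 : y ≠ 0) (hy : ∀ ψ : Ω →+* ℂ, (ψ y).im = 0) : IsTotPos (y ^ 2) :=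
  fun ψ ↦ by
  have h0 : (ψ y).re ≠ 0 := fun h ↦ hy0 ((map_eq_zero ψ).1 (Complex.ext h (hy ψ)))
  rw [map_pow, sq, Complex.mul_im, Complex.mul_re, hy ψ]
  exact ⟨by ring, by simpa using mul_self_pos.2 h0⟩

namespace IsRootSystem

lemma im_eq_zero_of_fixer_re (hζ : IsRootSystem ζ)
    (hK : ∀ ψ : K →+* ℂ, NumberField.ComplexEmbedding.IsReal ψ) {n : ℕ} {z : Ω}
    (hz : ∀ g ∈ fixer K (hζ.re n), g z = z) (ψ : Ω →+* ℂ) : (ψ z).im = 0 := by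
  obtain ⟨c, hc⟩ := exists_isComplexConj hK ψ
  exact hc.im_eq_zero (hz c (hc.mem_fixer_re hζ n))

lemma abs_re_lt_two (hζ : IsRootSystem ζ)
    (hK : ∀ ψ : K →+* ℂ, NumberField.ComplexEmbedding.IsReal ψ) {n : ℕ} (ψ : Ω →+* ℂ) :
    |(ψ (hζ.re (n + 3))).re| < 2 := by
  have him := hζ.im_eq_zero_of_fixer_re hK (n := n + 3) (fun g hg ↦ mem_fixer.1 hg) ψ
  have him' := hζ.im_eq_zero_of_fixer_re hK (n := n + 4) (fun g hg ↦ mem_fixer.1 hg) ψ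
  obtain ⟨c, hc⟩ := exists_isComplexConj hK ψ
  have h1 := hc.map_mul_apply (ζ (n + 3))
  have h0 := hζ.ne_zero (n + 3)
  rw [hc.apply_eq_inv (hζ.pow_eq_one (n + 3)), mul_inv_cancel₀ h0, map_one] at h1
  have h2 : Complex.normSq (ψ (ζ (n + 3))) = 1 := by exact_mod_cast h1.symm
  have h3 : (ψ (hζ.re (n + 3))).re = 2 * (ψ (ζ (n + 3))).re := by
    rw [re, map_add, ← hc.apply_eq_inv (hζ.pow_eq_one (n + 3)), hc, Complex.add_re,
      Complex.conj_re]
    ring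
  have h4 : (ψ (ζ (n + 3))).im ≠ 0 := fun h ↦ by
    rw [Complex.normSq_apply, h] at h2
    have h5 : ψ (ζ (n + 3) ^ 2) = 1 := by
      rw [map_pow, sq]
      refine Complex.ext ?_ ?_ <;> simp [h]
      simpa using h2
    rw [hζ.succ_sq, map_eq_one_iff ψ ψ.injective] at h5
    have h6 := hζ.pow_two_pow 1 (n + 1)
    rw [show 1 + (n + 1) = n + 2 by ring, h5, one_pow, hζ.one] at h6
    norm_num at h6
  rw [Complex.normSq_apply] at h2
  rw [h3, abs_lt]
  have := mul_self_pos.2 h4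
  constructor <;> nlinarith

lemma apply_mul_conj_eq (hζ : IsRootSystem ζ) {ψ : Ω →+* ℂ} {c : Ω ≃ₐ[K] Ω}
    (hc : IsComplexConj ψ c) {n : ℕ} {η : (Ω ≃ₐ[K] Ω) → twoTors Ω}
    (hη : IsLocHom (fixer K (hζ.re n)) η) {t : Ω}
    (ht : ∀ g ∈ fixer K (ζ n), g t = tval (η g) * t) (g : Ω ≃ₐ[K] Ω)
    (hg : g ∈ fixer K (hζ.re n)) : g (t * c t) = t * c t := by
  have hcR := hc.mem_fixer_re hζ n
  have hcinv : c⁻¹ = c := inv_eq_of_mul_eq_one_left hc.mul_self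
  have key (g : Ω ≃ₐ[K] Ω) (hg : g ∈ fixer K (ζ n)) : g (t * c t) = t * c t := by
    have h1 : c (c * g * c⁻¹ <| t) = g (c t) := by
      rw [hcinv, AlgEquiv.mul_apply, AlgEquiv.mul_apply, hc.apply_apply]
    have h2 : η (c * g * c⁻¹) = η g := by
      have hgR := hζ.fixer_le_fixer_re n hg
      rw [hη.map_mul _ (mul_mem hcR hgR) _ (inv_mem hcR), hη.map_mul _ hcR _ hgR,
        hη.map_inv hcR, mul_inv_cancel_comm]
    rw [map_mul, ← h1, ht _ (hζ.conj_mem_fixer c g hg), h2, map_mul, hc.apply_tval, ht g hg]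
    field_simp [tval_ne_zero]
  rcases hζ.mem_fixer_re.1 hg with h | h
  · exact key g h
  · have h1 := key (g * c) (by
      rw [mem_fixer, AlgEquiv.mul_apply, hc.apply_eq_inv (hζ.pow_eq_one n), map_inv₀, h, inv_inv])
    rwa [AlgEquiv.mul_apply, map_mul, hc.apply_apply, mul_comm (c t)] at h1

lemma exists_isTotPos_twist [Algebra.IsAlgebraic ℚ Ω] (hζ : IsRootSystem ζ)
    (hK : ∀ ψ : K →+* ℂ, NumberField.ComplexEmbedding.IsReal ψ) {ψ : Ω →+* ℂ} {c γ : Ω ≃ₐ[K] Ω}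
    (hc : IsComplexConj ψ c) {M r : ℕ} (hγ : γ (hζ.re (M + 3)) = -hζ.re (M + 3))
    {η : (Ω ≃ₐ[K] Ω) → twoTors Ω} (hη : IsLocHom (fixer K (hζ.re (M + r + 2))) η) {t : Ω}
    (ht0 : t ≠ 0) (ht : ∀ g ∈ fixer K (ζ (M + r + 2)), g t = tval (η g) * t) :
    ∃ l : (Ω ≃ₐ[K] Ω) → twoTors Ω, IsLocHom (fixer K (hζ.re (M + r + 3))) l ∧ ∃ t' ≠ 0,
      (∀ g ∈ fixer K (ζ (M + r + 3)), g t' = tval (η g * (l g * (l (γ * g * γ⁻¹))⁻¹)) * t') ∧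
      IsTotPos (t' * c t') := by
  set R := fixer K (hζ.re (M + r + 2)) with hR
  set R' := fixer K (hζ.re (M + r + 3)) with hR'
  have hRR : R' ≤ R := hζ.fixer_re_anti (by omega)
  have hc0 (z : Ω) (hz : z ≠ 0) : c z ≠ 0 := by simpa
  set y := t * c t with hy
  have hy0 : y ≠ 0 := mul_ne_zero ht0 (hc0 t ht0)
  have hyR : ∀ g ∈ R, g y = y := hζ.apply_mul_conj_eq hc hη ht
  set u := hζ.re (M + r + 3) with hu
  have hu0 : u ≠ 0 := hζ.re_add_three_ne_zero _
  have him {z : Ω} (hz : ∀ g ∈ R', g z = z) (φ : Ω →+* ℂ) : (φ z).im = 0 :=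
    hζ.im_eq_zero_of_fixer_re hK hz φ
  obtain ⟨B, hB⟩ := exists_isTotPos_mul hy0 hu0 (him fun g hg ↦ hyR g (hRR hg))
    (him fun g hg ↦ hg) (fun φ ↦ hζ.abs_re_lt_two hK φ)
  set v := 1 + y * (1 + u / 2) ^ B with hv
  have hvR : ∀ g ∈ R', g v = v := fun g hg ↦ by
    simp only [hv, map_add, map_one, map_mul, map_pow, map_div₀, map_ofNat, hyR g (hRR hg),
      show g u = u from mem_fixer.1 hg]
  have hNu := hζ.pow_two_pow_apply_re hγ r
  rw [← hu] at hNu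
  have hNR : γ ^ 2 ^ r ∈ R := by
    have h1 := congrArg (fun z ↦ (γ ^ 2 ^ r) z) (hζ.re_sq (M + r + 2))
    rw [map_pow, ← hu, hNu, map_add, neg_sq, map_ofNat, hu, hζ.re_sq] at h1
    exact (add_right_cancel h1).symm
  have hNv : (γ ^ 2 ^ r) v = 1 + y * (1 - u / 2) ^ B := by
    simp only [hv, map_add, map_one, map_mul, map_pow, map_div₀, map_ofNat, hyR _ hNR, hNu]
    ring
  rw [← hNv] at hB
  have hne {z : Ω} (hz : IsTotPos z) : z ≠ 0 := by
    rintro rfl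
    simpa using (hz ψ).2
  have hv0 : v ≠ 0 := fun h ↦ hne hB (by rw [h]; simp)
  have hconj (x : Ω ≃ₐ[K] Ω) {z : Ω} (hz : ∀ g ∈ R', g z = z) : ∀ g ∈ R', g (x z) = x z :=
    fun g hg ↦ by
      have h1 := conj_apply_apply x⁻¹ g (x z)
      have h2 : x⁻¹ (x z) = z := by rw [← AlgEquiv.mul_apply, inv_mul_cancel]; rfl
      rw [h2, hz _ (hζ.conj_mem_fixer_re x⁻¹ g hg)] at h1
      exact x⁻¹.injective (h1.symm.trans h2.symm)
  set w' := ∏ i ∈ Finset.range (2 ^ r), (γ ^ i) v with hw'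
  have hpow (i : ℕ) : γ ((γ ^ i) v) = (γ ^ (i + 1)) v := by rw [pow_succ', AlgEquiv.mul_apply]
  have hw'0 : w' ≠ 0 := Finset.prod_ne_zero_iff.2 fun i _ ↦ (map_ne_zero _).2 hv0
  have hw'R : ∀ g ∈ R', g w' = w' := fun g hg ↦ by
    rw [hw', map_prod]
    exact Finset.prod_congr rfl fun i _ ↦ hconj _ hvR g hg
  have hgw : γ w' * v = w' * (γ ^ 2 ^ r) v := by
    have h1 := (Finset.prod_range_succ (fun i ↦ (γ ^ i) v) (2 ^ r)).symm.trans
      (Finset.prod_range_succ' (fun i ↦ (γ ^ i) v) (2 ^ r))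
    rw [hw', map_prod]
    simp only [hpow]
    exact h1.symm
  have hpos : IsTotPos (y * γ w' * w') := by
    have h1 : y * γ w' * w' = y * v * (γ ^ 2 ^ r) v * (w' / v) ^ 2 := by
      field_simp
      linear_combination hgw
    rw [h1]
    refine hB.mul (isTotPos_sq (div_ne_zero hw'0 hv0) (him fun g hg ↦ ?_))
    rw [map_div₀, hw'R g hg, hvR g hg]
  obtain ⟨s', hs'⟩ := IsAlgClosed.exists_pow_nat_eq w' two_pos
  have hs'0 : s' ≠ 0 := by
    rintro rfl
    exact hw'0 (by rw [← hs']; simp)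
  have hs0 : γ s' ≠ 0 := by simpa
  have hs : (γ s') ^ 2 ^ 1 = γ w' := by rw [pow_one, ← map_pow, hs']
  have hsR : ∀ g ∈ R', g ((γ s') ^ 2 ^ 1) = (γ s') ^ 2 ^ 1 := fun g hg ↦ by
    rw [hs, hconj γ hw'R g hg]
  have hs'R : ∀ g ∈ R', g (s' ^ 2 ^ 1) = s' ^ 2 ^ 1 := fun g hg ↦ by
    rw [pow_one, hs', hw'R g hg]
  have htop : R' ≤ fixer K (ζ 1) := fun g _ ↦ by rw [mem_fixer, hζ.one, map_neg, map_one]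
  have hginv : γ⁻¹ (γ s') = s' := by rw [← AlgEquiv.mul_apply, inv_mul_cancel]; rfl
  have hsq {a : twoTors Ω} (ha : a ^ 2 ^ 1 = 1) (g : Ω ≃ₐ[K] Ω) : g (tval a) = tval a :=
    hζ.apply_eq (n := 1) (by rw [mem_fixer, hζ.one, map_neg, map_one])
      (by rw [← map_pow, ha, map_one])
  have hl (g : Ω ≃ₐ[K] Ω) (hg : g ∈ R') : (kum (γ s') (γ * g * γ⁻¹))⁻¹ = kum s' g := by
    have h1 : kum (γ s') (γ * g * γ⁻¹) = kum s' g := by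
      refine kum_eq_of_apply hs0 ?_
      rw [conj_apply_apply, apply_eq_kum_mul hs'0 (hs'R g hg), map_mul,
        hsq (kum_pow_eq_one hs'0 (hs'R g hg))]
    have h2 := kum_pow_eq_one hs'0 (hs'R g hg)
    rw [h1]
    exact inv_eq_of_mul_eq_one_left (by rwa [pow_one, sq] at h2)
  refine ⟨kum (γ s'), hζ.isLocHom_kum (isOpen_fixer _) htop hs0 hsR, t * γ s' * s',
    mul_ne_zero (mul_ne_zero ht0 hs0) hs'0, fun g hg ↦ ?_, ?_⟩
  · have hgR' := hζ.fixer_le_fixer_re _ hg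
    rw [hl g hgR', map_mul, map_mul, ht g (hζ.fixer_anti (by omega) hg),
      apply_eq_kum_mul hs0 (hsR g hgR'), apply_eq_kum_mul hs'0 (hs'R g hgR'), map_mul, map_mul]
    ring
  · have hcR : c ∈ R' := hc.mem_fixer_re hζ _
    have hsgn {z a : Ω} (hz : z ^ 2 = a) (ha : c a = a) : z * c z = a ∨ z * c z = -a :=
      sq_eq_sq_iff_eq_or_eq_neg.1 (by rw [mul_pow, ← map_pow, hz, ha, sq])
    have h1 := hsgn hs' (hw'R c hcR)
    have h2 := hsgn (by rw [← pow_one 2, hs]) (hconj γ hw'R c hcR)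
    have h3 : t * γ s' * s' * c (t * γ s' * s') = y * γ w' * w' ∨
        t * γ s' * s' * c (t * γ s' * s') = -(y * γ w' * w') := by
      have h4 : t * γ s' * s' * c (t * γ s' * s') = y * (γ s' * c (γ s')) * (s' * c s') := by
        rw [map_mul, map_mul]; ring
      rw [h4]
      rcases h1 with h1 | h1 <;> rcases h2 with h2 | h2 <;> rw [h1, h2]
      · exact .inl rfl
      · exact .inr (by ring)
      · exact .inr (by ring)
      · exact .inl (by ring)
    rcases h3 with h3 | h3
    · rwa [h3]
    · exfalso
      have h4 := hc.map_mul_apply (t * γ s' * s')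
      rw [h3, map_neg] at h4
      have h5 := congrArg Complex.re h4
      rw [Complex.neg_re, Complex.ofReal_re] at h5
      have h6 := (hpos ψ).2
      have h7 := Complex.normSq_nonneg (ψ (t * γ s' * s'))
      linarith

end IsRootSystem

end RealTower

section RealTower

open IntermediateField

variable {K Ω : Type*} [Field K] [NumberField K] [Field Ω] [Algebra K Ω] [CharZero Ω]
  [IsAlgClosed Ω] [IsGalois K Ω] {ζ : ℕ → Ω}

namespace IsRootSystem

variable {ψ : Ω →+* ℂ} {c γ : Ω ≃ₐ[K] Ω} {n : ℕ} {η : (Ω ≃ₐ[K] Ω) → twoTors Ω}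

lemma exists_eq_kum_mul_conj [Algebra.IsAlgebraic ℚ Ω] (hζ : IsRootSystem ζ)
    (hc : IsComplexConj ψ c) (hη : IsLocHom (fixer K (hζ.re n)) η) {t : Ω} (ht0 : t ≠ 0)
    (ht : ∀ g ∈ fixer K (ζ n), g t = tval (η g) * t) (hpos : IsTotPos (t * c t)) :
    ∃ m ≥ n, ∃ k ≠ 0, k ≤ m ∧ ∃ z ≠ 0, (∀ g ∈ fixer K (ζ m), g (z ^ 2 ^ k) = z ^ 2 ^ k) ∧
      ∀ g ∈ fixer K (ζ m), η g = kum z g * kum z (c * g * c⁻¹) := by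
  have hyR := hζ.apply_mul_conj_eq hc hη ht
  have hcy : c (t * c t) = t * c t := by rw [map_mul, hc.apply_apply, mul_comm]
  obtain ⟨m₀, v, hv, hvt⟩ := hpos.isNorm hc hζ (m := n)
    (mem_adjoin_of_fixer fun g hg ↦ hyR g (hζ.fixer_le_fixer_re n hg)) hcy
  obtain ⟨k₀, hk₀⟩ := hη.exists_pow_eq_one exists_pow_two_pow_eq_one
  obtain ⟨k, hk⟩ : ∃ k, k = k₀ + 1 := ⟨_, rfl⟩
  obtain ⟨m, hm⟩ : ∃ m, m = max (max m₀ n) (max k 2) := ⟨_, rfl⟩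
  have hηk (g : Ω ≃ₐ[K] Ω) (hg : g ∈ fixer K (ζ n)) : η g ^ 2 ^ k = 1 := by
    rw [hk, pow_succ, pow_mul, hk₀ g (hζ.fixer_le_fixer_re n hg), one_pow]
  have hv0 : v ≠ 0 := by
    rintro rfl
    rw [zero_mul] at hvt
    exact mul_ne_zero ht0 ((map_ne_zero c).2 ht0) hvt
  have hcv0 : c v ≠ 0 := (map_ne_zero c).2 hv0
  have hJn : fixer K (ζ m) ≤ fixer K (ζ n) := hζ.fixer_anti (by omega)
  have hvJ (g : Ω ≃ₐ[K] Ω) (hg : g ∈ fixer K (ζ m)) : g v = v :=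
    apply_eq_of_mem_adjoin hv (hζ.fixer_anti (by omega : m₀ ≤ m) hg)
  set s := t / v with hs
  have hs0 : s ≠ 0 := div_ne_zero ht0 hv0
  have hsc : s * c s = 1 := by
    rw [hs, map_div₀, div_mul_div_comm, hvt, div_self (mul_ne_zero hv0 hcv0)]
  have hsg (g : Ω ≃ₐ[K] Ω) (hg : g ∈ fixer K (ζ m)) : g s = tval (η g) * s := by
    rw [hs, map_div₀, hvJ g hg, ht g (hJn hg), mul_div_assoc]
  set x := s ^ 2 ^ k with hx
  have hx0 : x ≠ 0 := pow_ne_zero _ hs0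
  have hxc : c x = x⁻¹ := eq_inv_of_mul_eq_one_right (by
    rw [hx, map_pow, ← mul_pow, hsc, one_pow])
  have hxJ (g : Ω ≃ₐ[K] Ω) (hg : g ∈ fixer K (ζ m)) : g x = x := by
    rw [hx, map_pow, hsg g hg, mul_pow, ← map_pow, hηk g (hJn hg), map_one, one_mul]
  obtain ⟨w, hw0, hwJ, hwx⟩ : ∃ w ≠ 0, (∀ g ∈ fixer K (ζ m), g w = w) ∧ w = x * c w := by
    by_cases h : x = -1
    · refine ⟨ζ 2, hζ.ne_zero 2, fun g hg ↦ hζ.fixer_anti (by omega : 2 ≤ m) hg, ?_⟩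
      have h2 : (ζ 2)⁻¹ = -ζ 2 := inv_eq_of_mul_eq_one_right (by linear_combination -hζ.sq_two)
      rw [h, hc.apply_eq_inv (hζ.pow_eq_one 2), h2]
      ring
    · refine ⟨1 + x, fun h' ↦ h (by linear_combination h'), fun g hg ↦ ?_, ?_⟩
      · rw [map_add, map_one, hxJ g hg]
      · rw [map_add, map_one, hxc, mul_add, mul_inv_cancel₀ hx0]
        ring
  obtain ⟨z, hz⟩ := IsAlgClosed.exists_pow_nat_eq w (n := 2 ^ k) (by positivity)
  have hz0 : z ≠ 0 := by
    rintro rfl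
    exact hw0 (by rw [← hz, zero_pow (by positivity)])
  have hcz0 : c z ≠ 0 := (map_ne_zero c).2 hz0
  have hzJ (g : Ω ≃ₐ[K] Ω) (hg : g ∈ fixer K (ζ m)) : g (z ^ 2 ^ k) = z ^ 2 ^ k := by
    rw [hz, hwJ g hg]
  refine ⟨m, by omega, k, by omega, by omega, z, hz0, hzJ, fun g hg ↦ ?_⟩
  have hcg := hζ.conj_mem_fixer c g hg
  have h1 : s ^ 2 ^ k = (z / c z) ^ 2 ^ k := by
    rw [← hx, div_pow, ← map_pow, hz, eq_div_iff ((map_ne_zero c).2 hw0), ← hwx]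
  rw [← kum_eq_of_apply hs0 (hsg g hg),
    hζ.kum_congr hs0 h1 (hζ.fixer_anti (by omega : k ≤ m) hg)]
  refine kum_eq_of_apply (div_ne_zero hz0 hcz0) ?_
  have h2 : g (c z) = (tval (kum z (c * g * c⁻¹)))⁻¹ * c z := by
    have hcinv : c⁻¹ = c := inv_eq_of_mul_eq_one_left hc.mul_self
    have h3 : c (c * g * c⁻¹ <| z) = g (c z) := by
      rw [hcinv, AlgEquiv.mul_apply, AlgEquiv.mul_apply, hc.apply_apply]
    rw [← h3, apply_eq_kum_mul hz0 (hzJ _ hcg), map_mul, hc.apply_tval]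
  rw [map_div₀, h2, apply_eq_kum_mul hz0 (hzJ g hg), map_mul]
  field_simp

lemma mul_conj_mem_fixer (hζ : IsRootSystem ζ) (hc : IsComplexConj ψ c) {m : ℕ} {g : Ω ≃ₐ[K] Ω}
    (hg : g ∈ fixer K (hζ.re m)) (hg' : g ∉ fixer K (ζ m)) : g * c ∈ fixer K (ζ m) := by
  have h := (hζ.mem_fixer_re.1 hg).resolve_left hg'
  rw [mem_fixer, AlgEquiv.mul_apply, hc.apply_eq_inv (hζ.pow_eq_one m), map_inv₀, h, inv_inv]

lemma exists_isLocHom_symm (hζ : IsRootSystem ζ) (hc : IsComplexConj ψ c) {m : ℕ}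
    (hm : 2 ≤ m) {Θ : (Ω ≃ₐ[K] Ω) → twoTors Ω} (hΘ : IsLocHom (fixer K (ζ m)) Θ) :
    ∃ ω, IsLocHom (fixer K (hζ.re m)) ω ∧ ∀ g ∈ fixer K (ζ m), ω g = Θ g * Θ (c * g * c⁻¹) := by
  classical
  have hcinv : c⁻¹ = c := inv_eq_of_mul_eq_one_left hc.mul_self
  have hop : IsOpen (fixer K (ζ m) : Set (Ω ≃ₐ[K] Ω)) := isOpen_fixer _
  have h0 := hΘ.mul (hΘ.conj hop (hζ.conj_mem_fixer c))
  set ω₀ := fun g ↦ Θ g * Θ (c * g * c⁻¹) with hω₀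
  have hsymm (g : Ω ≃ₐ[K] Ω) : ω₀ (c * g * c) = ω₀ g := by
    have h1 : c * (c * g * c) * c = g := by
      rw [show c * (c * g * c) * c = (c * c) * g * (c * c) by group, hc.mul_self]; simp
    simp only [hω₀, hcinv, h1]
    exact mul_comm _ _
  have hcJ (g : Ω ≃ₐ[K] Ω) (hg : g ∈ fixer K (ζ m)) : c * g * c ∈ fixer K (ζ m) := by
    simpa [hcinv] using hζ.conj_mem_fixer c g hg
  have hcnot : c ∉ fixer K (ζ m) := fun h ↦ by
    have h2 := hζ.fixer_anti hm h
    rw [mem_fixer, hc.apply_eq_inv (hζ.pow_eq_one 2)] at h2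
    have h3 := mul_inv_cancel₀ (hζ.ne_zero 2)
    rw [h2, ← sq, hζ.sq_two] at h3
    norm_num at h3
  let ω : (Ω ≃ₐ[K] Ω) → twoTors Ω := fun g ↦ if g ∈ fixer K (ζ m) then ω₀ g else ω₀ (g * c)
  have hin {g : Ω ≃ₐ[K] Ω} (hg : g ∈ fixer K (ζ m)) : ω g = ω₀ g := if_pos hg
  have hout {g : Ω ≃ₐ[K] Ω} (hg : g ∈ fixer K (ζ m)) : ω (g * c) = ω₀ g := by
    have h1 : g * c ∉ fixer K (ζ m) := fun h ↦ hcnot (by simpa using mul_mem (inv_mem hg) h)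
    simp only [ω, if_neg h1, mul_assoc, hc.mul_self, mul_one]
  refine ⟨ω, ⟨fun g hg h hh ↦ ?_, fixer K (ζ m) ⊓ (h0.loc.choose), ?_, ?_, ?_⟩, fun g hg ↦ hin hg⟩
  · have hdec (g : Ω ≃ₐ[K] Ω) (hg : g ∈ fixer K (hζ.re m)) (hg' : g ∉ fixer K (ζ m)) :
        ∃ g' ∈ fixer K (ζ m), g = g' * c :=
      ⟨g * c, hζ.mul_conj_mem_fixer hc hg hg', by rw [mul_assoc, hc.mul_self, mul_one]⟩
    by_cases hg' : g ∈ fixer K (ζ m) <;> by_cases hh' : h ∈ fixer K (ζ m)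
    · rw [hin hg', hin hh', hin (mul_mem hg' hh'), h0.map_mul g hg' h hh']
    · obtain ⟨h, hhJ, rfl⟩ := hdec h hh hh'
      rw [← mul_assoc, hin hg', hout hhJ, hout (mul_mem hg' hhJ), h0.map_mul g hg' h hhJ]
    · obtain ⟨g, hgJ, rfl⟩ := hdec g hg hg'
      have h1 : g * c * h = g * (c * h * c) * c := by
        rw [show g * (c * h * c) * c = g * c * h * (c * c) by group, hc.mul_self, mul_one]
      rw [h1, hout (mul_mem hgJ (hcJ h hh')), hout hgJ, hin hh', h0.map_mul g hgJ _ (hcJ h hh'),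
        hsymm]
    · obtain ⟨g, hgJ, rfl⟩ := hdec g hg hg'
      obtain ⟨h, hhJ, rfl⟩ := hdec h hh hh'
      have h1 : g * c * (h * c) = g * (c * h * c) := by group
      rw [h1, hin (mul_mem hgJ (hcJ h hhJ)), hout hgJ, hout hhJ, h0.map_mul g hgJ _ (hcJ h hhJ),
        hsymm]
  · exact hop.inter h0.loc.choose_spec.1
  · exact inf_le_left.trans (hζ.fixer_le_fixer_re m)
  · intro l hl
    rw [hin hl.1]
    exact h0.loc.choose_spec.2.2 l hl.2

lemma exists_isLocHom_of_eq_on_fixer (hζ : IsRootSystem ζ) (hc : IsComplexConj ψ c) {M m : ℕ}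
    (hγ : γ (hζ.re (M + 3)) = -hζ.re (M + 3)) (hm : M + 3 ≤ m)
    (hη : IsLocHom (fixer K (hζ.re m)) η) {ω : (Ω ≃ₐ[K] Ω) → twoTors Ω}
    (hω : IsLocHom (fixer K (hζ.re m)) ω)
    (hωJ : ∀ g ∈ fixer K (ζ m), ω (γ * g * γ⁻¹) = ω g * η g) :
    ∃ ω', IsLocHom (fixer K (hζ.re m)) ω' ∧
      ∀ g ∈ fixer K (hζ.re m), ω' (γ * g * γ⁻¹) = ω' g * η g := by
  set R := fixer K (hζ.re m) with hR
  have hRo : IsOpen (R : Set (Ω ≃ₐ[K] Ω)) := isOpen_fixer _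
  have hcR : c ∈ R := hc.mem_fixer_re hζ m
  have hD := ((hω.conj hRo (hζ.conj_mem_fixer_re γ)).mul hω.inv).mul hη.inv
  set D := fun g ↦ ω (γ * g * γ⁻¹) * (ω g)⁻¹ * (η g)⁻¹ with hDdef
  have hωD (g : Ω ≃ₐ[K] Ω) : ω (γ * g * γ⁻¹) = ω g * η g * D g := by
    simp only [hDdef]
    rw [mul_assoc _ (ω g)⁻¹, ← mul_inv, mul_comm (ω (γ * g * γ⁻¹)), mul_inv_cancel_left]
  have hDJ (g : Ω ≃ₐ[K] Ω) (hg : g ∈ fixer K (ζ m)) : D g = 1 := by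
    simp only [hDdef]
    rw [hωJ g hg, mul_assoc, ← mul_inv, mul_inv_cancel]
  have hDc : D c ^ 2 = 1 := by rw [sq, ← hD.map_mul c hcR c hcR, hc.mul_self, hD.map_one]
  have hDR (g : Ω ≃ₐ[K] Ω) (hg : g ∈ R) (hg' : g ∉ fixer K (ζ m)) : D g = D c := by
    have h1 := hζ.mul_conj_mem_fixer hc hg hg'
    have h2 : g = (g * c) * c := by rw [mul_assoc, hc.mul_self, mul_one]
    conv_lhs => rw [h2]
    rw [hD.map_mul _ (mul_mem hg hcR) c hcR, hDJ _ h1, one_mul]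
  by_cases hD1 : D c = 1
  · refine ⟨ω, hω, fun g hg ↦ ?_⟩
    have h1 : D g = 1 := by
      by_cases h : g ∈ fixer K (ζ m)
      · exact hDJ g h
      · rw [hDR g hg h, hD1]
    rw [hωD, h1, mul_one]
  have hDc' : tval (D c) = -1 := by
    have h1 : tval (D c) ^ 2 = 1 := by rw [← map_pow, hDc, map_one]
    exact ((sq_eq_sq_iff_eq_or_eq_neg (b := 1)).1 (by rw [h1, one_pow])).resolve_left
      fun h ↦ hD1 (tval_injective (by rw [h, map_one]))
  have hD2 (g : Ω ≃ₐ[K] Ω) (hg : g ∈ R) : g (ζ 2) = tval (D g) * ζ 2 := by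
    by_cases h : g ∈ fixer K (ζ m)
    · rw [hDJ g h, map_one, one_mul]
      exact hζ.fixer_anti (by omega : 2 ≤ m) h
    · have h1 : (g * c) (ζ 2) = ζ 2 :=
        hζ.fixer_anti (by omega : 2 ≤ m) (hζ.mul_conj_mem_fixer hc hg h)
      have h2 : (ζ 2)⁻¹ = -ζ 2 := inv_eq_of_mul_eq_one_right (by linear_combination -hζ.sq_two)
      rw [AlgEquiv.mul_apply, hc.apply_eq_inv (hζ.pow_eq_one 2), h2, map_neg] at h1
      rw [hDR g hg h, hDc']
      linear_combination -h1
  have hu0 := hζ.re_add_three_ne_zero M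
  obtain ⟨s, hs⟩ := IsAlgClosed.exists_pow_nat_eq (hζ.re (M + 3)) two_pos
  have hs0 : s ≠ 0 := by
    rintro rfl
    exact hu0 (by rw [← hs]; simp)
  have hgs0 : γ s ≠ 0 := (map_ne_zero γ).2 hs0
  have htop : R ≤ fixer K (ζ 1) := fun g _ ↦ by rw [mem_fixer, hζ.one, map_neg, map_one]
  have hsR (g : Ω ≃ₐ[K] Ω) (hg : g ∈ R) : g (s ^ 2 ^ 1) = s ^ 2 ^ 1 := by
    rw [pow_one, hs]
    exact hζ.fixer_re_anti hm hg
  have hl := hζ.isLocHom_kum hRo htop hs0 hsR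
  have hgs : γ s = ζ 2 * s ∨ γ s = -(ζ 2 * s) := sq_eq_sq_iff_eq_or_eq_neg.1 (by
    rw [← map_pow, hs, hγ, mul_pow, hs, hζ.sq_two]; ring)
  have hsq {a : twoTors Ω} (ha : a ^ 2 ^ 1 = 1) (g : Ω ≃ₐ[K] Ω) : g (tval a) = tval a :=
    hζ.apply_eq (n := 1) (by rw [mem_fixer, hζ.one, map_neg, map_one])
      (by rw [← map_pow, ha, map_one])
  have hkey (g : Ω ≃ₐ[K] Ω) (hg : g ∈ R) : kum s (γ * g * γ⁻¹) = kum s g * D g := by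
    have hg' := hζ.conj_mem_fixer_re γ g hg
    have h1 := conj_apply_apply γ g s
    rw [apply_eq_kum_mul hs0 (hsR g hg), map_mul, hsq (kum_pow_eq_one hs0 (hsR g hg))] at h1
    have h2 : (γ * g * γ⁻¹) (ζ 2 * s) = tval (kum s g) * (ζ 2 * s) := by
      rcases hgs with h | h
      · rwa [h] at h1
      · rw [h, map_neg] at h1
        linear_combination -h1
    have hD' : D (γ * g * γ⁻¹) = D g := by
      have h3 := conj_apply_apply γ g (ζ 2)
      rw [hD2 g hg] at h3
      by_cases h : g ∈ fixer K (ζ m)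
      · rw [hDJ g h, hDJ _ (hζ.conj_mem_fixer γ g h)]
      · rw [hDR g hg h, hDR _ hg' fun h' ↦ h ((hζ.conj_mem_fixer_iff γ g).2 h')]
    rw [map_mul, hD2 _ hg', apply_eq_kum_mul hs0 (hsR _ hg'), hD'] at h2
    have h4 : tval (kum s (γ * g * γ⁻¹)) * tval (D g) = tval (kum s g) :=
      mul_right_cancel₀ (mul_ne_zero (hζ.ne_zero 2) hs0) (by linear_combination h2)
    rw [← map_mul] at h4
    have h5 : D g * D g = 1 := by
      by_cases h : g ∈ fixer K (ζ m)
      · rw [hDJ g h, one_mul]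
      · rw [hDR g hg h, ← sq, hDc]
    rw [← tval_injective h4, mul_assoc (kum s _), h5, mul_one]
  refine ⟨fun g ↦ ω g * (kum s g)⁻¹, hω.mul hl.inv, fun g hg ↦ ?_⟩
  dsimp only
  rw [hωD, hkey g hg, mul_inv]
  have : ω g * η g * D g * ((kum s g)⁻¹ * (D g)⁻¹) =
    ω g * (kum s g)⁻¹ * η g * (D g * (D g)⁻¹) := by ac_rfl
  rw [this, mul_inv_cancel, mul_one]

lemma exists_isLocHom_of_isTotPos [Algebra.IsAlgebraic ℚ Ω] (hζ : IsRootSystem ζ)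
    (hc : IsComplexConj ψ c) {M : ℕ} (hγ : γ (hζ.re (M + 3)) = -hζ.re (M + 3))
    (hη : IsLocHom (fixer K (hζ.re n)) η) {t : Ω} (ht0 : t ≠ 0)
    (ht : ∀ g ∈ fixer K (ζ n), g t = tval (η g) * t) (hpos : IsTotPos (t * c t)) :
    ∃ m ≥ n, ∃ ω, IsLocHom (fixer K (hζ.re m)) ω ∧
      ∀ g ∈ fixer K (hζ.re m), ω (γ * g * γ⁻¹) = ω g * η g := by
  obtain ⟨m₁, hm₁, k, hk0, hk, z, hz0, hzJ, hηz⟩ := hζ.exists_eq_kum_mul_conj hc hη ht0 ht hpos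
  obtain ⟨m₂, hm₂, -, Θ, hΘ, hΘγ⟩ := hζ.exists_twisted_kum hγ hk0 hz0 hzJ
  obtain ⟨m, hm⟩ : ∃ m, m = max m₂ (M + 3) := ⟨_, rfl⟩
  have hle : fixer K (ζ m) ≤ fixer K (ζ m₂) := hζ.fixer_anti (by omega)
  have hle₁ : fixer K (ζ m) ≤ fixer K (ζ m₁) := hζ.fixer_anti (by omega)
  have hop : IsOpen (fixer K (ζ m) : Set (Ω ≃ₐ[K] Ω)) := isOpen_fixer _
  have hΘ' := hΘ.mono hle hop
  have hκ := hζ.isLocHom_kum hop (hζ.fixer_anti (by omega : k ≤ m)) hz0 fun g hg ↦ hzJ g (hle₁ hg)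
  obtain ⟨ω, hω, hωJ⟩ := hζ.exists_isLocHom_symm hc (by omega : 2 ≤ m) hΘ'
  refine ⟨m, by omega, hζ.exists_isLocHom_of_eq_on_fixer hc hγ (by omega)
    (hη.mono (hζ.fixer_re_anti (by omega)) (isOpen_fixer _)) hω fun g hg ↦ ?_⟩
  have hcg := hζ.conj_mem_fixer c g hg
  set d := γ⁻¹ * c * γ * c⁻¹ with hd
  have hdJ : d ∈ fixer K (ζ m) := by
    have h1 : γ (ζ m) ^ 2 ^ m = 1 := by rw [← map_pow, hζ.pow_eq_one, map_one]
    have h2 : γ⁻¹ (γ (ζ m)) = ζ m := by rw [← AlgEquiv.mul_apply, inv_mul_cancel]; rfl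
    have hcinv : c⁻¹ = c := inv_eq_of_mul_eq_one_left hc.mul_self
    rw [mem_fixer, hd, hcinv, AlgEquiv.mul_apply, AlgEquiv.mul_apply, AlgEquiv.mul_apply,
      hc.apply_eq_inv (hζ.pow_eq_one m), map_inv₀, map_inv₀, hc.apply_eq_inv h1, inv_inv, h2]
  have hconj {F : (Ω ≃ₐ[K] Ω) → twoTors Ω} (hF : IsLocHom (fixer K (ζ m)) F) :
      F (d * (c * g * c⁻¹) * d⁻¹) = F (c * g * c⁻¹) := by
    rw [hF.map_mul _ (mul_mem hdJ hcg) _ (inv_mem hdJ), hF.map_mul _ hdJ _ hcg, hF.map_inv hdJ,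
      mul_inv_cancel_comm]
  have hsw : c * (γ * g * γ⁻¹) * c⁻¹ = γ * (d * (c * g * c⁻¹) * d⁻¹) * γ⁻¹ := by
    rw [hd]; group
  have hmem : d * (c * g * c⁻¹) * d⁻¹ ∈ fixer K (ζ m) := mul_mem (mul_mem hdJ hcg) (inv_mem hdJ)
  rw [hωJ _ (hζ.conj_mem_fixer γ g hg), hωJ g hg, hsw, hΘγ _ (hle hmem), hΘγ g (hle hg),
    hconj hΘ', hconj hκ, hηz g (hle₁ hg)]
  ac_rfl

/-- The main extension step along the real cyclotomic tower. -/
theorem exists_isLocHom_re [Algebra.IsAlgebraic ℚ Ω] (hζ : IsRootSystem ζ)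
    (hK : ∀ ψ : K →+* ℂ, NumberField.ComplexEmbedding.IsReal ψ) (hc : IsComplexConj ψ c) {M : ℕ}
    (hγ : γ (hζ.re (M + 3)) = -hζ.re (M + 3)) (hη : IsLocHom (fixer K (hζ.re n)) η) :
    ∃ m ≥ n, ∃ ω, IsLocHom (fixer K (hζ.re m)) ω ∧
      ∀ g ∈ fixer K (hζ.re m), ω (γ * g * γ⁻¹) = ω g * η g := by
  obtain ⟨k, hk⟩ := hη.exists_pow_eq_one exists_pow_two_pow_eq_one
  obtain ⟨r, hr⟩ : ∃ r, r = max n k := ⟨_, rfl⟩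
  have hη' := hη.mono (hζ.fixer_re_anti (by omega : n ≤ M + r + 2)) (isOpen_fixer _)
  have hJo : IsOpen (fixer K (ζ (M + r + 2)) : Set (Ω ≃ₐ[K] Ω)) := isOpen_fixer _
  have hηJ := hη'.mono (hζ.fixer_le_fixer_re _) hJo
  obtain ⟨t, ht0, ht⟩ := hζ.exists_apply_eq_mul (hζ.fixer_anti (by omega : k ≤ M + r + 2)) hηJ
    fun g hg ↦ hk g (hζ.fixer_re_anti (by omega) (hζ.fixer_le_fixer_re _ hg))
  obtain ⟨l, hl, t', ht'0, ht', hpos⟩ := hζ.exists_isTotPos_twist hK hc hγ hη' ht0 ht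
  have hRo : IsOpen (fixer K (hζ.re (M + r + 3)) : Set (Ω ≃ₐ[K] Ω)) := isOpen_fixer _
  obtain ⟨m, hm, ω, hω, hωγ⟩ := hζ.exists_isLocHom_of_isTotPos hc hγ
    ((hη'.mono (hζ.fixer_re_anti (by omega)) hRo).mul
      (hl.mul (hl.conj hRo (hζ.conj_mem_fixer_re γ)).inv)) ht'0 ht' hpos
  refine ⟨m, by omega, fun g ↦ ω g * l g,
    hω.mul (hl.mono (hζ.fixer_re_anti hm) (isOpen_fixer _)), fun g hg ↦ ?_⟩
  dsimp only
  rw [hωγ g hg]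
  have : ω g * (η g * (l g * (l (γ * g * γ⁻¹))⁻¹)) * l (γ * g * γ⁻¹) =
    ω g * l g * η g * ((l (γ * g * γ⁻¹))⁻¹ * l (γ * g * γ⁻¹)) := by ac_rfl
  rw [this, inv_mul_cancel, mul_one]

end IsRootSystem

end RealTower

section Anticyclotomic

/-- The cocycle whose trivializations solve `χ = φ / φᶜ`. -/
lemma exists_antiCocycle {A G : Type*} [CommGroup A] [Group G] {H : Subgroup G} {c : G}
    (hcH : c ∉ H) (hH : ∀ g ∉ H, ∀ h ∉ H, g * h ∈ H) (hc : c * c = 1) {χ : G → A}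
    (hχ : ∀ g ∈ H, ∀ h ∈ H, χ (g * h) = χ g * χ h)
    (hχc : ∀ g ∈ H, χ (c * g * c⁻¹) = (χ g)⁻¹) :
    ∃ f : TwoCocycle A G, (∀ g ∈ H, ∀ h, f g h = 1) ∧ ∀ g ∉ H, ∀ h ∈ H, f g h = (χ h)⁻¹ := by
  classical
  have hmul {g h : G} (hg : g ∈ H) : g * h ∈ H ↔ h ∈ H := H.mul_mem_cancel_left hg
  have hmul' {g h : G} (hh : h ∈ H) : g * h ∈ H ↔ g ∈ H := H.mul_mem_cancel_right hh
  have hci : c⁻¹ = c := inv_eq_of_mul_eq_one_left hc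
  rw [hci] at hχc
  let ρ : G → A := fun g ↦ if g ∈ H then χ g else χ (g * c)
  have hρ {g : G} (hg : g ∈ H) : ρ g = χ g := if_pos hg
  have hρ' {g : G} (hg : g ∉ H) : ρ g = χ (g * c) := if_neg hg
  have h1 : χ 1 = 1 := by simpa using hχ 1 H.one_mem 1 H.one_mem
  have hρl {h k : G} (hh : h ∈ H) : ρ (h * k) = ρ h * ρ k := by
    by_cases hk : k ∈ H
    · rw [hρ hh, hρ hk, hρ (mul_mem hh hk), hχ h hh k hk]
    · rw [hρ hh, hρ' hk, hρ' (fun h' ↦ hk ((hmul hh).1 h')), mul_assoc, hχ h hh _ (hH k hk c hcH)]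
  have hρr {h k : G} (hh : h ∉ H) : ρ (h * k) * ρ k = ρ h := by
    have hhc := hH h hh c hcH
    by_cases hk : k ∈ H
    · have hck : c * k * c ∈ H := hH _ (fun h' ↦ hcH ((hmul' hk).1 h')) c hcH
      rw [hρ hk, hρ' hh, hρ' (fun h' ↦ hh ((hmul' hk).1 h')),
        show h * k * c = h * c * (c * k * c) by
          rw [← mul_assoc, ← mul_assoc, mul_assoc h c c, hc, mul_one],
        hχ _ hhc _ hck, hχc k hk, inv_mul_cancel_right]
    · have hkc := hH k hk c hcH
      have hck : c * (k * c) * c ∈ H := hH _ (fun h' ↦ hcH ((hmul' hkc).1 h')) c hcH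
      rw [hρ' hk, hρ' hh, hρ (hH h hh k hk),
        show h * k = h * c * (c * (k * c) * c) by
          rw [← mul_assoc, ← mul_assoc, ← mul_assoc, mul_assoc h c c, hc, mul_one, mul_assoc _ c c,
            hc, mul_one],
        hχ _ hhc _ hck, hχc _ hkc, inv_mul_cancel_right]
  refine ⟨⟨fun g h ↦ if g ∈ H then 1 else (ρ h)⁻¹, fun g ↦ if_pos H.one_mem, fun g ↦ ?_,
    fun g h k ↦ ?_⟩, fun g hg h ↦ if_pos hg, fun g hg h hh ↦ (if_neg hg).trans (by rw [hρ hh])⟩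
  · simp [hρ H.one_mem, h1]
  · by_cases hg : g ∈ H
    · simp [hg, hmul hg]
    by_cases hh : h ∈ H
    · simp only [hg, hh, hmul' hh, hρl hh, if_true, if_false, mul_inv, mul_one]
    · simp only [hg, hh, hH g hg h hh, if_true, if_false, mul_one]
      rw [← hρr (k := k) hh, mul_inv]

variable {K Ω : Type*} [Field K] [NumberField K] [Field Ω] [Algebra K Ω] [CharZero Ω]
  [IsAlgClosed Ω] [IsGalois K Ω] {ζ : ℕ → Ω}

lemma IsRootSystem.exists_forall_mem_fixer (hζ : IsRootSystem ζ) {δ : Ω}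
    (h : ∀ m, ¬ fixer K (ζ m) ≤ fixer K δ) : ∃ τ : Ω ≃ₐ[K] Ω, (∀ n, τ ∈ fixer K (ζ n)) ∧
      τ ∉ fixer K δ := by
  have hcl (m : ℕ) : IsClosed ((fixer K (ζ m) : Set (Ω ≃ₐ[K] Ω)) \ fixer K δ) :=
    ((fixer K (ζ m)).isClosed_of_isOpen (isOpen_fixer _)).sdiff (isOpen_fixer _)
  obtain ⟨τ, hτ⟩ := IsCompact.nonempty_iInter_of_sequence_nonempty_isCompact_isClosed
    (fun m ↦ (fixer K (ζ m) : Set (Ω ≃ₐ[K] Ω)) \ fixer K δ)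
    (fun m ↦ Set.sdiff_subset_sdiff_left (hζ.fixer_anti m.le_succ))
    (fun m ↦ Set.sdiff_nonempty.2 (h m)) (hcl 0).isCompact hcl
  rw [Set.mem_iInter] at hτ
  exact ⟨τ, fun n ↦ (hτ n).1, (hτ 0).2⟩

lemma IsRootSystem.exists_apply_re_eq_neg (hζ : IsRootSystem ζ) {n : ℕ}
    (h : ¬ ∀ g : Ω ≃ₐ[K] Ω, g ∈ fixer K (hζ.re n)) :
    ∃ M, (∀ g : Ω ≃ₐ[K] Ω, g ∈ fixer K (hζ.re (M + 2))) ∧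
      ∃ γ : Ω ≃ₐ[K] Ω, γ (hζ.re (M + 3)) = -hζ.re (M + 3) := by
  classical
  have hex : ∃ n, ¬ ∀ g : Ω ≃ₐ[K] Ω, g ∈ fixer K (hζ.re n) := ⟨n, h⟩
  obtain ⟨m, hm⟩ : ∃ m, m = Nat.find hex := ⟨_, rfl⟩
  have hm1 := Nat.find_spec hex
  rw [← hm] at hm1
  have hm2 (k : ℕ) (hk : k < m) (g : Ω ≃ₐ[K] Ω) : g ∈ fixer K (hζ.re k) :=
    not_not.1 (Nat.find_min hex (hm ▸ hk)) g
  have h1 : hζ.re 1 = -2 := by rw [IsRootSystem.re, hζ.one, inv_neg_one]; norm_num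
  have h2 : hζ.re 2 = 0 := pow_eq_zero_iff (two_ne_zero) |>.1 (by rw [hζ.re_sq, h1]; norm_num)
  have h3 : 3 ≤ m := by
    by_contra! hlt
    refine hm1 fun g ↦ hζ.fixer_re_anti (by omega : m ≤ 2) ?_
    rw [mem_fixer, h2, map_zero]
  obtain ⟨M, rfl⟩ := Nat.exists_eq_add_of_le' h3
  have hM := hm2 (M + 2) (by omega)
  push Not at hm1
  obtain ⟨γ, hγ⟩ := hm1
  exact ⟨M, hM, γ, (hζ.apply_re_succ (mem_fixer.1 (hM γ))).resolve_left hγ⟩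

/-- The `2`-primary case: characters with `χ χᶜ = 1` have the form `φ / φᶜ`. -/
theorem exists_isLocHom_div_conj [Algebra.IsAlgebraic ℚ Ω]
    (hK : ∀ ψ : K →+* ℂ, NumberField.ComplexEmbedding.IsReal ψ) {ψ : Ω →+* ℂ} {c : Ω ≃ₐ[K] Ω}
    (hc : IsComplexConj ψ c) {δ : Ω} {a : K} (hδ : δ ^ 2 = algebraMap K Ω a) (ha : a ≠ 0)
    (hcδ : c δ = -δ) {χ : (Ω ≃ₐ[K] Ω) → twoTors Ω} (hχ : IsLocHom (fixer K δ) χ)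
    (hχc : ∀ g ∈ fixer K δ, χ (c * g * c⁻¹) = (χ g)⁻¹) :
    ∃ φ, IsLocHom (fixer K δ) φ ∧ ∀ g ∈ fixer K δ, χ g = φ g * (φ (c * g * c⁻¹))⁻¹ := by
  obtain ⟨ζ, hζ⟩ := exists_isRootSystem (Ω := Ω)
  have hδ0 : δ ≠ 0 := by
    rintro rfl
    exact ha ((algebraMap K Ω).injective (by rw [← hδ, map_zero]; simp))
  have hHo : IsOpen (fixer K δ : Set (Ω ≃ₐ[K] Ω)) := isOpen_fixer _
  have hneg {g : Ω ≃ₐ[K] Ω} (hg : g δ = -δ) : g ∉ fixer K δ := fun h ↦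
    hδ0 (CharZero.eq_neg_self_iff.1 ((mem_fixer.1 h).symm.trans hg))
  have hneg' {g : Ω ≃ₐ[K] Ω} (hg : g ∉ fixer K δ) : g δ = -δ :=
    (apply_eq_or_eq_neg_of_sq hδ g).resolve_left hg
  have hcH := hneg hcδ
  have hH (g : Ω ≃ₐ[K] Ω) (hg : g ∉ fixer K δ) (h : Ω ≃ₐ[K] Ω) (hh : h ∉ fixer K δ) :
      g * h ∈ fixer K δ := by
    rw [mem_fixer, AlgEquiv.mul_apply, hneg' hh, map_neg, hneg' hg, neg_neg]
  have hcj {x g : Ω ≃ₐ[K] Ω} (hg : g ∈ fixer K δ) : x * g * x⁻¹ ∈ fixer K δ :=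
    conj_mem_fixer_of_sq hδ x g hg
  obtain ⟨f, hfH, hfχ⟩ := exists_antiCocycle hcH hH hc.mul_self hχ.map_mul hχc
  have hf : f.IsLocTrivial := by
    obtain ⟨L, hL, hLH, hχL⟩ := hχ.loc
    refine ⟨L, hL, fun l hl g ↦ ⟨?_, hfH l (hLH hl) g⟩⟩
    by_cases hg : g ∈ fixer K δ
    · exact hfH g hg l
    · rw [hfχ g hg l (hLH hl), hχL l hl, inv_one]
  have htriv {J : Subgroup (Ω ≃ₐ[K] Ω)} (hJ : J ≤ fixer K δ) (hJo : IsOpen (J : Set (Ω ≃ₐ[K] Ω))) :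
      f.IsLocSol J fun _ ↦ 1 :=
    ⟨fun g hg h _ ↦ by rw [hfH g (hJ hg), mul_one, mul_one], J, hJo, le_rfl, fun _ _ ↦ rfl⟩
  have step1 : ∃ m p, f.IsLocSol (fixer K (ζ m)) p := by
    by_cases h : ∃ m, fixer K (ζ m) ≤ fixer K δ
    · obtain ⟨m, hm⟩ := h
      exact ⟨m, _, htriv hm (isOpen_fixer _)⟩
    push Not at h
    obtain ⟨τ, hτ, hτH⟩ := hζ.exists_forall_mem_fixer h
    have hτc := hH τ hτH c hcH
    have hcc : c⁻¹ = c := inv_eq_of_mul_eq_one_left hc.mul_self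
    have hχτ (g : Ω ≃ₐ[K] Ω) (hg : g ∈ fixer K δ) : χ (τ * g * τ⁻¹) = (χ g)⁻¹ := by
      rw [show τ * g * τ⁻¹ = (τ * c) * (c⁻¹ * g * c⁻¹⁻¹) * (τ * c)⁻¹ by group,
        hχ.map_mul _ (mul_mem hτc (hcj hg)) _ (inv_mem hτc), hχ.map_mul _ hτc _ (hcj hg),
        hχ.map_inv hτc, mul_right_comm, mul_inv_cancel, one_mul, hcc, hχc g hg]
    have hχ2 : χ (τ * τ) = 1 := by
      have e : τ * τ = (τ * c) * (c * (τ * c) * c⁻¹) := by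
        rw [← mul_assoc c, mul_inv_cancel_right, ← mul_assoc, mul_assoc τ c c, hc.mul_self, mul_one]
      rw [e, hχ.map_mul _ hτc _ (hcj hτc), hχc _ hτc, mul_inv_cancel]
    obtain ⟨m, ω, hω, hωτ⟩ := hζ.exists_isLocHom_of_anti hδ ha hτ (hneg' hτH) hχ hχτ hχ2
    have hJo : IsOpen ((fixer K (ζ m) ⊓ fixer K δ : Subgroup _) : Set (Ω ≃ₐ[K] Ω)) :=
      (isOpen_fixer _).inter (isOpen_fixer _)
    refine ⟨m, (htriv inf_le_right hJo).exists_extension (fun _ ↦ exists_zpow_eq) (x := τ)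
      (fun g ↦ ?_) hω (fun g hg ↦ ?_) inf_le_left fun g hg ↦ ?_⟩
    · refine and_congr (hζ.conj_mem_fixer_iff τ g) ⟨hcj, fun hg ↦ ?_⟩
      have := hcj (x := τ⁻¹) hg
      rwa [show τ⁻¹ * (τ * g * τ⁻¹) * τ⁻¹⁻¹ = g by group] at this
    · rw [hωτ g hg]
      simp [TwoCocycle.defect, hfχ τ hτH g hg.2, hfH _ (hcj hg.2)]
    · by_cases hgH : g ∈ fixer K δ
      · exact ⟨0, by simpa using ⟨hg, hgH⟩⟩
      · exact ⟨1, by simpa using ⟨mul_mem hg (hτ m), hH g hgH τ hτH⟩⟩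
  obtain ⟨m, p₁, hp₁⟩ := step1
  obtain ⟨n, p₂, hp₂⟩ := hp₁.exists_fixer_re hf hζ hc.mul_self hc.apply_tval
  obtain ⟨p, hp⟩ : ∃ p, f.IsLocSol ⊤ p := by
    by_cases h : ∀ g : Ω ≃ₐ[K] Ω, g ∈ fixer K (hζ.re n)
    · exact ⟨p₂, by rwa [(Subgroup.eq_top_iff' _).2 h] at hp₂⟩
    obtain ⟨M, hM, γ, hγ⟩ := hζ.exists_apply_re_eq_neg h
    obtain ⟨m, hm, ω, hω, hωγ⟩ := hζ.exists_isLocHom_re hK hc hγ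
      (hp₂.isLocHom_defect hf (hζ.conj_mem_fixer_re γ))
    refine (hp₂.mono (hζ.fixer_re_anti hm) (isOpen_fixer _)).exists_extension
      (fun _ ↦ exists_zpow_eq) (hζ.conj_mem_fixer_re_iff γ) hω hωγ le_top fun g _ ↦ ?_
    obtain ⟨i, hi⟩ := hζ.exists_mul_pow_mem hM hγ m g
    exact ⟨i, by rwa [zpow_natCast]⟩
  have hpm (g h : Ω ≃ₐ[K] Ω) : p (g * h) = p g * p h * f g h := hp.isSol g trivial h trivial
  refine ⟨p, ⟨fun g hg h _ ↦ by rw [hpm, hfH g hg, mul_one], ?_⟩, fun g hg ↦ ?_⟩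
  · obtain ⟨L, hL, -, hpL⟩ := hp.loc
    exact ⟨L ⊓ fixer K δ, hL.inter hHo, inf_le_right, fun l hl ↦ hpL l hl.1⟩
  · have e1 := hpm (c * g * c⁻¹) c
    rw [inv_mul_cancel_right, hfH _ (hcj hg), mul_one, hpm, hfχ c hcH g hg] at e1
    have e2 : p g * (χ g)⁻¹ = p (c * g * c⁻¹) := by
      refine mul_right_cancel (b := p c) ?_
      rw [← e1]
      ac_rfl
    rw [← e2, mul_inv, inv_inv, mul_inv_cancel_left]

end Anticyclotomic

section Krull

open IntermediateField

variable {K Ω : Type*} [Field K] [Field Ω] [Algebra K Ω] [CharZero Ω]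

lemma exists_fixer_subset [CharZero K] {s : Set (Ω ≃ₐ[K] Ω)} (hs : s ∈ nhds 1) :
    ∃ α : Ω, (fixer K α : Set (Ω ≃ₐ[K] Ω)) ⊆ s := by
  obtain ⟨E, hE, hEs⟩ := (krullTopology_mem_nhds_one_iff K Ω s).1 hs
  obtain ⟨α, hα⟩ := Field.exists_primitive_element K E
  refine ⟨α, fun g hg ↦ hEs ?_⟩
  have hE' : K⟮(α : Ω)⟯ = E := by
    have := congrArg (IntermediateField.map E.val) hα
    rwa [adjoin_map, Set.image_singleton, ← AlgHom.fieldRange_eq_map, fieldRange_val] at this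
  exact (IntermediateField.mem_fixingSubgroup_iff _ _).2 fun x hx ↦ apply_eq_of_mem_adjoin (by rwa [hE']) hg

lemma continuous_of_fixer [Algebra.IsIntegral K Ω] {A : Type*} [AddGroup A]
    {φ : (Ω ≃ₐ[K] Ω) → A} (hφ : ∀ g h, φ (g * h) = φ g + φ h) {α : Ω}
    (hα : ∀ g ∈ fixer K α, φ g = 0) : @Continuous _ _ _ ⊥ φ := by
  let _ : TopologicalSpace A := ⊥
  refine continuous_def.2 fun s _ ↦ isOpen_iff_mem_nhds.2 fun g hg ↦ ?_
  have h1 : IsOpen ((fun h ↦ g⁻¹ * h) ⁻¹' (fixer K α : Set (Ω ≃ₐ[K] Ω))) :=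
    (isOpen_fixer α).preimage (continuous_const_mul g⁻¹)
  refine Filter.mem_of_superset (h1.mem_nhds (by simp [one_mem])) fun h hh ↦ ?_
  have h2 := hφ g (g⁻¹ * h)
  rw [mul_inv_cancel_left, hα _ hh, add_zero] at h2
  rwa [Set.mem_preimage, h2]

lemma exists_fixer_of_continuous [CharZero K] {A : Type*} [AddGroup A]
    {φ : (Ω ≃ₐ[K] Ω) → A} (hφ : ∀ g h, φ (g * h) = φ g + φ h) (hc : @Continuous _ _ _ ⊥ φ) :
    ∃ α : Ω, ∀ g ∈ fixer K α, φ g = 0 := by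
  let _ : TopologicalSpace A := ⊥
  have : DiscreteTopology A := ⟨rfl⟩
  have h1 : φ 1 = 0 := by simpa using hφ 1 1
  obtain ⟨α, hα⟩ := exists_fixer_subset (s := φ ⁻¹' {0})
    (((isOpen_discrete _).preimage hc).mem_nhds h1)
  exact ⟨α, fun g hg ↦ hα hg⟩

lemma exists_nsmul_eq_zero [IsGalois K Ω] {A : Type*} [AddGroup A]
    {φ : (Ω ≃ₐ[K] Ω) → A} (hφ : ∀ g h, φ (g * h) = φ g + φ h) {α : Ω}
    (hα : ∀ g ∈ fixer K α, φ g = 0) : ∃ N : ℕ, N ≠ 0 ∧ ∀ g, N • φ g = 0 := by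
  have : Finite ((Ω ≃ₐ[K] Ω) ⧸ fixer K α) := (fixer K α).quotient_finite_of_isOpen (isOpen_fixer α)
  have hpow (g : Ω ≃ₐ[K] Ω) (n : ℕ) : φ (g ^ n) = n • φ g := by
    induction n with
    | zero => simpa using hφ 1 1
    | succ n ih => rw [pow_succ, hφ, ih, succ_nsmul]
  refine ⟨(fixer K α).index.factorial, Nat.factorial_ne_zero _, fun g ↦ ?_⟩
  obtain ⟨n, hn, hn', hg⟩ := (fixer K α).exists_pow_mem_of_index_ne_zero
    Subgroup.index_ne_zero_of_finite g
  obtain ⟨d, hd⟩ := Nat.dvd_factorial hn hn'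
  rw [hd, mul_nsmul, ← hpow g n, hα _ hg, nsmul_zero]

end Krull

lemma exists_quadratic_generator (K F : Type*) [Field K] [Field F] [CharZero K] [Algebra K F]
    (h : Module.finrank K F = 2) :
    ∃ (δ : F) (a : K), δ ^ 2 = algebraMap K F a ∧ a ≠ 0 ∧
      ∀ y : F, ∃ p q : K, y = algebraMap K F p + algebraMap K F q * δ := by
  obtain ⟨x, hx⟩ : ∃ x : F, x ∉ (⊥ : Subalgebra K F) := by
    by_contra! hall
    have := Subalgebra.bot_eq_top_iff_finrank_eq_one.1 (eq_top_iff.2 fun x _ ↦ hall x).symm.symm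
    omega
  have hli : LinearIndependent K ![1, x] := by
    refine LinearIndependent.pair_iff.2 fun s t hst ↦ ?_
    have ht : t = 0 := by
      by_contra ht
      refine hx (Algebra.mem_bot.2 ⟨-(s / t), ?_⟩)
      have ht' : algebraMap K F t ≠ 0 := by simpa
      simp only [Algebra.smul_def, mul_one] at hst
      rw [map_neg, map_div₀]
      field_simp
      linear_combination -hst
    subst ht
    simpa using hst
  have hspan (y : F) : ∃ p q : K, y = algebraMap K F p + algebraMap K F q * x := by
    have h1 := hli.span_eq_top_of_card_eq_finrank (by simp [h])
    have h2 : y ∈ Submodule.span K (Set.range ![1, x]) := h1 ▸ Submodule.mem_top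
    rw [Matrix.range_cons_cons_empty, Submodule.mem_span_pair] at h2
    obtain ⟨p, q, rfl⟩ := h2
    exact ⟨p, q, by simp [Algebra.smul_def]⟩
  obtain ⟨s, b, hb⟩ := hspan (x ^ 2)
  have h2 : (algebraMap K F 2 : F) ≠ 0 := by simp
  have hy (y : F) : ∃ p q : K, y = algebraMap K F p +
      algebraMap K F q * (2 * x - algebraMap K F b) := by
    obtain ⟨p, q, rfl⟩ := hspan y
    refine ⟨p + q * b / 2, q / 2, ?_⟩
    rw [map_add, map_div₀, map_div₀, map_mul]
    rw [map_ofNat] at h2 ⊢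
    field_simp
    ring
  refine ⟨2 * x - algebraMap K F b, b ^ 2 + 4 * s, ?_, fun h0 ↦ hx ?_, hy⟩
  · rw [map_add, map_mul, map_pow, map_ofNat]
    linear_combination 4 * hb
  · have h3 : (2 * x - algebraMap K F b) ^ 2 = 0 := by
      have h4 := congrArg (algebraMap K F) h0
      rw [map_add, map_mul, map_pow, map_ofNat, map_zero] at h4
      linear_combination 4 * hb + h4
    obtain ⟨p, q, hpq⟩ := hy x
    rw [pow_eq_zero_iff two_ne_zero |>.1 h3, mul_zero, add_zero] at hpq
    exact Algebra.mem_bot.2 ⟨p, hpq.symm⟩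

section Circle

open Complex

lemma exists_exp_hom : ∃ E : QmodZ → ℂ, (∀ x y, E (x + y) = E x * E y) ∧ Function.Injective E ∧
    ∀ (n : ℕ) (z : ℂ), n ≠ 0 → z ^ n = 1 → ∃ x, E x = z := by
  have hE (q : ℚ) : exp (2 * Real.pi * I * q) = 1 ↔ q ∈ AddSubgroup.zmultiples (1 : ℚ) := by
    rw [exp_eq_one_iff, AddSubgroup.mem_zmultiples_iff]
    have h0 := two_pi_I_ne_zero
    refine exists_congr fun n ↦ ⟨fun h ↦ ?_, fun h ↦ ?_⟩
    · rw [mul_comm] at h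
      have := mul_right_cancel₀ h0 h
      simp only [zsmul_eq_mul, mul_one]
      exact_mod_cast this.symm
    · rw [← h]
      simp [mul_comm]
  have hadd (p q : ℚ) : exp (2 * Real.pi * I * (p + q : ℚ)) =
      exp (2 * Real.pi * I * p) * exp (2 * Real.pi * I * q) := by
    rw [← exp_add]
    push_cast
    ring_nf
  have hlift (p q : ℚ) : (p : QmodZ) = q ↔
      exp (2 * Real.pi * I * p) = exp (2 * Real.pi * I * q) := by
    have h1 : q = p + (-p + q) := by ring
    rw [QuotientAddGroup.eq, ← hE]
    conv_rhs => rw [h1, hadd]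
    rw [left_eq_mul₀ (exp_ne_zero _)]
  refine ⟨fun x ↦ Quotient.liftOn' x (fun q : ℚ ↦ exp (2 * Real.pi * I * q)) fun p q h ↦
    (hlift p q).1 (Quotient.sound' h), fun x y ↦ ?_, fun x y h ↦ ?_, fun n z hn hz ↦ ?_⟩
  · induction x using QuotientAddGroup.induction_on
    induction y using QuotientAddGroup.induction_on
    exact hadd _ _
  · induction x using QuotientAddGroup.induction_on
    induction y using QuotientAddGroup.induction_on
    exact (hlift _ _).2 h
  · have : NeZero n := ⟨hn⟩
    obtain ⟨i, -, rfl⟩ := (isPrimitiveRoot_exp n hn).eq_pow_of_pow_eq_one hz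
    refine ⟨((i / n : ℚ) : QmodZ), ?_⟩
    change exp _ = _
    rw [← exp_nat_mul]
    congr 1
    push_cast
    ring

end Circle

section Reduction

open ComplexConjugate

variable {K F Ω : Type*} [Field K] [NumberField K] [Field F] [Algebra K F] [Field Ω]
  [Algebra F Ω] [Algebra K Ω] [IsScalarTower K F Ω] [CharZero Ω] [CharZero F]
  [IsAlgClosed Ω] [IsGalois K Ω] [Algebra.IsIntegral F Ω]

/-- The `2`-primary case for characters with values in `ℚ/ℤ`. -/
theorem exists_character_of_two_pow [Algebra.IsAlgebraic ℚ Ω]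
    (hK : ∀ ψ : K →+* ℂ, NumberField.ComplexEmbedding.IsReal ψ)
    (hF : ∀ ψ : F →+* ℂ, ¬ NumberField.ComplexEmbedding.IsReal ψ)
    {δ : F} {a : K} (hδ : δ ^ 2 = algebraMap K F a) (ha : a ≠ 0)
    (hspan : ∀ y : F, ∃ p q : K, y = algebraMap K F p + algebraMap K F q * δ)
    {σ : Ω ≃ₐ[K] Ω} (hσ : σ (algebraMap F Ω δ) = -algebraMap F Ω δ)
    {c : (Ω ≃ₐ[F] Ω) → (Ω ≃ₐ[F] Ω)} (hc : ∀ g x, c g x = σ (g (σ.symm x)))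
    {χ : (Ω ≃ₐ[F] Ω) → QmodZ} (hχ : ∀ g h, χ (g * h) = χ g + χ h)
    {α : Ω} (hα : ∀ g ∈ fixer F α, χ g = 0) {k : ℕ} (hk : ∀ g, 2 ^ k • χ g = 0)
    (hχc : ∀ g, χ g + χ (c g) = 0) :
    ∃ φ : (Ω ≃ₐ[F] Ω) → QmodZ, (∀ g h, φ (g * h) = φ g + φ h) ∧
      (∃ β : Ω, ∀ g ∈ fixer F β, φ g = 0) ∧ ∀ g, χ g = φ g - φ (c g) := by
  classical
  obtain ⟨D, hD⟩ : ∃ D, D = algebraMap F Ω δ := ⟨_, rfl⟩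
  have hD2 : D ^ 2 = algebraMap K Ω a := by
    rw [hD, ← map_pow, hδ, ← IsScalarTower.algebraMap_apply]
  have hDspan (y : F) : ∃ p q : K, algebraMap F Ω y = algebraMap K Ω p + algebraMap K Ω q * D := by
    obtain ⟨p, q, rfl⟩ := hspan y
    exact ⟨p, q, by simp [hD, IsScalarTower.algebraMap_apply K F Ω]⟩
  rw [← hD] at hσ
  let ψ : Ω →+* ℂ := (IsAlgClosed.lift (R := ℚ) (S := Ω) (M := ℂ)).toRingHom
  obtain ⟨c₀, hc₀⟩ := exists_isComplexConj (Ω := Ω) hK ψ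
  have hc₀D : c₀ D = -D := by
    refine (apply_eq_or_eq_neg_of_sq hD2 c₀).resolve_left fun h ↦ ?_
    refine hF (ψ.comp (algebraMap F Ω)) (RingHom.ext fun y ↦ ?_)
    change conj (ψ (algebraMap F Ω y)) = ψ (algebraMap F Ω y)
    obtain ⟨p, q, hy⟩ := hDspan y
    rw [← hc₀, hy, map_add, map_mul, h, AlgEquiv.commutes, AlgEquiv.commutes]
  -- the restriction of scalars
  let res : (Ω ≃ₐ[F] Ω) → (Ω ≃ₐ[K] Ω) := fun g ↦ g.restrictScalars K
  have res_apply (g : Ω ≃ₐ[F] Ω) (x : Ω) : res g x = g x := rfl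
  have res_mul (g h : Ω ≃ₐ[F] Ω) : res (g * h) = res g * res h := rfl
  have res_inj {g h : Ω ≃ₐ[F] Ω} (e : res g = res h) : g = h :=
    AlgEquiv.ext fun x ↦ DFunLike.congr_fun e x
  have res_mem (g : Ω ≃ₐ[F] Ω) : res g ∈ fixer K D := by
    rw [mem_fixer, res_apply, hD, AlgEquiv.commutes]
  have res_c (g : Ω ≃ₐ[F] Ω) : res (c g) = σ * res g * σ⁻¹ := AlgEquiv.ext fun x ↦ hc g x
  have res_surj (g : Ω ≃ₐ[K] Ω) (hg : g ∈ fixer K D) : ∃ g', res g' = g := by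
    refine ⟨AlgEquiv.ofRingEquiv (f := g.toRingEquiv) fun y ↦ ?_, AlgEquiv.ext fun x ↦ rfl⟩
    obtain ⟨p, q, hy⟩ := hDspan y
    change g _ = _
    rw [hy, map_add, map_mul, mem_fixer.1 hg, AlgEquiv.commutes, AlgEquiv.commutes]
  choose! lift hlift using res_surj
  have lift_res (g : Ω ≃ₐ[F] Ω) : lift (res g) = g := res_inj (hlift _ (res_mem g))
  have lift_mul {g h : Ω ≃ₐ[K] Ω} (hg : g ∈ fixer K D) (hh : h ∈ fixer K D) :
      lift (g * h) = lift g * lift h :=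
    res_inj (by rw [res_mul, hlift _ hg, hlift _ hh, hlift _ (mul_mem hg hh)])
  -- transport of the values
  obtain ⟨E, hEadd, hEinj, hEsurj⟩ := exists_exp_hom
  have hE0 : E 0 = 1 := by
    obtain ⟨x, hx⟩ := hEsurj 1 1 one_ne_zero (one_pow 1)
    have h1 := hEadd x 0
    rw [add_zero, hx, one_mul] at h1
    exact h1.symm
  have hEn (n : ℕ) (x : QmodZ) : E x ^ n = E (n • x) := by
    induction n with
    | zero => rw [pow_zero, zero_nsmul, hE0]
    | succ n ih => rw [pow_succ, ih, succ_nsmul, hEadd]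
  have htinj : Function.Injective fun u : twoTors Ω ↦ ψ (tval u) :=
    ψ.injective.comp tval_injective
  obtain ⟨ζ, hζ⟩ := exists_isRootSystem (Ω := Ω)
  have hu (x : QmodZ) (hx : 2 ^ k • x = 0) : ∃ u : twoTors Ω, ψ (tval u) = E x := by
    have h1 := (hζ.isPrimitiveRoot k).map_of_injective ψ.injective
    obtain ⟨i, -, hi⟩ := h1.eq_pow_of_pow_eq_one (ξ := E x) (by rw [hEn, hx, hE0])
    obtain ⟨u, hu⟩ := exists_tval_eq (hζ.pow_eq_one k)
    exact ⟨u ^ i, by rw [map_pow, map_pow, hu, hi]⟩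
  have hv (u : twoTors Ω) : ∃ x : QmodZ, E x = ψ (tval u) := by
    obtain ⟨l, hl⟩ := exists_pow_two_pow_eq_one u
    exact hEsurj (2 ^ l) _ (by positivity) (by rw [← map_pow, ← map_pow, hl, map_one, map_one])
  choose u hu using fun g ↦ hu (χ g) (hk g)
  have hu_mul (g h : Ω ≃ₐ[F] Ω) : u (g * h) = u g * u h := htinj (by
    simp only [map_mul, hu, hχ, hEadd])
  have hu_one {g : Ω ≃ₐ[F] Ω} (hg : χ g = 0) : u g = 1 := htinj (by
    simp only [map_one, hu, hg, hE0])
  have hu_c (g : Ω ≃ₐ[F] Ω) : u (c g) = (u g)⁻¹ := by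
    refine eq_inv_of_mul_eq_one_right (htinj ?_)
    simp only [map_mul, map_one, hu, ← hEadd, hχc, hE0]
  -- comparison of the conjugations
  have hd : σ * c₀⁻¹ ∈ fixer K D := by
    have h1 : c₀⁻¹ = c₀ := inv_eq_of_mul_eq_one_left hc₀.mul_self
    rw [mem_fixer, AlgEquiv.mul_apply, h1, hc₀D, map_neg, hσ, neg_neg]
  have hcj (x : Ω ≃ₐ[K] Ω) {g : Ω ≃ₐ[K] Ω} (hg : g ∈ fixer K D) : x * g * x⁻¹ ∈ fixer K D :=
    conj_mem_fixer_of_sq hD2 x g hg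
  have hσc {ω : (Ω ≃ₐ[K] Ω) → twoTors Ω} (hω : IsLocHom (fixer K D) ω) {g : Ω ≃ₐ[K] Ω}
      (hg : g ∈ fixer K D) : ω (c₀ * g * c₀⁻¹) = ω (σ * g * σ⁻¹) := by
    rw [show σ * g * σ⁻¹ = (σ * c₀⁻¹) * (c₀ * g * c₀⁻¹) * (σ * c₀⁻¹)⁻¹ by group,
      hω.map_mul _ (mul_mem hd (hcj _ hg)) _ (inv_mem hd), hω.map_mul _ hd _ (hcj _ hg),
      hω.map_inv hd, mul_right_comm, mul_inv_cancel, one_mul]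
  have hχ' : IsLocHom (fixer K D) fun g ↦ u (lift g) := by
    refine ⟨fun g hg h hh ↦ by rw [lift_mul hg hh, hu_mul], fixer K α ⊓ fixer K D,
      (isOpen_fixer _).inter (isOpen_fixer _), inf_le_right, fun l hl ↦ hu_one (hα _ ?_)⟩
    rw [mem_fixer, ← res_apply, hlift l hl.2, mem_fixer.1 hl.1]
  obtain ⟨φ, hφ, hφχ⟩ := exists_isLocHom_div_conj hK hc₀ hD2 ha hc₀D hχ' fun g hg ↦ by
    obtain ⟨g', rfl⟩ : ∃ g', res g' = g := ⟨_, hlift g hg⟩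
    rw [hσc hχ' hg, ← res_c, lift_res, lift_res, hu_c]
  choose v hv using hv
  have hv_mul (a b : twoTors Ω) : v (a * b) = v a + v b := hEinj (by
    rw [hEadd, hv, hv, hv, map_mul, map_mul])
  have hv_one : v 1 = 0 := hEinj (by rw [hv, map_one, map_one, hE0])
  refine ⟨fun g ↦ v (φ (res g)), fun g h ↦ ?_, ?_, fun g ↦ ?_⟩
  · dsimp only
    rw [res_mul, hφ.map_mul _ (res_mem g) _ (res_mem h), hv_mul]
  · obtain ⟨L, hL, -, hφL⟩ := hφ.loc
    obtain ⟨β, hβ⟩ := exists_fixer_subset (hL.mem_nhds L.one_mem)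
    refine ⟨β, fun g hg ↦ ?_⟩
    dsimp only
    rw [hφL (res g) (hβ (mem_fixer.1 hg)), hv_one]
  · have h1 := hφχ (res g) (res_mem g)
    rw [hσc hφ (res_mem g), ← res_c, lift_res] at h1
    rw [eq_sub_iff_add_eq]
    refine hEinj ?_
    rw [hEadd, hv, hv, ← hu, h1, ← map_mul, ← map_mul, inv_mul_cancel_right]

end Reduction

end QuadSymbol

theorem exists_continuous_character_of_anticyclotomic
    -- the totally real field F⁺
    (Fp : Type*) [Field Fp] [NumberField Fp]
    (htotreal : ∀ ψ : Fp →+* ℂ, NumberField.ComplexEmbedding.IsReal ψ)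
    -- the CM field F, a totally imaginary quadratic extension of F⁺
    (F : Type*) [Field F] [NumberField F] [Algebra Fp F]
    (hquad : Module.finrank Fp F = 2)
    (htotim : ∀ ψ : F →+* ℂ, ¬ NumberField.ComplexEmbedding.IsReal ψ)
    -- an algebraic closure Ω of F
    (Ω : Type*) [Field Ω] [Algebra F Ω] [IsAlgClosure F Ω]
    [Algebra Fp Ω] [IsScalarTower Fp F Ω]
    -- σ ∈ Aut(Ω/F⁺) restricting to the nontrivial element τ of Gal(F/F⁺)
    (σ : Ω ≃ₐ[Fp] Ω) (τ : F ≃ₐ[Fp] F) (hτ : τ ≠ AlgEquiv.refl)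
    (hστ : ∀ x : F, σ (algebraMap F Ω x) = algebraMap F Ω (τ x))
    -- the conjugation map c : G_F → G_F, g ↦ σgσ⁻¹
    (c : (Ω ≃ₐ[F] Ω) → (Ω ≃ₐ[F] Ω))
    (hc : ∀ (g : Ω ≃ₐ[F] Ω) (x : Ω), c g x = σ (g (σ.symm x)))
    -- the continuous homomorphism χ : G_F → ℚ/ℤ with χ(g) + χ(σgσ⁻¹) = 0
    (χ : (Ω ≃ₐ[F] Ω) → QmodZ)
    (hχhom : ∀ g h : Ω ≃ₐ[F] Ω, χ (g * h) = χ g + χ h)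
    (hχcont : @Continuous _ _ _ ⊥ χ)
    (hχ : ∀ g : Ω ≃ₐ[F] Ω, χ g + χ (c g) = 0) :
    ∃ φ : (Ω ≃ₐ[F] Ω) → QmodZ,
      (∀ g h : Ω ≃ₐ[F] Ω, φ (g * h) = φ g + φ h) ∧
      (@Continuous _ _ _ ⊥ φ) ∧
      (∀ g : Ω ≃ₐ[F] Ω, χ g = φ g - φ (c g)) := by
  have hΩF : Algebra.IsAlgebraic F Ω := IsAlgClosure.isAlgebraic
  have : IsAlgClosed Ω := IsAlgClosure.isAlgClosed F
  have : CharZero Ω := charZero_of_injective_algebraMap (algebraMap F Ω).injective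
  have : Algebra.IsAlgebraic ℚ Ω := Algebra.IsAlgebraic.trans ℚ F Ω
  have : FiniteDimensional Fp F := .of_finrank_eq_succ hquad
  have : Algebra.IsAlgebraic Fp Ω := Algebra.IsAlgebraic.trans Fp F Ω
  have : IsAlgClosure Fp Ω := ⟨inferInstance, inferInstance⟩
  have : IsGalois Fp Ω := {}
  have : IsGalois F Ω := {}
  obtain ⟨δ, a, hδ, ha, hspan⟩ := QuadSymbol.exists_quadratic_generator Fp F hquad
  have hτδ : τ δ = -δ := by
    refine (sq_eq_sq_iff_eq_or_eq_neg.1 (by rw [← map_pow, hδ, AlgEquiv.commutes])).resolve_left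
      fun h ↦ hτ (AlgEquiv.ext fun y ↦ ?_)
    obtain ⟨p, q, rfl⟩ := hspan y
    simp [h]
  obtain ⟨α, hα⟩ := QuadSymbol.exists_fixer_of_continuous hχhom hχcont
  obtain ⟨N, hN, hNχ⟩ := QuadSymbol.exists_nsmul_eq_zero hχhom hα
  obtain ⟨k, m, hm, rfl⟩ := Nat.exists_eq_two_pow_mul_odd hN
  obtain ⟨r, rfl⟩ := hm
  obtain ⟨φ, hφ, ⟨β, hβ⟩, hφχ⟩ := QuadSymbol.exists_character_of_two_pow htotreal htotim hδ ha hspan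
    (σ := σ) (by rw [hστ, hτδ, map_neg]) hc (χ := fun g ↦ (2 * r + 1) • χ g)
    (fun g h ↦ by rw [hχhom, smul_add]) (α := α) (fun g hg ↦ by rw [hα g hg, smul_zero])
    (k := k) (fun g ↦ by rw [← mul_smul, hNχ]) (fun g ↦ by rw [← smul_add, hχ, smul_zero])
  obtain ⟨s, t, hst⟩ : IsCoprime ((2 * r + 1 : ℕ) : ℤ) ((2 ^ k : ℕ) : ℤ) :=
    Nat.isCoprime_iff_coprime.2 (Nat.Coprime.pow_right k (by simp))
  have h1 (g : Ω ≃ₐ[F] Ω) : s • ((2 * r + 1) • χ g) + t • (2 ^ k • χ g) = χ g := by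
    rw [← natCast_zsmul, ← natCast_zsmul, ← mul_smul, ← mul_smul, ← add_smul, hst, one_smul]
  have h2 (g : Ω ≃ₐ[F] Ω) : 2 ^ k • χ g = (r + 1) • (2 ^ k • χ g) + (r + 1) • (2 ^ k • χ g) := by
    have h3 := hNχ g
    rw [mul_comm, mul_smul] at h3
    rw [← add_smul, show r + 1 + (r + 1) = 2 * r + 1 + 1 by ring, add_smul, h3, zero_add, one_smul]
  refine ⟨fun g ↦ s • φ g + t • ((r + 1) • (2 ^ k • χ g)), ?_, ?_, fun g ↦ ?_⟩
  · intro g h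
    simp only [hφ, hχhom, smul_add]
    abel
  · obtain ⟨γ, hγ⟩ := QuadSymbol.exists_fixer_subset
      (((QuadSymbol.isOpen_fixer (K := F) α).inter (QuadSymbol.isOpen_fixer β)).mem_nhds
        ⟨one_mem _, one_mem _⟩)
    refine QuadSymbol.continuous_of_fixer (fun g h ↦ ?_) (α := γ) fun g hg ↦ ?_
    · simp only [hφ, hχhom, smul_add]
      abel
    · simp only [hα g (hγ hg).1, hβ g (hγ hg).2, smul_zero, add_zero]
  · have h4 : χ (c g) = -χ g := eq_neg_of_add_eq_zero_right (hχ g)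
    dsimp only
    conv_lhs => rw [← h1 g, h2 g, hφχ g]
    rw [h4]
    simp only [smul_neg, smul_add, smul_sub]
    abel
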